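/- (Nesterenko's theorem). The real numbers π and e^π are algebraically independent over ℚ. -/

import Mathlib

namespace NestPi

open Polynomial Finset

/-- A submultiplicative length function on a commutative ring. -/
structure IsLen {A : Type*} [CommRing A] (N : A → ℝ) : Prop where
  nonneg : ∀ a, 0 ≤ N a
  zero : N 0 = 0
  one : N 1 ≤ 1
  neg : ∀ a, N (-a) = N a
  add : ∀ a b, N (a + b) ≤ N a + N b
  mul : ∀ a b, N (a * b) ≤ N a * N b

namespace IsLen
variable {A : Type*} [CommRing A] {N : A → ℝ} (h : IsLen N)
include h

lemma sum {ι : Type*} (s : Finset ι) (f : ι → A) : N (∑ i ∈ s, f i) ≤ ∑ i ∈ s, N (f i) := by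
  classical
  induction s using Finset.induction_on with
  | empty => simp [h.zero]
  | insert a s ha ih =>
    rw [Finset.sum_insert ha, Finset.sum_insert ha]
    exact (h.add _ _).trans (by gcongr)

lemma prod {ι : Type*} (s : Finset ι) (f : ι → A) : N (∏ i ∈ s, f i) ≤ ∏ i ∈ s, N (f i) := by
  classical
  induction s using Finset.induction_on with
  | empty => simpa using h.one
  | insert a s ha ih =>
    rw [Finset.prod_insert ha, Finset.prod_insert ha]
    exact (h.mul _ _).trans (mul_le_mul_of_nonneg_left ih (h.nonneg _))

lemma pow (a : A) (n : ℕ) : N (a ^ n) ≤ N a ^ n := by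
  simpa using h.prod (Finset.range n) (fun _ => a)

lemma units_smul (u : ℤˣ) (a : A) : N (u • a) = N a := by
  rcases Int.units_eq_one_or u with rfl | rfl
  · simp
  · simp [h.neg]

lemma sub (a b : A) : N (a - b) ≤ N a + N b := by
  rw [sub_eq_add_neg, ← h.neg b]; exact h.add _ _

lemma det {n : Type*} [Fintype n] [DecidableEq n] (M : Matrix n n A) :
    N M.det ≤ ∏ i, ∑ j, N (M i j) := by
  rw [← Matrix.det_transpose, Matrix.det_apply, Finset.prod_univ_sum]
  refine (h.sum _ _).trans ?_
  have h1 : ∀ σ : Equiv.Perm n, N (Equiv.Perm.sign σ • ∏ i, M.transpose (σ i) i) ≤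
      ∏ i, N (M i (σ i)) := fun σ => by
    rw [h.units_smul]; exact h.prod _ _
  refine (Finset.sum_le_sum fun σ _ => h1 σ).trans ?_
  rw [← Finset.sum_image (s := (Finset.univ : Finset (Equiv.Perm n)))
    (g := fun σ : Equiv.Perm n => (σ : n → n)) (f := fun p : n → n => ∏ i, N (M i (p i)))]
  · apply Finset.sum_le_sum_of_subset_of_nonneg
    · intro p _; simp
    · intro p _ _; exact Finset.prod_nonneg fun i _ => h.nonneg _
  · intro a _ b _ hab; exact Equiv.coe_fn_injective hab

end IsLen

/-- The length of a polynomial with respect to a length function of the coefficients. -/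
noncomputable def polyLen {A : Type*} [CommRing A] (N : A → ℝ) (p : A[X]) : ℝ :=
  p.sum fun _ a => N a

lemma isLen_norm {A : Type*} [NormedCommRing A] [NormOneClass A] : IsLen (fun a : A => ‖a‖) where
  nonneg a := norm_nonneg a
  zero := norm_zero
  one := by simp
  neg a := norm_neg a
  add a b := norm_add_le a b
  mul a b := norm_mul_le a b

section polyLen
variable {A : Type*} [CommRing A] {N : A → ℝ} (h : IsLen N)
include h

lemma polyLen_eq_sum_of_subset (p : A[X]) {s : Finset ℕ} (hs : p.support ⊆ s) :
    polyLen N p = ∑ i ∈ s, N (p.coeff i) := by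
  rw [polyLen, Polynomial.sum]
  exact Finset.sum_subset hs fun i _ hi => by
    rw [Polynomial.notMem_support_iff.1 hi, h.zero]

lemma polyLen_eq_range (p : A[X]) {n : ℕ} (hn : p.natDegree ≤ n) :
    polyLen N p = ∑ i ∈ range (n + 1), N (p.coeff i) :=
  polyLen_eq_sum_of_subset h p fun i hi => by
    have := Polynomial.le_natDegree_of_mem_supp i hi
    simp; omega

lemma polyLen_nonneg (p : A[X]) : 0 ≤ polyLen N p :=
  Finset.sum_nonneg fun _ _ => h.nonneg _

lemma polyLen_add (p q : A[X]) : polyLen N (p + q) ≤ polyLen N p + polyLen N q := by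
  classical
  rw [polyLen_eq_sum_of_subset h (p + q) Polynomial.support_add,
    polyLen_eq_sum_of_subset h p (Finset.subset_union_left (s₂ := q.support)),
    polyLen_eq_sum_of_subset h q (Finset.subset_union_right (s₁ := p.support)),
    ← Finset.sum_add_distrib]
  exact Finset.sum_le_sum fun i _ => by rw [coeff_add]; exact h.add _ _

lemma polyLen_monomial (n : ℕ) (a : A) : polyLen N (monomial n a) = N a := by
  rw [polyLen, Polynomial.sum_monomial_index]; exact h.zero

lemma polyLen_C (a : A) : polyLen N (C a) = N a := polyLen_monomial h 0 a

lemma polyLen_finset_sum {ι : Type*} (s : Finset ι) (f : ι → A[X]) :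
    polyLen N (∑ i ∈ s, f i) ≤ ∑ i ∈ s, polyLen N (f i) := by
  classical
  induction s using Finset.induction_on with
  | empty => simp [polyLen]
  | insert a s ha ih =>
    rw [Finset.sum_insert ha, Finset.sum_insert ha]
    exact (polyLen_add h _ _).trans (by gcongr)

lemma isLen_polyLen : IsLen (polyLen N) where
  nonneg := polyLen_nonneg h
  zero := by simp [polyLen]
  one := by rw [← C_1, polyLen_C h]; exact h.one
  neg a := by simp [polyLen, Polynomial.sum, h.neg]
  add := polyLen_add h
  mul p q := by
    have : p * q = ∑ i ∈ p.support, ∑ j ∈ q.support,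
        monomial (i + j) (p.coeff i * q.coeff j) := by
      conv_lhs => rw [p.as_sum_support, q.as_sum_support, Finset.sum_mul_sum]
      simp [monomial_mul_monomial]
    rw [this]
    refine (polyLen_finset_sum h _ _).trans ?_
    refine (Finset.sum_le_sum fun i _ => polyLen_finset_sum h _ _).trans ?_
    simp only [polyLen_monomial h]
    rw [polyLen, polyLen, Polynomial.sum, Polynomial.sum, Finset.sum_mul_sum]
    exact Finset.sum_le_sum fun i _ => Finset.sum_le_sum fun j _ => h.mul _ _

lemma len_coeff_le (p : A[X]) (i : ℕ) : N (p.coeff i) ≤ polyLen N p := by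
  by_cases hi : i ∈ p.support
  · exact Finset.single_le_sum (f := fun i => N (p.coeff i)) (fun _ _ => h.nonneg _) hi
  · rw [Polynomial.notMem_support_iff.1 hi, h.zero]; exact polyLen_nonneg h p

lemma polyLen_X_le : polyLen N (X : A[X]) ≤ 1 := by
  rw [← monomial_one_one_eq_X, polyLen_monomial h]; exact h.one

/-- Evaluation of a polynomial, coefficientwise through a ring homomorphism, is bounded by length. -/
lemma len_eval₂_le {B : Type*} [CommRing B] {N' : B → ℝ} (h' : IsLen N') (φ : A →+* B)
    {K : ℝ} (p : A[X]) (hφ : ∀ i, N' (φ (p.coeff i)) ≤ K * N (p.coeff i)) (b : B)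
    {R : ℝ} (hR : 1 ≤ R) (hb : N' b ≤ R) {n : ℕ} (hn : p.natDegree ≤ n) :
    N' (p.eval₂ φ b) ≤ K * polyLen N p * R ^ n := by
  rw [Polynomial.eval₂_eq_sum_range' φ (Nat.lt_succ_of_le hn), polyLen_eq_range h p hn,
    Finset.mul_sum, Finset.sum_mul]
  refine (h'.sum _ _).trans (Finset.sum_le_sum fun i hi => ?_)
  have hi' : i ≤ n := by simpa [Nat.lt_succ_iff] using hi
  calc N' (φ (p.coeff i) * b ^ i) ≤ N' (φ (p.coeff i)) * N' (b ^ i) := h'.mul _ _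
    _ ≤ (K * N (p.coeff i)) * R ^ n := by
      have h1 := hφ i
      have h2 : N' (b ^ i) ≤ R ^ n := (h'.pow _ _).trans
        ((pow_le_pow_left₀ (h'.nonneg _) hb i).trans (pow_le_pow_right₀ hR hi'))
      exact mul_le_mul h1 h2 (h'.nonneg _) ((h'.nonneg _).trans h1)

lemma polyLen_map_le {B : Type*} [CommRing B] {N' : B → ℝ} (h' : IsLen N') (φ : A →+* B)
    (hφ : ∀ a, N' (φ a) ≤ N a) (p : A[X]) : polyLen N' (p.map φ) ≤ polyLen N p := by
  rw [polyLen_eq_range h' (p.map φ) natDegree_map_le, polyLen_eq_range h p le_rfl]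
  exact Finset.sum_le_sum fun i _ => by rw [coeff_map]; exact hφ _

lemma polyLen_map_eq {B : Type*} [CommRing B] {N' : B → ℝ} (h' : IsLen N') (φ : A →+* B)
    (hφ : ∀ a, N' (φ a) = N a) (p : A[X]) : polyLen N' (p.map φ) = polyLen N p := by
  rw [polyLen_eq_range h' (p.map φ) natDegree_map_le, polyLen_eq_range h p le_rfl]
  exact Finset.sum_congr rfl fun i _ => by rw [coeff_map]; exact hφ _

/-- A polynomial of degree less than the number of nodes, small at integral nodes in `[0, D]`,
has small length. -/
lemma polyLen_le_of_eval_nodes [Algebra ℂ A] (hs : ∀ (c : ℂ) (a : A), N (c • a) ≤ ‖c‖ * N a)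
    (s : Finset ℕ) {D : ℕ} (hsD : ∀ a ∈ s, a ≤ D) (p : A[X]) {n : ℕ} (hn : s.card = n + 1)
    (hp : p.natDegree ≤ n) {δ : ℝ} (hδ : ∀ a ∈ s, N (p.eval (a : A)) ≤ δ) :
    polyLen N p ≤ (n + 1) * (1 + D) ^ n * δ := by
  classical
  have key : p = ∑ a ∈ s, C (p.eval (a : A)) *
      ((Lagrange.basis s (fun k : ℕ => (k : ℂ)) a).map (algebraMap ℂ A)) := by
    have hinj : Set.InjOn (fun k : ℕ => (k : ℂ)) s := fun a _ b _ hab => by simpa using hab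
    -- monomials first
    have hmon : ∀ i ≤ n, (X : ℂ[X]) ^ i = ∑ a ∈ s, C ((a : ℂ) ^ i) *
        Lagrange.basis s (fun k : ℕ => (k : ℂ)) a := by
      intro i hi
      have := Lagrange.eq_interpolate (s := s) (v := fun k : ℕ => (k : ℂ)) hinj
        (f := (X : ℂ[X]) ^ i) (by
          rw [degree_X_pow, hn]; exact_mod_cast Nat.lt_succ_of_le hi)
      rw [Lagrange.interpolate_apply] at this
      simpa using this
    have hmonA : ∀ i ≤ n, (X : A[X]) ^ i = ∑ a ∈ s, C ((a : A) ^ i) *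
        (Lagrange.basis s (fun k : ℕ => (k : ℂ)) a).map (algebraMap ℂ A) := by
      intro i hi
      have := congrArg (Polynomial.map (algebraMap ℂ A)) (hmon i hi)
      simpa [Polynomial.map_sum, Polynomial.map_mul] using this
    conv_lhs => rw [p.as_sum_range_C_mul_X_pow' (Nat.lt_succ_of_le hp)]
    rw [Finset.sum_congr rfl fun i hi => by
      rw [hmonA i (by simpa [Nat.lt_succ_iff] using hi), Finset.mul_sum]]
    rw [Finset.sum_comm]
    refine Finset.sum_congr rfl fun a _ => ?_
    rw [Polynomial.eval_eq_sum_range' (Nat.lt_succ_of_le hp), map_sum, Finset.sum_mul]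
    refine Finset.sum_congr rfl fun i _ => ?_
    rw [C_mul]; ring
  have hL := isLen_polyLen h
  have hC := isLen_norm (A := ℂ)
  have hbasis : ∀ a ∈ s, polyLen (fun c : ℂ => ‖c‖) (Lagrange.basis s (fun k : ℕ => (k : ℂ)) a)
      ≤ (1 + D) ^ n := by
    intro a ha
    rw [Lagrange.basis]
    refine ((isLen_polyLen hC).prod _ _).trans ?_
    have : (s.erase a).card = n := by rw [Finset.card_erase_of_mem ha, hn]; rfl
    rw [← this, ← Finset.prod_const]
    refine Finset.prod_le_prod (fun i _ => polyLen_nonneg hC _) fun b hb => ?_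
    have hba : b ≠ a := Finset.ne_of_mem_erase hb
    rw [Lagrange.basisDivisor]
    refine ((isLen_polyLen hC).mul _ _).trans ?_
    rw [polyLen_C hC]
    have h1 : ‖((a : ℂ) - (b : ℂ))⁻¹‖ ≤ 1 := by
      rw [norm_inv]
      apply inv_le_one_of_one_le₀
      have h2 : ((a : ℂ) - (b : ℂ)) = (((a : ℤ) - (b : ℤ) : ℤ) : ℂ) := by push_cast; ring
      rw [h2, Complex.norm_intCast]
      have : (1 : ℤ) ≤ |(a : ℤ) - b| := Int.one_le_abs (by omega)
      exact_mod_cast this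
    have h3 : polyLen (fun c : ℂ => ‖c‖) (X - C (b : ℂ)) ≤ 1 + D := by
      refine ((isLen_polyLen hC).sub _ _).trans ?_
      rw [polyLen_C hC]
      have := polyLen_X_le hC
      have hb' : ‖(b : ℂ)‖ ≤ D := by
        rw [Complex.norm_natCast]; exact_mod_cast hsD b (Finset.mem_of_mem_erase hb)
      linarith
    calc _ ≤ 1 * (1 + (D : ℝ)) := mul_le_mul h1 h3 (polyLen_nonneg hC _) zero_le_one
      _ = _ := one_mul _
  have hmapb : ∀ q : ℂ[X], polyLen N (q.map (algebraMap ℂ A)) ≤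
      polyLen (fun c : ℂ => ‖c‖) q := fun q => by
    refine polyLen_map_le hC h _ (fun c => ?_) q
    rw [Algebra.algebraMap_eq_smul_one]
    exact (hs c 1).trans (by nlinarith [h.one, norm_nonneg c])
  rw [key]
  refine (hL.sum _ _).trans ?_
  have hbd : ∀ a ∈ s, polyLen N (C (p.eval (a : A)) *
      ((Lagrange.basis s (fun k : ℕ => (k : ℂ)) a).map (algebraMap ℂ A))) ≤
      (1 + D) ^ n * δ := by
    intro a ha
    refine (hL.mul _ _).trans ?_
    rw [polyLen_C h, mul_comm]
    exact mul_le_mul ((hmapb _).trans (hbasis a ha)) (hδ a ha) (h.nonneg _) (by positivity)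
  refine (Finset.sum_le_sum hbd).trans ?_
  rw [Finset.sum_const, hn]
  simp [mul_assoc]

end polyLen

end NestPi

namespace NestPi

open Polynomial Finset

/-- The length of an integer polynomial. -/
noncomputable abbrev len1 : ℤ[X] → ℝ := polyLen (fun a : ℤ => ‖a‖)
/-- The length of an integer polynomial in two variables. -/
noncomputable abbrev len2 : ℤ[X][X] → ℝ := polyLen len1

lemma isLen_len1 : IsLen len1 := isLen_polyLen isLen_norm
lemma isLen_len2 : IsLen len2 := isLen_polyLen isLen_len1

lemma one_le_len1 {p : ℤ[X]} (hp : p ≠ 0) : 1 ≤ len1 p := by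
  refine le_trans ?_ (len_coeff_le isLen_norm p p.natDegree)
  have : (1 : ℤ) ≤ |p.leadingCoeff| := Int.one_le_abs (leadingCoeff_ne_zero.2 hp)
  rw [Int.norm_eq_abs]
  exact_mod_cast this

lemma one_le_len2 {p : ℤ[X][X]} (hp : p ≠ 0) : 1 ≤ len2 p :=
  (one_le_len1 (leadingCoeff_ne_zero.2 hp)).trans (len_coeff_le isLen_len1 p p.natDegree)

/-- Degree in the inner variable. -/
noncomputable def degU {R : Type*} [CommRing R] (F : R[X][X]) : ℕ :=
  (Bivariate.swap F).natDegree

lemma coeff_coeff_swap {R : Type*} [CommRing R] (F : R[X][X]) (i j : ℕ) :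
    ((Bivariate.swap F).coeff i).coeff j = (F.coeff j).coeff i := by
  induction F using Polynomial.induction_on' with
  | add p q hp hq => simp [hp, hq]
  | monomial n f =>
    induction f using Polynomial.induction_on' with
    | add p q hp hq => simp only [map_add, coeff_add, hp, hq]
    | monomial m r =>
      rw [Bivariate.swap_monomial_monomial]
      simp only [coeff_monomial]
      split_ifs <;> simp_all [coeff_monomial]

lemma natDegree_coeff_le_degU {R : Type*} [CommRing R] (F : R[X][X]) (i : ℕ) :
    (F.coeff i).natDegree ≤ degU F := by
  rw [Polynomial.natDegree_le_iff_coeff_eq_zero]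
  intro k hk
  rw [← coeff_coeff_swap, coeff_eq_zero_of_natDegree_lt hk, coeff_zero]

lemma degU_mul {R : Type*} [CommRing R] [IsDomain R] {F G : R[X][X]} (hF : F ≠ 0) (hG : G ≠ 0) :
    degU (F * G) = degU F + degU G := by
  rw [degU, map_mul, natDegree_mul (by simpa) (by simpa)]; rfl

/-- Evaluation of an integer polynomial in two variables at a complex point. -/
noncomputable def ev (a b : ℂ) : ℤ[X][X] →+* ℂ :=
  eval₂RingHom (eval₂RingHom (Int.castRingHom ℂ) a) b

lemma ev_apply (a b : ℂ) (F : ℤ[X][X]) :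
    ev a b F = F.eval₂ (eval₂RingHom (Int.castRingHom ℂ) a) b := rfl

/-- Specialisation of the inner variable at a natural number. -/
noncomputable def spec (a : ℕ) : ℤ[X][X] →+* ℤ[X] := mapRingHom (evalRingHom (a : ℤ))

lemma norm_intCastRingHom (a : ℤ) : ‖Int.castRingHom ℂ a‖ = ‖a‖ := by
  simp [Int.norm_eq_abs]

/-- The logarithmic Mahler measure of an integer polynomial. -/
noncomputable def logM (f : ℤ[X]) : ℝ :=
  Real.log (f.map (Int.castRingHom ℂ)).mahlerMeasure

lemma logM_nonneg (f : ℤ[X]) : 0 ≤ logM f := by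
  by_cases hf : f = 0
  · simp [hf, logM]
  · exact Real.log_nonneg (one_le_mahlerMeasure_of_ne_zero hf)

lemma map_cast_ne_zero {f : ℤ[X]} (hf : f ≠ 0) : f.map (Int.castRingHom ℂ) ≠ 0 :=
  (Polynomial.map_ne_zero_iff (Int.castRingHom ℂ).injective_int).2 hf

lemma logM_mul {f g : ℤ[X]} (hf : f ≠ 0) (hg : g ≠ 0) : logM (f * g) = logM f + logM g := by
  rw [logM, Polynomial.map_mul, mahlerMeasure_mul, Real.log_mul, logM, logM]
  · exact (mahlerMeasure_pos_of_ne_zero (map_cast_ne_zero hf)).ne'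
  · exact (mahlerMeasure_pos_of_ne_zero (map_cast_ne_zero hg)).ne'

lemma mahlerMeasure_le_len1 (f : ℤ[X]) :
    (f.map (Int.castRingHom ℂ)).mahlerMeasure ≤ len1 f := by
  refine (mahlerMeasure_le_sum_norm_coeff _).trans ?_
  exact polyLen_map_le isLen_norm (isLen_norm (A := ℂ)) (Int.castRingHom ℂ)
    (fun a => (norm_intCastRingHom a).le) f

lemma logM_le {f : ℤ[X]} (hf : f ≠ 0) : logM f ≤ Real.log (len1 f) :=
  Real.log_le_log (mahlerMeasure_pos_of_ne_zero (map_cast_ne_zero hf)) (mahlerMeasure_le_len1 f)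

lemma polyLen_cast_le (f : ℤ[X]) :
    polyLen (fun c : ℂ => ‖c‖) (f.map (Int.castRingHom ℂ)) ≤
      2 ^ f.natDegree * (f.map (Int.castRingHom ℂ)).mahlerMeasure := by
  rw [polyLen_eq_range (isLen_norm (A := ℂ)) _
    (natDegree_map_eq_of_injective (Int.castRingHom ℂ).injective_int f).le]
  have : (2 : ℝ) ^ f.natDegree = ∑ i ∈ range (f.natDegree + 1), (f.natDegree.choose i : ℝ) := by
    exact_mod_cast (Nat.sum_range_choose _).symm
  rw [this, Finset.sum_mul]
  refine Finset.sum_le_sum fun i _ => ?_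
  have := norm_coeff_le_choose_mul_mahlerMeasure i (f.map (Int.castRingHom ℂ))
  rwa [natDegree_map_eq_of_injective (Int.castRingHom ℂ).injective_int f] at this

lemma len1_spec_le (a : ℕ) (F : ℤ[X][X]) {D n : ℕ} (hD : 1 ≤ D) (ha : a ≤ D) (hn : degU F ≤ n) :
    len1 (spec a F) ≤ len2 F * D ^ n := by
  have : len1 (spec a F) ≤ ∑ i ∈ range (F.natDegree + 1), len1 (F.coeff i) * (D : ℝ) ^ n := by
    rw [len1, polyLen_eq_range isLen_norm (spec a F) (n := F.natDegree)
      (by rw [spec, coe_mapRingHom]; exact natDegree_map_le)]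
    refine Finset.sum_le_sum fun i _ => ?_
    rw [spec, coe_mapRingHom, coeff_map, coe_evalRingHom, ← eval₂_id]
    have := len_eval₂_le (isLen_norm (A := ℤ)) (isLen_norm (A := ℤ)) (RingHom.id ℤ) (K := 1)
      (F.coeff i) (by simp) (a : ℤ) (R := D) (by exact_mod_cast hD)
      (by simp; exact_mod_cast ha) ((natDegree_coeff_le_degU F i).trans hn)
    simpa using this
  rwa [← Finset.sum_mul, ← polyLen_eq_range isLen_len1 F le_rfl] at this

lemma norm_ev_le (a b : ℂ) (F : ℤ[X][X]) {R : ℝ} (hR : 1 ≤ R) (ha : ‖a‖ ≤ R) (hb : ‖b‖ ≤ R)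
    {n m : ℕ} (hn : degU F ≤ n) (hm : F.natDegree ≤ m) :
    ‖ev a b F‖ ≤ len2 F * R ^ (n + m) := by
  have h1 := len_eval₂_le isLen_len1 (isLen_norm (A := ℂ))
    (eval₂RingHom (Int.castRingHom ℂ) a) (K := R ^ n) F (fun i => by
      have := len_eval₂_le (isLen_norm (A := ℤ)) (isLen_norm (A := ℂ)) (Int.castRingHom ℂ)
        (K := 1) (F.coeff i)
          (fun j => by
            rw [norm_intCastRingHom, one_mul]) a hR ha ((natDegree_coeff_le_degU F i).trans hn)
      rw [one_mul, mul_comm] at this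
      exact this) b hR hb hm
  rw [ev_apply]
  refine h1.trans (le_of_eq ?_)
  rw [pow_add]; ring

/-- Logarithmic size: the degrees plus the logarithm of the length. -/
noncomputable def size (F : ℤ[X][X]) : ℝ := degU F + F.natDegree + Real.log (len2 F)

lemma size_nonneg {F : ℤ[X][X]} (hF : F ≠ 0) : 0 ≤ size F := by
  have := Real.log_nonneg (one_le_len2 hF)
  unfold size; positivity

/-- An additive measure of complexity, averaging Mahler measures of specialisations. -/
noncomputable def avgSize (s : Finset ℕ) (n : ℕ) (F : ℤ[X][X]) : ℝ :=
  degU F + F.natDegree + (∑ a ∈ s, logM (spec a F)) / (n + 1)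

lemma avgSize_nonneg (s : Finset ℕ) (n : ℕ) (F : ℤ[X][X]) : 0 ≤ avgSize s n F := by
  have : 0 ≤ ∑ a ∈ s, logM (spec a F) := Finset.sum_nonneg fun a _ => logM_nonneg _
  unfold avgSize; positivity

lemma avgSize_mul {s : Finset ℕ} {n : ℕ} {F G : ℤ[X][X]} (hF0 : F ≠ 0) (hG0 : G ≠ 0)
    (hF : ∀ a ∈ s, spec a F ≠ 0) (hG : ∀ a ∈ s, spec a G ≠ 0) :
    avgSize s n (F * G) = avgSize s n F + avgSize s n G := by
  unfold avgSize
  rw [degU_mul hF0 hG0, natDegree_mul hF0 hG0,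
    Finset.sum_congr rfl fun a ha => by rw [map_mul, logM_mul (hF a ha) (hG a ha)],
    Finset.sum_add_distrib]
  push_cast; ring

/-- Some irreducible factor is at least as small, relative to its complexity. -/
lemma exp_neg_avgSize_le (s : Finset ℕ) (n : ℕ) (a b : ℂ) {c : ℝ} (hc : 0 ≤ c) (F : ℤ[X][X]) :
    F ≠ 0 → (∀ x ∈ s, spec x F ≠ 0) →
    (∀ q, Irreducible q → q ∣ F → Real.exp (-(c * avgSize s n q)) < ‖ev a b q‖) →
    Real.exp (-(c * avgSize s n F)) ≤ ‖ev a b F‖ := by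
  induction F using UniqueFactorizationMonoid.induction_on_prime with
  | h₁ => intro h; exact absurd rfl h
  | h₂ x hx =>
    intro _ _ _
    obtain ⟨r', hr', rfl⟩ := Polynomial.isUnit_iff.1 hx
    obtain ⟨r, hr, rfl⟩ := Polynomial.isUnit_iff.1 hr'
    have h1 : ‖ev a b (C (C r))‖ = 1 := by
      rcases Int.isUnit_iff.1 hr with rfl | rfl <;> simp [ev_apply]
    rw [h1, Real.exp_le_one_iff, neg_nonpos]
    exact mul_nonneg hc (avgSize_nonneg _ _ _)
  | h₃ F p hF0 hp ih =>
    intro h0 hs hq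
    have hs' : ∀ x ∈ s, spec x p ≠ 0 ∧ spec x F ≠ 0 := fun x hx => by
      have := hs x hx
      rwa [map_mul, mul_ne_zero_iff] at this
    rw [avgSize_mul hp.ne_zero hF0 (fun x hx => (hs' x hx).1) (fun x hx => (hs' x hx).2),
      map_mul, norm_mul, mul_add, neg_add, Real.exp_add]
    exact mul_le_mul (hq p hp.irreducible (dvd_mul_right _ _)).le
      (ih hF0 (fun x hx => (hs' x hx).2) fun q hqi hqd => hq q hqi (hqd.mul_left _))
      (Real.exp_pos _).le (norm_nonneg _)

lemma exists_specialisation_nodes {F : ℤ[X][X]} (hF : F ≠ 0) {n : ℕ} (hn : degU F ≤ n) :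
    ∃ s : Finset ℕ, s.card = 2 * n + 2 ∧ (∀ a ∈ s, a ≤ 3 * n + 2) ∧ ∀ a ∈ s, spec a F ≠ 0 := by
  classical
  set lc := F.leadingCoeff with hlc
  have hlc0 : lc ≠ 0 := leadingCoeff_ne_zero.2 hF
  have hbad : ((range (3 * n + 3)).filter fun a : ℕ => lc.eval (a : ℤ) = 0).card ≤ n := by
    have h1 : (((range (3 * n + 3)).filter fun a : ℕ => lc.eval (a : ℤ) = 0).image
        (fun a : ℕ => (a : ℤ))) ⊆ lc.roots.toFinset := by
      intro z hz
      simp only [Finset.mem_image, Finset.mem_filter] at hz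
      obtain ⟨a, ⟨_, ha⟩, rfl⟩ := hz
      simp [hlc0, ha]
    have h2 := Finset.card_le_card h1
    rw [Finset.card_image_of_injective _ Nat.cast_injective] at h2
    refine h2.trans ((Multiset.toFinset_card_le _).trans ((card_roots' _).trans ?_))
    exact (natDegree_coeff_le_degU F _).trans hn
  have hgood : 2 * n + 2 ≤ ((range (3 * n + 3)).filter fun a : ℕ => ¬ lc.eval (a : ℤ) = 0).card :=
    by
    have := Finset.card_filter_add_card_filter_not (s := range (3 * n + 3))
      (fun a : ℕ => lc.eval (a : ℤ) = 0)
    rw [card_range] at this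
    omega
  obtain ⟨s, hs, hcard⟩ := Finset.exists_subset_card_eq hgood
  refine ⟨s, hcard, fun a ha => ?_, fun a ha h0 => ?_⟩
  · have := (Finset.mem_filter.1 (hs ha)).1
    rw [Finset.mem_range] at this
    omega
  · apply (Finset.mem_filter.1 (hs ha)).2
    have := congrArg (fun p => p.coeff F.natDegree) h0
    simpa [spec, coeff_map] using this

lemma eval_swap_natCast (a : ℕ) (q : ℤ[X][X]) :
    (Bivariate.swap q).eval (a : ℤ[X]) = spec a q := by
  induction q using Polynomial.induction_on' with
  | add p q hp hq => rw [map_add, eval_add, hp, hq, map_add]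
  | monomial k f =>
    rw [Bivariate.swap_monomial, spec, coe_mapRingHom, map_monomial, eval_mul, eval_map]
    simp only [map_pow, eval_pow, eval_C, coe_evalRingHom]
    rw [← C_mul_X_pow_eq_monomial]
    congr 1
    rw [show (a : ℤ[X]) = C (a : ℤ) by simp, eval₂_hom]

lemma size_le_avgSize {s : Finset ℕ} {n : ℕ} (hcard : s.card = 2 * n + 2)
    (hs : ∀ a ∈ s, a ≤ 3 * n + 2) {q : ℤ[X][X]} (hq0 : q ≠ 0) (hq : ∀ a ∈ s, spec a q ≠ 0)
    (hn : degU q ≤ n) :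
    size q ≤ (4 + Real.log (3 * n + 3)) * avgSize s n q := by
  classical
  set μ₀ : ℝ := (∑ a ∈ s, logM (spec a q)) / (n + 1) with hμ
  have hμ0 : 0 ≤ μ₀ := div_nonneg (Finset.sum_nonneg fun a _ => logM_nonneg _) (by positivity)
  -- many good nodes
  have hgood : degU q + 1 ≤ (s.filter fun a => logM (spec a q) ≤ μ₀).card := by
    by_contra hcon
    have hsum := Finset.card_filter_add_card_filter_not (s := s)
      (fun a => logM (spec a q) ≤ μ₀)
    have hb : n + 1 < (s.filter fun a => ¬ logM (spec a q) ≤ μ₀).card := by omega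
    have h1 : ((s.filter fun a => ¬ logM (spec a q) ≤ μ₀).card : ℝ) * μ₀ ≤
        ∑ a ∈ s.filter (fun a => ¬ logM (spec a q) ≤ μ₀), logM (spec a q) := by
      rw [← nsmul_eq_mul, ← Finset.sum_const]
      exact Finset.sum_le_sum fun a ha => (not_le.1 (Finset.mem_filter.1 ha).2).le
    have hne : (s.filter fun a => ¬ logM (spec a q) ≤ μ₀).Nonempty := by
      rw [← Finset.card_pos]; omega
    have h1' : ((s.filter fun a => ¬ logM (spec a q) ≤ μ₀).card : ℝ) * μ₀ <
        ∑ a ∈ s.filter (fun a => ¬ logM (spec a q) ≤ μ₀), logM (spec a q) := by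
      rw [← nsmul_eq_mul, ← Finset.sum_const]
      exact Finset.sum_lt_sum_of_nonempty hne
        fun a ha => (not_le.1 (Finset.mem_filter.1 ha).2)
    have h2 : ∑ a ∈ s.filter (fun a => ¬ logM (spec a q) ≤ μ₀), logM (spec a q) ≤
        ∑ a ∈ s, logM (spec a q) :=
      Finset.sum_le_sum_of_subset_of_nonneg (Finset.filter_subset _ _) fun a _ _ => logM_nonneg _
    have h3 : ∑ a ∈ s, logM (spec a q) = μ₀ * (n + 1) := by
      rw [hμ, div_mul_cancel₀]; positivity
    have h4 : ((n : ℝ) + 1) ≤ ((s.filter fun a => ¬ logM (spec a q) ≤ μ₀).card : ℝ) := by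
      exact_mod_cast hb.le
    nlinarith
  obtain ⟨t, hts, htc⟩ := Finset.exists_subset_card_eq hgood
  -- the polynomial with the roles of the variables exchanged, over `ℂ`
  set p : ℂ[X][X] := (Bivariate.swap q).map (mapRingHom (Int.castRingHom ℂ)) with hp
  have hlenp : len2 q = polyLen (polyLen fun c : ℂ => ‖c‖) p := by
    have e1 : polyLen (polyLen fun c : ℂ => ‖c‖) p = len2 (Bivariate.swap q) := by
      rw [hp]
      refine polyLen_map_eq isLen_len1 (isLen_polyLen isLen_norm) _ (fun f => ?_) _
      rw [coe_mapRingHom]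
      exact polyLen_map_eq isLen_norm isLen_norm _ (fun a => norm_intCastRingHom a) f
    have key : ∀ F : ℤ[X][X], ∀ n m : ℕ, degU F ≤ n → F.natDegree ≤ m →
        len2 F = ∑ i ∈ range (m + 1), ∑ j ∈ range (n + 1), ‖(F.coeff i).coeff j‖ := by
      intro F n m hn hm
      rw [len2, polyLen_eq_range isLen_len1 F hm]
      exact Finset.sum_congr rfl fun i _ => polyLen_eq_range isLen_norm _
        ((natDegree_coeff_le_degU F i).trans hn)
    rw [e1, key q _ _ le_rfl le_rfl, key (Bivariate.swap q) q.natDegree (degU q)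
      (by rw [degU, Bivariate.swap_swap_apply]) le_rfl, Finset.sum_comm]
    simp only [coeff_coeff_swap]
  have hdegp : p.natDegree ≤ degU q := natDegree_map_le
  have hevalp : ∀ a : ℕ, p.eval (a : ℂ[X]) = (spec a q).map (Int.castRingHom ℂ) := by
    intro a
    rw [hp, ← eval_swap_natCast, eval_natCast_map, coe_mapRingHom]
  have hbound := polyLen_le_of_eval_nodes (isLen_polyLen (isLen_norm (A := ℂ)))
    (fun c f => by
      rw [smul_eq_C_mul]
      refine ((isLen_polyLen isLen_norm).mul _ _).trans ?_
      rw [polyLen_C isLen_norm]) t (D := 3 * n + 2)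
    (fun a ha => hs a (Finset.mem_filter.1 (hts ha)).1) p htc hdegp
    (δ := 2 ^ q.natDegree * Real.exp μ₀) (fun a ha => by
      rw [hevalp]
      refine (polyLen_cast_le _).trans ?_
      have ha' := Finset.mem_filter.1 (hts ha)
      refine mul_le_mul ?_ ?_ (mahlerMeasure_nonneg _) (by positivity)
      · exact pow_le_pow_right₀ (by norm_num) (by rw [spec, coe_mapRingHom]; exact natDegree_map_le)
      · rw [← Real.log_le_iff_le_exp
          (mahlerMeasure_pos_of_ne_zero (map_cast_ne_zero (hq a ha'.1)))]
        exact ha'.2)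
  rw [← hlenp] at hbound
  have hlog : Real.log (len2 q) ≤ Real.log (((degU q : ℕ) + 1) * (1 + ((3 * n + 2 : ℕ) : ℝ))
    ^ degU q *
      (2 ^ q.natDegree * Real.exp μ₀)) :=
    Real.log_le_log (lt_of_lt_of_le one_pos (one_le_len2 hq0)) hbound
  rw [Real.log_mul (by positivity) (by positivity), Real.log_mul (by positivity) (by positivity),
    Real.log_mul (by positivity) (by positivity), Real.log_exp, Real.log_pow, Real.log_pow] at hlog
  have h5 : Real.log ((degU q : ℕ) + 1) ≤ degU q := by
    have := Real.log_le_sub_one_of_pos (show (0 : ℝ) < (degU q : ℝ) + 1 by positivity)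
    linarith
  have h6 : Real.log (1 + ((3 * n + 2 : ℕ) : ℝ)) = Real.log (3 * n + 3) := by
    congr 1; push_cast; ring
  rw [h6] at hlog
  have h7 : Real.log 2 ≤ 1 := by linarith [Real.log_two_lt_d9]
  have h8 : 0 ≤ Real.log (3 * n + 3) := Real.log_nonneg (by
    have : (0 : ℝ) ≤ n := by positivity
    linarith)
  have hm0 : (0 : ℝ) ≤ q.natDegree := by positivity
  have hd0 : (0 : ℝ) ≤ degU q := by positivity
  have e : avgSize s n q = degU q + q.natDegree + μ₀ := rfl
  rw [e, size]
  nlinarith [mul_nonneg hm0 h8, mul_nonneg hd0 h8, mul_nonneg hμ0 h8,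
    mul_nonneg hm0 (sub_nonneg.2 h7)]

lemma avgSize_le {s : Finset ℕ} {n : ℕ} (hcard : s.card = 2 * n + 2)
    (hs : ∀ a ∈ s, a ≤ 3 * n + 2) {F : ℤ[X][X]} (hF : ∀ a ∈ s, spec a F ≠ 0) (hF0 : F ≠ 0)
    (hn : degU F ≤ n) :
    avgSize s n F ≤ degU F + F.natDegree + 2 * (Real.log (len2 F) + n * Real.log (3 * n + 3)) := by
  have h1 : ∑ a ∈ s, logM (spec a F) ≤ ∑ _a ∈ s, (Real.log (len2 F) + n * Real.log (3 * n + 3)) :=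
    by
    refine Finset.sum_le_sum fun a ha => (logM_le (hF a ha)).trans ?_
    have h2 := len1_spec_le a F (D := 3 * n + 3) (n := n) (by omega)
      ((hs a ha).trans (by omega)) hn
    have h3 := Real.log_le_log (lt_of_lt_of_le one_pos (one_le_len1 (hF a ha))) h2
    rw [Real.log_mul (lt_of_lt_of_le one_pos (one_le_len2 hF0)).ne' (by positivity),
      Real.log_pow] at h3
    push_cast at h3
    exact h3
  rw [Finset.sum_const, hcard, nsmul_eq_mul] at h1
  unfold avgSize
  have : (∑ a ∈ s, logM (spec a F)) / (n + 1) ≤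
      2 * (Real.log (len2 F) + n * Real.log (3 * n + 3)) := by
    rw [div_le_iff₀ (by positivity)]
    refine h1.trans (le_of_eq ?_)
    push_cast; ring
  linarith

/-- **Gelfond's lemma** on factors of an integer polynomial in two variables: sizes of the
divisors are controlled, and a small value is due to some irreducible factor. -/
theorem gelfond_log {F : ℤ[X][X]} (hF0 : F ≠ 0) {n : ℕ} {T : ℝ} (hT : 2 ≤ T)
    (hn : degU F ≤ n) (hnT : n ≤ T) (hm : F.natDegree ≤ T) (hL : Real.log (len2 F) ≤ T) :
    (∀ q, q ∣ F → size q ≤ 180 * T * Real.log T ^ 2) ∧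
    ∀ (a b : ℂ) (V : ℝ), 0 < V → ‖ev a b F‖ ≤ Real.exp (-V) →
      ∃ q, Irreducible q ∧ q ∣ F ∧
        ‖ev a b q‖ ≤ Real.exp (-(V * size q / (180 * T * Real.log T ^ 2))) := by
  obtain ⟨s, hcard, hs, hspec⟩ := exists_specialisation_nodes hF0 hn
  have hμ := avgSize_le hcard hs hspec hF0 hn
  set l := Real.log T with hl
  have hl2 : 2 / 3 < l := by
    have := Real.log_le_log (by norm_num) hT
    linarith [Real.log_two_gt_d9]
  have hlog : Real.log (3 * n + 3) ≤ 4 * l := by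
    have h1 : (3 * (n : ℝ) + 3) ≤ T ^ 4 := by
      have : 3 * T + 3 ≤ T ^ 4 := by nlinarith [sq_nonneg (T ^ 2 - 4), sq_nonneg (T - 2)]
      linarith
    have := Real.log_le_log (by positivity) h1
    rw [Real.log_pow] at this
    push_cast at this
    exact this
  have hlog0 : 0 ≤ Real.log (3 * n + 3) := Real.log_nonneg (by
    have : (0 : ℝ) ≤ n := by positivity
    linarith)
  have hμ' : avgSize s n F < 15 * T * l := by
    have h1 : (degU F : ℝ) ≤ T := le_trans (by exact_mod_cast hn) hnT
    have h2 : (n : ℝ) * Real.log (3 * n + 3) ≤ T * (4 * l) :=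
      mul_le_mul hnT hlog hlog0 (by linarith)
    have h3 : T * (2 / 3) < T * l := mul_lt_mul_of_pos_left hl2 (by linarith)
    linarith
  have hsize : ∀ q, q ∣ F → size q ≤ 12 * l * avgSize s n q := by
    intro q hq
    obtain ⟨r, rfl⟩ := hq
    have hq0 := left_ne_zero_of_mul hF0
    have hr0 := right_ne_zero_of_mul hF0
    have hd := degU_mul hq0 hr0
    refine (size_le_avgSize hcard hs hq0 (fun a ha => ?_) (by omega : degU q ≤ n)).trans ?_
    · have := hspec a ha
      rw [map_mul] at this
      exact left_ne_zero_of_mul this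
    · exact mul_le_mul_of_nonneg_right (by linarith) (avgSize_nonneg _ _ _)
  refine ⟨fun q hq => ?_, fun a b V hV hval => ?_⟩
  · refine (hsize q hq).trans ?_
    obtain ⟨r, rfl⟩ := hq
    have h1 := avgSize_mul (s := s) (n := n) (left_ne_zero_of_mul hF0) (right_ne_zero_of_mul hF0)
      (fun a ha => by have := hspec a ha; rw [map_mul] at this; exact left_ne_zero_of_mul this)
      (fun a ha => by have := hspec a ha; rw [map_mul] at this; exact right_ne_zero_of_mul this)
    have h2 := avgSize_nonneg s n r
    have h3 : avgSize s n q ≤ 15 * T * l := by linarith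
    calc 12 * l * avgSize s n q ≤ 12 * l * (15 * T * l) := by gcongr
      _ = _ := by ring
  · by_contra hcon
    push Not at hcon
    have hden : 0 < 15 * T * l := by positivity
    have h1 := exp_neg_avgSize_le s n a b (c := V / (15 * T * l)) (by positivity) F hF0 hspec
      (fun q hq hqd => by
        refine lt_of_le_of_lt ?_ (hcon q hq hqd)
        rw [Real.exp_le_exp, neg_le_neg_iff]
        rw [show V * size q / (180 * T * l ^ 2) = V / (15 * T * l) * (size q / (12 * l)) by
          field_simp; ring]
        gcongr
        rw [div_le_iff₀ (by positivity)]
        linarith [hsize q hqd])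
    have h2 := h1.trans hval
    rw [Real.exp_le_exp, neg_le_neg_iff] at h2
    have h3 : V / (15 * T * l) * avgSize s n F < V := by
      rw [div_mul_eq_mul_div, div_lt_iff₀ hden]
      exact mul_lt_mul_of_pos_left hμ' hV
    linarith

end NestPi

namespace NestPi

open Polynomial Finset

lemma sum_fin_shift {A : Type*} [AddCommMonoid A] (h : ℕ → ℕ → A) {M j n : ℕ} (hj : j + n < M) :
    ∑ i : Fin M, (if (i : ℕ) ∈ Set.Icc j (j + n) then h (i - j) i else 0) =
      ∑ k ∈ range (n + 1), h k (k + j) := by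
  rw [Fin.sum_univ_eq_sum_range (fun i => if i ∈ Set.Icc j (j + n) then h (i - j) i else 0),
    ← Finset.sum_filter]
  refine Finset.sum_bij' (fun i _ => i - j) (fun k _ => k + j) ?_ ?_ ?_ ?_ ?_
  · intro i hi; simp at hi ⊢; omega
  · intro i hi; simp at hi ⊢; omega
  · intro i hi; simp at hi ⊢; omega
  · intro i hi; simp at hi ⊢
  · intro i hi; simp at hi ⊢; congr 1; omega

section
variable {A : Type*} [CommRing A] {N : A → ℝ} (h : IsLen N)
include h

lemma sylvester_col_sum_le (f g : A[X]) {m n : ℕ} (hf : f.natDegree ≤ m) (hg : g.natDegree ≤ n)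
    (j : Fin (m + n)) : ∑ i, N (sylvester f g m n i j) ≤
      j.addCases (motive := fun _ => ℝ) (fun _ => polyLen N g) (fun _ => polyLen N f) := by
  refine Fin.addCases (fun j => ?_) (fun j => ?_) j
  · simp only [sylvester, Matrix.of_apply, Fin.addCases_left, apply_ite N, h.zero]
    rw [sum_fin_shift (fun k _ => N (g.coeff k)) (by omega), polyLen_eq_range h g hg]
  · simp only [sylvester, Matrix.of_apply, Fin.addCases_right, apply_ite N, h.zero]
    rw [sum_fin_shift (fun k _ => N (f.coeff k)) (by omega), polyLen_eq_range h f hf]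

lemma len_resultant_le (f g : A[X]) {m n : ℕ} (hf : f.natDegree ≤ m) (hg : g.natDegree ≤ n) :
    N (resultant f g m n) ≤ polyLen N f ^ n * polyLen N g ^ m := by
  rw [resultant, ← Matrix.det_transpose]
  refine (h.det _).trans ?_
  refine (Finset.prod_le_prod (fun i _ => Finset.sum_nonneg fun j _ => h.nonneg _)
    fun i _ => sylvester_col_sum_le h f g hf hg i).trans ?_
  rw [Fin.prod_univ_add]
  simp [mul_comm]

end

lemma vecMul_sylvester {A : Type*} [CommRing A] (f g : A[X]) {m n : ℕ} (hf : f.natDegree ≤ m)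
    (hg : g.natDegree ≤ n) (y : A) (j : Fin (m + n)) :
    ∑ i, sylvester f g m n i j * y ^ (i : ℕ) =
      j.addCases (motive := fun _ => A) (fun j => y ^ (j : ℕ) * g.eval y)
        (fun j => y ^ (j : ℕ) * f.eval y) := by
  refine Fin.addCases (fun j => ?_) (fun j => ?_) j
  · simp only [sylvester, Matrix.of_apply, Fin.addCases_left, ite_mul, zero_mul]
    rw [sum_fin_shift (fun k i => g.coeff k * y ^ i) (by omega),
      Polynomial.eval_eq_sum_range' (Nat.lt_succ_of_le hg), Finset.mul_sum]
    exact Finset.sum_congr rfl fun _ _ => by ring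
  · simp only [sylvester, Matrix.of_apply, Fin.addCases_right, ite_mul, zero_mul]
    rw [sum_fin_shift (fun k i => f.coeff k * y ^ i) (by omega),
      Polynomial.eval_eq_sum_range' (Nat.lt_succ_of_le hf), Finset.mul_sum]
    exact Finset.sum_congr rfl fun _ _ => by ring

/-- A resultant is small where both polynomials are. -/
lemma norm_resultant_le (f g : ℂ[X]) {m n : ℕ} (hf : f.natDegree ≤ m) (hg : g.natDegree ≤ n)
    (hmn : 0 < m + n) (y : ℂ) {R F G ε : ℝ} (hR : 1 ≤ R) (hy : ‖y‖ ≤ R)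
    (hF1 : 1 ≤ F) (hG1 : 1 ≤ G) (hF : polyLen (fun a : ℂ => ‖a‖) f ≤ F)
    (hG : polyLen (fun a : ℂ => ‖a‖) g ≤ G) (hfy : ‖f.eval y‖ ≤ ε) (hgy : ‖g.eval y‖ ≤ ε) :
    ‖resultant f g m n‖ ≤ (m + n) * (F ^ n * G ^ m) * R ^ (m + n) * ε := by
  have h : IsLen (fun a : ℂ => ‖a‖) := isLen_norm
  set S := (sylvester f g m n).transpose with hS
  have hε : 0 ≤ ε := (norm_nonneg _).trans hfy
  set v : Fin (m + n) → ℂ := fun i => y ^ (i : ℕ) with hv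
  set w := S.mulVec v with hw
  have hwj : ∀ j, ‖w j‖ ≤ R ^ (m + n) * ε := by
    intro j
    have := vecMul_sylvester f g hf hg y j
    have hwe : w j = ∑ i, sylvester f g m n i j * y ^ (i : ℕ) := rfl
    rw [hwe, this]
    have key : ∀ (k : ℕ) (z : ℂ), k ≤ m + n → ‖z‖ ≤ ε → ‖y ^ k * z‖ ≤ R ^ (m + n) * ε := by
      intro k z hk hz
      rw [norm_mul, norm_pow]
      have : ‖y‖ ^ k ≤ R ^ (m + n) :=
        (pow_le_pow_left₀ (norm_nonneg _) hy k).trans (pow_le_pow_right₀ hR hk)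
      gcongr
    refine Fin.addCases (fun j => ?_) (fun j => ?_) j
    · simp only [Fin.addCases_left]; exact key _ _ (by omega) hgy
    · simp only [Fin.addCases_right]; exact key _ _ (by omega) hfy
  have hrow : ∀ i, ∑ j, ‖S i j‖ ≤
      i.addCases (motive := fun _ => ℝ) (fun _ => G) (fun _ => F) := by
    intro i
    refine (sylvester_col_sum_le h f g hf hg i).trans ?_
    refine Fin.addCases (fun j => ?_) (fun j => ?_) i
    · simpa using hG
    · simpa using hF
  have hadj : ∀ i j, ‖S.adjugate i j‖ ≤ F ^ n * G ^ m := by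
    intro i j
    rw [Matrix.adjugate_apply]
    refine (h.det _).trans ?_
    have : ∀ k, ∑ l, ‖(S.updateRow j (Pi.single i 1)) k l‖ ≤
        k.addCases (motive := fun _ => ℝ) (fun _ => G) (fun _ => F) := by
      intro k
      by_cases hk : k = j
      · subst hk
        simp only [Matrix.updateRow_self]
        have : ∑ l, ‖(Pi.single i (1 : ℂ) : Fin (m + n) → ℂ) l‖ = 1 := by
          rw [Finset.sum_eq_single i] <;> simp +contextual
        rw [this]
        refine Fin.addCases (fun j => ?_) (fun j => ?_) k
        · simpa using hG1
        · simpa using hF1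
      · rw [Matrix.updateRow_ne hk]; exact hrow k
    refine (Finset.prod_le_prod (fun i _ => Finset.sum_nonneg fun j _ => h.nonneg _)
      fun k _ => this k).trans ?_
    rw [Fin.prod_univ_add]
    simp [mul_comm]
  have hdet : resultant f g m n = ∑ j, S.adjugate ⟨0, hmn⟩ j * w j := by
    have h1 : S.adjugate.mulVec w = S.det • v := by
      rw [hw, Matrix.mulVec_mulVec, Matrix.adjugate_mul, Matrix.smul_mulVec, Matrix.one_mulVec]
    have h2 := congrFun h1 ⟨0, hmn⟩
    simp only [Pi.smul_apply, hv, pow_zero, smul_eq_mul, mul_one] at h2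
    rw [resultant, ← Matrix.det_transpose, ← hS, ← h2]
    rfl
  rw [hdet]
  refine (norm_sum_le _ _).trans ?_
  have : ∀ j ∈ (univ : Finset (Fin (m + n))), ‖S.adjugate ⟨0, hmn⟩ j * w j‖ ≤
      F ^ n * G ^ m * (R ^ (m + n) * ε) := fun j _ => by
    rw [norm_mul]
    have := hadj ⟨0, hmn⟩ j
    have := hwj j
    gcongr
  refine (Finset.sum_le_sum this).trans (le_of_eq ?_)
  simp; ring

lemma natDegree_map_det_le {A B : Type*} [CommRing A] [CommRing B] (φ : A →+* B[X]) {ι : Type*}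
    [Fintype ι] [DecidableEq ι] (M : Matrix ι ι A) (d : ι → ℕ)
    (hd : ∀ i j, (φ (M i j)).natDegree ≤ d j) : (φ M.det).natDegree ≤ ∑ j, d j := by
  rw [Matrix.det_apply, map_sum]
  refine natDegree_sum_le_of_forall_le _ _ fun σ _ => ?_
  have : φ (Equiv.Perm.sign σ • ∏ i, M (σ i) i) = Equiv.Perm.sign σ • ∏ i, φ (M (σ i) i) := by
    rcases Int.units_eq_one_or (Equiv.Perm.sign σ) with h | h <;> simp [h, map_prod]
  rw [this]
  have h2 : (Equiv.Perm.sign σ • ∏ i, φ (M (σ i) i)).natDegree = (∏ i, φ (M (σ i) i)).natDegree :=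
    by
    rcases Int.units_eq_one_or (Equiv.Perm.sign σ) with h | h <;> simp [h]
  rw [h2]
  exact (natDegree_prod_le _ _).trans (Finset.sum_le_sum fun i _ => hd _ _)

lemma natDegree_map_resultant_le {A B : Type*} [CommRing A] [CommRing B] (φ : A →+* B[X])
    (f g : A[X]) (m n : ℕ) {a b : ℕ} (hf : ∀ k, (φ (f.coeff k)).natDegree ≤ a)
    (hg : ∀ k, (φ (g.coeff k)).natDegree ≤ b) :
    (φ (resultant f g m n)).natDegree ≤ n * a + m * b := by
  have := natDegree_map_det_le φ (sylvester f g m n)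
    (fun j => j.addCases (motive := fun _ => ℕ) (fun _ => b) (fun _ => a)) ?_
  · refine this.trans (le_of_eq ?_)
    rw [Fin.sum_univ_add]; simp [add_comm]
  · intro i j
    refine Fin.addCases (fun j => ?_) (fun j => ?_) j
    · simp only [sylvester, Matrix.of_apply, Fin.addCases_left]
      split_ifs
      · exact hg _
      · simp
    · simp only [sylvester, Matrix.of_apply, Fin.addCases_right]
      split_ifs
      · exact hf _
      · simp

lemma isPrimitive_of_irreducible {A : Type*} [CommRing A] [IsDomain A] {f : A[X]}
    (hf : Irreducible f) (hd : 0 < f.natDegree) : f.IsPrimitive := by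
  intro r hr
  obtain ⟨g, hg⟩ := hr
  rcases hf.isUnit_or_isUnit hg with h | h
  · exact isUnit_C.1 h
  · exfalso
    have h1 : g.natDegree = 0 := natDegree_eq_zero_of_isUnit h
    have : f.natDegree ≤ g.natDegree := by rw [hg]; exact natDegree_C_mul_le _ _
    omega

section
variable {A : Type*} [CommRing A] [IsDomain A] [UniqueFactorizationMonoid A]

lemma isCoprime_fractionRing {f g : A[X]} (hf : Irreducible f)
    (hd : 0 < f.natDegree) (hfg : ¬ f ∣ g) :
    IsCoprime (f.map (algebraMap A (FractionRing A))) (g.map (algebraMap A (FractionRing A))) := by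
  have hp := isPrimitive_of_irreducible hf hd
  let _ : NormalizedGCDMonoid A := Nonempty.some inferInstance
  have h1 : Irreducible (f.map (algebraMap A (FractionRing A))) :=
    (hp.irreducible_iff_irreducible_map_fraction_map).1 hf
  refine (EuclideanDomain.dvd_or_coprime _ _ h1).resolve_left fun h => hfg ?_
  exact hp.dvd_of_fraction_map_dvd_fraction_map h

lemma resultant_ne_zero_of_irreducible {f g : A[X]} (hf : Irreducible f)
    (hd : 0 < f.natDegree) (hfg : ¬ f ∣ g) : resultant f g ≠ 0 := by
  intro h0
  have h2 := isCoprime_fractionRing hf hd hfg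
  have hinj := IsFractionRing.injective A (FractionRing A)
  have : resultant (f.map (algebraMap A (FractionRing A)))
      (g.map (algebraMap A (FractionRing A))) = 0 := by
    rw [natDegree_map_eq_of_injective hinj, natDegree_map_eq_of_injective hinj,
      resultant_map_map, h0, map_zero]
  rw [resultant_eq_zero_iff] at this
  exact this.2 h2

end

end NestPi

namespace NestPi

open Polynomial Finset

section integrality
variable {N : Type*} [Field N]

lemma isIntegral_leadingCoeff_mul_root {f : N[X]} (hf : ∀ i, IsIntegral ℤ (f.coeff i)) {α : N}
    (hα : f.eval α = 0) : IsIntegral ℤ (f.leadingCoeff * α) := by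
  obtain ⟨F, hF, hd⟩ := Polynomial.exists_degree_eq_of_mem_lifts
    (f := algebraMap (integralClosure ℤ N) N) (p := f) (by
      rw [Polynomial.lifts_iff_coeff_lifts]
      intro n; exact ⟨⟨f.coeff n, hf n⟩, rfl⟩)
  have h1 : aeval α F = 0 := by
    rw [aeval_def, ← eval_map, hF, hα]
  have h2 := isIntegral_trans (R := ℤ) _ (isIntegral_leadingCoeff_smul F α h1)
  have hl : algebraMap (integralClosure ℤ N) N F.leadingCoeff = f.leadingCoeff := by
    rw [leadingCoeff, leadingCoeff, ← hF, coeff_map]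
    congr 2
    rw [hF]; exact natDegree_eq_of_degree_eq hd
  rwa [Algebra.smul_def, hl] at h2

/-- Dividing a polynomial with integral coefficients by `X - α` leaves integral coefficients. -/
lemma isIntegral_coeff_of_X_sub_C_mul {α : N} (n : ℕ) : ∀ g : N[X], g.natDegree ≤ n →
    (∀ i, IsIntegral ℤ (((X - C α) * g).coeff i)) → ∀ i, IsIntegral ℤ (g.coeff i) := by
  have hb : ∀ g : N[X], (∀ i, IsIntegral ℤ (((X - C α) * g).coeff i)) →
      IsIntegral ℤ g.leadingCoeff ∧ IsIntegral ℤ (g.leadingCoeff * α) := by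
    intro g h
    have hl : ((X - C α) * g).leadingCoeff = g.leadingCoeff := by
      rw [leadingCoeff_mul, leadingCoeff_X_sub_C, one_mul]
    refine ⟨hl ▸ h _, ?_⟩
    have := isIntegral_leadingCoeff_mul_root h (α := α) (by simp)
    rwa [hl] at this
  induction n with
  | zero =>
    intro g hg h i
    obtain ⟨h1, -⟩ := hb g h
    rw [eq_C_of_natDegree_le_zero hg] at h1 ⊢
    rw [leadingCoeff_C] at h1
    rw [coeff_C]; split_ifs
    · exact h1
    · exact isIntegral_zero
  | succ n ih =>
    intro g hg h
    obtain ⟨h1, h2⟩ := hb g h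
    have h3 : ∀ i, IsIntegral ℤ (((X - C α) * g.eraseLead).coeff i) := by
      intro i
      have : (X - C α) * g.eraseLead = (X - C α) * g -
          (monomial (g.natDegree + 1) g.leadingCoeff -
            monomial g.natDegree (g.leadingCoeff * α)) := by
        rw [← g.self_sub_monomial_natDegree_leadingCoeff]
        have e1 : (monomial (g.natDegree + 1) g.leadingCoeff : N[X]) =
            X * monomial g.natDegree g.leadingCoeff := by
          rw [X_mul_monomial]
        have e2 : (monomial g.natDegree (g.leadingCoeff * α) : N[X]) =
            C α * monomial g.natDegree g.leadingCoeff := by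
          rw [C_mul_monomial, mul_comm]
        rw [e1, e2]; ring
      rw [this, coeff_sub, coeff_sub, coeff_monomial, coeff_monomial]
      refine (h i).sub (IsIntegral.sub ?_ ?_)
      · split_ifs <;> [exact h1; exact isIntegral_zero]
      · split_ifs <;> [exact h2; exact isIntegral_zero]
    have h4 := ih g.eraseLead (by
      have := g.eraseLead_natDegree_le; omega) h3
    intro i
    rw [← g.eraseLead_add_monomial_natDegree_leadingCoeff, coeff_add, coeff_monomial]
    refine (h4 i).add ?_
    split_ifs <;> [exact h1; exact isIntegral_zero]

lemma isIntegral_coeff_of_prod_mul {ι : Type*} (s : Finset ι) (α : ι → N) (g : N[X])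
    (h : ∀ i, IsIntegral ℤ (((∏ i ∈ s, (X - C (α i))) * g).coeff i)) (i : ℕ) :
    IsIntegral ℤ (g.coeff i) := by
  classical
  induction s using Finset.induction_on generalizing g i with
  | empty => simpa using h i
  | insert a s ha ih =>
    refine isIntegral_coeff_of_X_sub_C_mul (α := α a) _ g le_rfl
      (fun i => ih ((X - C (α a)) * g) (fun j => ?_) i) i
    have := h j
    rw [Finset.prod_insert ha] at this
    convert this using 2; ring

lemma isIntegral_mul_prod_roots {ι : Type*} [Fintype ι] (a : N) (α : ι → N)
    (h : ∀ i, IsIntegral ℤ ((C a * ∏ i, (X - C (α i))).coeff i)) (s : Finset ι) :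
    IsIntegral ℤ (a * ∏ i ∈ s, α i) := by
  classical
  have h1 := isIntegral_coeff_of_prod_mul sᶜ α (C a * ∏ i ∈ s, (X - C (α i))) (fun i => by
    convert h i using 2
    rw [← Finset.prod_compl_mul_prod s]; ring) 0
  rw [coeff_C_mul, coeff_zero_eq_eval_zero, eval_prod] at h1
  simp only [eval_sub, eval_X, eval_C, zero_sub, Finset.prod_neg] at h1
  rcases neg_one_pow_eq_or N s.card with h2 | h2
  · simpa [h2] using h1
  · rw [h2] at h1; simpa using h1.neg

lemma isIntegral_pow_mul_prod_pow {ι : Type*} [Fintype ι] (a : N) (α : ι → N)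
    (h : ∀ i, IsIntegral ℤ ((C a * ∏ i, (X - C (α i))).coeff i)) (T : ℕ) (e : ι → ℕ)
    (he : ∀ i, e i ≤ T) : IsIntegral ℤ (a ^ T * ∏ i, α i ^ e i) := by
  classical
  induction T generalizing e with
  | zero =>
    have : e = 0 := funext fun i => by simpa using he i
    simpa [this] using isIntegral_one
  | succ T ih =>
    have h1 := ih (fun i => e i - 1) (fun i => by have := he i; omega)
    have h2 := isIntegral_mul_prod_roots a α h (univ.filter fun i => e i ≠ 0)
    have : a ^ (T + 1) * ∏ i, α i ^ e i = (a * ∏ i ∈ univ.filter (fun i => e i ≠ 0), α i) *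
        (a ^ T * ∏ i, α i ^ (e i - 1)) := by
      have : ∏ i, α i ^ e i = (∏ i ∈ univ.filter (fun i => e i ≠ 0), α i) *
          ∏ i, α i ^ (e i - 1) := by
        rw [Finset.prod_filter, ← Finset.prod_mul_distrib]
        refine Finset.prod_congr rfl fun i _ => ?_
        by_cases hi : e i = 0
        · simp [hi]
        · simp only [ne_eq, hi, not_false_eq_true, if_true]
          rw [← pow_succ']; congr 1; omega
      rw [this]; ring
    rw [this]
    exact h2.mul h1

/-- Evaluation of an integral polynomial at a point of a field. -/
noncomputable def evF (a b : N) : ℤ[X][X] →+* N := eval₂RingHom (eval₂RingHom (Int.castRingHom N)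
    a) b

lemma evF_eq_sum (a b : N) (F : ℤ[X][X]) {T : ℕ} (h1 : degU F ≤ T) (h2 : F.natDegree ≤ T) :
    evF a b F = ∑ x ∈ range (T + 1) ×ˢ range (T + 1),
      (((F.coeff x.2).coeff x.1 : ℤ) : N) * (a ^ x.1 * b ^ x.2) := by
  rw [evF, coe_eval₂RingHom, eval₂_eq_sum_range' _ (Nat.lt_succ_of_le h2), Finset.sum_product_right]
  refine Finset.sum_congr rfl fun j _ => ?_
  rw [coe_eval₂RingHom, eval₂_eq_sum_range' _ (Nat.lt_succ_of_le
    ((natDegree_coeff_le_degU F j).trans h1)), Finset.sum_mul]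
  refine Finset.sum_congr rfl fun i _ => ?_
  simp; ring

lemma isIntegral_pow_mul_prod_evF {ι : Type*} [Fintype ι] (a : N) (α β : ι → N)
    (hα : ∀ i, IsIntegral ℤ ((C a * ∏ i, (X - C (α i))).coeff i))
    (hβ : ∀ i, IsIntegral ℤ ((C a * ∏ i, (X - C (β i))).coeff i))
    (F : ℤ[X][X]) {T : ℕ} (h1 : degU F ≤ T) (h2 : F.natDegree ≤ T) :
    IsIntegral ℤ (a ^ (2 * T) * ∏ i, evF (α i) (β i) F) := by
  classical
  simp only [evF_eq_sum _ _ F h1 h2]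
  rw [Finset.prod_univ_sum, Finset.mul_sum]
  refine IsIntegral.sum _ fun p hp => ?_
  rw [Fintype.mem_piFinset] at hp
  simp only [Finset.mem_product, Finset.mem_range, Nat.lt_succ_iff] at hp
  have e : a ^ (2 * T) * ∏ i, (((F.coeff (p i).2).coeff (p i).1 : ℤ) : N) *
      (α i ^ (p i).1 * β i ^ (p i).2) = (∏ i, (((F.coeff (p i).2).coeff (p i).1 : ℤ) : N)) *
      ((a ^ T * ∏ i, α i ^ (p i).1) * (a ^ T * ∏ i, β i ^ (p i).2)) := by
    rw [Finset.prod_mul_distrib, Finset.prod_mul_distrib]; ring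
  rw [e]
  refine IsIntegral.mul (IsIntegral.prod _ fun i _ => isIntegral_algebraMap (R := ℤ))
    ((isIntegral_pow_mul_prod_pow a α hα T _ fun i => (hp i).1).mul
     (isIntegral_pow_mul_prod_pow a β hβ T _ fun i => (hp i).2))

end integrality

end NestPi

namespace NestPi

open Polynomial Finset

section galois
variable {N : Type*} [Field N]

/-- The linear form `X - (p₁ + u p₂)` in the outer variable attached to a point. -/
noncomputable def lineF {N : Type*} [Field N] (p : N × N) : N[X] := C p.1 + X * C p.2

lemma lineF_injective : Function.Injective (lineF (N := N)) := by
  intro p q h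
  have h0 := congrArg (fun f => f.coeff 0) h
  have h1 := congrArg (fun f => f.coeff 1) h
  simp [lineF, coeff_C] at h0 h1
  exact Prod.ext h0 h1

/-- Base change of an integral polynomial in two variables. -/
noncomputable def bc (N : Type*) [CommRing N] : ℤ[X][X] →+* N[X][X] :=
  mapRingHom (mapRingHom (Int.castRingHom N))

lemma bc_injective [CharZero N] : Function.Injective (bc N) :=
  Polynomial.map_injective _ (Polynomial.map_injective _ Int.cast_injective)

lemma bc_map {N' : Type*} [CommRing N'] (g : N →+* N') (F : ℤ[X][X]) :
    (bc N F).map (mapRingHom g) = bc N' F := by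
  have : (mapRingHom (mapRingHom g)).comp (bc N) = bc N' := by
    ext <;> simp [bc]
  exact RingHom.congr_fun this F

lemma exists_int_mul_eq_map (p : ℚ[X]) : ∃ c : ℤ, c ≠ 0 ∧ ∃ q : ℤ[X],
    q.map (Int.castRingHom ℚ) = C (c : ℚ) * p := by
  obtain ⟨b, hb0, hb⟩ := IsLocalization.integerNormalization_spec (nonZeroDivisors ℤ) p
  refine ⟨b, nonZeroDivisors.ne_zero hb0,
    IsLocalization.integerNormalization (nonZeroDivisors ℤ) p, ?_⟩
  rw [show (Int.castRingHom ℚ) = algebraMap ℤ ℚ from rfl, hb, ← smul_eq_C_mul]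
  ext; simp

lemma exists_int_mul_eq_map_map (p : ℚ[X][X]) : ∃ c : ℤ, c ≠ 0 ∧ ∃ q : ℤ[X][X],
    bc ℚ q = C (C (c : ℚ)) * p := by
  induction p using Polynomial.induction_on' with
  | add p q hp hq =>
    obtain ⟨c, hc, f, hf⟩ := hp
    obtain ⟨d, hd, g, hg⟩ := hq
    refine ⟨c * d, mul_ne_zero hc hd, (d : ℤ[X][X]) * f + (c : ℤ[X][X]) * g, ?_⟩
    rw [map_add, map_mul, map_mul, hf, hg]
    simp
    ring
  | monomial n a =>
    obtain ⟨c, hc, f, hf⟩ := exists_int_mul_eq_map a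
    refine ⟨c, hc, monomial n f, ?_⟩
    rw [bc, coe_mapRingHom, map_monomial, coe_mapRingHom, hf, C_mul_monomial]

/-- A common root of an irreducible polynomial and another one forces divisibility. -/
lemma dvd_of_common_root {A B : Type*} [CommRing A] [IsDomain A] [UniqueFactorizationMonoid A]
    [CommRing B] (φ : A →+* B) (hφ : Function.Injective φ) {f g : A[X]} (hf : Irreducible f)
    (hd : 0 < f.natDegree) {y : B} (h1 : f.eval₂ φ y = 0) (h2 : g.eval₂ φ y = 0) : f ∣ g := by
  by_contra hfg
  have h0 := resultant_ne_zero_of_irreducible hf hd hfg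
  obtain ⟨p, q, -, -, hpq⟩ := exists_mul_add_mul_eq_C_resultant f g (m := f.natDegree)
    (n := g.natDegree) le_rfl le_rfl (by omega)
  have := congrArg (fun F => F.eval₂ φ y) hpq
  simp only [eval₂_add, eval₂_mul, h1, h2, zero_mul, add_zero, eval₂_C] at this
  exact h0 (hφ (by rw [← this, map_zero]))

variable [CharZero N] [Algebra ℚ N] [FiniteDimensional ℚ N] [IsGalois ℚ N]

theorem galois_factorization {Ψ : ℤ[X][X]} (hΨ : Irreducible Ψ) (hd : 0 < Ψ.natDegree) (p : N × N)
    (hp : (bc N Ψ).eval (lineF p) = 0) : ∃ (O : Finset (N × N)) (a : ℤ), p ∈ O ∧ a ≠ 0 ∧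
      bc N Ψ = C (C (a : N)) * ∏ x ∈ O, (X - C (lineF x)) ∧
      (∀ x ∈ O, ∃ g : N ≃ₐ[ℚ] N, x = (g p.1, g p.2)) ∧
      (∀ (g : N ≃ₐ[ℚ] N) (f : N × N → N), ∏ x ∈ O, f (g x.1, g x.2) = ∏ x ∈ O, f x) := by
  classical
  set O : Finset (N × N) := univ.image fun g : N ≃ₐ[ℚ] N => (g p.1, g p.2) with hO
  have hOim : ∀ g : N ≃ₐ[ℚ] N, O.image (fun x => (g x.1, g x.2)) = O := by
    intro g
    apply Finset.eq_of_subset_of_card_le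
    · intro x hx
      simp only [hO, Finset.mem_image, Finset.mem_univ, true_and] at hx ⊢
      obtain ⟨_, ⟨g', rfl⟩, rfl⟩ := hx
      exact ⟨g * g', rfl⟩
    · rw [Finset.card_image_of_injective O]
      intro x y h
      simp only [Prod.mk.injEq, EmbeddingLike.apply_eq_iff_eq] at h
      exact Prod.ext h.1 h.2
  have hmem : ∀ x ∈ O, ∃ g : N ≃ₐ[ℚ] N, x = (g p.1, g p.2) := by
    intro x hx
    simp only [hO, Finset.mem_image, Finset.mem_univ, true_and] at hx
    obtain ⟨g, hg⟩ := hx; exact ⟨g, hg.symm⟩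
  have hmapline : ∀ (g : N ≃ₐ[ℚ] N) (x : N × N),
      (lineF x).map (g : N →+* N) = lineF (g x.1, g x.2) := by
    intro g x; simp [lineF]
  have hroot : ∀ x ∈ O, (bc N Ψ).eval (lineF x) = 0 := by
    intro x hx
    obtain ⟨g, rfl⟩ := hmem x hx
    rw [← hmapline, ← bc_map (g : N →+* N) Ψ, ← coe_mapRingHom, eval_map, eval₂_hom, hp, map_zero]
  set ψ : N[X][X] := ∏ x ∈ O, (X - C (lineF x)) with hψ
  have hψm : ψ.Monic := monic_prod_of_monic _ _ fun x _ => monic_X_sub_C _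
  have hΨ0 : bc N Ψ ≠ 0 := by
    rw [Ne, ← map_zero (bc N)]; exact fun h => hΨ.ne_zero (bc_injective h)
  have hdvd : ψ ∣ bc N Ψ := by
    have e : ψ = ((O.image lineF).val.map fun a => X - C a).prod := by
      have : ψ = ∏ a ∈ O.image lineF, (X - C a) := by
        rw [Finset.prod_image fun _ _ _ _ h => lineF_injective h]
      rw [this]; rfl
    rw [e, Multiset.prod_X_sub_C_dvd_iff_le_roots hΨ0, Finset.val_le_iff_val_subset]
    intro y hy
    rw [Finset.mem_val, Finset.mem_image] at hy
    obtain ⟨x, hx, rfl⟩ := hy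
    rw [mem_roots hΨ0]; exact hroot x hx
  have hinv : ∀ g : N ≃ₐ[ℚ] N, ψ.map (mapRingHom (g : N →+* N)) = ψ := by
    intro g
    conv_rhs => rw [hψ, ← hOim g]
    rw [Finset.prod_image, hψ, Polynomial.map_prod]
    · refine Finset.prod_congr rfl fun x _ => ?_
      rw [Polynomial.map_sub, map_X, map_C, coe_mapRingHom, hmapline]
    · intro x _ y _ h
      simp only [Prod.mk.injEq, EmbeddingLike.apply_eq_iff_eq] at h
      exact Prod.ext h.1 h.2
  have hrat : ∃ ψ0 : ℚ[X][X], ψ0.map (mapRingHom (algebraMap ℚ N)) = ψ := by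
    rw [← coe_mapRingHom, ← RingHom.mem_range, mem_map_range]
    intro n
    rw [mem_map_range]
    intro k
    have : (ψ.coeff n).coeff k ∈ Set.range (algebraMap ℚ N) := by
      rw [IsGalois.mem_range_algebraMap_iff_fixed]
      intro g
      conv_rhs => rw [← hinv g]
      simp
    exact this
  obtain ⟨ψ0, hψ0⟩ := hrat
  obtain ⟨c, hc, ψ1, hψ1⟩ := exists_int_mul_eq_map_map ψ0
  have hψ1' : bc N ψ1 = C (C (c : N)) * ψ := by
    rw [← bc_map (algebraMap ℚ N), hψ1, Polynomial.map_mul, hψ0]; simp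
  have hpO : p ∈ O := by
    simp only [hO, Finset.mem_image, Finset.mem_univ, true_and]
    exact ⟨1, rfl⟩
  have hΨψ1 : Ψ ∣ ψ1 := by
    refine dvd_of_common_root (mapRingHom (Int.castRingHom N))
      (Polynomial.map_injective _ Int.cast_injective) hΨ hd (y := lineF p) ?_ ?_
    · rw [← eval_map]; exact hp
    · rw [← eval_map]
      change (bc N ψ1).eval (lineF p) = 0
      rw [hψ1', eval_mul, hψ, eval_prod, Finset.prod_eq_zero hpO (by simp), mul_zero]
  obtain ⟨χ, hχ⟩ := hdvd
  obtain ⟨χ', hχ'⟩ := hΨψ1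
  have h3 : χ * bc N χ' = C (C (c : N)) := by
    have : ψ * (χ * bc N χ') = ψ * C (C (c : N)) := by
      rw [← mul_assoc, ← hχ, ← map_mul, ← hχ', hψ1', mul_comm]
    exact mul_left_cancel₀ hψm.ne_zero this
  have hu : IsUnit χ := by
    refine isUnit_of_mul_isUnit_left (y := bc N χ') ?_
    rw [h3]
    exact isUnit_C.2 (isUnit_C.2 (by simpa using hc))
  obtain ⟨r, hr, hrχ⟩ := isUnit_iff.1 hu
  obtain ⟨α, hα, hαr⟩ := isUnit_iff.1 hr
  have hχα : χ = C (C α) := by rw [← hrχ, ← hαr]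
  have hαa : α = (((Ψ.coeff ψ.natDegree).coeff 0 : ℤ) : N) := by
    have h4 : ((bc N Ψ).coeff ψ.natDegree).coeff 0 = α := by
      rw [hχ, hχα, coeff_mul_C, coeff_natDegree, hψm.leadingCoeff, one_mul, coeff_C_zero]
    rw [← h4]; simp [bc]
  refine ⟨O, (Ψ.coeff ψ.natDegree).coeff 0, hpO, ?_, ?_, hmem, fun g f => ?_⟩
  · intro h0
    rw [h0, Int.cast_zero] at hαa
    exact hα.ne_zero hαa
  · rw [hχ, hχα, hαa, mul_comm]
  · have : ∏ x ∈ O.image (fun x => (g x.1, g x.2)), f x = ∏ x ∈ O, f (g x.1, g x.2) := by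
      refine Finset.prod_image fun x _ y _ h => ?_
      simp only [Prod.mk.injEq, EmbeddingLike.apply_eq_iff_eq] at h
      exact Prod.ext h.1 h.2
    rw [← this, hOim g]

end galois

end NestPi

namespace NestPi

open Polynomial Finset

/-- The substitution `u ↦ s`, `ℓ ↦ ℓ s` used to extract the top homogeneous part. -/
noncomputable def tau (R : Type*) [CommRing R] : R[X][X] →+* R[X][X] :=
  eval₂RingHom (mapRingHom C) (C X * X)

lemma bc_tau {N : Type*} [CommRing N] (F : ℤ[X][X]) : bc N (tau ℤ F) = tau N (bc N F) := by
  have : (bc N).comp (tau ℤ) = (tau N).comp (bc N) := by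
    ext <;> simp [bc, tau]
  exact RingHom.congr_fun this F

lemma len2_tau_le (F : ℤ[X][X]) : len2 (tau ℤ F) ≤ len2 F := by
  have hl := isLen_len1
  have := len_eval₂_le hl isLen_len2 (mapRingHom (C : ℤ →+* ℤ[X])) (K := 1) F (fun i => by
      rw [one_mul]
      exact polyLen_map_le isLen_norm hl C (fun a => (polyLen_C isLen_norm a).le) _)
    (C X * X) (R := 1) le_rfl (by
      refine (isLen_len2.mul _ _).trans ?_
      have h1 : len2 (C (X : ℤ[X])) ≤ 1 := by
        rw [len2, polyLen_C hl]; exact polyLen_X_le isLen_norm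
      have h2 : len2 (X : ℤ[X][X]) ≤ 1 := polyLen_X_le hl
      exact mul_le_one₀ h1 (isLen_len2.nonneg _) h2) (n := F.natDegree) le_rfl
  rw [one_mul, one_pow, mul_one] at this
  exact this

section
variable {N : Type*} [Field N] {Ψ : ℤ[X][X]} {O : Finset (N × N)} {a : ℤ}
  (h : bc N Ψ = C (C (a : N)) * ∏ x ∈ O, (X - C (lineF x)))
include h

lemma map_eval_zero_eq : (Ψ.map (evalRingHom 0)).map (Int.castRingHom N) =
    C (a : N) * ∏ x ∈ O, (X - C x.1) := by
  have h1 := congrArg (mapRingHom (evalRingHom 0)) h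
  have h2 : (mapRingHom (evalRingHom (0 : N))).comp (bc N) =
      (mapRingHom (Int.castRingHom N)).comp (mapRingHom (evalRingHom 0)) := by
    ext <;> simp [bc]
  have h3 := RingHom.congr_fun h2 Ψ
  simp only [RingHom.comp_apply] at h3
  rw [h3] at h1
  simpa [Polynomial.map_prod, lineF] using h1

lemma map_tau_coeff_eq : ((tau ℤ Ψ).coeff O.card).map (Int.castRingHom N) =
    C (a : N) * ∏ x ∈ O, (X - C x.2) := by
  have h1 : ((tau ℤ Ψ).coeff O.card).map (Int.castRingHom N) = (bc N (tau ℤ Ψ)).coeff O.card := by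
    simp [bc]
  rw [h1, bc_tau, h, map_mul, map_prod]
  have h2 : tau N (C (C (a : N))) = C (C (a : N)) := by simp [tau]
  rw [h2, coeff_C_mul]
  congr 1
  have h3 := coeff_prod_of_natDegree_le (s := O) (fun x => tau N (X - C (lineF x))) 1 ?_
  · rw [mul_one] at h3
    rw [h3]
    refine Finset.prod_congr rfl fun x _ => ?_
    simp [tau, lineF, coeff_C]
  · intro x _
    simp only [tau, lineF, coe_eval₂RingHom, eval₂_sub, eval₂_X, eval₂_C]
    simp only [coe_mapRingHom, Polynomial.map_add, map_C, Polynomial.map_mul, map_X]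
    compute_degree

end

lemma mahler_bound {f : ℤ[X]} {a : ℤ} {ι : Type*} {O : Finset ι} {α : ι → ℂ}
    (h : f.map (Int.castRingHom ℂ) = C (a : ℂ) * ∏ x ∈ O, (X - C (α x))) :
    |(a : ℝ)| * ∏ x ∈ O, max 1 ‖α x‖ ≤ len1 f := by
  have h1 := mahlerMeasure_le_len1 f
  rw [h, mahlerMeasure_mul, mahlerMeasure_const] at h1
  have : (∏ x ∈ O, (X - C (α x))).mahlerMeasure = ∏ x ∈ O, max 1 ‖α x‖ := by
    classical
    clear h h1
    induction O using Finset.induction_on with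
    | empty => simp
    | insert b s hb ih =>
      rw [Finset.prod_insert hb, Finset.prod_insert hb, mahlerMeasure_mul, mahlerMeasure_X_sub_C,
        ih]
  rw [this] at h1
  simpa using h1

theorem exists_int_norm {N : Type*} [Field N] [CharZero N] [Algebra ℚ N] [FiniteDimensional ℚ N]
    [IsGalois ℚ N] {Ψ : ℤ[X][X]} {O : Finset (N × N)} {a : ℤ} (ha : a ≠ 0) (p : N × N)
    (h : bc N Ψ = C (C (a : N)) * ∏ x ∈ O, (X - C (lineF x)))
    (hO1 : ∀ x ∈ O, ∃ g : N ≃ₐ[ℚ] N, x = (g p.1, g p.2))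
    (hO2 : ∀ (g : N ≃ₐ[ℚ] N) (f : N × N → N), ∏ x ∈ O, f (g x.1, g x.2) = ∏ x ∈ O, f x)
    (F : ℤ[X][X]) {T : ℕ} (h1 : degU F ≤ T) (h2 : F.natDegree ≤ T)
    (hF : ∃ x ∈ O, evF x.1 x.2 F ≠ 0) :
    ∃ z : ℤ, z ≠ 0 ∧ (z : N) = (a : N) ^ (2 * T) * ∏ x ∈ O, evF x.1 x.2 F := by
  have hg : ∀ (g : N ≃ₐ[ℚ] N) (x : N × N), g (evF x.1 x.2 F) = evF (g x.1) (g x.2) F := by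
    intro g x
    have : ((g : N →+* N)).comp (evF x.1 x.2) = evF (g x.1) (g x.2) := by
      ext <;> simp [evF]
    exact RingHom.congr_fun this F
  set y := (a : N) ^ (2 * T) * ∏ x ∈ O, evF x.1 x.2 F with hy
  have hcoef : ∀ (f : ℤ[X]) (i : ℕ), IsIntegral ℤ ((f.map (Int.castRingHom N)).coeff i) := by
    intro f i; rw [coeff_map]; exact isIntegral_algebraMap (R := ℤ)
  have hintegral : IsIntegral ℤ y := by
    have := isIntegral_pow_mul_prod_evF (ι := O) (a : N) (fun x => x.1.1) (fun x => x.1.2)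
      (fun i => by
        rw [Finset.prod_coe_sort O (fun x => X - C x.1), ← map_eval_zero_eq h]; exact hcoef _ i)
      (fun i => by
        rw [Finset.prod_coe_sort O (fun x => X - C x.2), ← map_tau_coeff_eq h]; exact hcoef _ i)
      F h1 h2
    rwa [Finset.prod_coe_sort O (fun x => evF x.1 x.2 F)] at this
  have hfix : ∀ g : N ≃ₐ[ℚ] N, g y = y := by
    intro g
    rw [hy, map_mul, map_prod, map_pow, map_intCast]
    simp only [hg]
    rw [hO2 g (fun x => evF x.1 x.2 F)]
  obtain ⟨r, hr⟩ := (IsGalois.mem_range_algebraMap_iff_fixed y).2 hfix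
  have hrint : IsIntegral ℤ r := by
    rw [← hr] at hintegral
    exact (isIntegral_algebraMap_iff (algebraMap ℚ N).injective).1 hintegral
  obtain ⟨z, hz⟩ := IsIntegrallyClosed.isIntegral_iff.1 hrint
  have hzy : (z : N) = y := by rw [← hr, ← hz]; simp
  refine ⟨z, ?_, hzy⟩
  rintro rfl
  obtain ⟨x, hx, hxF⟩ := hF
  rw [Int.cast_zero, hy, eq_comm, mul_eq_zero] at hzy
  rcases hzy with h0 | h0
  · exact pow_ne_zero _ (Int.cast_ne_zero.2 ha) h0
  · obtain ⟨x', hx', hx'F⟩ := Finset.prod_eq_zero_iff.1 h0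
    obtain ⟨g, rfl⟩ := hO1 x hx
    obtain ⟨g', rfl⟩ := hO1 x' hx'
    have e1 := hg g p
    have e2 := hg g' p
    simp only at hxF hx'F
    rw [← e1] at hxF
    rw [← e2, map_eq_zero] at hx'F
    exact hxF (by rw [hx'F, map_zero])

theorem exists_cycle_of_galois {N : Type} [Field N] [CharZero N] [Algebra ℚ N]
    [FiniteDimensional ℚ N] [IsGalois ℚ N]
    (ι : N →+* ℂ) {Ψ : ℤ[X][X]} (hΨ : Irreducible Ψ) (hd : 0 < Ψ.natDegree) (q : N × N)
    (hp : (bc ℂ Ψ).eval (lineF (ι q.1, ι q.2)) = 0) :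
    ∃ (O : Finset (ℂ × ℂ)) (a : ℤ), a ≠ 0 ∧ O.Nonempty ∧
      bc ℂ Ψ = C (C (a : ℂ)) * ∏ x ∈ O, (X - C (lineF x)) ∧
      |(a : ℝ)| * ∏ x ∈ O, max 1 ‖x.1‖ ≤ len2 Ψ ∧ |(a : ℝ)| * ∏ x ∈ O, max 1 ‖x.2‖ ≤ len2 Ψ ∧
      ∀ (F : ℤ[X][X]) (T : ℕ), degU F ≤ T → F.natDegree ≤ T → (∃ x ∈ O, ev x.1 x.2 F ≠ 0) →
        1 ≤ |(a : ℝ)| ^ (2 * T) * ∏ x ∈ O, ‖ev x.1 x.2 F‖ := by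
  classical
  have hιinj : Function.Injective ι := ι.injective
  have hline : ∀ x : N × N, (lineF x).map ι = lineF (ι x.1, ι x.2) := by
    intro x; simp [lineF]
  have hq0 : (bc N Ψ).eval (lineF q) = 0 := by
    apply Polynomial.map_injective ι hιinj
    rw [Polynomial.map_zero, ← coe_mapRingHom, ← eval₂_hom, ← eval_map, bc_map, coe_mapRingHom,
      hline]
    exact hp
  obtain ⟨O, a, hqO, ha, hfac, hO1, hO2⟩ := galois_factorization hΨ hd q hq0
  have hinj : Function.Injective (fun x : N × N => (ι x.1, ι x.2)) := by
    intro x y h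
    simp only [Prod.mk.injEq] at h
    exact Prod.ext (hιinj h.1) (hιinj h.2)
  have hprod : ∀ {M : Type} [CommMonoid M] (f : ℂ × ℂ → M),
      ∏ x ∈ O.image (fun x : N × N => (ι x.1, ι x.2)), f x = ∏ x ∈ O, f (ι x.1, ι x.2) :=
    fun f => Finset.prod_image fun x _ y _ h => hinj h
  have hfacC : bc ℂ Ψ = C (C (a : ℂ)) * ∏ x ∈ O.image (fun x : N × N => (ι x.1, ι x.2)),
      (X - C (lineF x)) := by
    rw [hprod, ← bc_map ι, hfac, Polynomial.map_mul, Polynomial.map_prod]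
    congr 1
    · simp
    · refine Finset.prod_congr rfl fun x _ => ?_
      rw [Polynomial.map_sub, map_X, map_C, coe_mapRingHom, hline]
  have hev : ∀ (x : N × N) (F : ℤ[X][X]), ev (ι x.1) (ι x.2) F = ι (evF x.1 x.2 F) := by
    intro x F
    have : ι.comp (evF x.1 x.2) = ev (ι x.1) (ι x.2) := by
      ext <;> simp [evF, ev]
    exact (RingHom.congr_fun this F).symm
  refine ⟨O.image (fun x : N × N => (ι x.1, ι x.2)), a, ha, Finset.Nonempty.image ⟨q, hqO⟩ _, hfacC,
    ?_, ?_, ?_⟩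
  · refine (mahler_bound (map_eval_zero_eq hfacC)).trans ?_
    refine polyLen_map_le isLen_len1 isLen_norm _ (fun f => ?_) Ψ
    rw [coe_evalRingHom, ← coeff_zero_eq_eval_zero]
    exact len_coeff_le isLen_norm f 0
  · refine (mahler_bound (map_tau_coeff_eq hfacC)).trans ?_
    exact (len_coeff_le isLen_len1 _ _).trans (len2_tau_le Ψ)
  · intro F T h1 h2 ⟨x, hx, hxF⟩
    obtain ⟨y, hy, rfl⟩ := Finset.mem_image.1 hx
    obtain ⟨z, hz0, hz⟩ := exists_int_norm ha q hfac hO1 hO2 F h1 h2 ⟨y, hy, fun h0 => hxF (by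
      rw [hev, h0, map_zero])⟩
    have h3 := congrArg (fun y => ‖ι y‖) hz
    simp only [map_intCast, map_mul, map_pow, map_prod, ← hev, norm_mul, norm_pow, norm_prod,
      Complex.norm_intCast] at h3
    rw [hprod, ← h3]
    exact_mod_cast Int.one_le_abs hz0


/-- The zero cycle over `ℚ` attached to an irreducible polynomial vanishing on a line. -/
theorem exists_cycle_of_line {Ψ : ℤ[X][X]} (hΨ : Irreducible Ψ) (hd : 0 < Ψ.natDegree) (p : ℂ × ℂ)
    (hp1 : IsAlgebraic ℚ p.1) (hp2 : IsAlgebraic ℚ p.2) (hp : (bc ℂ Ψ).eval (lineF p) = 0) :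
    ∃ (O : Finset (ℂ × ℂ)) (a : ℤ), a ≠ 0 ∧ O.Nonempty ∧
      bc ℂ Ψ = C (C (a : ℂ)) * ∏ x ∈ O, (X - C (lineF x)) ∧
      |(a : ℝ)| * ∏ x ∈ O, max 1 ‖x.1‖ ≤ len2 Ψ ∧ |(a : ℝ)| * ∏ x ∈ O, max 1 ‖x.2‖ ≤ len2 Ψ ∧
      ∀ (F : ℤ[X][X]) (T : ℕ), degU F ≤ T → F.natDegree ≤ T → (∃ x ∈ O, ev x.1 x.2 F ≠ 0) →
        1 ≤ |(a : ℝ)| ^ (2 * T) * ∏ x ∈ O, ‖ev x.1 x.2 F‖ := by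
  classical
  set L := IntermediateField.adjoin ℚ
    (((minpoly ℚ p.1 * minpoly ℚ p.2).rootSet ℂ)) with hL
  have hspl : ((minpoly ℚ p.1 * minpoly ℚ p.2).map (algebraMap ℚ ℂ)).Splits :=
    IsAlgClosed.splits _
  have hsf : IsSplittingField ℚ L (minpoly ℚ p.1 * minpoly ℚ p.2) :=
    IntermediateField.adjoin_rootSet_isSplittingField hspl
  have : FiniteDimensional ℚ L := IsSplittingField.finiteDimensional L
    (minpoly ℚ p.1 * minpoly ℚ p.2)
  have : Normal ℚ L := Normal.of_isSplittingField (minpoly ℚ p.1 * minpoly ℚ p.2)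
  have : IsGalois ℚ L := {}
  have hne : (minpoly ℚ p.1 * minpoly ℚ p.2) ≠ 0 :=
    mul_ne_zero (minpoly.ne_zero hp1.isIntegral) (minpoly.ne_zero hp2.isIntegral)
  have hm1 : p.1 ∈ L := by
    refine IntermediateField.subset_adjoin _ _ ?_
    rw [mem_rootSet]; exact ⟨hne, by simp⟩
  have hm2 : p.2 ∈ L := by
    refine IntermediateField.subset_adjoin _ _ ?_
    rw [mem_rootSet]; exact ⟨hne, by simp⟩
  exact exists_cycle_of_galois (algebraMap L ℂ) hΨ hd (⟨p.1, hm1⟩, ⟨p.2, hm2⟩) hp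

end NestPi

namespace NestPi

open Polynomial Finset

lemma eq_double_sum {R : Type*} [CommRing R] (F : R[X][X]) :
    F = ∑ j ∈ range (F.natDegree + 1), ∑ i ∈ range (degU F + 1),
      C (C ((F.coeff j).coeff i)) * (C X) ^ i * X ^ j := by
  conv_lhs => rw [F.as_sum_range_C_mul_X_pow]
  refine Finset.sum_congr rfl fun j _ => ?_
  conv_lhs => rw [(F.coeff j).as_sum_range_C_mul_X_pow'
    (Nat.lt_succ_of_le (natDegree_coeff_le_degU F j))]
  simp [Finset.sum_mul]

lemma natDegree_hom_le {S : Type*} [CommRing S] (φ : ℤ[X][X] →+* S[X]) (F : ℤ[X][X]) {a b : ℕ}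
    (h1 : (φ (C X)).natDegree ≤ a) (h2 : (φ X).natDegree ≤ b) :
    (φ F).natDegree ≤ degU F * a + F.natDegree * b := by
  conv_lhs => rw [eq_double_sum F]
  simp only [map_sum, map_mul, map_pow]
  refine natDegree_sum_le_of_forall_le _ _ fun j hj => ?_
  refine natDegree_sum_le_of_forall_le _ _ fun i hi => ?_
  have h3 : φ (C (C ((F.coeff j).coeff i))) = C (((F.coeff j).coeff i : ℤ) : S) := by
    rw [← RingHom.comp_apply, ← RingHom.comp_apply]; simp
  rw [h3, mul_assoc]
  refine (natDegree_C_mul_le _ _).trans (natDegree_mul_le.trans (add_le_add ?_ ?_))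
  · exact (natDegree_pow_le_of_le i h1).trans (Nat.mul_le_mul_right _ (by simp at hi; omega))
  · exact (natDegree_pow_le_of_le j h2).trans (Nat.mul_le_mul_right _ (by simp at hj; omega))

/-- The form `ℓ - u Y`. -/
noncomputable def wform : ℤ[X][X][X] := C X - C (C X) * X

/-- The substitution `F(X, Y) ↦ F(ℓ - u Y, Y)`. -/
noncomputable def sg : ℤ[X][X] →+* ℤ[X][X][X] :=
  eval₂RingHom (eval₂RingHom (Int.castRingHom ℤ[X][X][X]) wform) X

@[simp] lemma sg_CX : sg (C X) = wform := by simp [sg]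
@[simp] lemma sg_X : sg X = X := by simp [sg]
lemma sg_CC (a : ℤ) : sg (C (C a)) = C (C (C a)) := by simp [sg]

lemma eval_sg (F : ℤ[X][X]) (u l y : ℂ) :
    ((sg F).map (ev u l)).eval y = ev (l - u * y) y F := by
  have : ((evalRingHom y).comp (mapRingHom (ev u l))).comp sg = ev (l - u * y) y := by
    ext <;> simp [sg, ev, wform]
  exact RingHom.congr_fun this F

lemma swap_sub_C {R : Type*} [CommRing R] (u : R) :
    Bivariate.swap (C X - C (C u) * X) = X - C (C u * X) := by
  rw [map_sub, map_mul, Bivariate.swap_X, Bivariate.swap_Y, Bivariate.swap_C_C, C_mul]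

lemma swap_CC_sub {R : Type*} [CommRing R] (u : R) :
    Bivariate.swap (C (C u) - C X * X) = C (C u) - X * C X := by
  rw [map_sub, map_mul, Bivariate.swap_X, Bivariate.swap_Y, Bivariate.swap_C_C]

lemma natDegree_sg_coeff_le (F : ℤ[X][X]) (k : ℕ) : ((sg F).coeff k).natDegree ≤ degU F := by
  have h := natDegree_hom_le
    ((Bivariate.swap (R := ℤ[X]) : ℤ[X][X][X] →+* ℤ[X][X][X]).comp sg)
    F (a := 1) (b := 0) ?_ ?_
  · refine (natDegree_coeff_le_degU _ k).trans (le_trans (le_of_eq ?_) (h.trans (by simp)))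
    rfl
  · have : ((Bivariate.swap (R := ℤ[X]) : ℤ[X][X][X] →+* ℤ[X][X][X]).comp sg) (C X) =
        X - C (C X * X) := by
      simp only [wform, RingHom.comp_apply, sg_CX]
      exact swap_sub_C _
    rw [this]
    refine (natDegree_sub_le _ _).trans (max_le natDegree_X_le ?_)
    rw [natDegree_C]; exact Nat.zero_le _
  · simp [Bivariate.swap_apply]

lemma degU_CC_sub {R : Type*} [CommRing R] (u : R) : degU (C (C u) - C X * X) ≤ 1 := by
  rw [degU, swap_CC_sub]
  refine (natDegree_sub_le _ _).trans (max_le (by simp) ?_)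
  exact (natDegree_mul_C_le _ _).trans natDegree_X_le

/-- Exchange of the two innermost variables. -/
noncomputable def swapIn : ℤ[X][X][X] →+* ℤ[X][X][X] :=
  mapRingHom (Bivariate.swap (R := ℤ) : ℤ[X][X] →+* ℤ[X][X])

lemma swapIn_wform : swapIn wform = C (C X) - C X * X := by
  simp [swapIn, wform, Bivariate.swap_X, Bivariate.swap_Y]

/-- Exchange of the two outermost variables. -/
noncomputable def swapOut : ℤ[X][X][X] →+* ℤ[X][X][X] :=
  (Bivariate.swap (R := ℤ[X]) : ℤ[X][X][X] →+* ℤ[X][X][X])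

lemma swapOut_natDegree (F : ℤ[X][X][X]) : (swapOut F).natDegree = degU F := rfl

lemma swapIn_coeff (F : ℤ[X][X][X]) (k : ℕ) : (swapIn F).coeff k = Bivariate.swap (F.coeff k) := by
  rw [swapIn, coe_mapRingHom, coeff_map]; rfl

lemma degU_sg_coeff_le (F : ℤ[X][X]) (k : ℕ) : degU ((sg F).coeff k) ≤ degU F := by
  have h := natDegree_hom_le (swapOut.comp (swapIn.comp sg)) F (a := 1) (b := 0) ?_ ?_
  · have h2 := natDegree_coeff_le_degU (swapIn (sg F)) k
    rw [swapIn_coeff, ← swapOut_natDegree] at h2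
    exact h2.trans (h.trans_eq (by ring))
  · rw [RingHom.comp_apply, RingHom.comp_apply, sg_CX, swapIn_wform, swapOut_natDegree]
    exact degU_CC_sub _
  · rw [RingHom.comp_apply, RingHom.comp_apply, sg_X, swapIn, coe_mapRingHom, map_X]
    simp [swapOut, Bivariate.swap_Y]

lemma polyLen_sg_le (F : ℤ[X][X]) : polyLen len2 (sg F) ≤ 2 ^ degU F * len2 F := by
  have h3 : IsLen (polyLen len2) := isLen_polyLen isLen_len2
  have hw : polyLen len2 wform ≤ 2 := by
    refine (h3.sub _ _).trans ?_
    have h1 : polyLen len2 (C X) ≤ 1 := by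
      rw [polyLen_C isLen_len2]; exact polyLen_X_le isLen_len1
    have h2 : polyLen len2 (C (C X) * X) ≤ 1 := by
      rw [C_mul_X_eq_monomial, polyLen_monomial isLen_len2, len2, polyLen_C isLen_len1]
      exact polyLen_X_le isLen_norm
    linarith
  have := len_eval₂_le isLen_len1 h3 (eval₂RingHom (Int.castRingHom ℤ[X][X][X]) wform)
    (K := 2 ^ degU F) F
    (fun i => ?_) X le_rfl (polyLen_X_le isLen_len2) le_rfl
  · simpa [sg] using this
  · have := len_eval₂_le isLen_norm h3 (Int.castRingHom ℤ[X][X][X]) (K := 1) (F.coeff i)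
      (fun k => ?_) wform one_le_two hw (natDegree_coeff_le_degU F i)
    · rw [coe_eval₂RingHom]
      linarith
    · have : (Int.castRingHom ℤ[X][X][X]) ((F.coeff i).coeff k) = C (C (C ((F.coeff i).coeff k)))
        := by
        simp
      rw [this, polyLen_C isLen_len2, len2, polyLen_C isLen_len1, len1, polyLen_C isLen_norm,
        one_mul]

lemma exists_sg_leading {F : ℤ[X][X]} (hF : F ≠ 0) : ∃ (d : ℕ) (g : ℤ[X]), g ≠ 0 ∧
    (sg F).natDegree = d ∧ (sg F).coeff d = C g ∧ d ≤ degU F + F.natDegree ∧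
    degU F ≤ d ∧ F.natDegree ≤ d := by
  classical
  set m := degU F
  set n := F.natDegree
  set a : ℕ → ℕ → ℤ := fun i j => (F.coeff j).coeff i with ha
  have ha0 : ∀ i j, a i j ≠ 0 → i ≤ m ∧ j ≤ n := by
    intro i j h
    constructor
    · by_contra! hi
      exact h (coeff_eq_zero_of_natDegree_lt ((natDegree_coeff_le_degU F j).trans_lt hi))
    · by_contra! hj
      exact h (by simp [ha, coeff_eq_zero_of_natDegree_lt hj])
  set P := (range (m + 1) ×ˢ range (n + 1)).filter fun x => a x.1 x.2 ≠ 0 with hP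
  have hPmem : ∀ i j, (i, j) ∈ P ↔ a i j ≠ 0 := by
    intro i j
    simp only [hP, Finset.mem_filter, Finset.mem_product, Finset.mem_range]
    exact ⟨fun h => h.2, fun h => ⟨by have := ha0 i j h; omega, h⟩⟩
  have hPne : P.Nonempty := by
    refine ⟨((F.coeff n).natDegree, n), (hPmem _ _).2 ?_⟩
    simp only [ha]
    exact leadingCoeff_ne_zero.2 (leadingCoeff_ne_zero.2 hF)
  obtain ⟨⟨i0, j0⟩, hij0, hmax⟩ := P.exists_max_image (fun x => x.1 + x.2) hPne
  set d := i0 + j0 with hd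
  have hle : ∀ i j, a i j ≠ 0 → i + j ≤ d := fun i j h => hmax (i, j) ((hPmem i j).2 h)
  have hF' : sg F = ∑ j ∈ range (n + 1), ∑ i ∈ range (m + 1), C (C (C (a i j))) * wform ^ i * X ^ j
    := by
    conv_lhs => rw [eq_double_sum F]
    simp only [map_sum, map_mul, map_pow, sg_CX, sg_X, sg_CC]
    rfl
  have hw : wform.natDegree ≤ 1 := by
    refine (natDegree_sub_le _ _).trans (max_le (by simp) ?_)
    exact natDegree_mul_le.trans (by simp)
  have hw1 : wform.coeff 1 = -(C X : ℤ[X][X]) := by simp [wform]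
  have hdeg : ∀ i j, (C (C (C (a i j))) * wform ^ i * X ^ j).natDegree ≤ i + j := by
    intro i j
    refine natDegree_mul_le.trans (add_le_add ?_ (natDegree_X_pow_le j))
    refine (natDegree_C_mul_le _ _).trans ?_
    simpa using natDegree_pow_le_of_le i hw
  have hnd : (sg F).natDegree ≤ d := by
    rw [hF']
    refine natDegree_sum_le_of_forall_le _ _ fun j hj => ?_
    refine natDegree_sum_le_of_forall_le _ _ fun i hi => ?_
    by_cases h : a i j = 0
    · simp [h]
    · exact (hdeg i j).trans (hle i j h)
  have hco : ∀ i j, (C (C (C (a i j))) * wform ^ i * X ^ j).coeff d =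
      if i + j = d then C (C (a i j) * (-X) ^ i) else 0 := by
    intro i j
    by_cases h : a i j = 0
    · simp [h]
    · split_ifs with h1
      · rw [← h1, coeff_mul_X_pow, coeff_C_mul]
        have := coeff_pow_of_natDegree_le (m := i) hw
        rw [mul_one] at this
        rw [this, hw1]; simp
      · refine coeff_eq_zero_of_natDegree_lt ((hdeg i j).trans_lt ?_)
        have := hle i j h
        omega
  set g : ℤ[X] := ∑ j ∈ range (n + 1), ∑ i ∈ range (m + 1),
    if i + j = d then C (a i j) * (-X) ^ i else 0 with hg
  have hcg : (sg F).coeff d = C g := by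
    rw [hF', finsetSum_coeff, hg, map_sum]
    refine Finset.sum_congr rfl fun j _ => ?_
    rw [finsetSum_coeff, map_sum]
    refine Finset.sum_congr rfl fun i _ => ?_
    rw [hco]; split_ifs <;> simp
  have hg0 : g ≠ 0 := by
    intro h0
    have h1 : g.coeff i0 = a i0 j0 * (-1) ^ i0 := by
      rw [hg, finsetSum_coeff, Finset.sum_eq_single j0]
      · rw [finsetSum_coeff, Finset.sum_eq_single i0]
        · rw [if_pos rfl, neg_pow, ← mul_assoc, coeff_mul_X_pow', if_pos le_rfl, Nat.sub_self,
            coeff_C_mul, coeff_zero_eq_eval_zero]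
          simp
        · intro i _ hi
          rw [if_neg (by omega), coeff_zero]
        · intro h
          exact absurd (Finset.mem_range.2 (Nat.lt_succ_of_le (ha0 _ _ ((hPmem _ _).1 hij0)).1)) h
      · intro j _ hj
        rw [finsetSum_coeff]
        refine Finset.sum_eq_zero fun i _ => ?_
        split_ifs with h
        · rw [neg_pow, ← mul_assoc, coeff_mul_X_pow']
          split_ifs with h2
          · have : i0 - i ≠ 0 := by omega
            have h3 : (C (a i j) * (-1 : ℤ[X]) ^ i) = C (a i j * (-1) ^ i) := by simp
            rw [h3, coeff_C_of_ne_zero this]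
          · rfl
        · simp
      · intro h
        exact absurd (Finset.mem_range.2 (Nat.lt_succ_of_le (ha0 _ _ ((hPmem _ _).1 hij0)).2)) h
    rw [h0, coeff_zero] at h1
    exact (mul_ne_zero ((hPmem _ _).1 hij0) (pow_ne_zero _ (by norm_num))) h1.symm
  refine ⟨d, g, hg0, le_antisymm hnd (le_natDegree_of_ne_zero ?_), hcg, ?_, ?_, ?_⟩
  · rw [hcg]; simpa using hg0
  · have := ha0 _ _ ((hPmem _ _).1 hij0); omega
  · have h1 : (Bivariate.swap F).coeff m ≠ 0 := by
      refine leadingCoeff_ne_zero.2 ?_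
      simpa using hF
    have h2 := leadingCoeff_ne_zero.2 h1
    rw [leadingCoeff, coeff_coeff_swap] at h2
    exact (Nat.le_add_right _ _).trans (hle _ _ h2)
  · refine le_trans (Nat.le_add_left _ _) (hle (F.coeff n).natDegree n ?_)
    simp only [ha]
    exact leadingCoeff_ne_zero.2 (leadingCoeff_ne_zero.2 hF)

end NestPi

namespace NestPi

open Polynomial Finset

/-- The common zeros of two polynomials. -/
def comZ (F G : ℤ[X][X]) : Set (ℂ × ℂ) := {p | ev p.1 p.2 F = 0 ∧ ev p.1 p.2 G = 0}

lemma ev_C (a b : ℂ) (r : ℤ[X]) : ev a b (C r) = aeval a r := by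
  rw [ev_apply, eval₂_C, aeval_def]; rfl

lemma ev_swap (a b : ℂ) (F : ℤ[X][X]) : ev a b (Bivariate.swap F) = ev b a F := by
  have : (ev a b).comp (Bivariate.swap (R := ℤ) : ℤ[X][X] →+* ℤ[X][X]) = ev b a := by
    ext <;> simp [ev, Bivariate.swap_X, Bivariate.swap_Y]
  exact RingHom.congr_fun this F

lemma exists_annihilator {F G : ℤ[X][X]} (hF : Irreducible F) (h : ¬ F ∣ G) :
    ∃ r : ℤ[X], r ≠ 0 ∧ ∀ p ∈ comZ F G, aeval p.1 r = 0 := by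
  rcases Nat.eq_zero_or_pos F.natDegree with hd | hd
  · obtain ⟨r, hr⟩ := natDegree_eq_zero.1 hd
    refine ⟨r, fun h0 => hF.ne_zero (by rw [← hr, h0, C_0]), fun p hp => ?_⟩
    rw [← ev_C _ p.2, hr]; exact hp.1
  · have h1 := resultant_ne_zero_of_irreducible hF hd h
    obtain ⟨u, v, -, -, huv⟩ := exists_mul_add_mul_eq_C_resultant F G le_rfl le_rfl
      (Or.inl hd.ne')
    refine ⟨_, h1, fun p hp => ?_⟩
    rw [← ev_C _ p.2, ← huv, map_add, map_mul, map_mul, hp.1, hp.2]; simp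

lemma exists_annihilator_snd {F G : ℤ[X][X]} (hF : Irreducible F) (h : ¬ F ∣ G) :
    ∃ r : ℤ[X], r ≠ 0 ∧ ∀ p ∈ comZ F G, aeval p.2 r = 0 := by
  obtain ⟨r, h1, h2⟩ := exists_annihilator (F := Bivariate.swap F) (G := Bivariate.swap G)
    ((MulEquiv.irreducible_iff (Bivariate.swap (R := ℤ))).2 hF)
    (fun h0 => h ((map_dvd_iff (Bivariate.swap (R := ℤ))).1 h0))
  exact ⟨r, h1, fun p hp => h2 (p.2, p.1)
    ⟨by rw [ev_swap]; exact hp.1, by rw [ev_swap]; exact hp.2⟩⟩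

lemma isAlgebraic_of_aeval_int {z : ℂ} {r : ℤ[X]} (hr : r ≠ 0) (h : aeval z r = 0) :
    IsAlgebraic ℚ z :=
  (show IsAlgebraic ℤ z from ⟨r, hr, h⟩).extendScalars (Int.cast_injective)

lemma comZ_isAlgebraic {F G : ℤ[X][X]} (hF : Irreducible F) (h : ¬ F ∣ G) :
    ∀ p ∈ comZ F G, IsAlgebraic ℚ p.1 ∧ IsAlgebraic ℚ p.2 := by
  obtain ⟨r, h1, h2⟩ := exists_annihilator hF h
  obtain ⟨s, h3, h4⟩ := exists_annihilator_snd hF h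
  exact fun p hp => ⟨isAlgebraic_of_aeval_int h1 (h2 p hp), isAlgebraic_of_aeval_int h3 (h4 p hp)⟩

lemma comZ_finite {F G : ℤ[X][X]} (hF : Irreducible F) (h : ¬ F ∣ G) : (comZ F G).Finite := by
  obtain ⟨r, h1, h2⟩ := exists_annihilator hF h
  obtain ⟨s, h3, h4⟩ := exists_annihilator_snd hF h
  refine (((r.rootSet_finite ℂ).prod (s.rootSet_finite ℂ))).subset fun p hp => ?_
  exact ⟨(mem_rootSet'.2 ⟨(Polynomial.map_ne_zero_iff Int.cast_injective).2 h1, h2 p hp⟩),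
    (mem_rootSet'.2 ⟨(Polynomial.map_ne_zero_iff Int.cast_injective).2 h3, h4 p hp⟩)⟩

lemma exists_common_root {f g : ℂ[X]} (hf : f ≠ 0) {n : ℕ} (hg : g.natDegree ≤ n)
    (h : resultant f g f.natDegree n = 0) : ∃ y, f.eval y = 0 ∧ g.eval y = 0 := by
  rw [resultant_eq_prod_eval _ _ _ hg (IsAlgClosed.splits f)] at h
  have h1 := (mul_eq_zero.1 h).resolve_left (pow_ne_zero _ (leadingCoeff_ne_zero.2 hf))
  obtain ⟨y, hy, hy0⟩ := Multiset.mem_map.1 (Multiset.prod_eq_zero_iff.1 h1)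
  exact ⟨y, (mem_roots'.1 hy).2, hy0⟩

/-- The Chow form of the intersection of two curves. -/
noncomputable def chow (F G : ℤ[X][X]) : ℤ[X][X] := resultant (sg F) (sg G)

lemma exists_mem_comZ {F G : ℤ[X][X]} {g : ℤ[X]} (hg : (sg F).coeff (sg F).natDegree = C g)
    {u l : ℂ} (hu : aeval u g ≠ 0) (h : ev u l (chow F G) = 0) :
    ∃ p ∈ comZ F G, l = p.1 + u * p.2 := by
  rw [chow, ← resultant_map_map] at h
  have hc : ((sg F).map (ev u l)).coeff (sg F).natDegree ≠ 0 := by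
    rwa [coeff_map, hg, ev_C]
  have hd : ((sg F).map (ev u l)).natDegree = (sg F).natDegree :=
    le_antisymm natDegree_map_le (le_natDegree_of_ne_zero hc)
  rw [← hd] at h
  obtain ⟨y, h1, h2⟩ := exists_common_root
    (fun h0 => hc (by rw [h0, coeff_zero])) natDegree_map_le h
  rw [eval_sg] at h1 h2
  exact ⟨(l - u * y, y), ⟨h1, h2⟩, by ring⟩

lemma eval_bc (u l : ℂ) (F : ℤ[X][X]) :
    ((bc ℂ F).map (evalRingHom u)).eval l = ev u l F := by
  have : ((evalRingHom l).comp (mapRingHom (evalRingHom u))).comp (bc ℂ) = ev u l := by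
    ext <;> simp [ev, bc]
  exact RingHom.congr_fun this F

lemma eval_eval_lineF (u : ℂ) (p : ℂ × ℂ) (F : ℤ[X][X]) :
    ((bc ℂ F).eval (lineF p)).eval u = ev u (p.1 + u * p.2) F := by
  rw [← eval_bc, ← coe_evalRingHom u, ← eval₂_hom, ← eval_map]
  rw [mul_comm u]; simp [lineF]

lemma eq_zero_of_eval_nat {f : ℂ[X]} (h : ∀ n : ℕ, f.eval (n : ℂ) = 0) : f = 0 :=
  eq_zero_of_infinite_isRoot f
    ((Set.infinite_range_of_injective (f := fun n : ℕ => (n : ℂ)) Nat.cast_injective).mono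
      (by rintro _ ⟨n, rfl⟩; exact h n))

theorem chow_ne_zero {F G : ℤ[X][X]} (hF : Irreducible F) (h : ¬ F ∣ G) : chow F G ≠ 0 := by
  intro h0
  obtain ⟨d, g, hg0, hd, hg, -⟩ := exists_sg_leading hF.ne_zero
  rw [← hd] at hg
  have hg' : g.map (Int.castRingHom ℂ) ≠ 0 := by
    rwa [Ne, Polynomial.map_eq_zero_iff Int.cast_injective]
  obtain ⟨u, hu⟩ : ∃ u : ℕ, aeval (u : ℂ) g ≠ 0 := by
    by_contra! h1
    refine hg' (eq_zero_of_eval_nat fun n => ?_)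
    rw [eval_map]; exact h1 n
  refine Set.infinite_univ (α := ℂ)
    (((comZ_finite hF h).image fun p : ℂ × ℂ => p.1 + u * p.2).subset fun l _ => ?_)
  obtain ⟨p, hp, hl⟩ := exists_mem_comZ (G := G) (l := l) hg hu (by rw [h0, map_zero])
  exact ⟨p, hp, hl.symm⟩

theorem exists_line_of_dvd_chow {F G Ψ : ℤ[X][X]} (hF : Irreducible F) (h : ¬ F ∣ G)
    (hΨ : Ψ ∣ chow F G) (hd : 0 < Ψ.natDegree) : ∃ p ∈ comZ F G, (bc ℂ Ψ).eval (lineF p) = 0 := by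
  obtain ⟨d, g, hg0, hd', hg, -⟩ := exists_sg_leading hF.ne_zero
  rw [← hd'] at hg
  set Z := (comZ_finite hF h).toFinset with hZ
  have key : g.map (Int.castRingHom ℂ) * Ψ.leadingCoeff.map (Int.castRingHom ℂ) *
      ∏ p ∈ Z, (bc ℂ Ψ).eval (lineF p) = 0 := by
    refine eq_zero_of_eval_nat fun n => ?_
    rw [eval_mul, eval_mul]
    by_cases h1 : eval (n : ℂ) (g.map (Int.castRingHom ℂ)) = 0
    · rw [h1]; ring
    by_cases h2 : eval (n : ℂ) (Ψ.leadingCoeff.map (Int.castRingHom ℂ)) = 0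
    · rw [h2]; ring
    have hdeg : ((bc ℂ Ψ).map (evalRingHom (n : ℂ))).degree ≠ 0 := by
      have : ((bc ℂ Ψ).map (evalRingHom (n : ℂ))).coeff Ψ.natDegree ≠ 0 := by
        rw [coeff_map, bc, coe_mapRingHom, coeff_map]; exact h2
      intro h3
      have h4 := le_degree_of_ne_zero this
      rw [h3] at h4
      have : Ψ.natDegree ≤ 0 := by exact_mod_cast h4
      omega
    obtain ⟨l, hl⟩ := IsAlgClosed.exists_root _ hdeg
    rw [IsRoot, eval_bc] at hl
    obtain ⟨p, hp, rfl⟩ := exists_mem_comZ (F := F) (G := G) (u := n) (l := l) hg (by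
      rw [eval_map] at h1; exact h1) (by
      obtain ⟨q, hq⟩ := hΨ
      rw [hq, map_mul, hl, zero_mul])
    rw [eval_prod, Finset.prod_eq_zero (i := p) (by simpa [hZ] using hp), mul_zero]
    rw [eval_eval_lineF, hl]
  rcases mul_eq_zero.1 key with h1 | h1
  · rcases mul_eq_zero.1 h1 with h2 | h2
    · exact absurd ((Polynomial.map_eq_zero_iff Int.cast_injective).1 h2) hg0
    · exact absurd ((Polynomial.map_eq_zero_iff Int.cast_injective).1 h2)
        (leadingCoeff_ne_zero.2 (by
        rintro rfl; simp at hd))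
  · obtain ⟨p, hp, h2⟩ := Finset.prod_eq_zero_iff.1 h1
    exact ⟨p, by simpa [hZ] using hp, h2⟩

end NestPi

namespace NestPi

open Polynomial Finset

lemma natDegree_sg_le {F : ℤ[X][X]} : (sg F).natDegree ≤ degU F + F.natDegree := by
  by_cases hF : F = 0
  · simp [hF]
  · obtain ⟨d, g, -, hd, -, h, -⟩ := exists_sg_leading hF
    rwa [hd]

lemma natDegree_chow_le (F G : ℤ[X][X]) : (chow F G).natDegree ≤
    (sg G).natDegree * degU F + (sg F).natDegree * degU G :=
  natDegree_map_resultant_le (RingHom.id _) (sg F) (sg G) _ _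
    (natDegree_sg_coeff_le F) (natDegree_sg_coeff_le G)

lemma degU_chow_le (F G : ℤ[X][X]) : degU (chow F G) ≤
    (sg G).natDegree * degU F + (sg F).natDegree * degU G :=
  natDegree_map_resultant_le (Bivariate.swap (R := ℤ) : ℤ[X][X] →+* ℤ[X][X]) (sg F) (sg G) _ _
    (degU_sg_coeff_le F) (degU_sg_coeff_le G)

lemma len2_chow_le (F G : ℤ[X][X]) : len2 (chow F G) ≤
    (2 ^ degU F * len2 F) ^ (sg G).natDegree * (2 ^ degU G * len2 G) ^ (sg F).natDegree := by
  refine (len_resultant_le isLen_len2 (sg F) (sg G) le_rfl le_rfl).trans ?_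
  have h3 : IsLen (polyLen len2) := isLen_polyLen isLen_len2
  exact mul_le_mul (pow_le_pow_left₀ (h3.nonneg _) (polyLen_sg_le F) _)
    (pow_le_pow_left₀ (h3.nonneg _) (polyLen_sg_le G) _) (pow_nonneg (h3.nonneg _) _)
    (pow_nonneg ((h3.nonneg _).trans (polyLen_sg_le F)) _)

lemma polyLen_sg_map_le (F : ℤ[X][X]) {u l : ℂ} {R : ℝ} (hR : 1 ≤ R) (hu : ‖u‖ ≤ R) (hl : ‖l‖ ≤ R) :
    polyLen (fun a : ℂ => ‖a‖) ((sg F).map (ev u l)) ≤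
      2 ^ degU F * len2 F * R ^ (degU F + degU F) := by
  rw [polyLen_eq_range isLen_norm _ natDegree_map_le]
  refine le_trans (Finset.sum_le_sum fun i _ => ?_)
    (?_ : ∑ i ∈ range ((sg F).natDegree + 1), len2 ((sg F).coeff i) * R ^ (degU F + degU F) ≤ _)
  · rw [coeff_map]
    exact norm_ev_le u l _ hR hu hl (degU_sg_coeff_le F i) (natDegree_sg_coeff_le F i)
  · rw [← Finset.sum_mul, ← polyLen_eq_range isLen_len2 _ le_rfl]
    gcongr
    exact polyLen_sg_le F

lemma norm_ev_chow_le {F G : ℤ[X][X]} (hF : F ≠ 0) (hG : G ≠ 0) (hd : 0 < (sg F).natDegree)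
    (x y k : ℂ) {R ε : ℝ} (hR : 1 ≤ R) (hk : ‖k‖ ≤ R) (hl : ‖x + k * y‖ ≤ R) (hy : ‖y‖ ≤ R)
    (h1 : ‖ev x y F‖ ≤ ε) (h2 : ‖ev x y G‖ ≤ ε) :
    ‖ev k (x + k * y) (chow F G)‖ ≤ ((sg F).natDegree + (sg G).natDegree) *
      ((2 ^ degU F * len2 F * R ^ (degU F + degU F)) ^ (sg G).natDegree *
        (2 ^ degU G * len2 G * R ^ (degU G + degU G)) ^ (sg F).natDegree) *
      R ^ ((sg F).natDegree + (sg G).natDegree) * ε := by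
  have one : ∀ H : ℤ[X][X], H ≠ 0 → 1 ≤ 2 ^ degU H * len2 H * R ^ (degU H + degU H) := fun H hH =>
    one_le_mul_of_one_le_of_one_le (one_le_mul_of_one_le_of_one_le (one_le_pow₀ one_le_two)
      (one_le_len2 hH)) (one_le_pow₀ hR)
  rw [chow, ← resultant_map_map]
  refine norm_resultant_le _ _ natDegree_map_le natDegree_map_le (by omega) y hR hy (one F hF)
    (one G hG) (polyLen_sg_map_le F hR hk hl) (polyLen_sg_map_le G hR hk hl) ?_ ?_
  · rw [eval_sg, add_sub_cancel_right]; exact h1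
  · rw [eval_sg, add_sub_cancel_right]; exact h2

/-- Some slope `k ≤ K` separates the point `(x, y)` from all points of a small finite set. -/
lemma exists_slope (B : Finset (ℂ × ℂ)) {g : ℤ[X]} (hg : g ≠ 0) (x y : ℂ) {K : ℕ} (hK1 : 1 ≤ K)
    (hK : B.card + g.natDegree ≤ K) : ∃ k : ℕ, k ≤ K ∧ aeval (k : ℤ) g ≠ 0 ∧
      ∀ p ∈ B, max ‖x - p.1‖ ‖y - p.2‖ ≤ (2 * K + 1) * ‖(x - p.1) + k * (y - p.2)‖ := by
  classical
  set bad : ℂ × ℂ → Finset ℕ := fun p => (range (K + 1)).filter fun k =>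
    (2 * K + 1) * ‖(x - p.1) + k * (y - p.2)‖ < max ‖x - p.1‖ ‖y - p.2‖ with hbad
  have hbad1 : ∀ p, (bad p).card ≤ 1 := by
    intro p
    rw [Finset.card_le_one]
    by_contra! hne
    obtain ⟨k1, hk1, k2, hk2, hne⟩ := hne
    wlog hlt : k1 < k2 generalizing k1 k2
    · exact this k2 hk2 k1 hk1 hne.symm (by omega)
    simp only [hbad, Finset.mem_filter, Finset.mem_range] at hk1 hk2
    obtain ⟨hk1, h1⟩ := hk1
    obtain ⟨hk2, h2⟩ := hk2
    set u := x - p.1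
    set v := y - p.2
    have e1 : ‖v‖ ≤ ‖u + k2 * v‖ + ‖u + k1 * v‖ := by
      have h3 : ((k2 : ℂ) - k1) * v = (u + k2 * v) - (u + k1 * v) := by ring
      have h4 : (1 : ℝ) ≤ ‖(k2 : ℂ) - k1‖ := by
        rw [← Nat.cast_sub hlt.le, Complex.norm_natCast]
        exact_mod_cast (by omega : 1 ≤ k2 - k1)
      calc ‖v‖ ≤ ‖(k2 : ℂ) - k1‖ * ‖v‖ := le_mul_of_one_le_left (norm_nonneg _) h4
        _ = ‖(u + k2 * v) - (u + k1 * v)‖ := by rw [← norm_mul, h3]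
        _ ≤ _ := norm_sub_le _ _
    have e2 : ‖u‖ ≤ ‖u + k1 * v‖ + K * ‖v‖ := by
      have h3 : u = (u + k1 * v) - k1 * v := by ring
      calc ‖u‖ = ‖(u + k1 * v) - k1 * v‖ := by rw [← h3]
        _ ≤ ‖u + k1 * v‖ + ‖(k1 : ℂ) * v‖ := norm_sub_le _ _
        _ ≤ _ := by
          rw [norm_mul, Complex.norm_natCast]
          have : (k1 : ℝ) ≤ K := by exact_mod_cast (by omega : k1 ≤ K)
          gcongr
    have hK1' : (1 : ℝ) ≤ K := by exact_mod_cast hK1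
    rcases max_cases ‖u‖ ‖v‖ with ⟨h, _⟩ | ⟨h, _⟩ <;> rw [h] at h1 h2
    · have e3 : (K : ℝ) * ‖v‖ ≤ K * (‖u + k2 * v‖ + ‖u + k1 * v‖) := by gcongr
      have e4 := mul_lt_mul_of_pos_left h1 (by linarith : (0 : ℝ) < 1 + K)
      have e5 := mul_lt_mul_of_pos_left h2 (by linarith : (0 : ℝ) < K)
      have e6 := mul_le_mul_of_nonneg_left (e2.trans (add_le_add_right e3 _))
        (by linarith : (0 : ℝ) ≤ 2 * K + 1)
      nlinarith
    · nlinarith [norm_nonneg (u + k1 * v), norm_nonneg (u + k2 * v)]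
  set roots : Finset ℕ := (range (K + 1)).filter fun k => aeval (k : ℤ) g = 0 with hroots
  have hrc : roots.card ≤ g.natDegree := by
    have : (roots.image fun k : ℕ => (k : ℤ)) ⊆ g.roots.toFinset := by
      intro z hz
      obtain ⟨k, hk, rfl⟩ := Finset.mem_image.1 hz
      simp only [hroots, Finset.mem_filter] at hk
      rw [Multiset.mem_toFinset, mem_roots hg]
      simpa [IsRoot, aeval_def] using hk.2
    rw [← Finset.card_image_of_injective roots (Nat.cast_injective (R := ℤ))]
    exact (Finset.card_le_card this).trans ((Multiset.toFinset_card_le _).trans (card_roots' g))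
  obtain ⟨k, hk, hk2⟩ : ∃ k ∈ range (K + 1), k ∉ roots ∪ B.biUnion bad := by
    by_contra! h
    have h1 := Finset.card_le_card (show range (K + 1) ⊆ roots ∪ B.biUnion bad from h)
    have h2 := Finset.card_biUnion_le_card_mul B bad 1 (fun p _ => hbad1 p)
    have h3 := Finset.card_union_le roots (B.biUnion bad)
    rw [card_range] at h1
    omega
  simp only [Finset.mem_union, Finset.mem_biUnion, not_or, not_exists, not_and] at hk2
  refine ⟨k, by simp at hk; omega, fun h => hk2.1 ?_, fun p hp => ?_⟩
  · simp only [hroots, Finset.mem_filter]; exact ⟨hk, h⟩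
  · have := hk2.2 p hp
    simp only [hbad, Finset.mem_filter, not_and, not_lt] at this
    exact this hk

end NestPi

namespace NestPi

open Polynomial Finset

lemma len2_pos {F : ℤ[X][X]} (hF : F ≠ 0) : 0 < len2 F := one_pos.trans_le (one_le_len2 hF)

lemma len2_eq_exp {F : ℤ[X][X]} (hF : F ≠ 0) : len2 F = Real.exp (Real.log (len2 F)) :=
  (Real.exp_log (len2_pos hF)).symm

lemma two_pow_le_exp (n : ℕ) : (2 : ℝ) ^ n ≤ Real.exp n := by
  rw [← Real.exp_one_pow]
  have := Real.add_one_le_exp (1 : ℝ)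
  gcongr; linarith

lemma two_pow_mul_len2_le {F : ℤ[X][X]} (hF : F ≠ 0) {s : ℝ} (h : degU F + Real.log (len2 F) ≤ s) :
    2 ^ degU F * len2 F ≤ Real.exp s := by
  refine le_trans ?_ (Real.exp_le_exp.2 h)
  rw [Real.exp_add, ← len2_eq_exp hF]
  have := (len2_pos hF).le
  gcongr
  exact two_pow_le_exp _

lemma exp_pow_le {s b : ℝ} {n : ℕ} (hs : 0 ≤ s) (hn : (n : ℝ) ≤ b) :
    Real.exp s ^ n ≤ Real.exp (b * s) := by
  rw [← Real.exp_nat_mul]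
  exact Real.exp_le_exp.2 (by gcongr)

section
variable {F G : ℤ[X][X]} (hF : F ≠ 0) (hG : G ≠ 0) {t T : ℝ} (ht : 1 ≤ t) (hT : 1 ≤ T)
  (hFt : size F ≤ t) (hG1 : degU G ≤ T) (hG2 : G.natDegree ≤ T) (hG3 : Real.log (len2 G) ≤ T)

include hF hFt in
lemma sg_bounds : (degU F : ℝ) + Real.log (len2 F) ≤ t ∧ (degU F : ℝ) ≤ t ∧
    ((sg F).natDegree : ℝ) ≤ t := by
  have h1 := Real.log_nonneg (one_le_len2 hF)
  have h2 : ((sg F).natDegree : ℝ) ≤ degU F + F.natDegree := by exact_mod_cast natDegree_sg_le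
  have h3 : (0 : ℝ) ≤ F.natDegree := Nat.cast_nonneg _
  have h4 : (0 : ℝ) ≤ degU F := Nat.cast_nonneg _
  unfold size at hFt
  refine ⟨?_, ?_, ?_⟩ <;> linarith

include hG1 hG2 in
lemma natDegree_sg_le_two_mul : ((sg G).natDegree : ℝ) ≤ 2 * T := by
  have h2 : ((sg G).natDegree : ℝ) ≤ degU G + G.natDegree := by exact_mod_cast natDegree_sg_le
  linarith

include hF hG ht hT hFt hG1 hG2 hG3

lemma chow_bounds (hc : chow F G ≠ 0) : (degU (chow F G) : ℝ) ≤ 3 * (t * T) ∧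
    ((chow F G).natDegree : ℝ) ≤ 3 * (t * T) ∧ Real.log (len2 (chow F G)) ≤ 6 * (t * T) := by
  obtain ⟨h1, h2, h3⟩ := sg_bounds hF hFt
  have h4 := natDegree_sg_le_two_mul hG1 hG2
  have key : ((sg G).natDegree * degU F + (sg F).natDegree * degU G : ℝ) ≤ 3 * (t * T) := by
    have e1 : ((sg G).natDegree * degU F : ℝ) ≤ 2 * T * t := by gcongr
    have e2 : ((sg F).natDegree * degU G : ℝ) ≤ t * T := by gcongr
    linarith
  refine ⟨le_trans (by exact_mod_cast degU_chow_le F G) key,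
    le_trans (by exact_mod_cast natDegree_chow_le F G) key, ?_⟩
  rw [Real.log_le_iff_le_exp (len2_pos hc)]
  have p1 := (len2_pos hF).le
  have p2 := (len2_pos hG).le
  calc len2 (chow F G) ≤ (2 ^ degU F * len2 F) ^ (sg G).natDegree *
        (2 ^ degU G * len2 G) ^ (sg F).natDegree := len2_chow_le F G
    _ ≤ Real.exp t ^ (sg G).natDegree * Real.exp (2 * T) ^ (sg F).natDegree := by
      gcongr
      · exact two_pow_mul_len2_le hF h1
      · exact two_pow_mul_len2_le hG (by linarith)
    _ ≤ Real.exp (2 * T * t) * Real.exp (t * (2 * T)) := by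
      gcongr
      · exact exp_pow_le (by linarith) h4
      · exact exp_pow_le (by linarith) h3
    _ ≤ _ := by
      rw [← Real.exp_add]; exact Real.exp_le_exp.2 (by nlinarith)

lemma norm_ev_chow_le_exp (hd : 0 < (sg F).natDegree)
    (x y k : ℂ) {R ε : ℝ} (hR : 1 ≤ R) (hk : ‖k‖ ≤ R) (hl : ‖x + k * y‖ ≤ R) (hy : ‖y‖ ≤ R)
    (h1 : ‖ev x y F‖ ≤ ε) (h2 : ‖ev x y G‖ ≤ ε) :
    ‖ev k (x + k * y) (chow F G)‖ ≤ Real.exp (16 * (t * T) * (1 + Real.log R)) * ε := by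
  refine (norm_ev_chow_le hF hG hd x y k hR hk hl hy h1 h2).trans ?_
  obtain ⟨h5, h6, h3⟩ := sg_bounds hF hFt
  have h4 := natDegree_sg_le_two_mul hG1 hG2
  have hε : 0 ≤ ε := (norm_nonneg _).trans h1
  set L := Real.log R with hL
  have hL0 : 0 ≤ L := Real.log_nonneg hR
  have hRe : R = Real.exp L := (Real.exp_log (by linarith)).symm
  have p1 := (len2_pos hF).le
  have p2 := (len2_pos hG).le
  have htT : t + 2 * T ≤ 3 * (t * T) := by nlinarith
  have a1 : 2 ^ degU F * len2 F * R ^ (degU F + degU F) ≤ Real.exp (t + 2 * t * L) := by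
    rw [Real.exp_add]
    gcongr
    · exact two_pow_mul_len2_le hF h5
    · conv_lhs => rw [hRe]
      exact exp_pow_le hL0 (by push_cast; linarith)
  have a2 : 2 ^ degU G * len2 G * R ^ (degU G + degU G) ≤ Real.exp (2 * T + 2 * T * L) := by
    rw [Real.exp_add]
    gcongr
    · exact two_pow_mul_len2_le hG (by linarith)
    · conv_lhs => rw [hRe]
      exact exp_pow_le hL0 (by push_cast; linarith)
  have a3 : R ^ ((sg F).natDegree + (sg G).natDegree) ≤ Real.exp (3 * (t * T) * L) := by
    conv_lhs => rw [hRe]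
    exact exp_pow_le hL0 (by push_cast; linarith)
  have a4 : ((sg F).natDegree + (sg G).natDegree : ℝ) ≤ Real.exp (3 * (t * T)) := by
    have := Real.add_one_le_exp (3 * (t * T))
    linarith
  have b1 : (2 ^ degU F * len2 F * R ^ (degU F + degU F)) ^ (sg G).natDegree ≤
      Real.exp (2 * T * (t + 2 * t * L)) :=
    (pow_le_pow_left₀ (by positivity) a1 _).trans (exp_pow_le (by positivity) h4)
  have b2 : (2 ^ degU G * len2 G * R ^ (degU G + degU G)) ^ (sg F).natDegree ≤
      Real.exp (t * (2 * T + 2 * T * L)) :=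
    (pow_le_pow_left₀ (by positivity) a2 _).trans (exp_pow_le (by positivity) h3)
  gcongr
  calc _ ≤ Real.exp (3 * (t * T)) * (Real.exp (2 * T * (t + 2 * t * L)) *
        Real.exp (t * (2 * T + 2 * T * L))) * Real.exp (3 * (t * T) * L) := by gcongr
    _ ≤ _ := by
      rw [← Real.exp_add, ← Real.exp_add, ← Real.exp_add]
      refine Real.exp_le_exp.2 ?_
      have : 0 ≤ t * T := by positivity
      have : 0 ≤ t * T * L := by positivity
      nlinarith

end

/-- The cost of factoring a polynomial of size `s`. -/
noncomputable def wcost (s : ℝ) : ℝ := 180 * s * Real.log s ^ 2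

/-- A zero cycle over `ℚ` with controlled height. -/
structure IsCycle (O : Finset (ℂ × ℂ)) (a : ℤ) (s : ℝ) : Prop where
  ne_zero : a ≠ 0
  nonempty : O.Nonempty
  card_le : (O.card : ℝ) ≤ s
  fst_le : |(a : ℝ)| * ∏ x ∈ O, max 1 ‖x.1‖ ≤ Real.exp s
  snd_le : |(a : ℝ)| * ∏ x ∈ O, max 1 ‖x.2‖ ≤ Real.exp s
  one_le : ∀ (F : ℤ[X][X]) (T : ℕ), degU F ≤ T → F.natDegree ≤ T →
    (∃ x ∈ O, ev x.1 x.2 F ≠ 0) → 1 ≤ |(a : ℝ)| ^ (2 * T) * ∏ x ∈ O, ‖ev x.1 x.2 F‖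

theorem exists_small_cycle {F G : ℤ[X][X]} (hF : Irreducible F) (hFG : ¬ F ∣ G)
    (hFd : 0 < degU F + F.natDegree)
    {t T : ℝ} (ht : 1 ≤ t) (hT : 1 ≤ T) (hFt : size F ≤ t) (hG1 : degU G ≤ T)
    (hG2 : G.natDegree ≤ T) (hG3 : Real.log (len2 G) ≤ T)
    (x y : ℂ) {C₀ E : ℝ} (hC₀ : 1 ≤ C₀) (hx : ‖x‖ ≤ C₀) (hy : ‖y‖ ≤ C₀)
    (h1 : ‖ev x y F‖ ≤ Real.exp (-E)) (h2 : ‖ev x y G‖ ≤ Real.exp (-E))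
    (hE : 0 < E)
    (hE1 : 16 * (t * T) * (1 + Real.log (C₀ * (1 + 6 * (t * T)))) ≤ E / 2)
    (hE2 : Real.log (2 * (6 * (t * T)) + 1) ≤ E / 2 / (2 * wcost (6 * (t * T)))) :
    ∃ (O : Finset (ℂ × ℂ)) (a : ℤ) (s : ℝ), IsCycle O a s ∧ s ≤ wcost (6 * (t * T)) ∧
      ∏ p ∈ O, max ‖x - p.1‖ ‖y - p.2‖ ≤
        Real.exp (-(E / 2 / (2 * wcost (6 * (t * T))) * s)) := by
  classical
  have hc := chow_ne_zero hF hFG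
  have hG0 : G ≠ 0 := by rintro rfl; exact hFG (dvd_zero _)
  obtain ⟨c1, c2, c3⟩ := chow_bounds hF.ne_zero hG0 ht hT hFt hG1 hG2 hG3 hc
  set S := 6 * (t * T) with hS
  have htT : 1 ≤ t * T := one_le_mul_of_one_le_of_one_le ht hT
  set Ch := chow F G with hCh
  set K : ℕ := ⌊S⌋₊ with hK
  have hKS : (K : ℝ) ≤ S := Nat.floor_le (by linarith)
  -- the lines contained in the zero locus of the Chow form
  have hbc : bc ℂ Ch ≠ 0 := by
    rw [Ne, map_eq_zero_iff _ bc_injective]; exact hc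
  set B : Finset (ℂ × ℂ) := ((bc ℂ Ch).roots.toFinset).preimage lineF
    lineF_injective.injOn with hB
  have hBc : B.card ≤ Ch.natDegree := by
    rw [← Finset.card_image_of_injective B lineF_injective]
    refine (Finset.card_le_card (t := (bc ℂ Ch).roots.toFinset) ?_).trans
      ((Multiset.toFinset_card_le _).trans ((card_roots' _).trans natDegree_map_le))
    intro f hf
    obtain ⟨p, hp, rfl⟩ := Finset.mem_image.1 hf
    exact Finset.mem_preimage.1 hp
  have hlc : Ch.leadingCoeff ≠ 0 := leadingCoeff_ne_zero.2 hc
  obtain ⟨k, hkK, hk0, hkB⟩ := exists_slope B hlc x y (K := K)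
    (Nat.le_floor (by push_cast; linarith)) (Nat.le_floor (by
      have e1 : (B.card : ℝ) ≤ Ch.natDegree := by exact_mod_cast hBc
      have e2 : (Ch.leadingCoeff.natDegree : ℝ) ≤ degU Ch := by
        exact_mod_cast natDegree_coeff_le_degU Ch _
      push_cast; linarith))
  have hkS : (k : ℝ) ≤ S := le_trans (by exact_mod_cast hkK) hKS
  set R := C₀ * (1 + S) with hR
  have hd : 0 < (sg F).natDegree := by
    obtain ⟨d, g, -, hd, -, -, h3, h4⟩ := exists_sg_leading hF.ne_zero
    omega
  have hsmall := norm_ev_chow_le_exp hF.ne_zero hG0 ht hT hFt hG1 hG2 hG3 hd x y k (R := R)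
    (by nlinarith) (by rw [Complex.norm_natCast]; nlinarith) (by
      refine (norm_add_le _ _).trans ?_
      rw [norm_mul, Complex.norm_natCast]
      have : k * ‖y‖ ≤ S * C₀ := by gcongr
      linarith) (by nlinarith) h1 h2
  rw [← Real.exp_add, ← hCh] at hsmall
  have hsmall' : ‖ev k (x + k * y) Ch‖ ≤ Real.exp (-(E / 2)) :=
    hsmall.trans (Real.exp_le_exp.2 (by linarith))
  obtain ⟨g1, g2⟩ := gelfond_log hc (n := degU Ch) (T := S) (by linarith) le_rfl (by linarith)
    (by linarith) c3
  obtain ⟨Ψ, hΨ, hΨC, hΨs⟩ := g2 k (x + k * y) (E / 2) (by linarith) hsmall'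
  have hΨW := g1 Ψ hΨC
  have hWe : 180 * S * Real.log S ^ 2 = wcost S := rfl
  rw [hWe] at hΨW hΨs
  set W := wcost S with hW
  have hW0 : 0 < W := by
    rw [hW, wcost]
    have : 0 < Real.log S := Real.log_pos (by linarith)
    positivity
  have hsz := size_nonneg hΨ.ne_zero
  -- the factor has positive degree
  have hΨd : 0 < Ψ.natDegree := by
    rw [Nat.pos_iff_ne_zero]
    intro h0
    obtain ⟨ψ, hψ⟩ := natDegree_eq_zero.1 h0
    have hdvd : ψ ∣ Ch.leadingCoeff := (C_dvd_iff_dvd_coeff _ _).1 (hψ ▸ hΨC) _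
    have hψk : aeval (k : ℤ) ψ ≠ 0 := by
      obtain ⟨q, hq⟩ := hdvd
      intro h; exact hk0 (by rw [hq, map_mul, h, zero_mul])
    have hval : ev k (x + k * y) Ψ = ((aeval (k : ℤ) ψ : ℤ) : ℂ) := by
      rw [← hψ, ev_C]
      have := (aeval_algebraMap_apply ℂ (k : ℤ) ψ)
      simpa using this
    have hge : 1 ≤ ‖ev k (x + k * y) Ψ‖ := by
      rw [hval, Complex.norm_intCast]; exact_mod_cast Int.one_le_abs hψk
    have hsz0 : 0 < size Ψ := by
      by_contra! hle
      have hle : size Ψ = 0 := le_antisymm hle hsz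
      unfold size at hle
      have l0 := Real.log_nonneg (one_le_len2 hΨ.ne_zero)
      have d0 : (0 : ℝ) ≤ degU Ψ := Nat.cast_nonneg _
      have n0 : (0 : ℝ) ≤ Ψ.natDegree := Nat.cast_nonneg _
      have hdU : degU Ψ = 0 := by
        have : (degU Ψ : ℝ) = 0 := by linarith
        exact_mod_cast this
      have hlog : Real.log (len2 Ψ) = 0 := by linarith
      have hψ0 : ψ.natDegree = 0 := by
        have := natDegree_coeff_le_degU Ψ 0
        rw [← hψ, coeff_C_zero, hψ, hdU] at this
        omega
      obtain ⟨z, hz⟩ := natDegree_eq_zero.1 hψ0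
      have hlen : len2 Ψ = |(z : ℝ)| := by
        rw [← hψ, ← hz, len2, polyLen_C isLen_len1, len1, polyLen_C isLen_norm, Int.norm_eq_abs]
      have : len2 Ψ = 1 := by rw [len2_eq_exp hΨ.ne_zero, hlog, Real.exp_zero]
      rw [hlen] at this
      have hz1 : |z| = 1 := by exact_mod_cast this
      refine hΨ.not_isUnit ?_
      rw [← hψ, ← hz]
      exact ((Int.isUnit_iff_abs_eq.2 hz1).map C).map C
    have : Real.exp (-(E / 2 * size Ψ / W)) < 1 := by
      rw [Real.exp_lt_one_iff]
      have : 0 < E / 2 * size Ψ / W := by positivity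
      linarith
    linarith
  obtain ⟨p, hpZ, hp⟩ := exists_line_of_dvd_chow hF hFG hΨC hΨd
  obtain ⟨hp1, hp2⟩ := comZ_isAlgebraic hF hFG p hpZ
  obtain ⟨O, a, ha, hO, hfac, hb1, hb2, hb3⟩ := exists_cycle_of_line hΨ hΨd p hp1 hp2 hp
  have hcard : O.card = Ψ.natDegree := by
    have e1 : (bc ℂ Ψ).natDegree = Ψ.natDegree := by
      rw [bc, coe_mapRingHom]
      exact natDegree_map_eq_of_injective (Polynomial.map_injective _ Int.cast_injective) _
    rw [← e1, hfac, natDegree_C_mul (by simpa using ha), natDegree_prod_of_monic _ _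
      (fun i _ => monic_X_sub_C _)]
    simp
  have hlogs : len2 Ψ ≤ Real.exp (size Ψ) := by
    rw [len2_eq_exp hΨ.ne_zero]
    refine Real.exp_le_exp.2 ?_
    unfold size
    have d0 : (0 : ℝ) ≤ degU Ψ := Nat.cast_nonneg _
    have n0 : (0 : ℝ) ≤ Ψ.natDegree := Nat.cast_nonneg _
    linarith
  have hcards : (O.card : ℝ) ≤ size Ψ := by
    rw [hcard]
    have l0 := Real.log_nonneg (one_le_len2 hΨ.ne_zero)
    have d0 : (0 : ℝ) ≤ degU Ψ := Nat.cast_nonneg _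
    unfold size; linarith
  have hOB : ∀ q ∈ O, q ∈ B := by
    intro q hq
    rw [hB, Finset.mem_preimage, Multiset.mem_toFinset, mem_roots hbc]
    obtain ⟨H, hH⟩ := hΨC
    rw [IsRoot, hH, map_mul, eval_mul, hfac, eval_mul, eval_prod,
      Finset.prod_eq_zero hq (by simp)]
    simp
  have hΨev : ev k (x + k * y) Ψ = a * ∏ q ∈ O, ((x - q.1) + k * (y - q.2)) := by
    rw [← eval_bc, hfac]
    simp only [Polynomial.map_mul, Polynomial.map_prod, eval_mul, eval_prod]
    congr 1
    · simp
    · refine Finset.prod_congr rfl fun q _ => ?_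
      simp [lineF]; ring
  refine ⟨O, a, size Ψ, ⟨ha, hO, hcards, hb1.trans hlogs, hb2.trans hlogs, hb3⟩, hΨW, ?_⟩
  have ha1 : 1 ≤ |(a : ℝ)| := by exact_mod_cast Int.one_le_abs ha
  have hprod : ∏ q ∈ O, ‖(x - q.1) + k * (y - q.2)‖ ≤ Real.exp (-(E / 2 * size Ψ / W)) := by
    refine le_trans ?_ hΨs
    rw [hΨev, norm_mul, norm_prod, Complex.norm_intCast]
    exact le_mul_of_one_le_left (Finset.prod_nonneg fun _ _ => norm_nonneg _) ha1
  calc ∏ q ∈ O, max ‖x - q.1‖ ‖y - q.2‖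
      ≤ ∏ q ∈ O, ((2 * K + 1) * ‖(x - q.1) + k * (y - q.2)‖) :=
        Finset.prod_le_prod (fun q _ => le_max_of_le_left (norm_nonneg _))
          fun q hq => hkB q (hOB q hq)
    _ = (2 * K + 1) ^ O.card * ∏ q ∈ O, ‖(x - q.1) + k * (y - q.2)‖ := by
        rw [Finset.prod_mul_distrib, Finset.prod_const]
    _ ≤ Real.exp (size Ψ * (E / 2 / (2 * W))) * Real.exp (-(E / 2 * size Ψ / W)) := by
        gcongr
        have e0 : (0 : ℝ) < 2 * K + 1 := by positivity
        have e1 : (2 * K + 1 : ℝ) ≤ Real.exp (E / 2 / (2 * W)) := by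
          rw [← Real.log_le_iff_le_exp e0]
          exact (Real.log_le_log e0 (by linarith)).trans hE2
        exact (pow_le_pow_left₀ e0.le e1 _).trans (exp_pow_le (by positivity) hcards)
    _ = _ := by
        rw [← Real.exp_add]
        congr 1
        field_simp
        ring

end NestPi

namespace NestPi

open Polynomial Finset

lemma norm_pow_sub_pow_le {b b' : ℂ} {R d : ℝ} (hR : 1 ≤ R) (hb : ‖b‖ ≤ R) (hb' : ‖b'‖ ≤ R)
    (hd : ‖b - b'‖ ≤ d) (i : ℕ) : ‖b ^ i - b' ^ i‖ ≤ d * i * R ^ i := by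
  have hd0 : 0 ≤ d := (norm_nonneg _).trans hd
  induction i with
  | zero => simp
  | succ i ih =>
    have e : b ^ (i + 1) - b' ^ (i + 1) = (b ^ i - b' ^ i) * b + b' ^ i * (b - b') := by ring
    rw [e]
    calc _ ≤ ‖b ^ i - b' ^ i‖ * ‖b‖ + ‖b'‖ ^ i * ‖b - b'‖ := by
          refine (norm_add_le _ _).trans ?_
          rw [norm_mul, norm_mul, norm_pow]
      _ ≤ d * i * R ^ i * R + R ^ i * d := by gcongr
      _ ≤ d * i * R ^ i * R + R ^ i * d * R := by
          have := le_mul_of_one_le_right (show 0 ≤ R ^ i * d by positivity) hR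
          linarith
      _ = _ := by push_cast; ring

lemma norm_eval₂_sub_eval₂_le {A : Type*} [CommRing A] {N : A → ℝ} (h : IsLen N) (φ ψ : A →+* ℂ)
    {b b' : ℂ} {R d K : ℝ} (hK : 0 ≤ K) (hR : 1 ≤ R) (hb : ‖b‖ ≤ R) (hb' : ‖b'‖ ≤ R)
    (hd : ‖b - b'‖ ≤ d) (hφ : ∀ a, ‖φ a‖ ≤ K * N a) (hφψ : ∀ a, ‖φ a - ψ a‖ ≤ d * (K * N a))
    (p : A[X]) {n : ℕ} (hn : p.natDegree ≤ n) :
    ‖p.eval₂ φ b - p.eval₂ ψ b'‖ ≤ d * (K * (n + 1) * R ^ n * polyLen N p) := by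
  have hd0 : 0 ≤ d := (norm_nonneg _).trans hd
  rw [eval₂_eq_sum_range' φ (Nat.lt_succ_of_le hn), eval₂_eq_sum_range' ψ (Nat.lt_succ_of_le hn),
    ← Finset.sum_sub_distrib, polyLen_eq_range h p hn, Finset.mul_sum, Finset.mul_sum]
  refine norm_sum_le_of_le _ fun i hi => ?_
  have hin : i ≤ n := Nat.lt_succ_iff.1 (Finset.mem_range.1 hi)
  have hN : 0 ≤ N (p.coeff i) := h.nonneg _
  have e : φ (p.coeff i) * b ^ i - ψ (p.coeff i) * b' ^ i
      = φ (p.coeff i) * (b ^ i - b' ^ i) + (φ (p.coeff i) - ψ (p.coeff i)) * b' ^ i := by ring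
  rw [e]
  have hin' : (i : ℝ) ≤ n := by exact_mod_cast hin
  have hRi : R ^ i ≤ R ^ n := pow_le_pow_right₀ hR hin
  calc _ ≤ ‖φ (p.coeff i)‖ * ‖b ^ i - b' ^ i‖ + ‖φ (p.coeff i) - ψ (p.coeff i)‖ * ‖b'‖ ^ i := by
        refine (norm_add_le _ _).trans ?_
        rw [norm_mul, norm_mul, norm_pow]
    _ ≤ (K * N (p.coeff i)) * (d * i * R ^ i) + (d * (K * N (p.coeff i))) * R ^ i := by
        gcongr
        · exact hφ _
        · exact norm_pow_sub_pow_le hR hb hb' hd i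
        · exact hφψ _
    _ ≤ (K * N (p.coeff i)) * (d * n * R ^ n) + (d * (K * N (p.coeff i))) * R ^ n := by
        gcongr
    _ = _ := by ring

lemma norm_ev_sub_ev_le {x y x' y' : ℂ} {R d : ℝ} (hR : 1 ≤ R) (hx : ‖x‖ ≤ R) (hx' : ‖x'‖ ≤ R)
    (hy : ‖y‖ ≤ R) (hy' : ‖y'‖ ≤ R) (hdx : ‖x - x'‖ ≤ d) (hdy : ‖y - y'‖ ≤ d) (F : ℤ[X][X])
    {n : ℕ} (hn : degU F ≤ n) (hm : F.natDegree ≤ n) :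
    ‖ev x y F - ev x' y' F‖ ≤ d * ((n + 1) ^ 2 * R ^ (2 * n) * len2 F) := by
  have hd0 : 0 ≤ d := (norm_nonneg _).trans hdx
  have key : ‖ev x y F - ev x' y' F‖ ≤ ∑ i ∈ range (n + 1),
      d * ((n + 1) ^ 2 * R ^ (2 * n) * len1 (F.coeff i)) := by
    rw [ev_apply, ev_apply, eval₂_eq_sum_range' _ (Nat.lt_succ_of_le hm),
      eval₂_eq_sum_range' _ (Nat.lt_succ_of_le hm), ← Finset.sum_sub_distrib]
    refine norm_sum_le_of_le _ fun i hi => ?_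
    have hin : i ≤ n := Nat.lt_succ_iff.1 (Finset.mem_range.1 hi)
    have hin' : (i : ℝ) ≤ n := by exact_mod_cast hin
    have hRi : R ^ i ≤ R ^ n := pow_le_pow_right₀ hR hin
    set p := F.coeff i with hp
    have hpn : p.natDegree ≤ n := (natDegree_coeff_le_degU F i).trans hn
    have hl : 0 ≤ len1 p := isLen_len1.nonneg _
    have b1 : ‖p.eval₂ (Int.castRingHom ℂ) x‖ ≤ 1 * len1 p * R ^ n :=
      len_eval₂_le isLen_norm isLen_norm (Int.castRingHom ℂ) p
        (fun a => by rw [norm_intCastRingHom, one_mul]) x hR hx hpn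
    have b2 : ‖p.eval₂ (Int.castRingHom ℂ) x - p.eval₂ (Int.castRingHom ℂ) x'‖ ≤
        d * (1 * (n + 1) * R ^ n * len1 p) :=
      norm_eval₂_sub_eval₂_le isLen_norm _ _ zero_le_one hR hx hx' hdx
        (fun a => by rw [norm_intCastRingHom, one_mul])
        (fun a => by rw [sub_self, norm_zero]; positivity) p hpn
    simp only [coe_eval₂RingHom]
    have e : p.eval₂ (Int.castRingHom ℂ) x * y ^ i - p.eval₂ (Int.castRingHom ℂ) x' * y' ^ i
      = p.eval₂ (Int.castRingHom ℂ) x * (y ^ i - y' ^ i) + (p.eval₂ (Int.castRingHom ℂ) x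
        - p.eval₂ (Int.castRingHom ℂ) x') * y' ^ i := by ring
    rw [e]
    calc _ ≤ ‖p.eval₂ (Int.castRingHom ℂ) x‖ * ‖y ^ i - y' ^ i‖ + ‖p.eval₂ (Int.castRingHom ℂ) x
        - p.eval₂ (Int.castRingHom ℂ) x'‖ * ‖y'‖ ^ i := by
          refine (norm_add_le _ _).trans ?_
          rw [norm_mul, norm_mul, norm_pow]
      _ ≤ (1 * len1 p * R ^ n) * (d * i * R ^ i) + (d * (1 * (n + 1) * R ^ n * len1 p)) * R ^ i :=
        by
          gcongr
          exact norm_pow_sub_pow_le hR hy hy' hdy i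
      _ ≤ (1 * len1 p * R ^ n) * (d * n * R ^ n) + (d * (1 * (n + 1) * R ^ n * len1 p)) * R ^ n :=
        by
          gcongr
      _ = d * ((2 * n + 1) * R ^ (2 * n) * len1 p) := by ring
      _ ≤ _ := by
          gcongr
          nlinarith [sq_nonneg (n : ℝ)]
  refine key.trans_eq ?_
  rw [← Finset.mul_sum, ← Finset.mul_sum, len2, polyLen_eq_range isLen_len1 F hm]

lemma norm_ev_le_two (x y : ℂ) (F : ℤ[X][X]) {n : ℕ} (hn : degU F ≤ n) (hm : F.natDegree ≤ n) :
    ‖ev x y F‖ ≤ len2 F * (max 1 ‖x‖ ^ n * max 1 ‖y‖ ^ n) := by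
  rw [ev_apply, eval₂_eq_sum_range' _ (Nat.lt_succ_of_le hm), len2,
    polyLen_eq_range isLen_len1 F hm, Finset.sum_mul]
  refine norm_sum_le_of_le _ fun i hi => ?_
  have hin : i ≤ n := Nat.lt_succ_iff.1 (Finset.mem_range.1 hi)
  have hl : 0 ≤ len1 (F.coeff i) := isLen_len1.nonneg _
  have b1 : ‖(F.coeff i).eval₂ (Int.castRingHom ℂ) x‖ ≤ 1 * len1 (F.coeff i) * max 1 ‖x‖ ^ n :=
      len_eval₂_le isLen_norm isLen_norm (Int.castRingHom ℂ) _
        (fun a => by rw [norm_intCastRingHom, one_mul]) x (le_max_left _ _) (le_max_right _ _)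
        ((natDegree_coeff_le_degU F i).trans hn)
  rw [norm_mul, norm_pow]
  calc _ ≤ (1 * len1 (F.coeff i) * max 1 ‖x‖ ^ n) * max 1 ‖y‖ ^ n := by
        gcongr
        · simpa using b1
        · exact (pow_le_pow_left₀ (norm_nonneg _) (le_max_right 1 _) i).trans
            (pow_le_pow_right₀ (le_max_left _ _) hin)
    _ = _ := by ring

end NestPi

namespace NestPi

open Polynomial Finset

lemma norm_ev_le_exp_of_dist {x y : ℂ} {C₀ : ℝ} (hC₀ : 1 ≤ C₀) (hx : ‖x‖ ≤ C₀) (hy : ‖y‖ ≤ C₀)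
    {F : ℤ[X][X]} (hF0 : F ≠ 0) {n : ℕ} {τ c : ℝ} (hnτ : n ≤ τ)
    (hn : degU F ≤ n) (hm : F.natDegree ≤ n)
    (hL : Real.log (len2 F) ≤ τ) (hc : c = τ * (3 + 2 * Real.log (C₀ + 1)))
    {p : ℂ × ℂ} {σ : ℝ} (hσ : 0 ≤ σ) (hd : max ‖x - p.1‖ ‖y - p.2‖ ≤ Real.exp (-σ)) :
    ‖ev x y F - ev p.1 p.2 F‖ ≤ Real.exp (c - σ) := by
  have hd1 : Real.exp (-σ) ≤ 1 := Real.exp_le_one_iff.2 (by linarith)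
  have h1 : ‖x - p.1‖ ≤ Real.exp (-σ) := (le_max_left _ _).trans hd
  have h2 : ‖y - p.2‖ ≤ Real.exp (-σ) := (le_max_right _ _).trans hd
  have hp1 : ‖p.1‖ ≤ C₀ + 1 := by
    have := norm_sub_norm_le p.1 x
    rw [norm_sub_rev] at this
    linarith
  have hp2 : ‖p.2‖ ≤ C₀ + 1 := by
    have := norm_sub_norm_le p.2 y
    rw [norm_sub_rev] at this
    linarith
  refine (norm_ev_sub_ev_le (R := C₀ + 1) (by linarith) (by linarith) hp1 (by linarith) hp2 h1 h2 F
    hn hm).trans ?_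
  have e1 : ((n : ℝ) + 1) ^ 2 ≤ Real.exp (2 * τ) := by
    have : (n : ℝ) + 1 ≤ Real.exp τ :=
      (by linarith : (n : ℝ) + 1 ≤ τ + 1).trans (Real.add_one_le_exp τ)
    calc ((n : ℝ) + 1) ^ 2 ≤ Real.exp τ ^ 2 := by gcongr
      _ = _ := by rw [← Real.exp_nat_mul]; norm_num
  have e2 : (C₀ + 1) ^ (2 * n) ≤ Real.exp (τ * (2 * Real.log (C₀ + 1))) := by
    have hl : 0 ≤ Real.log (C₀ + 1) := Real.log_nonneg (by linarith)
    have : (C₀ + 1) ^ (2 * n) = Real.exp (Real.log (C₀ + 1)) ^ (2 * n) := by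
      rw [Real.exp_log (by linarith)]
    rw [this]
    refine (exp_pow_le hl (b := 2 * τ) (by push_cast; linarith)).trans_eq ?_
    ring_nf
  have e3 : len2 F ≤ Real.exp τ := by rw [len2_eq_exp hF0]; exact Real.exp_le_exp.2 hL
  have l0 := len2_pos hF0
  calc _ ≤ Real.exp (-σ) * (Real.exp (2 * τ) * Real.exp (τ * (2 * Real.log (C₀ + 1))) * Real.exp τ)
    := by
        gcongr
    _ = _ := by
        rw [← Real.exp_add, ← Real.exp_add, ← Real.exp_add, hc]
        ring_nf

/-- A cycle close to a point `(x, y)` is in conflict with a polynomial whose value at `(x, y)` is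
small, but not too small. -/
lemma IsCycle.sum_le {O : Finset (ℂ × ℂ)} {a : ℤ} {s : ℝ} (h : IsCycle O a s)
    {x y : ℂ} {C₀ : ℝ} (hC₀ : 1 ≤ C₀) (hx : ‖x‖ ≤ C₀) (hy : ‖y‖ ≤ C₀)
    {F : ℤ[X][X]} {n : ℕ} {τ c : ℝ} (hnτ : n ≤ τ) (hn : degU F ≤ n) (hm : F.natDegree ≤ n)
    (hL : Real.log (len2 F) ≤ τ) (hc : c = τ * (3 + 2 * Real.log (C₀ + 1)))
    (σ : ℂ × ℂ → ℝ) {s₁ M : ℝ} (hs₁ : 0 < s₁) (hσ0 : ∀ p ∈ O, 0 ≤ σ p) (hσ1 : ∀ p ∈ O, σ p ≤ s₁)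
    (hσ2 : ∃ p ∈ O, σ p = s₁)
    (hσ : ∀ p ∈ O, 0 < σ p → max ‖x - p.1‖ ‖y - p.2‖ ≤ Real.exp (-σ p))
    (hM0 : 0 ≤ M) (hM : M ≤ s₁) (hcs : c < s₁ / 2)
    (hF1 : Real.exp (-(s₁ / 2)) ≤ ‖ev x y F‖) (hF2 : ‖ev x y F‖ ≤ Real.exp (-M)) :
    M / s₁ * ∑ p ∈ O, σ p ≤ (c + 1 + 2 * τ) * s := by
  have hF0 : F ≠ 0 := by
    rintro rfl
    rw [map_zero, norm_zero] at hF1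
    exact (Real.exp_pos _).not_ge hF1
  have hτ : 0 ≤ τ := (Nat.cast_nonneg n).trans hnτ
  have hlC : 0 ≤ Real.log (C₀ + 1) := Real.log_nonneg (by linarith)
  have hcτ : τ ≤ c := by rw [hc]; nlinarith
  have hc0 : 0 ≤ c := hτ.trans hcτ
  have hs : 0 ≤ s := (Nat.cast_nonneg _).trans h.card_le
  have hclose : ∀ p ∈ O, 0 < σ p → ‖ev x y F - ev p.1 p.2 F‖ ≤ Real.exp (c - σ p) :=
    fun p hp hpp => norm_ev_le_exp_of_dist hC₀ hx hy hF0 hnτ hn hm hL hc hpp.le (hσ p hp hpp)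
  have hne : ∃ p ∈ O, ev p.1 p.2 F ≠ 0 := by
    obtain ⟨p, hp, hps⟩ := hσ2
    refine ⟨p, hp, fun h0 => ?_⟩
    have := hclose p hp (by rw [hps]; exact hs₁)
    rw [h0, sub_zero, hps] at this
    have := Real.exp_le_exp.1 (hF1.trans this)
    linarith
  have h1 := h.one_le F n hn hm hne
  set ρ := M / s₁ with hρ
  have hρ0 : 0 ≤ ρ := by positivity
  have hρ1 : ρ ≤ 1 := (div_le_one hs₁).2 hM
  have hval : ∀ p ∈ O, ‖ev p.1 p.2 F‖ ≤
      Real.exp (c + 1) * max 1 ‖p.1‖ ^ n * max 1 ‖p.2‖ ^ n * Real.exp (-(ρ * σ p)) := by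
    intro p hp
    have m1 : 1 ≤ max 1 ‖p.1‖ ^ n := one_le_pow₀ (le_max_left _ _)
    have m2 : 1 ≤ max 1 ‖p.2‖ ^ n := one_le_pow₀ (le_max_left _ _)
    rcases (hσ0 p hp).eq_or_lt with h0 | h0
    · rw [← h0, mul_zero, neg_zero, Real.exp_zero, mul_one, mul_assoc]
      refine (norm_ev_le_two p.1 p.2 F hn hm).trans ?_
      gcongr
      rw [len2_eq_exp hF0]
      exact Real.exp_le_exp.2 (by linarith)
    · have hexp : ‖ev p.1 p.2 F‖ ≤ Real.exp (c + 1) * Real.exp (-(ρ * σ p)) := by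
        have e1 : ‖ev p.1 p.2 F‖ ≤ ‖ev x y F‖ + ‖ev x y F - ev p.1 p.2 F‖ := by
          have := norm_sub_le (ev x y F) (ev x y F - ev p.1 p.2 F)
          rwa [sub_sub_cancel] at this
        have e2 : Real.exp (-M) ≤ Real.exp (c - ρ * σ p) := by
          refine Real.exp_le_exp.2 ?_
          have : ρ * σ p ≤ ρ * s₁ := by gcongr; exact hσ1 p hp
          rw [hρ, div_mul_cancel₀ _ hs₁.ne'] at this
          linarith
        have e3 : Real.exp (c - σ p) ≤ Real.exp (c - ρ * σ p) := by
          refine Real.exp_le_exp.2 ?_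
          have : ρ * σ p ≤ 1 * σ p := by gcongr
          linarith
        have e4 : 2 * Real.exp (c - ρ * σ p) ≤ Real.exp (c + 1) * Real.exp (-(ρ * σ p)) := by
          have : (2 : ℝ) ≤ Real.exp 1 := by linarith [Real.add_one_le_exp (1 : ℝ)]
          rw [Real.exp_add, sub_eq_add_neg, Real.exp_add]
          have : 0 < Real.exp c * Real.exp (-(ρ * σ p)) := by positivity
          nlinarith
        linarith [hclose p hp h0]
      calc _ ≤ Real.exp (c + 1) * 1 * 1 * Real.exp (-(ρ * σ p)) := by simpa using hexp
        _ ≤ _ := by gcongr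
  have hprod : ∏ p ∈ O, ‖ev p.1 p.2 F‖ ≤ Real.exp ((c + 1) * s) * (∏ p ∈ O, max 1 ‖p.1‖) ^ n *
      (∏ p ∈ O, max 1 ‖p.2‖) ^ n * Real.exp (-(ρ * ∑ p ∈ O, σ p)) := by
    refine (Finset.prod_le_prod (fun _ _ => norm_nonneg _) hval).trans ?_
    rw [Finset.prod_mul_distrib, Finset.prod_mul_distrib, Finset.prod_mul_distrib,
      Finset.prod_const, Finset.prod_pow, Finset.prod_pow, ← Real.exp_sum, Finset.sum_neg_distrib,
      ← Finset.mul_sum, mul_comm (c + 1) s]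
    gcongr
    exact exp_pow_le (by linarith) h.card_le
  have hfin : (1 : ℝ) ≤ Real.exp ((c + 1) * s + 2 * τ * s - ρ * ∑ p ∈ O, σ p) := by
    have hA := pow_le_pow_left₀ (mul_nonneg (abs_nonneg _) (Finset.prod_nonneg fun p _ =>
      zero_le_one.trans (le_max_left 1 ‖p.1‖))) h.fst_le n
    have hB := pow_le_pow_left₀ (mul_nonneg (abs_nonneg _) (Finset.prod_nonneg fun p _ =>
      zero_le_one.trans (le_max_left 1 ‖p.2‖))) h.snd_le n
    have hT := exp_pow_le hs hnτ
    calc (1 : ℝ) ≤ _ := h1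
      _ ≤ |(a : ℝ)| ^ (2 * n) * (Real.exp ((c + 1) * s) * (∏ p ∈ O, max 1 ‖p.1‖) ^ n *
      (∏ p ∈ O, max 1 ‖p.2‖) ^ n * Real.exp (-(ρ * ∑ p ∈ O, σ p))) := by gcongr
      _ = Real.exp ((c + 1) * s) * ((|(a : ℝ)| * ∏ p ∈ O, max 1 ‖p.1‖) ^ n *
      (|(a : ℝ)| * ∏ p ∈ O, max 1 ‖p.2‖) ^ n) * Real.exp (-(ρ * ∑ p ∈ O, σ p)) := by
          rw [mul_pow, mul_pow]; ring
      _ ≤ Real.exp ((c + 1) * s) * (Real.exp (τ * s) * Real.exp (τ * s)) *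
          Real.exp (-(ρ * ∑ p ∈ O, σ p)) := by
          gcongr
          · exact hA.trans hT
          · exact hB.trans hT
      _ = _ := by
          rw [← Real.exp_add, ← Real.exp_add, ← Real.exp_add]
          ring_nf
  have := Real.exp_le_exp.1 (Real.exp_zero.trans_le hfin)
  linarith

/-- Truncated logarithmic distances. -/
lemma exists_truncated_distances {O : Finset (ℂ × ℂ)} (x y : ℂ) {S B : ℝ}
    (hS : 0 < S) (hBS : B ≤ S)
    (hd : ∏ p ∈ O, max ‖x - p.1‖ ‖y - p.2‖ ≤ Real.exp (-B)) :
    ∃ σ : ℂ × ℂ → ℝ, (∀ p ∈ O, 0 ≤ σ p) ∧ (∀ p ∈ O, σ p ≤ S) ∧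
      (∀ p ∈ O, 0 < σ p → max ‖x - p.1‖ ‖y - p.2‖ ≤ Real.exp (-σ p)) ∧ B ≤ ∑ p ∈ O, σ p := by
  classical
  set d : ℂ × ℂ → ℝ := fun p => max ‖x - p.1‖ ‖y - p.2‖ with hdd
  have hd0 : ∀ p, 0 ≤ d p := fun p => le_max_of_le_left (norm_nonneg _)
  set σ : ℂ × ℂ → ℝ := fun p => if d p = 0 then S else min S (max 0 (-Real.log (d p))) with hσ
  have h0 : ∀ p, 0 ≤ σ p := fun p => by
    simp only [hσ]; split_ifs
    · exact hS.le
    · exact le_min hS.le (le_max_left _ _)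
  refine ⟨σ, fun p _ => h0 p, fun p _ => ?_, fun p _ hp => ?_, ?_⟩
  · simp only [hσ]; split_ifs
    · exact le_rfl
    · exact min_le_left _ _
  · change d p ≤ _
    by_cases hz : d p = 0
    · rw [hz]; positivity
    · have hpos : 0 < d p := (hd0 p).lt_of_ne' hz
      rw [← Real.log_le_iff_le_exp hpos]
      simp only [hσ, if_neg hz] at hp ⊢
      have h1 := (lt_min_iff.1 hp).2
      have h2 : 0 < -Real.log (d p) := by
        rcases lt_max_iff.1 h1 with h | h
        · exact absurd h (lt_irrefl _)
        · exact h
      rw [max_eq_right h2.le]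
      linarith [min_le_right S (-Real.log (d p))]
  · by_cases hex : ∃ p ∈ O, σ p = S
    · obtain ⟨p, hp, hpS⟩ := hex
      exact (hBS.trans hpS.ge).trans (Finset.single_le_sum (fun q _ => h0 q) hp)
    · push Not at hex
      have hnz : ∀ p ∈ O, d p ≠ 0 := fun p hp hz => hex p hp (by simp [hσ, hz])
      have hle : ∀ p ∈ O, -Real.log (d p) ≤ σ p := fun p hp => by
        have := hex p hp
        simp only [hσ, if_neg (hnz p hp)] at this ⊢
        rcases min_choice S (max 0 (-Real.log (d p))) with h | h
        · exact absurd h this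
        · rw [h]; exact le_max_right _ _
      refine le_trans ?_ (Finset.sum_le_sum hle)
      rw [Finset.sum_neg_distrib, ← Real.log_prod hnz]
      have hpos : 0 < ∏ p ∈ O, d p := Finset.prod_pos fun p hp => (hd0 p).lt_of_ne' (hnz p hp)
      have := (Real.log_le_iff_le_exp hpos).2 hd
      linarith

end NestPi

namespace NestPi

open Polynomial Finset

/-- Integer polynomials of every large size `T` take a value at `(x, y)` which is small, but not
too small. -/
def TwoSided (x y : ℂ) : Prop :=
  ∃ T₀ : ℝ, ∀ T : ℝ, T₀ ≤ T → ∃ F : ℤ[X][X], (degU F : ℝ) ≤ T ∧ (F.natDegree : ℝ) ≤ T ∧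
    Real.log (len2 F) ≤ T ∧ Real.exp (-(T ^ 3)) ≤ ‖ev x y F‖ ∧
      ‖ev x y F‖ ≤ Real.exp (-(T ^ (2.95 : ℝ)))

/-- Nonzero integer polynomials of every large size `T` take a very small value at `(x, y)`. -/
def VerySmall (x y : ℂ) : Prop :=
  ∃ T₀ : ℝ, ∀ T : ℝ, T₀ ≤ T → ∃ F : ℤ[X][X], F ≠ 0 ∧ (degU F : ℝ) ≤ T ∧ (F.natDegree : ℝ) ≤ T ∧
    Real.log (len2 F) ≤ T ∧ ‖ev x y F‖ ≤ Real.exp (-(T ^ (3.9 : ℝ)))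

lemma TwoSided.cycle_le {x y : ℂ} (h : TwoSided x y) : ∃ K : ℝ, 0 < K ∧
    ∀ (O : Finset (ℂ × ℂ)) (a : ℤ) (s W S b : ℝ), IsCycle O a s → s ≤ W → b * W ≤ S → K ≤ b →
      ∏ p ∈ O, max ‖x - p.1‖ ‖y - p.2‖ ≤ Real.exp (-(b * s)) → b ≤ K * S ^ (0.35 : ℝ) := by
  obtain ⟨T₀, hT₀⟩ := h
  set C₀ := max 1 (max ‖x‖ ‖y‖) with hC₀
  have hC1 : 1 ≤ C₀ := le_max_left _ _
  set k := 3 + 2 * Real.log (C₀ + 1) with hk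
  have hk3 : 3 ≤ k := by
    have := Real.log_nonneg (by linarith : 1 ≤ C₀ + 1)
    linarith
  set L := max T₀ k with hL
  have hLk : k ≤ L := le_max_right _ _
  refine ⟨max (2 * L ^ 3) (2 * (k + 3)), lt_max_of_lt_right (by linarith), ?_⟩
  intro O a s W S b hO hsW hbW hKb hd
  have hKb1 := (le_max_left _ _).trans hKb
  have hb0 : 0 < b := lt_of_lt_of_le (by linarith) ((le_max_right _ _).trans hKb)
  have hs : 0 < s := lt_of_lt_of_le (by exact_mod_cast hO.nonempty.card_pos) hO.card_le
  have hbs : b * s ≤ S := (by gcongr : b * s ≤ b * W).trans hbW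
  obtain ⟨σ, σ0, σ1, σ2, σ3⟩ := exists_truncated_distances x y
    (lt_of_lt_of_le (by positivity : 0 < b * s) hbs) hbs hd
  obtain ⟨p₀, hp₀, hmax⟩ := Finset.exists_max_image O σ hO.nonempty
  set s₁ := σ p₀ with hs₁
  have hbs₁ : b ≤ s₁ := by
    have h1 : ∑ p ∈ O, σ p ≤ O.card * s₁ := by
      simpa using Finset.sum_le_card_nsmul O σ s₁ hmax
    have h2 : (O.card : ℝ) * s₁ ≤ s * s₁ := by
      gcongr
      · exact σ0 p₀ hp₀
      · exact hO.card_le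
    have h3 : b * s ≤ s₁ * s := by linarith
    exact le_of_mul_le_mul_right h3 hs
  have hs₁0 : 0 < s₁ := hb0.trans_le hbs₁
  set τ := (s₁ / 2) ^ (1 / 3 : ℝ) with hτ
  have hτ3 : τ ^ 3 = s₁ / 2 := by
    rw [hτ, ← Real.rpow_natCast, ← Real.rpow_mul (by positivity)]
    norm_num
  have hτ0 : 0 < τ := by positivity
  have hLτ : L ≤ τ := by
    refine le_of_pow_le_pow_left₀ (n := 3) (by norm_num) hτ0.le ?_
    rw [hτ3]; linarith
  obtain ⟨F, f1, f2, f3, f4, f5⟩ := hT₀ τ ((le_max_left _ _).trans hLτ)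
  have hkτ : k ≤ τ := hLk.trans hLτ
  have hτ1 : 1 ≤ τ := by linarith
  rw [hτ3] at f4
  have hM : τ ^ (2.95 : ℝ) ≤ s₁ := by
    have : τ ^ (2.95 : ℝ) ≤ τ ^ (3 : ℝ) := Real.rpow_le_rpow_of_exponent_le hτ1 (by norm_num)
    have e : τ ^ (3 : ℝ) = τ ^ 3 := by exact_mod_cast Real.rpow_natCast τ 3
    rw [e, hτ3] at this
    linarith
  have key := hO.sum_le hC1 ((le_max_left _ _).trans (le_max_right _ _) : ‖x‖ ≤ C₀)
    ((le_max_right _ _).trans (le_max_right _ _) : ‖y‖ ≤ C₀) (n := ⌊τ⌋₊) (τ := τ)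
    (Nat.floor_le hτ0.le) (Nat.le_floor f1) (Nat.le_floor f2) f3 (c := τ * k) rfl σ hs₁0 σ0 hmax
    ⟨p₀, hp₀, rfl⟩ σ2 (by positivity) hM (by rw [← hτ3]; nlinarith [mul_pos hτ0 hτ0]) f4 f5
  have h1 : τ ^ (2.95 : ℝ) / s₁ * b ≤ τ * k + 1 + 2 * τ := by
    have : τ ^ (2.95 : ℝ) / s₁ * (b * s) ≤ (τ * k + 1 + 2 * τ) * s :=
      le_trans (by gcongr) key
    rw [← mul_assoc] at this
    exact le_of_mul_le_mul_right this hs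
  have h2 : b ≤ 2 * (k + 3) * τ ^ (1.05 : ℝ) := by
    have e1 : s₁ = 2 * (τ ^ (2.95 : ℝ) * τ ^ (0.05 : ℝ)) := by
      rw [← Real.rpow_add hτ0]
      have : τ ^ (3 : ℝ) = τ ^ 3 := by exact_mod_cast Real.rpow_natCast τ 3
      norm_num [this, hτ3]
      ring
    have e2 : τ ^ (1.05 : ℝ) = τ * τ ^ (0.05 : ℝ) := by
      rw [← Real.rpow_one_add' hτ0.le (by norm_num)]
      norm_num
    rw [div_mul_eq_mul_div, div_le_iff₀ hs₁0] at h1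
    have e3 : τ ^ (2.95 : ℝ) * b ≤ τ ^ (2.95 : ℝ) * (2 * (k + 3) * τ ^ (1.05 : ℝ)) := by
      refine h1.trans ?_
      calc (τ * k + 1 + 2 * τ) * s₁ ≤ (τ * (k + 3)) * s₁ := by gcongr; linarith
        _ = _ := by rw [e1, e2]; ring
    exact le_of_mul_le_mul_left e3 (by positivity)
  have h3 : τ ^ (1.05 : ℝ) ≤ S ^ (0.35 : ℝ) := by
    rw [hτ, ← Real.rpow_mul (by positivity)]
    norm_num
    refine Real.rpow_le_rpow (by positivity) ?_ (by norm_num)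
    linarith [σ1 p₀ hp₀]
  calc b ≤ 2 * (k + 3) * τ ^ (1.05 : ℝ) := h2
    _ ≤ _ := by
      gcongr
      exact le_max_right _ _

lemma eventually_mul_rpow_le (C : ℝ) {α β : ℝ} (h : α < β) :
    ∀ᶠ u : ℝ in Filter.atTop, C * u ^ α ≤ u ^ β := by
  filter_upwards [(tendsto_rpow_atTop (sub_pos.2 h)).eventually_ge_atTop C,
    Filter.eventually_gt_atTop 0] with u hu hu0
  have e : u ^ β = u ^ (β - α) * u ^ α := by
    rw [← Real.rpow_add hu0, sub_add_cancel]
  rw [e]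
  gcongr

lemma wcost_le {s : ℝ} (hs : 1 ≤ s) : wcost s ≤ 180000000 * s ^ (1.002 : ℝ) := by
  have h0 : 0 ≤ Real.log s := Real.log_nonneg hs
  have h1 := Real.log_le_rpow_div (by linarith : 0 ≤ s) (by norm_num : (0 : ℝ) < 0.001)
  have h2 : Real.log s ^ 2 ≤ (s ^ (0.001 : ℝ) / 0.001) ^ 2 := by gcongr
  have h3 : s ^ (1.002 : ℝ) = s * (s ^ (0.001 : ℝ)) ^ 2 := by
    rw [← Real.rpow_natCast, ← Real.rpow_mul
      (by linarith), ← Real.rpow_one_add' (by linarith) (by norm_num)]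
    norm_num
  rw [h3, wcost]
  calc _ ≤ 180 * s * (s ^ (0.001 : ℝ) / 0.001) ^ 2 := by gcongr
    _ = _ := by ring

end NestPi

namespace NestPi

open Polynomial Finset Filter

/-- Polynomial factors of a very small value, together with the resulting numerical parameters. -/
lemma VerySmall.exists_irreducible {x y : ℂ} (h : VerySmall x y) (U : ℝ) :
    ∃ (q : ℤ[X][X]) (u : ℝ), Irreducible q ∧ 0 < degU q + q.natDegree ∧ 1 ≤ size q ∧ U ≤ u ∧
      size q ≤ 2 * u ^ (0.78 : ℝ) ∧ ‖ev x y q‖ ≤ Real.exp (-(2 * u ^ 3)) := by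
  obtain ⟨T₀, hT₀⟩ := h
  have hev := (eventually_mul_rpow_le 180000000 (by norm_num : (1.002 : ℝ) < 1.01)).and
    ((eventually_mul_rpow_le 2 (by norm_num : (2.7 : ℝ) < 2.89)).and
    ((eventually_ge_atTop (max 2 T₀)).and
      (((tendsto_rpow_atTop (by norm_num : (0 : ℝ) < 0.9)).eventually_ge_atTop U))))
  obtain ⟨T, hT1, hT2, hT3, hT4⟩ := hev.exists
  have hT : 2 ≤ T := (le_max_left _ _).trans hT3
  have hT0 : 0 < T := by linarith
  obtain ⟨F, hF0, f1, f2, f3, f4⟩ := hT₀ T ((le_max_right _ _).trans hT3)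
  obtain ⟨g1, g2⟩ := gelfond_log hF0 hT (le_rfl : degU F ≤ _) f1 f2 f3
  obtain ⟨q, hq, hqF, hq1⟩ := g2 x y _ (by positivity) f4
  have hW : wcost T ≤ T ^ (1.01 : ℝ) := (wcost_le (by linarith)).trans hT1
  have hW0 : 0 < wcost T := by
    have := Real.log_pos (by linarith : 1 < T)
    unfold wcost; positivity
  have hqW : size q ≤ wcost T := g1 q hqF
  have hqs : ∀ q : ℤ[X][X], q ≠ 0 → 0 < degU q + q.natDegree → 1 ≤ size q := by
    intro q hq0 h
    have : (1 : ℝ) ≤ degU q + q.natDegree := by exact_mod_cast h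
    have := Real.log_nonneg (one_le_len2 hq0)
    unfold size; linarith
  set t := size q with ht
  have hd : 0 < degU q + q.natDegree := by
    by_contra hcon
    have h0 : degU q = 0 ∧ q.natDegree = 0 := by omega
    obtain ⟨p, rfl⟩ := natDegree_eq_zero.1 h0.2
    have hp : p.natDegree = 0 := by
      have := natDegree_coeff_le_degU (C p) 0
      rw [coeff_C_zero, h0.1] at this
      omega
    obtain ⟨k, rfl⟩ := natDegree_eq_zero.1 hp
    have hk0 : k ≠ 0 := by
      rintro rfl
      exact hq.ne_zero (by simp)
    have hk1 : ¬ IsUnit k := fun hu => hq.not_isUnit ((hu.map C).map C)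
    have hk2 : (2 : ℤ) ≤ |k| := by
      have := Int.one_le_abs hk0
      have h2 : |k| ≠ 1 := fun h => hk1 (Int.isUnit_iff_abs_eq.2 h)
      omega
    have hval : ‖ev x y (C (C k))‖ = |(k : ℝ)| := by
      rw [show (C (C k) : ℤ[X][X]) = (k : ℤ[X][X]) by simp, map_intCast, Complex.norm_intCast]
    rw [hval] at hq1
    have h3 : (2 : ℝ) ≤ |(k : ℝ)| := by exact_mod_cast hk2
    have h4 : Real.exp (-(T ^ (3.9 : ℝ) * t / (180 * T * Real.log T ^ 2))) ≤ 1 := by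
      refine Real.exp_le_one_iff.2 (neg_nonpos.2 ?_)
      have := size_nonneg hq.ne_zero
      rw [← ht] at this
      positivity
    linarith
  have ht1 := hqs q hq.ne_zero hd
  rw [← ht] at ht1
  set Y := T ^ (3.9 : ℝ) * t / wcost T with hY
  have hq1' : ‖ev x y q‖ ≤ Real.exp (-Y) := hq1
  have hY1 : T ^ (2.89 : ℝ) * t ≤ Y := by
    rw [hY, le_div_iff₀ hW0]
    calc T ^ (2.89 : ℝ) * t * wcost T ≤ T ^ (2.89 : ℝ) * t * T ^ (1.01 : ℝ) := by gcongr
      _ = (T ^ (2.89 : ℝ) * T ^ (1.01 : ℝ)) * t := by ring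
      _ = _ := by rw [← Real.rpow_add hT0]; norm_num
  have hY2 : 2 * T ^ (2.7 : ℝ) ≤ Y := by
    refine hT2.trans (le_trans ?_ hY1)
    exact le_mul_of_one_le_right (by positivity) ht1
  have hY0 : 0 < Y := lt_of_lt_of_le (by positivity) hY2
  have hY3 : t ^ (3.85 : ℝ) ≤ Y := by
    refine le_trans ?_ hY1
    have e1 : t ^ (0.99 : ℝ) ≤ T := by
      calc t ^ (0.99 : ℝ) ≤ (T ^ (1.01 : ℝ)) ^ (0.99 : ℝ) := by
            gcongr; exact hqW.trans hW
        _ = T ^ (0.9999 : ℝ) := by rw [← Real.rpow_mul hT0.le]; norm_num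
        _ ≤ T ^ (1 : ℝ) := Real.rpow_le_rpow_of_exponent_le (by linarith) (by norm_num)
        _ = T := Real.rpow_one T
    calc t ^ (3.85 : ℝ) = t ^ (2.85 : ℝ) * t := by
          rw [← Real.rpow_add_one (by linarith)]; norm_num
      _ ≤ t ^ (2.8611 : ℝ) * t := by
          have := Real.rpow_le_rpow_of_exponent_le ht1 (by norm_num : (2.85 : ℝ) ≤ 2.8611)
          gcongr
      _ = (t ^ (0.99 : ℝ)) ^ (2.89 : ℝ) * t := by rw [← Real.rpow_mul (by linarith)]; norm_num
      _ ≤ _ := by gcongr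
  set u := (Y / 2) ^ (1 / 3 : ℝ) with hu
  have hu3 : u ^ 3 = Y / 2 := by
    rw [hu, ← Real.rpow_natCast, ← Real.rpow_mul (by positivity)]
    norm_num
  have hu0 : 0 < u := by positivity
  refine ⟨q, u, hq, hd, ht1, ?_, ?_, ?_⟩
  · refine hT4.trans ?_
    calc T ^ (0.9 : ℝ) = (T ^ (2.7 : ℝ)) ^ (1 / 3 : ℝ) := by
          rw [← Real.rpow_mul hT0.le]; norm_num
      _ ≤ u := by
          rw [hu]
          gcongr
          linarith
  · have hY1 : 1 ≤ Y := (Real.one_le_rpow ht1 (by norm_num)).trans hY3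
    calc t = (t ^ (3.85 : ℝ)) ^ (1 / 3.85 : ℝ) := by
          rw [← Real.rpow_mul (by linarith)]; norm_num
      _ ≤ Y ^ (1 / 3.85 : ℝ) := by gcongr
      _ ≤ Y ^ (0.26 : ℝ) := Real.rpow_le_rpow_of_exponent_le hY1 (by norm_num)
      _ = (2 * u ^ 3) ^ (0.26 : ℝ) := by rw [hu3]; ring_nf
      _ = 2 ^ (0.26 : ℝ) * u ^ (0.78 : ℝ) := by
          rw [Real.mul_rpow (by norm_num) (by positivity), ← Real.rpow_natCast,
            ← Real.rpow_mul hu0.le]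
          norm_num
      _ ≤ 2 ^ (1 : ℝ) * u ^ (0.78 : ℝ) := by
          gcongr <;> norm_num
      _ = _ := by rw [Real.rpow_one]
  · rw [hu3]
    convert hq1' using 2
    ring

set_option maxHeartbeats 1000000 in
/-- Values that are small but not too small exclude very small values. -/
theorem TwoSided.not_verySmall {x y : ℂ} (h : TwoSided x y) (h' : VerySmall x y) : False := by
  obtain ⟨K, hK, hcyc⟩ := h.cycle_le
  obtain ⟨T₀, hT₀⟩ := h
  set C₀ := max 1 (max ‖x‖ ‖y‖) with hC₀
  have hC1 : 1 ≤ C₀ := le_max_left _ _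
  have hx : ‖x‖ ≤ C₀ := (le_max_left _ _).trans (le_max_right _ _)
  have hy : ‖y‖ ≤ C₀ := (le_max_right _ _).trans (le_max_right _ _)
  have hlC : 0 ≤ Real.log C₀ := Real.log_nonneg hC1
  have hev := (eventually_ge_atTop (max 2 T₀)).and
    ((eventually_mul_rpow_le (180000000 * (1 + Real.log C₀)) (by norm_num : (1.002 : ℝ) < 2)).and
    ((eventually_mul_rpow_le (180000000 * 144) (by norm_num : (1.784 : ℝ) < 1.79)).and
    ((eventually_mul_rpow_le (2 * (32 * 131 * C₀)) (by norm_num : (1.958 : ℝ) < 2.95)).and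
    ((eventually_mul_rpow_le 200 (by norm_num : (0.89 : ℝ) < 1.16)).and
    ((eventually_mul_rpow_le (4 * K) (by norm_num : (0 : ℝ) < 1.16)).and
    (eventually_mul_rpow_le (5 * K) (by norm_num : (1.0325 : ℝ) < 1.16)))))))
  obtain ⟨U, hU⟩ := eventually_atTop.1 hev
  obtain ⟨q, u, hq, hqd, hqs1, hUu, hqs2, hqv⟩ := h'.exists_irreducible U
  obtain ⟨hu1, hu2, hu3, hu4, hu5, hu6, hu7⟩ := hU u hUu
  have hu2' : 2 ≤ u := (le_max_left _ _).trans hu1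
  have hu0 : 0 < u := by linarith
  obtain ⟨G, g1, g2, g3, g4, g5⟩ := hT₀ u ((le_max_right _ _).trans hu1)
  have hG0 : G ≠ 0 := by
    rintro rfl
    rw [map_zero, norm_zero] at g4
    exact (Real.exp_pos _).not_ge g4
  have hqG : ¬ q ∣ G := by
    rintro ⟨r, rfl⟩
    have hr0 : r ≠ 0 := right_ne_zero_of_mul hG0
    have hr := (gelfond_log hG0 hu2' (le_rfl : degU _ ≤ _) g1 g2 g3).1 r (dvd_mul_left _ _)
    have hrW : size r ≤ 180000000 * u ^ (1.002 : ℝ) := le_trans hr (wcost_le (by linarith))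
    have hrv : ‖ev x y r‖ ≤ Real.exp (size r * (1 + Real.log C₀)) := by
      refine (norm_ev_le x y r hC1 hx hy le_rfl le_rfl).trans ?_
      have e1 : C₀ ^ (degU r + r.natDegree) ≤ Real.exp (size r * Real.log C₀) := by
        have e : C₀ ^ (degU r + r.natDegree) = Real.exp (Real.log C₀) ^ (degU r + r.natDegree) := by
          rw [Real.exp_log (by linarith)]
        rw [e]
        refine exp_pow_le hlC ?_
        have := Real.log_nonneg (one_le_len2 hr0)
        unfold size; push_cast; linarith
      have e2 : len2 r ≤ Real.exp (size r) := by
        rw [len2_eq_exp hr0]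
        refine Real.exp_le_exp.2 ?_
        unfold size
        have a : (0 : ℝ) ≤ degU r := Nat.cast_nonneg _
        have b : (0 : ℝ) ≤ r.natDegree := Nat.cast_nonneg _
        linarith
      rw [mul_add, mul_one, Real.exp_add]
      gcongr
    rw [map_mul, norm_mul] at g4
    have h1 : Real.exp (-u ^ 3) ≤ Real.exp (-(2 * u ^ 3)) * Real.exp (size r * (1 + Real.log C₀)) :=
      g4.trans (by gcongr)
    rw [← Real.exp_add, Real.exp_le_exp] at h1
    have h2 : size r * (1 + Real.log C₀) ≤ u ^ (2 : ℝ) :=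
      le_trans (by nlinarith) hu2
    have h3 : u ^ (2 : ℝ) = u ^ 2 := by exact_mod_cast Real.rpow_natCast u 2
    rw [h3] at h2
    nlinarith [pow_pos hu0 2]
  set t := size q with ht
  set P := t * u with hP
  have hP1 : 1 ≤ P := by nlinarith
  have hP2 : P ≤ 2 * u ^ (1.78 : ℝ) := by
    calc P ≤ 2 * u ^ (0.78 : ℝ) * u := by rw [hP]; gcongr
      _ = 2 * u ^ (1.78 : ℝ) := by
        rw [mul_assoc, ← Real.rpow_add_one hu0.ne']; norm_num
  set E := u ^ (2.95 : ℝ) with hE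
  have hE0 : 0 < E := by positivity
  have hEu : E ≤ 2 * u ^ 3 := by
    have h1 : u ^ (2.95 : ℝ) ≤ u ^ (3 : ℝ) :=
      Real.rpow_le_rpow_of_exponent_le (by linarith) (by norm_num)
    have h3 : u ^ (3 : ℝ) = u ^ 3 := by exact_mod_cast Real.rpow_natCast u 3
    rw [h3] at h1
    have := pow_pos hu0 3
    linarith
  set W := wcost (6 * P) with hW
  have hW0 : 0 < W := by
    have := Real.log_pos (by linarith : 1 < 6 * P)
    rw [hW, wcost]; positivity
  have hWu : W ≤ u ^ (1.79 : ℝ) := by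
    refine le_trans ?_ hu3
    refine (wcost_le (by linarith)).trans ?_
    have : (6 * P) ^ (1.002 : ℝ) ≤ 144 * u ^ (1.784 : ℝ) := by
      calc (6 * P) ^ (1.002 : ℝ) ≤ (12 * u ^ (1.78 : ℝ)) ^ (1.002 : ℝ) :=
            Real.rpow_le_rpow (by linarith) (by linarith) (by norm_num)
        _ = 12 ^ (1.002 : ℝ) * u ^ (1.78356 : ℝ) := by
            rw [Real.mul_rpow (by norm_num) (by positivity), ← Real.rpow_mul hu0.le]; norm_num
        _ ≤ 12 ^ (2 : ℝ) * u ^ (1.784 : ℝ) := by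
            have := Real.rpow_le_rpow_of_exponent_le (by linarith : 1 ≤ u)
              (by norm_num : (1.78356 : ℝ) ≤ 1.784)
            gcongr <;> norm_num
        _ = _ := by norm_num
    linarith
  set b := E / 2 / (2 * W) with hb
  have hbu : u ^ (1.16 : ℝ) ≤ 4 * b := by
    have e : 4 * b = E / W := by rw [hb]; field_simp; norm_num
    rw [e, le_div_iff₀ hW0]
    calc u ^ (1.16 : ℝ) * W ≤ u ^ (1.16 : ℝ) * u ^ (1.79 : ℝ) := by gcongr
      _ = E := by rw [← Real.rpow_add hu0]; norm_num [hE]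
  have hE1 : 16 * (t * u) * (1 + Real.log (C₀ * (1 + 6 * (t * u)))) ≤ E / 2 := by
    rw [← hP]
    have l1 : Real.log (C₀ * (1 + 6 * P)) ≤ 130 * C₀ * u ^ (0.178 : ℝ) := by
      have hp13 : 1 + 6 * P ≤ 13 * u ^ (1.78 : ℝ) := by
        have : (1 : ℝ) ≤ u ^ (1.78 : ℝ) := Real.one_le_rpow (by linarith) (by norm_num)
        linarith
      refine (Real.log_le_rpow_div (by positivity) (by norm_num : (0 : ℝ) < 0.1)).trans ?_
      rw [div_le_iff₀ (by norm_num)]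
      calc (C₀ * (1 + 6 * P)) ^ (0.1 : ℝ) ≤ (C₀ * (13 * u ^ (1.78 : ℝ))) ^ (0.1 : ℝ) := by gcongr
        _ = (13 * C₀) ^ (0.1 : ℝ) * u ^ (0.178 : ℝ) := by
            rw [← mul_assoc, mul_comm C₀, Real.mul_rpow (by positivity) (by positivity),
              ← Real.rpow_mul hu0.le]
            norm_num
        _ ≤ (13 * C₀) ^ (1 : ℝ) * u ^ (0.178 : ℝ) := by
            have := Real.rpow_le_rpow_of_exponent_le (by linarith : 1 ≤ 13 * C₀)
              (by norm_num : (0.1 : ℝ) ≤ 1)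
            gcongr
        _ = _ := by rw [Real.rpow_one]; ring
    have l2 : 1 + Real.log (C₀ * (1 + 6 * P)) ≤ 131 * C₀ * u ^ (0.178 : ℝ) := by
      have : (1 : ℝ) ≤ u ^ (0.178 : ℝ) := Real.one_le_rpow (by linarith) (by norm_num)
      have := one_le_mul_of_one_le_of_one_le hC1 this
      linarith
    calc 16 * P * (1 + Real.log (C₀ * (1 + 6 * P)))
        ≤ 16 * P * (131 * C₀ * u ^ (0.178 : ℝ)) := by gcongr
      _ ≤ 16 * (2 * u ^ (1.78 : ℝ)) * (131 * C₀ * u ^ (0.178 : ℝ)) := by gcongr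
      _ = 32 * 131 * C₀ * (u ^ (1.78 : ℝ) * u ^ (0.178 : ℝ)) := by ring
      _ = 32 * 131 * C₀ * u ^ (1.958 : ℝ) := by rw [← Real.rpow_add hu0]; norm_num
      _ ≤ E / 2 := by linarith
  have hE2 : Real.log (2 * (6 * (t * u)) + 1) ≤ E / 2 / (2 * wcost (6 * (t * u))) := by
    rw [← hP, ← hW, ← hb]
    have h25 : 2 * (6 * P) + 1 ≤ 25 * u ^ (1.78 : ℝ) := by
      have : (1 : ℝ) ≤ u ^ (1.78 : ℝ) := Real.one_le_rpow (by linarith) (by norm_num)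
      linarith
    have : Real.log (2 * (6 * P) + 1) ≤ 50 * u ^ (0.89 : ℝ) := by
      refine (Real.log_le_rpow_div (by positivity) (by norm_num : (0 : ℝ) < 0.5)).trans ?_
      rw [div_le_iff₀ (by norm_num)]
      calc (2 * (6 * P) + 1) ^ (0.5 : ℝ) ≤ (25 * u ^ (1.78 : ℝ)) ^ (0.5 : ℝ) := by gcongr
        _ = 25 ^ (0.5 : ℝ) * u ^ (0.89 : ℝ) := by
            rw [Real.mul_rpow (by norm_num) (by positivity), ← Real.rpow_mul hu0.le]
            norm_num
        _ ≤ 25 ^ (1 : ℝ) * u ^ (0.89 : ℝ) := by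
            gcongr <;> norm_num
        _ = _ := by rw [Real.rpow_one]; ring
    linarith
  obtain ⟨O, a, s, hO, hsW, hprod⟩ := exists_small_cycle hq hqG hqd hqs1 (by linarith : 1 ≤ u)
    (le_rfl : size q ≤ t) g1 g2 g3 x y hC1 hx hy
    (hqv.trans (Real.exp_le_exp.2 (by linarith))) g5 hE0 hE1 hE2
  rw [Real.rpow_zero, mul_one] at hu6
  have hfin := hcyc O a s W (E / 2) b hO hsW (by rw [hb]; field_simp; norm_num) (by linarith) hprod
  have h35 : (E / 2) ^ (0.35 : ℝ) ≤ u ^ (1.0325 : ℝ) := by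
    calc (E / 2) ^ (0.35 : ℝ) ≤ E ^ (0.35 : ℝ) := by
          gcongr; linarith
      _ = _ := by rw [hE, ← Real.rpow_mul hu0.le]; norm_num
  have h0 : 0 < u ^ (1.0325 : ℝ) := by positivity
  have : b ≤ K * u ^ (1.0325 : ℝ) := hfin.trans (by gcongr)
  have := mul_pos hK h0
  linarith

end NestPi

namespace NestPi

open UpperHalfPlane hiding I
open ModularForm SlashInvariantForm MatrixGroups OnePoint Filter EisensteinSeries Function
open scoped Topology Manifold Derivative

/-- `f` is given on the upper half plane by the power series `c` in `exp (2πiτ)`. -/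
def HasQ (f : ℍ → ℂ) (c : PowerSeries ℂ) : Prop :=
  ∀ τ : ℍ, HasSum (fun m ↦ c.coeff m • Periodic.qParam 1 τ ^ m) (f τ)

theorem HasQ.add {f g : ℍ → ℂ} {c d : PowerSeries ℂ} (hf : HasQ f c) (hg : HasQ g d) :
    HasQ (f + g) (c + d) := fun τ ↦ by
  simpa [add_mul] using (hf τ).add (hg τ)

theorem HasQ.sub {f g : ℍ → ℂ} {c d : PowerSeries ℂ} (hf : HasQ f c) (hg : HasQ g d) :
    HasQ (f - g) (c - d) := fun τ ↦ by
  simpa [sub_mul] using (hf τ).sub (hg τ)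

theorem HasQ.smul {f : ℍ → ℂ} {c : PowerSeries ℂ} (a : ℂ) (hf : HasQ f c) :
    HasQ (a • f) (a • c) := fun τ ↦ by
  simpa [mul_assoc] using (hf τ).mul_left a

theorem HasQ.mul {f g : ℍ → ℂ} {c d : PowerSeries ℂ} (hf : HasQ f c) (hg : HasQ g d) :
    HasQ (f * g) (c * d) := fun τ ↦ by
  have h1 := (hf τ).summable.norm
  have h2 := (hg τ).summable.norm
  have h3 := summable_norm_sum_mul_antidiagonal_of_summable_norm h1 h2
  have h4 := tsum_mul_tsum_eq_tsum_sum_antidiagonal_of_summable_norm h1 h2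
  rw [(hf τ).tsum_eq, (hg τ).tsum_eq] at h4
  have h5 : ∀ n, (c * d).coeff n • Periodic.qParam 1 τ ^ n =
    ∑ kl ∈ Finset.HasAntidiagonal.antidiagonal n,
      (c.coeff kl.1 • Periodic.qParam 1 τ ^ kl.1) * (d.coeff kl.2 • Periodic.qParam 1 τ ^ kl.2) :=
        by
    intro n
    rw [PowerSeries.coeff_mul, Finset.sum_smul]
    refine Finset.sum_congr rfl fun x hx ↦ ?_
    rw [← Finset.HasAntidiagonal.mem_antidiagonal.mp hx, pow_add]
    simp only [smul_eq_mul]; ring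
  simp only [h5, Pi.mul_apply, h4]
  exact h3.of_norm.hasSum

theorem HasQ.deriv {f : ℍ → ℂ} {c : PowerSeries ℂ} (hf : HasQ f c) {C : ℝ} {k : ℕ}
    (hc : ∀ m, ‖c.coeff m‖ ≤ C * (m : ℝ) ^ k + C) :
    HasQ (D f) (PowerSeries.mk fun m ↦ (m : ℂ) * c.coeff m) := fun τ ↦ by
  set y : ℝ := τ.im / 2 with hy
  have hτ : 0 < τ.im := τ.im_pos
  set r : ℝ := Real.exp (-(2 * Real.pi * y)) with hr
  have hr1 : r < 1 := by
    rw [hr, Real.exp_lt_one_iff]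
    have : 0 < Real.pi * y := by positivity
    linarith
  have hr0 : 0 < r := Real.exp_pos _
  have hC : 0 ≤ C := by
    by_contra hC
    have := (norm_nonneg _).trans (hc 1)
    simp at this
    linarith
  have hu : Summable fun n : ℕ ↦ 2 * Real.pi * C * ((n : ℝ) ^ (k + 1) * r ^ n) +
      2 * Real.pi * C * ((n : ℝ) ^ 1 * r ^ n) := by
    have h := fun j ↦ summable_pow_mul_geometric_of_norm_lt_one (R := ℝ) j
      (show ‖r‖ < 1 by rwa [Real.norm_of_nonneg hr0.le])
    exact ((h (k + 1)).mul_left _).add ((h 1).mul_left _)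
  have hq : ∀ (n : ℕ) (z : ℂ), HasDerivAt (fun z : ℂ ↦ c.coeff n * Periodic.qParam 1 z ^ n)
      ((2 * Real.pi * Complex.I) * (n * c.coeff n * Periodic.qParam 1 z ^ n)) z := by
    intro n z
    have h1 : HasDerivAt (fun z : ℂ ↦ Complex.exp (n * (2 * Real.pi * Complex.I * z)))
        (Complex.exp (n * (2 * Real.pi * Complex.I * z)) * (n * (2 * Real.pi * Complex.I * 1))) z :=
      (((hasDerivAt_id z).const_mul _).const_mul _).cexp
    have h2 := h1.const_mul (c.coeff n)
    have h3 : ∀ z, Periodic.qParam 1 z ^ n = Complex.exp (n * (2 * Real.pi * Complex.I * z)) := by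
      intro z
      rw [Complex.exp_nat_mul]; simp [Periodic.qParam]
    simp only [h3]
    exact h2.congr_deriv (by ring)
  have hmem : (τ : ℂ) ∈ {z : ℂ | y < z.im} := by
    change y < τ.im
    rw [hy]; linarith
  have hbound : ∀ (n : ℕ) (z : ℂ), z ∈ {z : ℂ | y < z.im} →
      ‖(2 * Real.pi * Complex.I) * (n * c.coeff n * Periodic.qParam 1 z ^ n)‖ ≤
      2 * Real.pi * C * ((n : ℝ) ^ (k + 1) * r ^ n) + 2 * Real.pi * C * ((n : ℝ) ^ 1 * r ^ n) := by
    intro n z hz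
    have hz' : y < z.im := hz
    have hn : ‖Periodic.qParam 1 z‖ ≤ r := by
      rw [Periodic.norm_qParam, hr]
      apply Real.exp_le_exp.mpr
      have := mul_le_mul_of_nonneg_left hz'.le Real.pi_pos.le
      simp only [div_one]
      linarith
    have h1 := hc n
    have h2 := pow_le_pow_left₀ (norm_nonneg _) hn n
    rw [norm_mul, norm_mul, norm_mul, norm_mul, norm_mul, norm_pow, Complex.norm_I,
      Complex.norm_natCast, Complex.norm_real, Real.norm_of_nonneg Real.pi_pos.le,
        Complex.norm_ofNat]
    calc 2 * Real.pi * 1 * (n * ‖c.coeff n‖ * ‖Periodic.qParam 1 z‖ ^ n)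
        ≤ 2 * Real.pi * 1 * (n * (C * (n : ℝ) ^ k + C) * r ^ n) := by gcongr
      _ = _ := by ring
  have hd := hasDerivAt_tsum_of_isPreconnected hu
    (isOpen_lt continuous_const Complex.continuous_im)
    (convex_halfSpace_im_gt y).isPreconnected (fun n z _ ↦ hq n z) hbound hmem
    (by simpa using (hf τ).summable) hmem
  have hsum : Summable fun n : ℕ ↦ (n : ℂ) * c.coeff n * Periodic.qParam 1 τ ^ n := by
    have h := Summable.of_norm_bounded hu (fun n ↦ hbound n τ hmem)
    have h2 : (2 * Real.pi * Complex.I : ℂ) ≠ 0 := Complex.two_pi_I_ne_zero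
    exact (summable_mul_left_iff h2).mp h
  have hev : (f ∘ ofComplex) =ᶠ[𝓝 (τ : ℂ)] fun z ↦ ∑' n, c.coeff n * Periodic.qParam 1 z ^ n := by
    filter_upwards [isOpen_upperHalfPlaneSet.mem_nhds τ.im_pos] with w hw
    have := (hf ⟨w, hw⟩).tsum_eq
    rw [Function.comp_apply, ofComplex_apply_of_im_pos hw, ← this]
    simp
  have hval : (D f) τ = ∑' n : ℕ, (n : ℂ) * c.coeff n * Periodic.qParam 1 τ ^ n := by
    rw [Derivative.normalizedDerivOfComplex, hev.deriv_eq, hd.deriv, tsum_mul_left,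
      inv_mul_cancel_left₀ Complex.two_pi_I_ne_zero]
  rw [hval]
  simpa using hsum.hasSum

theorem levelOne_coeff_eq_zero {k : ℕ} (hk : k < 12) {f : ℍ → ℂ} (hf : MDiff f)
    (hinv : ∀ γ : SL(2, ℤ), f ∣[(k : ℤ)] γ = f) {c : PowerSeries ℂ} (hc : HasQ f c)
    (h0 : c.coeff 0 = 0) : c = 0 := by
  have hb : IsBoundedAtImInfty f := isBoundedAtImInfty_of_hasSum_qExpansion one_pos hc
  let F : ModularForm 𝒮ℒ (k : ℤ) :=
    { toFun := f
      slash_action_eq' := fun _ ⟨γ, hγ⟩ ↦ hγ ▸ hinv γ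
      holo' := hf
      bdd_at_cusps' := by
        intro c hc
        rw [Subgroup.IsArithmetic.isCusp_iff_isCusp_SL2Z] at hc
        rw [isBoundedAt_iff_forall_SL2Z hc]
        intro γ _
        rw [hinv γ]
        exact hb }
  have hco : ∀ m, c.coeff m = (qExpansion 1 F).coeff m := fun m ↦
    ModularFormClass.qExpansion_coeff_unique one_pos one_mem_strictPeriods_SL (f := F) hc m
  have hc' : c = qExpansion 1 F := PowerSeries.ext hco
  have hF : F = 0 := by
    apply sturm_bound_levelOne_nat
    rw [← hc', Nat.div_eq_of_lt hk]
    refine lt_of_lt_of_le (b := (1 : ℕ∞)) (by norm_num) ?_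
    refine PowerSeries.le_order _ _ fun i hi ↦ ?_
    have : i = 0 := by
      have : i < 1 := by exact_mod_cast hi
      omega
    rw [this, h0]
  rw [hc', hF]
  exact qExpansion_zero 1

end NestPi

namespace NestPi

open UpperHalfPlane hiding I
open ModularForm SlashInvariantForm MatrixGroups OnePoint Filter EisensteinSeries Function
open Derivative
open scoped Topology Manifold

/-- The derivation `z d/dz` on power series. -/
noncomputable def theta (R : Type*) [CommRing R] : Derivation R (PowerSeries R) (PowerSeries R) :=
  (PowerSeries.X : PowerSeries R) • PowerSeries.derivative R

theorem coeff_theta {R : Type*} [CommRing R] (p : PowerSeries R) (n : ℕ) :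
    (theta R p).coeff n = n * p.coeff n := by
  cases n with
  | zero => simp [theta]
  | succ n =>
    simp only [theta, Derivation.smul_apply, smul_eq_mul]
    rw [mul_comm, PowerSeries.coeff_succ_mul_X, PowerSeries.coeff_derivative]
    push_cast; ring

/-- The Eisenstein-type power series `1 + a ∑ σ_k(n) zⁿ`. -/
noncomputable def eisSer (a : ℤ) (k : ℕ) : PowerSeries ℤ :=
  PowerSeries.mk fun n ↦ if n = 0 then 1 else a * (ArithmeticFunction.sigma k n : ℤ)

theorem abs_coeff_eisSer_le (a : ℤ) (k n : ℕ) :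
    |((eisSer a k).coeff n : ℤ)| ≤ (|a| + 1) * ((n : ℤ) + 1) ^ (k + 1) := by
  rw [eisSer, PowerSeries.coeff_mk]
  have h1 : (1 : ℤ) ≤ ((n : ℤ) + 1) ^ (k + 1) := one_le_pow₀ (by linarith [Int.natCast_nonneg n])
  split_ifs with h
  · rw [abs_one]; nlinarith [abs_nonneg a]
  · rw [abs_mul]
    have h2 : (|(ArithmeticFunction.sigma k n : ℤ)|) ≤ ((n : ℤ) + 1) ^ (k + 1) := by
      rw [Nat.abs_cast]
      have := ArithmeticFunction.sigma_le_pow_succ k n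
      calc ((ArithmeticFunction.sigma k n : ℕ) : ℤ) ≤ (n : ℤ) ^ (k + 1) := by exact_mod_cast this
        _ ≤ _ := by gcongr; linarith
    nlinarith [abs_nonneg a, abs_nonneg (ArithmeticFunction.sigma k n : ℤ)]

/-- Base change of an integral power series to `ℂ`. -/
noncomputable def toC : PowerSeries ℤ →+* PowerSeries ℂ := PowerSeries.map (Int.castRingHom ℂ)

theorem coeff_toC (p : PowerSeries ℤ) (n : ℕ) : (toC p).coeff n = ((p.coeff n : ℤ) : ℂ) :=
  PowerSeries.coeff_map _ _ _

theorem hasQ_E2 : HasQ E2 (toC (eisSer (-24) 1)) := fun τ ↦ by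
  have := hasSum_qExpansion_E2 (z := τ)
  convert! this using 2 with m
  · simp only [coeff_toC, eisSer, PowerSeries.coeff_mk]
    split_ifs <;> simp [Periodic.qParam]

theorem hasQ_E4 : HasQ E₄ (toC (eisSer 240 3)) := fun τ ↦ by
  have := ModularForm.hasSum_qExpansion E₄ one_pos one_mem_strictPeriods_SL τ
  convert! this using 2 with m
  rw [E_qExpansion_coeff _ ⟨2, rfl⟩, show bernoulli 4 = -1 / 30 by decide +kernel]
  simp only [coeff_toC, eisSer, PowerSeries.coeff_mk]
  split_ifs <;> norm_num

theorem hasQ_E6 : HasQ E₆ (toC (eisSer (-504) 5)) := fun τ ↦ by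
  have := ModularForm.hasSum_qExpansion E₆ one_pos one_mem_strictPeriods_SL τ
  convert! this using 2 with m
  rw [E_qExpansion_coeff _ ⟨3, rfl⟩, show bernoulli 6 = 1 / 42 by decide +kernel]
  simp only [coeff_toC, eisSer, PowerSeries.coeff_mk]
  split_ifs <;> norm_num

theorem HasQ.theta_eisSer {f : ℍ → ℂ} {a : ℤ} {k : ℕ} (hf : HasQ f (toC (eisSer a k))) :
    HasQ (D f) (toC (theta ℤ (eisSer a k))) := by
  have h := hf.deriv (C := (|(a : ℝ)| + 1) * 2 ^ (k + 1)) (k := k + 1) (fun m ↦ by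
    rw [coeff_toC, Complex.norm_intCast]
    have h1 : ((|((eisSer a k).coeff m : ℤ)| : ℤ) : ℝ) ≤
        (((|a| + 1) * ((m : ℤ) + 1) ^ (k + 1) : ℤ) : ℝ) := by
      exact_mod_cast abs_coeff_eisSer_le a k m
    push_cast at h1
    have h2 : ((m : ℝ) + 1) ^ (k + 1) ≤ 2 ^ (k + 1) * ((m : ℝ) ^ (k + 1) + 1) := by
      rcases Nat.eq_zero_or_pos m with rfl | hm
      · simp
        exact one_le_pow₀ (by norm_num)
      · have hm : (1 : ℝ) ≤ m := by exact_mod_cast hm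
        calc ((m : ℝ) + 1) ^ (k + 1) ≤ (2 * m) ^ (k + 1) := by gcongr; linarith
          _ = 2 ^ (k + 1) * (m : ℝ) ^ (k + 1) := mul_pow _ _ _
          _ ≤ _ := by gcongr; linarith
    have h3 : (0 : ℝ) ≤ |(a : ℝ)| + 1 := by positivity
    calc _ ≤ _ := h1
      _ ≤ (|(a : ℝ)| + 1) * (2 ^ (k + 1) * ((m : ℝ) ^ (k + 1) + 1)) := by gcongr
      _ = _ := by ring)
  have e : toC (theta ℤ (eisSer a k)) =
      PowerSeries.mk fun m ↦ (m : ℂ) * (toC (eisSer a k)).coeff m := by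
    ext m
    simp [coeff_theta, coeff_toC]
  rw [e]; exact h

theorem coeff_zero_eisSer (a : ℤ) (k : ℕ) : (eisSer a k).coeff 0 = 1 := by simp [eisSer]

theorem toC_injective : Injective toC := fun p q h ↦ by
  ext n
  have := congrArg (PowerSeries.coeff n) h
  simpa [coeff_toC] using this

theorem toC_natCast_mul (n : ℕ) (p : PowerSeries ℤ) : toC (n * p) = (n : ℂ) • toC p := by
  rw [map_mul, map_natCast]
  ext m
  rw [PowerSeries.coeff_smul, ← nsmul_eq_mul, map_nsmul, nsmul_eq_mul, smul_eq_mul]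

theorem constantCoeff_eisSer (a : ℤ) (k : ℕ) : PowerSeries.constantCoeff (eisSer a k) = 1 := by
  simpa using coeff_zero_eisSer a k

theorem constantCoeff_theta (p : PowerSeries ℤ) : PowerSeries.constantCoeff (theta ℤ p) = 0 := by
  simpa using coeff_theta p 0

theorem slash_E4 (γ : SL(2, ℤ)) : (E₄ : ℍ → ℂ) ∣[(4 : ℤ)] γ = E₄ :=
  SlashInvariantFormClass.slash_action_eq E₄ γ ⟨γ, rfl⟩

theorem slash_E6 (γ : SL(2, ℤ)) : (E₆ : ℍ → ℂ) ∣[(6 : ℤ)] γ = E₆ :=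
  SlashInvariantFormClass.slash_action_eq E₆ γ ⟨γ, rfl⟩

theorem ramanujan_Q : 3 * theta ℤ (eisSer 240 3) =
    eisSer (-24) 1 * eisSer 240 3 - eisSer (-504) 5 := by
  have h1 : HasQ ((3 : ℂ) • D E₄ - (E2 * E₄ - E₆)) (toC (3 * theta ℤ (eisSer 240 3) -
      (eisSer (-24) 1 * eisSer 240 3 - eisSer (-504) 5))) := by
    have := (hasQ_E4.theta_eisSer.smul 3).sub ((hasQ_E2.mul hasQ_E4).sub hasQ_E6)
    have e := toC_natCast_mul 3 (theta ℤ (eisSer 240 3))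
    push_cast at e
    rwa [map_sub, e, map_sub, map_mul]
  have h2 : ((3 : ℂ) • D E₄ - (E2 * E₄ - E₆)) = (3 : ℂ) • serreDerivative 4 E₄ + E₆ := by
    ext z
    simp
    ring
  rw [h2] at h1
  refine sub_eq_zero.mp
    (toC_injective ((levelOne_coeff_eq_zero (k := 6) (by norm_num) ?_ ?_ h1 ?_).trans
    (map_zero _).symm))
  · exact ((serreDerivative_mdifferentiable 4 E₄.holo').const_smul 3).add E₆.holo'
  · intro γ
    have := serreDerivative_slash_invariant (k := 4) E₄.holo' (slash_E4 γ)
    push_cast at this ⊢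
    rw [SlashAction.add_slash, ModularForm.SL_smul_slash, slash_E6]
    exact congrArg (fun x ↦ (3 : ℂ) • x + (E₆ : ℍ → ℂ)) this
  · rw [coeff_toC]
    simp [constantCoeff_eisSer, constantCoeff_theta]

theorem ramanujan_R : 2 * theta ℤ (eisSer (-504) 5) =
    eisSer (-24) 1 * eisSer (-504) 5 - eisSer 240 3 * eisSer 240 3 := by
  have h1 : HasQ ((2 : ℂ) • D E₆ - (E2 * E₆ - E₄ * E₄)) (toC (2 * theta ℤ (eisSer (-504) 5) -
      (eisSer (-24) 1 * eisSer (-504) 5 - eisSer 240 3 * eisSer 240 3))) := by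
    have := (hasQ_E6.theta_eisSer.smul 2).sub ((hasQ_E2.mul hasQ_E6).sub (hasQ_E4.mul hasQ_E4))
    have e := toC_natCast_mul 2 (theta ℤ (eisSer (-504) 5))
    push_cast at e
    rwa [map_sub, e, map_sub, map_mul, map_mul]
  have h2 : ((2 : ℂ) • D E₆ - (E2 * E₆ - E₄ * E₄)) = (2 : ℂ) • serreDerivative 6 E₆ + (E₄ : ℍ → ℂ)
    * E₄ := by
    ext z
    simp
    ring
  rw [h2] at h1
  refine sub_eq_zero.mp
    (toC_injective ((levelOne_coeff_eq_zero (k := 8) (by norm_num) ?_ ?_ h1 ?_).trans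
    (map_zero _).symm))
  · exact ((serreDerivative_mdifferentiable 6 E₆.holo').const_smul 2).add (E₄.holo'.mul E₄.holo')
  · intro γ
    have := serreDerivative_slash_invariant (k := 6) E₆.holo' (slash_E6 γ)
    have h44 := ModularForm.mul_slash_SL2 4 4 γ E₄ E₄
    rw [slash_E4] at h44
    push_cast at this ⊢
    rw [SlashAction.add_slash, ModularForm.SL_smul_slash]
    exact congrArg₂ (fun x y ↦ (2 : ℂ) • x + y) this h44
  · rw [coeff_toC]
    simp [constantCoeff_eisSer, constantCoeff_theta]

theorem D_D2 (γ : SL(2, ℤ)) (z : ℍ) :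
    D (D2 γ) z = -((γ 1 0 : ℂ) / denom γ z) ^ 2 := by
  have h := (hasDerivAt_denom_zpow (γ : GL (Fin 2) ℝ) (-1) z).const_mul
    (2 * Real.pi * Complex.I * (γ 1 0 : ℂ))
  have hev : (D2 γ ∘ ofComplex) =ᶠ[𝓝 (z : ℂ)]
      fun w ↦ 2 * Real.pi * Complex.I * (γ 1 0 : ℂ) * denom (γ : GL (Fin 2) ℝ) w ^ (-1 : ℤ) := by
    filter_upwards [isOpen_upperHalfPlaneSet.mem_nhds z.im_pos] with w hw
    simp [D2, ofComplex_apply_of_im_pos hw, div_eq_mul_inv]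
  have hz := denom_ne_zero γ z
  rw [Derivative.normalizedDerivOfComplex, hev.deriv_eq, h.deriv]
  have hpi := Complex.two_pi_I_ne_zero
  simp
  field_simp
  rw [Complex.I_sq]; ring

theorem mdifferentiable_D2 (γ : SL(2, ℤ)) : MDiff (D2 γ) := by
  have h := E2_slash_action γ
  have hm := E2_mdifferentiable.slash 2 (γ : GL (Fin 2) ℝ)
  have h0 : (1 / (2 * riemannZeta 2)) ≠ 0 := by
    rw [riemannZeta_two]
    have : (Real.pi : ℂ) ≠ 0 := by exact_mod_cast Real.pi_ne_zero
    simp [this]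
  have e : D2 γ = (1 / (2 * riemannZeta 2))⁻¹ • (E2 - E2 ∣[(2 : ℤ)] γ) := by
    rw [h, sub_sub_cancel, smul_smul, inv_mul_cancel₀ h0, one_smul]
  rw [e]
  exact (E2_mdifferentiable.sub hm).const_smul _

theorem slash_D_E2 (γ : SL(2, ℤ)) :
    ((12 : ℂ) • D E2 - E2 * E2) ∣[(4 : ℤ)] γ = (12 : ℂ) • D E2 - E2 * E2 := by
  have h := E2_slash_action γ
  have h1 := normalizedDerivOfComplex_SL_slash (k := 2) E2_mdifferentiable (γ := γ)
  have h2 := ModularForm.mul_slash_SL2 2 2 γ E2 E2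
  rw [h] at h1 h2
  rw [normalizedDerivOfComplex_sub _ _ E2_mdifferentiable ((mdifferentiable_D2 γ).const_smul _),
    normalizedDerivOfComplex_smul _ _ (mdifferentiable_D2 γ)] at h1
  have h2' : (E2 * E2) ∣[(4 : ℤ)] γ = _ := h2
  have h1' : D E2 ∣[(4 : ℤ)] γ = _ := (eq_add_of_sub_eq h1.symm)
  have h3 : ((12 : ℂ) • D E2 - E2 * E2) ∣[(4 : ℤ)] γ =
      (12 : ℂ) • (D E2 ∣[(4 : ℤ)] γ) - (E2 * E2) ∣[(4 : ℤ)] γ := by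
    ext z
    simp [ModularForm.SL_slash_apply, sub_mul, mul_assoc]
  rw [h3, h1', h2']
  ext z
  have hz := denom_ne_zero γ z
  have hpi : (Real.pi : ℂ) ≠ 0 := by exact_mod_cast Real.pi_ne_zero
  simp only [Pi.sub_apply, Pi.add_apply, Pi.smul_apply, Pi.mul_apply, smul_eq_mul, D_D2, D2,
    riemannZeta_two]
  generalize denom γ z = d at hz ⊢
  generalize ((γ 1 0 : ℤ) : ℂ) = c
  generalize D E2 z = e
  generalize E2 z = u
  push_cast
  have hI := Complex.I_sq
  field_simp
  ring_nf
  linear_combination (-72 * c ^ 2 * Complex.I + 24 * Real.pi * d * c * u) * hI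

theorem ramanujan_P : 12 * theta ℤ (eisSer (-24) 1) =
    eisSer (-24) 1 * eisSer (-24) 1 - eisSer 240 3 := by
  have h1 : HasQ ((12 : ℂ) • D E2 - (E2 * E2 - E₄)) (toC (12 * theta ℤ (eisSer (-24) 1) -
      (eisSer (-24) 1 * eisSer (-24) 1 - eisSer 240 3))) := by
    have := (hasQ_E2.theta_eisSer.smul 12).sub ((hasQ_E2.mul hasQ_E2).sub hasQ_E4)
    have e := toC_natCast_mul 12 (theta ℤ (eisSer (-24) 1))
    push_cast at e
    rwa [map_sub, e, map_sub, map_mul]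
  have h2 : ((12 : ℂ) • D E2 - (E2 * E2 - E₄)) = ((12 : ℂ) • D E2 - E2 * E2) + E₄ := by
    ext z
    simp
    ring
  rw [h2] at h1
  refine sub_eq_zero.mp (toC_injective
    ((levelOne_coeff_eq_zero (k := 4) (by norm_num) ?_ ?_ h1 ?_).trans (map_zero _).symm))
  · exact (((normalizedDerivOfComplex_mdifferentiable E2_mdifferentiable).const_smul 12).sub
      (E2_mdifferentiable.mul E2_mdifferentiable)).add E₄.holo'
  · intro γ
    have h3 := slash_D_E2 γ
    have h4 := slash_E4 γ
    push_cast
    rw [SlashAction.add_slash]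
    exact congrArg₂ (fun x y ↦ x + y) h3 h4
  · rw [coeff_toC]
    simp [constantCoeff_eisSer, constantCoeff_theta]

end NestPi

namespace NestPi

open UpperHalfPlane hiding I
open ModularForm MatrixGroups EisensteinSeries Function

/-- Ramanujan's series `P`, `Q`, `R`. -/
noncomputable def ser : Fin 3 → PowerSeries ℤ := ![eisSer (-24) 1, eisSer 240 3, eisSer (-504) 5]

/-- The value of `E₄` at `i`. -/
noncomputable def omega : ℝ := (E₄ UpperHalfPlane.I).re

theorem E2_I : E2 UpperHalfPlane.I = 3 / Real.pi := by
  have h := congrFun (E2_slash_action ModularGroup.S) UpperHalfPlane.I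
  rw [ModularForm.SL_slash_apply] at h
  have hS : ModularGroup.S • UpperHalfPlane.I = UpperHalfPlane.I := by
    rw [modular_S_smul]; ext; simp [UpperHalfPlane.I]
  have hpi : (Real.pi : ℂ) ≠ 0 := by exact_mod_cast Real.pi_ne_zero
  have hI : ((UpperHalfPlane.I : ℍ) : ℂ) = Complex.I := rfl
  rw [ModularGroup.denom_S] at h
  simp only [hS, Pi.sub_apply, Pi.smul_apply, D2_S, riemannZeta_two, hI,
    smul_eq_mul] at h
  have e : Complex.I ^ (-2 : ℤ) = -1 := by
    rw [zpow_neg]; norm_cast; simp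
  rw [e] at h
  field_simp at h ⊢
  linear_combination (-1/2 : ℂ) * h

theorem E6_I : E₆ UpperHalfPlane.I = 0 := by
  have h := congrFun (slash_E6 ModularGroup.S) UpperHalfPlane.I
  rw [ModularForm.SL_slash_apply] at h
  have hS : ModularGroup.S • UpperHalfPlane.I = UpperHalfPlane.I := by
    rw [modular_S_smul]; ext; simp [UpperHalfPlane.I]
  have hI : ((UpperHalfPlane.I : ℍ) : ℂ) = Complex.I := rfl
  have e : Complex.I ^ (-6 : ℤ) = -1 := by
    rw [zpow_neg]; norm_cast; rw [Complex.I_pow_eq_pow_mod]; simp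
  rw [ModularGroup.denom_S, hS, hI, e] at h
  linear_combination (-1/2 : ℂ) * h

theorem exists_nome (c d : ℤ) (h : IsCoprime c d) : ∃ q : ℂ,
    ‖q‖ = Real.exp (-(2 * Real.pi) / (c ^ 2 + d ^ 2)) ∧
    HasSum (fun n ↦ (((ser 0).coeff n : ℤ) : ℂ) * q ^ n) (3 / Real.pi * (c ^ 2 + d ^ 2)) ∧
    HasSum (fun n ↦ (((ser 1).coeff n : ℤ) : ℂ) * q ^ n)
      (E₄ UpperHalfPlane.I * (d + c * Complex.I) ^ 4) ∧
    HasSum (fun n ↦ (((ser 2).coeff n : ℤ) : ℂ) * q ^ n) 0 := by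
  obtain ⟨γ, -, hγ⟩ := ModularGroup.bottom_row_surj (R := ℤ) (show ![c, d] ∈ _ by simpa using h)
  have h0 : γ 1 0 = c := by simpa using congrFun hγ 0
  have h1 : γ 1 1 = d := by simpa using congrFun hγ 1
  have hI : ((UpperHalfPlane.I : ℍ) : ℂ) = Complex.I := rfl
  have hden : denom γ UpperHalfPlane.I = d + c * Complex.I := by
    rw [ModularGroup.denom_apply, h0, h1, hI]; ring
  have hne := denom_ne_zero γ UpperHalfPlane.I
  have hns : Complex.normSq (denom γ UpperHalfPlane.I) = c ^ 2 + d ^ 2 := by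
    rw [hden, Complex.normSq_apply]
    simp; ring
  have hQ := congrFun (slash_E4 γ) UpperHalfPlane.I
  have hR := congrFun (slash_E6 γ) UpperHalfPlane.I
  have hP := congrFun (E2_slash_action γ) UpperHalfPlane.I
  have hpi : (Real.pi : ℂ) ≠ 0 := by exact_mod_cast Real.pi_ne_zero
  rw [ModularForm.SL_slash_apply] at hQ hR hP
  rw [hden] at hQ hR hP
  rw [hden] at hne
  rw [E6_I, mul_eq_zero, or_iff_left (zpow_ne_zero _ hne)] at hR
  rw [zpow_neg, mul_inv_eq_iff_eq_mul₀ (zpow_ne_zero _ hne)] at hQ hP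
  simp only [Pi.sub_apply, Pi.smul_apply, D2, E2_I, riemannZeta_two, smul_eq_mul, h0, hden] at hP
  have hP' : E2 (γ • UpperHalfPlane.I) = 3 / Real.pi * (c ^ 2 + d ^ 2) := by
    rw [hP]
    have hI := Complex.I_sq
    generalize (d : ℂ) = d' at hne ⊢
    generalize (c : ℂ) = c' at hne ⊢
    have hw : c' ^ 2 + d' ^ 2 = (d' + c' * Complex.I) * (d' + c' * Complex.I - 2 * c' * Complex.I)
      := by
      linear_combination (c' ^ 2) * hI
    rw [hw]
    generalize d' + c' * Complex.I = w at hne ⊢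
    field_simp
    ring
  refine ⟨Periodic.qParam 1 (γ • UpperHalfPlane.I : ℍ), ?_, ?_, ?_, ?_⟩
  · rw [Periodic.norm_qParam, show ((γ • UpperHalfPlane.I : ℍ) : ℂ).im =
      (γ • UpperHalfPlane.I : ℍ).im from rfl, ModularGroup.im_smul_eq_div_normSq, hns, I_im]
    congr 1
    ring
  · have := hasQ_E2 (γ • UpperHalfPlane.I)
    rw [hP'] at this
    simpa [coeff_toC, ser] using this
  · have := hasQ_E4 (γ • UpperHalfPlane.I)
    rw [hQ] at this
    simpa [coeff_toC, ser] using this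
  · have := hasQ_E6 (γ • UpperHalfPlane.I)
    rw [hR] at this
    simpa [coeff_toC, ser] using this

theorem hasSum_real_of_I (f : ℍ → ℂ) (p : PowerSeries ℤ) (hf : HasQ f (toC p)) :
    HasSum (fun n ↦ ((p.coeff n : ℤ) : ℝ) * Real.exp (-(2 * Real.pi)) ^ n)
      (f UpperHalfPlane.I).re := by
  have hI : ((UpperHalfPlane.I : ℍ) : ℂ) = Complex.I := rfl
  have hq : Periodic.qParam 1 (UpperHalfPlane.I : ℍ) = (Real.exp (-(2 * Real.pi)) : ℝ) := by
    rw [Periodic.qParam, hI]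
    push_cast
    congr 1
    linear_combination (2 * Real.pi : ℂ) * Complex.I_sq
  have h := hf UpperHalfPlane.I
  rw [hq] at h
  have h2 := Complex.hasSum_re h
  convert! h2 using 2 with n
  rw [coeff_toC, smul_eq_mul]
  norm_cast

theorem omega_hasSum :
    HasSum (fun n ↦ (((ser 1).coeff n : ℤ) : ℝ) * Real.exp (-(2 * Real.pi)) ^ n) omega :=
  hasSum_real_of_I _ _ hasQ_E4

theorem omega_ge_one : 1 ≤ omega := by
  have h := omega_hasSum
  have h1 : ∀ n, 0 ≤ (((ser 1).coeff n : ℤ) : ℝ) * Real.exp (-(2 * Real.pi)) ^ n := fun n ↦ by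
    have : (0 : ℤ) ≤ (ser 1).coeff n := by
      simp only [ser, Matrix.cons_val_one, Matrix.cons_val_zero, eisSer, PowerSeries.coeff_mk]
      split_ifs <;> positivity
    have : (0 : ℝ) ≤ ((ser 1).coeff n : ℤ) := by exact_mod_cast this
    positivity
  have h2 := le_hasSum h 0 (fun n _ ↦ h1 n)
  simpa [ser, constantCoeff_eisSer] using h2

theorem E4_I : E₄ UpperHalfPlane.I = omega := by
  have h := hasQ_E4 UpperHalfPlane.I
  refine h.unique ?_
  have hI : ((UpperHalfPlane.I : ℍ) : ℂ) = Complex.I := rfl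
  have hq : Periodic.qParam 1 (UpperHalfPlane.I : ℍ) = (Real.exp (-(2 * Real.pi)) : ℝ) := by
    rw [Periodic.qParam, hI]
    push_cast
    congr 1
    linear_combination (2 * Real.pi : ℂ) * Complex.I_sq
  have h2 := Complex.hasSum_ofReal.mpr omega_hasSum
  convert! h2 using 2 with n
  rw [coeff_toC, smul_eq_mul, hq]
  simp [ser]

/-- The point `(P(q₀), Q(q₀), R(q₀))` with `q₀ = e^{-2π}`. -/
noncomputable def pt : Fin 3 → ℝ := ![3 / Real.pi, omega, 0]

theorem hasSum_ser (i : Fin 3) :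
    HasSum (fun n ↦ (((ser i).coeff n : ℤ) : ℝ) * Real.exp (-(2 * Real.pi)) ^ n) (pt i) := by
  fin_cases i
  · have := hasSum_real_of_I _ _ hasQ_E2
    rw [E2_I] at this
    have e : (3 / (Real.pi : ℂ)).re = 3 / Real.pi := by norm_cast
    rw [e] at this
    exact this
  · exact omega_hasSum
  · have := hasSum_real_of_I _ _ hasQ_E6
    rw [E6_I] at this
    exact this

end NestPi

namespace NestPi

open Finset
open MvPolynomial (X C monomial aeval)

/-- The sum of the absolute values of the coefficients. -/
noncomputable def mlen (f : MvPolynomial (Fin 3) ℤ) : ℝ := ∑ m ∈ f.support, |((f.coeff m : ℤ) : ℝ)|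

theorem mlen_eq_of_subset {f : MvPolynomial (Fin 3) ℤ} {s : Finset (Fin 3 →₀ ℕ)}
    (h : f.support ⊆ s) : mlen f = ∑ m ∈ s, |((f.coeff m : ℤ) : ℝ)| :=
  Finset.sum_subset h fun m _ hm ↦ by simp [MvPolynomial.notMem_support_iff.mp hm]

theorem mlen_monomial_le (m : Fin 3 →₀ ℕ) (a : ℤ) : mlen (monomial m a) ≤ |(a : ℝ)| := by
  rw [mlen_eq_of_subset MvPolynomial.support_monomial_subset]
  simp

theorem mlen_add_le (f g : MvPolynomial (Fin 3) ℤ) : mlen (f + g) ≤ mlen f + mlen g := by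
  rw [mlen_eq_of_subset (f := f) (s := f.support ∪ g.support) subset_union_left,
    mlen_eq_of_subset (f := g) (s := f.support ∪ g.support) subset_union_right,
    mlen_eq_of_subset MvPolynomial.support_add, ← Finset.sum_add_distrib]
  refine Finset.sum_le_sum fun m _ ↦ ?_
  rw [MvPolynomial.coeff_add]
  push_cast
  exact abs_add_le _ _

theorem mlen_nonneg (f : MvPolynomial (Fin 3) ℤ) : 0 ≤ mlen f :=
  Finset.sum_nonneg fun _ _ ↦ abs_nonneg _

theorem mlen_sum_le {ι : Type*} (s : Finset ι) (f : ι → MvPolynomial (Fin 3) ℤ) :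
    mlen (∑ i ∈ s, f i) ≤ ∑ i ∈ s, mlen (f i) := by
  classical
  induction s using Finset.induction_on with
  | empty => simp [mlen]
  | insert a s ha ih =>
    rw [Finset.sum_insert ha, Finset.sum_insert ha]
    exact (mlen_add_le _ _).trans (by gcongr)

theorem isLen_mlen : IsLen mlen where
  nonneg := mlen_nonneg
  zero := by simp [mlen]
  one := by simpa using mlen_monomial_le 0 1
  neg f := by simp [mlen]
  add := mlen_add_le
  mul f g := by
    conv_lhs => rw [f.as_sum, g.as_sum, Finset.sum_mul_sum]
    refine (mlen_sum_le _ _).trans ?_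
    rw [mlen, mlen, Finset.sum_mul_sum]
    refine Finset.sum_le_sum fun m _ ↦ (mlen_sum_le _ _).trans (Finset.sum_le_sum fun n _ ↦ ?_)
    rw [MvPolynomial.monomial_mul]
    refine (mlen_monomial_le _ _).trans (le_of_eq ?_)
    push_cast
    exact abs_mul _ _

theorem one_le_mlen {f : MvPolynomial (Fin 3) ℤ} (hf : f ≠ 0) : 1 ≤ mlen f := by
  obtain ⟨m, hm⟩ := MvPolynomial.support_nonempty.mpr hf
  have h1 : (1 : ℝ) ≤ |((f.coeff m : ℤ) : ℝ)| := by
    have := Int.one_le_abs (MvPolynomial.mem_support_iff.mp hm)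
    exact_mod_cast this
  exact h1.trans (Finset.single_le_sum (f := fun m ↦ |((f.coeff m : ℤ) : ℝ)|)
    (fun _ _ ↦ abs_nonneg _) hm)

theorem mlen_X_le (i : Fin 3) : mlen (X i) ≤ 1 := by
  simpa [X] using mlen_monomial_le (Finsupp.single i 1) 1

theorem IsLen.intCast {A : Type*} [CommRing A] {N : A → ℝ} (h : IsLen N) (n : ℤ) :
    N (n : A) ≤ |(n : ℝ)| := by
  have hnat : ∀ n : ℕ, N (n : A) ≤ n := fun n ↦ by
    induction n with
    | zero => simp [h.zero]
    | succ n ih =>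
      push_cast
      exact (h.add _ _).trans (add_le_add ih h.one)
  rcases Int.eq_nat_or_neg n with ⟨k, rfl | rfl⟩
  · simpa using hnat k
  · simpa [h.neg] using hnat k

theorem len_prod_pow_le {A : Type*} [CommRing A] {N : A → ℝ} (h : IsLen N) {R : ℝ} (hR : 1 ≤ R)
    {g : Fin 3 → A} (hg : ∀ i, N (g i) ≤ R) {k : ℕ} {m : Fin 3 →₀ ℕ} (hm : m.degree ≤ k) :
    N (m.prod fun i n ↦ g i ^ n) ≤ R ^ k := by
  refine (h.prod _ _).trans ?_
  calc ∏ i ∈ m.support, N (g i ^ m i) ≤ ∏ i ∈ m.support, R ^ m i :=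
        Finset.prod_le_prod (fun _ _ ↦ h.nonneg _) fun i _ ↦
          (h.pow _ _).trans (pow_le_pow_left₀ (h.nonneg _) (hg i) _)
    _ = R ^ m.degree := by rw [Finset.prod_pow_eq_pow_sum]; rfl
    _ ≤ R ^ k := pow_le_pow_right₀ hR hm

theorem degree_le_of_mem_support {f : MvPolynomial (Fin 3) ℤ} {m : Fin 3 →₀ ℕ}
    (hm : m ∈ f.support) : m.degree ≤ f.totalDegree := MvPolynomial.le_totalDegree hm

theorem len_aeval_le {A : Type*} [CommRing A] {N : A → ℝ} (h : IsLen N) {R : ℝ} (hR : 1 ≤ R)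
    {g : Fin 3 → A} (hg : ∀ i, N (g i) ≤ R) {k : ℕ} {f : MvPolynomial (Fin 3) ℤ}
    (hf : f.totalDegree ≤ k) : N (aeval g f) ≤ mlen f * R ^ k := by
  rw [MvPolynomial.aeval_def, MvPolynomial.eval₂_eq, mlen, Finset.sum_mul]
  refine (h.sum _ _).trans (Finset.sum_le_sum fun m hm ↦ (h.mul _ _).trans ?_)
  gcongr
  · exact h.nonneg _
  · simpa using h.intCast (f.coeff m)
  · exact len_prod_pow_le h hR hg ((degree_le_of_mem_support hm).trans hf)

/-- The derivation on `ℤ[x₁, x₂, x₃]` corresponding to `12 z d/dz` under Ramanujan's identities. -/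
noncomputable def dlt : Derivation ℤ (MvPolynomial (Fin 3) ℤ) (MvPolynomial (Fin 3) ℤ) :=
  MvPolynomial.mkDerivation ℤ
    ![X 0 ^ 2 - X 1, 4 * (X 0 * X 1 - X 2), 6 * (X 0 * X 2 - X 1 ^ 2)]

/-- Substitution of Ramanujan's series. -/
noncomputable def eS : MvPolynomial (Fin 3) ℤ →ₐ[ℤ] PowerSeries ℤ := aeval ser

theorem eS_dlt (f : MvPolynomial (Fin 3) ℤ) : eS (dlt f) = 12 * theta ℤ (eS f) := by
  have hX : ∀ i, eS (X i) = ser i := fun i ↦ by simp [eS]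
  induction f using MvPolynomial.induction_on with
  | C a => simp [dlt, eS]
  | add p q hp hq => rw [map_add, map_add, hp, hq, map_add, map_add, mul_add]
  | mul_X p i hp =>
    rw [Derivation.leibniz, map_add, map_mul, Derivation.leibniz, smul_eq_mul, smul_eq_mul, map_mul,
      map_mul, hp]
    have : eS (dlt (X i)) = 12 * theta ℤ (eS (X i)) := by
      rw [dlt, MvPolynomial.mkDerivation_X]
      fin_cases i
      · have e := ramanujan_P
        simp only [Fin.zero_eta, Matrix.cons_val_zero, map_sub, map_pow, hX]
        simp only [ser, Matrix.cons_val]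
        linear_combination -e
      · have e := ramanujan_Q
        simp only [Fin.mk_one, Matrix.cons_val_one, Matrix.cons_val_zero, map_sub, map_mul, hX,
          map_ofNat]
        simp only [ser, Matrix.cons_val]
        linear_combination -4 * e
      · have e := ramanujan_R
        simp only [Fin.reduceFinMk, Matrix.cons_val, map_sub, map_mul, map_pow, hX, map_ofNat]
        simp only [ser, Matrix.cons_val]
        linear_combination -6 * e
    rw [this]
    simp only [smul_eq_mul]
    ring

theorem dlt_bounds (i : Fin 3) : (dlt (X i)).totalDegree ≤ 2 ∧ mlen (dlt (X i)) ≤ 12 := by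
  have hL := isLen_mlen
  have t4 : ∀ n : ℕ, (n : MvPolynomial (Fin 3) ℤ).totalDegree = 0 := fun n ↦ by
    rw [← map_natCast (MvPolynomial.C : ℤ →+* _) n, MvPolynomial.totalDegree_C]
  have tX : ∀ i : Fin 3, (X i : MvPolynomial (Fin 3) ℤ).totalDegree = 1 :=
    fun i ↦ MvPolynomial.totalDegree_X i
  have tXX : ∀ i j : Fin 3, (X i * X j : MvPolynomial (Fin 3) ℤ).totalDegree ≤ 2 := fun i j ↦
    (MvPolynomial.totalDegree_mul _ _).trans (by rw [tX, tX])
  have lXX : ∀ i j : Fin 3, mlen (X i * X j) ≤ 1 := fun i j ↦ (hL.mul _ _).trans (by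
    nlinarith [mlen_X_le i, mlen_X_le j, mlen_nonneg (X i), mlen_nonneg (X j)])
  have key : ∀ (n : ℕ) (a b : MvPolynomial (Fin 3) ℤ), a.totalDegree ≤ 2 → b.totalDegree ≤ 2 →
      mlen a ≤ 1 → mlen b ≤ 1 → n ≤ 6 → (n * (a - b)).totalDegree ≤ 2 ∧ mlen (n * (a - b)) ≤ 12 :=
        by
    intro n a b ha hb la lb hn
    refine ⟨(MvPolynomial.totalDegree_mul _ _).trans ?_, (hL.mul _ _).trans ?_⟩
    · rw [t4, zero_add]
      exact (MvPolynomial.totalDegree_sub _ _).trans (max_le ha hb)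
    · have h1 : mlen (a - b) ≤ 2 := (hL.sub _ _).trans (by linarith)
      have h2 := hL.intCast (n : ℤ)
      simp only [Int.cast_natCast, Nat.abs_cast] at h2
      have h3 : (n : ℝ) ≤ 6 := by exact_mod_cast hn
      nlinarith [mlen_nonneg (a - b), mlen_nonneg (n : MvPolynomial (Fin 3) ℤ)]
  rw [dlt, MvPolynomial.mkDerivation_X]
  fin_cases i
  · have := key 1 (X 0 * X 0) (X 1) (tXX _ _) (by rw [tX]; norm_num) (lXX _ _) (mlen_X_le _)
      (by norm_num)
    simpa [sq] using this
  · simpa using key 4 (X 0 * X 1) (X 2) (tXX _ _) (by rw [tX]; norm_num) (lXX _ _) (mlen_X_le _)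
      (by norm_num)
  · simpa [sq] using key 6 (X 0 * X 2) (X 1 * X 1) (tXX _ _) (tXX _ _) (lXX _ _) (lXX _ _)
      (by norm_num)

theorem dlt_monomial_bounds (m : Fin 3 →₀ ℕ) (a : ℤ) :
    (dlt (monomial m a)).totalDegree ≤ m.degree + 1 ∧
      mlen (dlt (monomial m a)) ≤ |(a : ℝ)| * (12 * m.degree) := by
  have hL := isLen_mlen
  have e : dlt (monomial m a) =
      ∑ i ∈ m.support, monomial (m - Finsupp.single i 1) (a * (m i : ℤ)) * dlt (X i) := by
    have hX : ∀ i, dlt (X i) = (![X 0 ^ 2 - X 1, 4 * (X 0 * X 1 - X 2), 6 * (X 0 * X 2 - X 1 ^ 2)] :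
      Fin 3 → MvPolynomial (Fin 3) ℤ) i := fun i ↦ MvPolynomial.mkDerivation_X _ _ _
    simp only [hX]
    rw [dlt, MvPolynomial.mkDerivation_monomial, Finsupp.sum, Finset.smul_sum]
    refine Finset.sum_congr rfl fun i _ ↦ ?_
    rw [smul_eq_mul, ← smul_mul_assoc, MvPolynomial.smul_monomial, smul_eq_mul]
  rw [e]
  constructor
  · refine MvPolynomial.totalDegree_finsetSum_le fun i hi ↦ ?_
    refine (MvPolynomial.totalDegree_mul _ _).trans ?_
    have h1 : (monomial (m - Finsupp.single i 1) (a * (m i : ℤ))).totalDegree ≤ m.degree - 1 := by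
      refine (MvPolynomial.totalDegree_monomial_le _ _).trans ?_
      have h2 : (m - Finsupp.single i 1) + Finsupp.single i 1 = m :=
        tsub_add_cancel_of_le (by
          rw [Finsupp.single_le_iff]
          exact Nat.one_le_iff_ne_zero.mpr (Finsupp.mem_support_iff.mp hi))
      have h3 := congrArg Finsupp.degree h2
      rw [map_add, Finsupp.degree_single] at h3
      change (m - Finsupp.single i 1).degree ≤ _
      omega
    have h2 : 1 ≤ m.degree := by
      have := Finset.single_le_sum (f := fun i ↦ m i) (fun _ _ ↦ Nat.zero_le _) hi
      have h3 := Nat.one_le_iff_ne_zero.mpr (Finsupp.mem_support_iff.mp hi)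
      exact h3.trans this
    have := (dlt_bounds i).1
    omega
  · refine (hL.sum _ _).trans ?_
    have h1 : (m.degree : ℝ) = ∑ i ∈ m.support, (m i : ℝ) := by
      rw [Finsupp.degree_apply]; push_cast; rfl
    rw [h1, Finset.mul_sum, Finset.mul_sum]
    refine Finset.sum_le_sum fun i _ ↦ (hL.mul _ _).trans ?_
    have h2 := mlen_monomial_le (m - Finsupp.single i 1) (a * (m i : ℤ))
    push_cast at h2
    rw [abs_mul, Nat.abs_cast] at h2
    have h3 := (dlt_bounds i).2
    calc _ ≤ (|(a : ℝ)| * m i) * 12 := mul_le_mul h2 h3 (mlen_nonneg _) (by positivity)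
      _ = _ := by ring

theorem dlt_totalDegree_le (f : MvPolynomial (Fin 3) ℤ) :
    (dlt f).totalDegree ≤ f.totalDegree + 1 := by
  conv_lhs => rw [f.as_sum, map_sum]
  refine MvPolynomial.totalDegree_finsetSum_le fun m hm ↦ (dlt_monomial_bounds _ _).1.trans ?_
  have := degree_le_of_mem_support hm
  omega

theorem mlen_dlt_le {f : MvPolynomial (Fin 3) ℤ} {k : ℕ} (hf : f.totalDegree ≤ k) :
    mlen (dlt f) ≤ 12 * k * mlen f := by
  conv_lhs => rw [f.as_sum, map_sum]
  refine (mlen_sum_le _ _).trans ?_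
  rw [mlen, Finset.mul_sum]
  refine Finset.sum_le_sum fun m hm ↦ (dlt_monomial_bounds _ _).2.trans ?_
  have : (m.degree : ℝ) ≤ k := by exact_mod_cast (degree_le_of_mem_support hm).trans hf
  rw [mul_comm]
  gcongr

end NestPi

namespace NestPi

open Finset
open MvPolynomial (X C monomial aeval)

/-- The power series `p` sums to `v` at `q`. -/
def HasEv (p : PowerSeries ℤ) (q v : ℂ) : Prop :=
  HasSum (fun n ↦ ((p.coeff n : ℤ) : ℂ) * q ^ n) v

theorem HasEv.add {p r : PowerSeries ℤ} {q v w : ℂ} (hp : HasEv p q v) (hr : HasEv r q w) :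
    HasEv (p + r) q (v + w) := by
  simpa [HasEv, add_mul] using HasSum.add hp hr

theorem HasEv.mul {p r : PowerSeries ℤ} {q v w : ℂ} (hp : HasEv p q v) (hr : HasEv r q w) :
    HasEv (p * r) q (v * w) := by
  have h1 := hp.summable.norm
  have h2 := hr.summable.norm
  have h3 := summable_norm_sum_mul_antidiagonal_of_summable_norm h1 h2
  have h4 := tsum_mul_tsum_eq_tsum_sum_antidiagonal_of_summable_norm h1 h2
  rw [hp.tsum_eq, hr.tsum_eq] at h4
  rw [h4, HasEv]
  convert! h3.of_norm.hasSum using 2 with n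
  rw [PowerSeries.coeff_mul]
  push_cast
  rw [Finset.sum_mul]
  refine Finset.sum_congr rfl fun x hx ↦ ?_
  rw [← mem_antidiagonal.mp hx, pow_add]
  ring

theorem HasEv.intCast (a : ℤ) (q : ℂ) : HasEv (a : PowerSeries ℤ) q a := by
  have := hasSum_single (f := fun n ↦ (((a : PowerSeries ℤ).coeff n : ℤ) : ℂ) * q ^ n) 0
    (fun n hn ↦ by
      rw [← map_intCast (PowerSeries.C : ℤ →+* _), PowerSeries.coeff_C, if_neg (by exact hn)]; simp)
  simpa [HasEv] using this

theorem HasEv.X_pow_mul {p : PowerSeries ℤ} {q v : ℂ} (hp : HasEv p q v) (j : ℕ) :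
    HasEv (PowerSeries.X ^ j * p) q (q ^ j * v) := by
  refine HasEv.mul ?_ hp
  have := hasSum_single (f := fun n ↦ (((PowerSeries.X ^ j : PowerSeries ℤ).coeff n : ℤ) : ℂ)
    * q ^ n)
    j (fun n hn ↦ by rw [PowerSeries.coeff_X_pow, if_neg hn]; simp)
  simpa [HasEv, PowerSeries.coeff_X_pow] using this

theorem HasEv.sum {ι : Type*} (s : Finset ι) {p : ι → PowerSeries ℤ} {q : ℂ} {v : ι → ℂ}
    (h : ∀ i ∈ s, HasEv (p i) q (v i)) : HasEv (∑ i ∈ s, p i) q (∑ i ∈ s, v i) := by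
  classical
  induction s using Finset.induction_on with
  | empty => simpa using HasEv.intCast 0 q
  | insert a s ha ih =>
    rw [Finset.sum_insert ha, Finset.sum_insert ha]
    exact (h a (mem_insert_self _ _)).add (ih fun i hi ↦ h i (mem_insert_of_mem hi))

theorem HasEv.eS {q : ℂ} {v : Fin 3 → ℂ} (h : ∀ i, HasEv (ser i) q (v i))
    (f : MvPolynomial (Fin 3) ℤ) : HasEv (eS f) q (aeval v f) := by
  induction f using MvPolynomial.induction_on with
  | C a =>
    have := HasEv.intCast a q
    have e1 : NestPi.eS (C a) = (a : PowerSeries ℤ) := by simp [NestPi.eS]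
    have e2 : aeval v (C a : MvPolynomial (Fin 3) ℤ) = (a : ℂ) := by simp
    rwa [e1, e2]
  | add p r hp hr => rw [map_add, map_add]; exact hp.add hr
  | mul_X p i hp =>
    rw [map_mul, map_mul]
    refine hp.mul ?_
    simpa [NestPi.eS] using h i

/-- Polynomial growth of the coefficients of a power series. -/
def Growth (a : ℝ) (s : ℕ) (p : PowerSeries ℤ) : Prop :=
  ∀ m, |((p.coeff m : ℤ) : ℝ)| ≤ a * ((m : ℝ) + 1) ^ s

theorem Growth.mul {a b : ℝ} {s t : ℕ} {p r : PowerSeries ℤ} (ha : 0 ≤ a) (hb : 0 ≤ b)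
    (hp : Growth a s p) (hr : Growth b t r) : Growth (a * b) (s + t + 1) (p * r) := fun m ↦ by
  rw [PowerSeries.coeff_mul]
  push_cast
  have h1 : ∀ x ∈ antidiagonal m, |(p.coeff x.1 : ℝ) * (r.coeff x.2 : ℝ)| ≤
      a * b * ((m : ℝ) + 1) ^ (s + t) := fun x hx ↦ by
    have hx := mem_antidiagonal.mp hx
    have h1 : (x.1 : ℝ) ≤ m := by exact_mod_cast (show x.1 ≤ m by omega)
    have h2 : (x.2 : ℝ) ≤ m := by exact_mod_cast (show x.2 ≤ m by omega)
    rw [abs_mul]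
    calc _ ≤ (a * ((x.1 : ℝ) + 1) ^ s) * (b * ((x.2 : ℝ) + 1) ^ t) := by
          gcongr
          · exact hp _
          · exact hr _
      _ ≤ (a * ((m : ℝ) + 1) ^ s) * (b * ((m : ℝ) + 1) ^ t) := by gcongr
      _ = _ := by ring
  refine (abs_sum_le_sum_abs _ _).trans ((Finset.sum_le_sum h1).trans (le_of_eq ?_))
  rw [Finset.sum_const, Nat.card_antidiagonal, nsmul_eq_mul]
  push_cast
  ring

theorem growth_ser (i : Fin 3) : Growth 505 6 (ser i) := fun m ↦ by
  have key : ∀ (a : ℤ) (k : ℕ), |a| ≤ 504 → k ≤ 5 →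
      |(((eisSer a k).coeff m : ℤ) : ℝ)| ≤ 505 * ((m : ℝ) + 1) ^ 6 := fun a k ha hk ↦ by
    have h1 : (((|(eisSer a k).coeff m| : ℤ)) : ℝ) ≤ (((|a| + 1) * ((m : ℤ) + 1) ^ (k + 1) : ℤ) :
      ℝ) := by
      exact_mod_cast abs_coeff_eisSer_le a k m
    push_cast at h1
    have h2 : |(a : ℝ)| ≤ 504 := by exact_mod_cast ha
    refine h1.trans (mul_le_mul (by linarith) (pow_le_pow_right₀ ?_ (by omega)) (by positivity)
      (by norm_num))
    linarith [(Nat.cast_nonneg m : (0 : ℝ) ≤ m)]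
  fin_cases i
  · exact key (-24) 1 (by norm_num) (by norm_num)
  · exact key 240 3 (by norm_num) (by norm_num)
  · exact key (-504) 5 (by norm_num) (by norm_num)

theorem growth_monomial (k : ℕ) : ∀ m : Fin 3 →₀ ℕ, m.degree = k →
    Growth (505 ^ k) (7 * k) (eS (monomial m 1)) := by
  induction k with
  | zero =>
    intro m hm
    rw [Finsupp.degree_eq_zero_iff] at hm
    subst hm
    intro n
    have : eS (monomial 0 1) = 1 := map_one eS
    rw [this, PowerSeries.coeff_one]
    split_ifs <;> simp
  | succ k ih =>
    intro m hm
    obtain ⟨i, hi⟩ : ∃ i, i ∈ m.support := by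
      by_contra! h
      have : m = 0 := Finsupp.support_eq_empty.mp (Finset.eq_empty_of_forall_notMem h)
      subst this
      simp at hm
    have h2 : (m - Finsupp.single i 1) + Finsupp.single i 1 = m :=
      tsub_add_cancel_of_le (by
        rw [Finsupp.single_le_iff]
        exact Nat.one_le_iff_ne_zero.mpr (Finsupp.mem_support_iff.mp hi))
    have h3 := congrArg Finsupp.degree h2
    rw [map_add, Finsupp.degree_single, hm] at h3
    have h4 := (ih (m - Finsupp.single i 1) (by omega)).mul (by positivity) (by norm_num)
      (growth_ser i)
    have e : eS (monomial m 1) = eS (monomial (m - Finsupp.single i 1) 1) * ser i := by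
      have : ser i = eS (monomial (Finsupp.single i 1) 1) := by
        change _ = eS (X i)
        simp [eS]
      rw [this, ← map_mul, MvPolynomial.monomial_mul, h2, one_mul]
    rw [e]
    have e2 : 7 * (k + 1) = 7 * k + 6 + 1 := by ring
    rw [pow_succ, e2]
    exact h4

theorem growth_eS {f : MvPolynomial (Fin 3) ℤ} {k : ℕ} (hf : f.totalDegree ≤ k) :
    Growth (mlen f * 505 ^ k) (7 * k) (eS f) := fun n ↦ by
  have e : ((eS f).coeff n : ℤ) = ∑ m ∈ f.support, f.coeff m * (eS (monomial m 1)).coeff n := by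
    conv_lhs => rw [f.as_sum, map_sum, map_sum]
    refine Finset.sum_congr rfl fun m _ ↦ ?_
    have : (monomial m (f.coeff m) : MvPolynomial (Fin 3) ℤ) = f.coeff m • monomial m 1 := by
      rw [MvPolynomial.smul_monomial, smul_eq_mul, mul_one]
    rw [this, map_smul, map_zsmul, smul_eq_mul]
  rw [e]
  push_cast
  rw [mlen, Finset.sum_mul, Finset.sum_mul]
  refine (abs_sum_le_sum_abs _ _).trans (Finset.sum_le_sum fun m hm ↦ ?_)
  rw [abs_mul, mul_assoc]
  have h1 := growth_monomial _ m rfl n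
  have h2 : m.degree ≤ k := (degree_le_of_mem_support hm).trans hf
  gcongr
  refine h1.trans ?_
  have h3 : (1 : ℝ) ≤ (n : ℝ) + 1 := by linarith [(Nat.cast_nonneg n : (0 : ℝ) ≤ n)]
  gcongr
  norm_num

theorem pow_le_factorial_mul_exp {t : ℝ} (ht : 0 < t) (K m : ℕ) :
    ((m : ℝ) + 1) ^ K ≤ K.factorial * t⁻¹ ^ K * Real.exp (t * (m + 1)) := by
  have h := Real.pow_div_factorial_le_exp (t * ((m : ℝ) + 1)) (by positivity) K
  rw [div_le_iff₀ (by positivity)] at h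
  rw [inv_pow, mul_assoc, mul_comm ((t ^ K)⁻¹), ← mul_assoc, ← div_eq_mul_inv,
    le_div_iff₀ (by positivity), ← mul_pow]
  rw [mul_comm ((m : ℝ) + 1) t]
  linarith

theorem norm_value_le {p : PowerSeries ℤ} {H t : ℝ} {K M : ℕ} {q v : ℂ} (hH : 0 ≤ H)
    (hp : Growth H K p) (hM : ∀ m < M, p.coeff m = 0) (ht : 0 < t)
    (hq : ‖q‖ = Real.exp (-(4 * t))) (hv : HasEv p q v) :
    ‖v‖ ≤ H * (K.factorial * t⁻¹ ^ K) * Real.exp t * (1 + t⁻¹) * Real.exp (-(2 * t * M)) := by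
  set G := H * (K.factorial * t⁻¹ ^ K) * Real.exp t * Real.exp (-(2 * t * M)) with hG
  have h1 : ∀ m, ‖((p.coeff m : ℤ) : ℂ) * q ^ m‖ ≤ G * Real.exp (-t) ^ m := fun m ↦ by
    rcases lt_or_ge m M with h | h
    · rw [hM m h]
      simp only [Int.cast_zero, zero_mul, norm_zero]
      positivity
    · rw [norm_mul, norm_pow, hq, Complex.norm_intCast, ← Real.exp_nat_mul, ← Real.exp_nat_mul]
      have hm : (M : ℝ) ≤ m := by exact_mod_cast h
      calc _ ≤ (H * (K.factorial * t⁻¹ ^ K * Real.exp (t * (m + 1)))) *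
            Real.exp (m * -(4 * t)) := by
            gcongr
            refine (hp m).trans ?_
            gcongr
            exact pow_le_factorial_mul_exp ht K m
        _ = H * (K.factorial * t⁻¹ ^ K) * Real.exp t *
            (Real.exp (-(2 * t * m)) * Real.exp (m * -t)) := by
            have e1 : Real.exp (t * (m + 1)) * Real.exp (m * -(4 * t)) =
                Real.exp t * (Real.exp (-(2 * t * m)) * Real.exp (m * -t)) := by
              rw [← Real.exp_add, ← Real.exp_add, ← Real.exp_add]; congr 1; ring
            linear_combination (H * (K.factorial * t⁻¹ ^ K)) * e1
        _ ≤ H * (K.factorial * t⁻¹ ^ K) * Real.exp t *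
            (Real.exp (-(2 * t * M)) * Real.exp (m * -t)) := by gcongr
        _ = _ := by rw [hG]; ring
  have hlt : Real.exp (-t) < 1 := Real.exp_lt_one_iff.mpr (by linarith)
  have hg := (hasSum_geometric_of_lt_one (Real.exp_pos _).le hlt).mul_left G
  have h2 := hv.norm_le_of_bounded hg h1
  refine h2.trans ?_
  have h3 : (1 - Real.exp (-t))⁻¹ ≤ 1 + t⁻¹ := by
    have h4 : Real.exp (-t) ≤ (1 + t)⁻¹ := by
      rw [Real.exp_neg]
      exact inv_anti₀ (by linarith) (by linarith [Real.add_one_le_exp t])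
    have h5 : (1 + t⁻¹)⁻¹ ≤ 1 - Real.exp (-t) := by
      have : (1 + t⁻¹)⁻¹ = 1 - (1 + t)⁻¹ := by field_simp; ring
      linarith
    rw [inv_le_comm₀ (by linarith) (by positivity)]
    exact h5
  calc G * (1 - Real.exp (-t))⁻¹ ≤ G * (1 + t⁻¹) := by gcongr
    _ = _ := by rw [hG]; ring

end NestPi

namespace NestPi

open Finset
open Polynomial (C X)

/-- Evaluation of an integral polynomial in three variables in a commutative ring. -/
noncomputable def gev {A : Type*} [CommRing A] (v : Fin 3 → A) (f : MvPolynomial (Fin 3) ℤ) : A :=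
  MvPolynomial.eval₂ (Int.castRingHom A) v f

theorem aeval_eq_gev {A : Type*} [CommRing A] [Algebra ℤ A] (v : Fin 3 → A)
    (f : MvPolynomial (Fin 3) ℤ) : MvPolynomial.aeval v f = gev v f := by
  rw [MvPolynomial.aeval_def, gev]
  congr 1
  exact RingHom.ext_int _ _

theorem natDegree_aeval_le {A : Type*} [CommRing A] {g : Fin 3 → Polynomial A} {r k : ℕ}
    (hg : ∀ i, (g i).natDegree ≤ r) {f : MvPolynomial (Fin 3) ℤ} (hf : f.totalDegree ≤ k) :
    (gev g f).natDegree ≤ r * k := by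
  rw [gev, MvPolynomial.eval₂_eq]
  refine Polynomial.natDegree_sum_le_of_forall_le _ _ fun m hm ↦ ?_
  have h0 : (Int.castRingHom (Polynomial A) (f.coeff m)).natDegree = 0 := by
    simp
  refine Polynomial.natDegree_mul_le.trans ?_
  rw [h0, zero_add]
  refine (Polynomial.natDegree_prod_le _ _).trans ?_
  calc ∑ i ∈ m.support, (g i ^ m i).natDegree ≤ ∑ i ∈ m.support, r * m i :=
        Finset.sum_le_sum fun i _ ↦ Polynomial.natDegree_pow_le.trans (by
          rw [mul_comm]; exact Nat.mul_le_mul_right _ (hg i))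
    _ = r * m.degree := by rw [← Finset.mul_sum]; rfl
    _ ≤ r * k := Nat.mul_le_mul_left _ ((degree_le_of_mem_support hm).trans hf)

/-- The generic value of `(P, Q, R)` at a point equivalent to `i`. -/
noncomputable def nodeVal {A : Type*} [CommRing A] (ι : ℂ →+* A) (c d : A) : Fin 3 → A :=
  ![ι (3 / Real.pi) * (c ^ 2 + d ^ 2), ι omega * (d + c * ι Complex.I) ^ 4, 0]

theorem map_aeval_nodeVal {A A' : Type*} [CommRing A] [CommRing A'] (ι : ℂ →+* A) (c d : A)
    (φ : A →+* A') (f : MvPolynomial (Fin 3) ℤ) :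
    φ (gev (nodeVal ι c d) f) = gev (nodeVal (φ.comp ι) (φ c) (φ d)) f := by
  rw [gev, gev, MvPolynomial.hom_eval₂]
  congr 1
  · exact RingHom.ext_int _ _
  · funext i
    fin_cases i <;> simp [nodeVal]

/-- The polynomial in the two entries of the bottom row. -/
noncomputable def rowPoly (f : MvPolynomial (Fin 3) ℤ) : Polynomial (Polynomial ℂ) :=
  gev (nodeVal (C.comp C) (C X) X) f

theorem natDegree_rowPoly_le {f : MvPolynomial (Fin 3) ℤ} {k : ℕ} (hf : f.totalDegree ≤ k) :
    (rowPoly f).natDegree ≤ 4 * k :=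
  natDegree_aeval_le (fun i ↦ by
    fin_cases i
    · simp only [nodeVal, Fin.zero_eta, Matrix.cons_val_zero, RingHom.comp_apply]
      compute_degree
      norm_num
    · simp only [nodeVal, Fin.mk_one, Matrix.cons_val_one, Matrix.cons_val_zero, RingHom.comp_apply]
      compute_degree
    · simp [nodeVal]) hf

theorem rowPoly_eval (f : MvPolynomial (Fin 3) ℤ) (d : Polynomial ℂ) :
    (rowPoly f).eval d = gev (nodeVal C X d) f := by
  rw [rowPoly, ← Polynomial.coe_evalRingHom, map_aeval_nodeVal]
  congr 2
  · exact RingHom.ext fun z ↦ by simp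
  · simp
  · simp

theorem natDegree_rowPoly_eval_le {f : MvPolynomial (Fin 3) ℤ} {k : ℕ} (hf : f.totalDegree ≤ k)
    (d : ℕ) : ((rowPoly f).eval (d : Polynomial ℂ)).natDegree ≤ 4 * k := by
  rw [rowPoly_eval, ← map_natCast (C : ℂ →+* _) d]
  refine natDegree_aeval_le (fun i ↦ ?_) hf
  fin_cases i
  · simp only [nodeVal, Fin.zero_eta, Matrix.cons_val_zero]
    compute_degree
    norm_num
  · simp only [nodeVal, Fin.mk_one, Matrix.cons_val_one, Matrix.cons_val_zero]
    compute_degree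
  · simp [nodeVal]

theorem rowPoly_eval_eval (f : MvPolynomial (Fin 3) ℤ) (c d : ℂ) :
    ((rowPoly f).eval (C d)).eval c = gev (nodeVal (RingHom.id ℂ) c d) f := by
  rw [rowPoly_eval, ← Polynomial.coe_evalRingHom, map_aeval_nodeVal]
  congr 2
  · exact RingHom.ext fun z ↦ by simp
  · simp
  · simp

theorem row_identity_left {A : Type*} [CommRing A] {i h s u : A} (h1 : i ^ 2 = -1)
    (h2 : 2 * h = 1) : h * (s + u) + -i * h * (s - u) * i = s := by
  linear_combination s * h2 - h * (s - u) * h1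

theorem row_identity_right {A : Type*} [CommRing A] {i h s u : A} (h1 : i ^ 2 = -1)
    (h2 : 2 * h = 1) : (-i * h * (s - u)) ^ 2 + (h * (s + u)) ^ 2 = s * u := by
  linear_combination h ^ 2 * (s - u) ^ 2 * h1 + s * u * (2 * h + 1) * h2

theorem exists_coeff_le_len_rowPoly {f : MvPolynomial (Fin 3) ℤ} {m : Fin 3 →₀ ℕ}
    (hm : m ∈ f.support) (hm2 : m 2 = 0) :
    (3 / Real.pi) ^ f.totalDegree ≤ polyLen (polyLen fun c : ℂ ↦ ‖c‖) (rowPoly f) := by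
  have hC := isLen_norm (A := ℂ)
  have hL := isLen_polyLen hC
  have hLL := isLen_polyLen hL
  set L1 := polyLen fun c : ℂ ↦ ‖c‖
  set N' := polyLen L1
  have hs : N' (C X) ≤ 1 := by exact (polyLen_C hL _).le.trans (polyLen_X_le hC)
  have ht : N' X ≤ 1 := polyLen_X_le hL
  have hsc : ∀ z : ℂ, N' (C (C z)) ≤ ‖z‖ := fun z ↦ (polyLen_C hL _).le.trans (polyLen_C hC _).le
  have h2I : ‖(2 * Complex.I)⁻¹‖ = 1 / 2 := by simp
  set c' : Polynomial (Polynomial ℂ) := C (C (2 * Complex.I)⁻¹) * (C X - X) with hc'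
  set d' : Polynomial (Polynomial ℂ) := C (C 2⁻¹) * (C X + X) with hd'
  have hc1 : N' c' ≤ 1 := by
    refine (hLL.mul _ _).trans ?_
    have h1 := hsc (2 * Complex.I)⁻¹
    rw [h2I] at h1
    have h2 : N' (C X - X) ≤ 2 := (hLL.sub _ _).trans (by linarith)
    nlinarith [hLL.nonneg (C X - X), hLL.nonneg (C (C (2 * Complex.I)⁻¹))]
  have hd1 : N' d' ≤ 1 := by
    refine (hLL.mul _ _).trans ?_
    have h1 := hsc 2⁻¹
    have h3 : ‖(2 : ℂ)⁻¹‖ = 1 / 2 := by simp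
    rw [h3] at h1
    have h2 : N' (C X + X) ≤ 2 := (hLL.add _ _).trans (by linarith)
    nlinarith [hLL.nonneg (C X + X), hLL.nonneg (C (C (2 : ℂ)⁻¹))]
  set φ : Polynomial ℂ →+* Polynomial (Polynomial ℂ) := Polynomial.eval₂RingHom (C.comp C) c'
  have hφ : ∀ p, N' (φ p) ≤ L1 p := fun p ↦ by
    have := len_eval₂_le hC hLL (C.comp C) (K := 1) p (fun i ↦ by
      rw [one_mul]; exact hsc _) c' le_rfl hc1 le_rfl
    rw [one_mul, one_pow, mul_one] at this
    exact this
  set σ : Polynomial (Polynomial ℂ) →+* Polynomial (Polynomial ℂ) := Polynomial.eval₂RingHom φ d'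
  have hσ : N' (σ (rowPoly f)) ≤ N' (rowPoly f) := by
    have := len_eval₂_le hL hLL φ (K := 1) (rowPoly f) (fun i ↦ by
      rw [one_mul]; exact hφ _) d' le_rfl hd1 le_rfl
    rw [one_mul, one_pow, mul_one] at this
    exact this
  have e1 : σ (rowPoly f) = gev (![C (C (3 / (Real.pi : ℂ))) * (C X * X),
      C (C (omega : ℂ)) * (C X) ^ 4, 0] : Fin 3 → Polynomial (Polynomial ℂ)) f := by
    rw [rowPoly, map_aeval_nodeVal]
    have eι : σ.comp (C.comp C) = (C.comp C : ℂ →+* Polynomial (Polynomial ℂ)) := by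
      ext z; simp [σ, φ]
    have eC : σ (C X) = c' := by simp [σ, φ]
    have eX : σ X = d' := by simp [σ]
    rw [eι, eC, eX]
    have i1 : (C (C (2 * Complex.I)⁻¹) : Polynomial (Polynomial ℂ)) = - C (C Complex.I) * C (C 2⁻¹)
      := by
      rw [← map_neg, ← map_neg, ← map_mul, ← map_mul]
      congr 2
      rw [mul_inv, Complex.inv_I]; ring
    have i2 : (C (C Complex.I) : Polynomial (Polynomial ℂ)) ^ 2 = -1 := by
      rw [← map_pow, ← map_pow, Complex.I_sq]; simp
    have i3 : 2 * (C (C 2⁻¹) : Polynomial (Polynomial ℂ)) = 1 := by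
      rw [← map_ofNat C 2, ← map_ofNat C 2, ← map_mul, ← map_mul]; simp
    have i4 : d' + c' * C (C Complex.I) = C X := by
      rw [hc', hd', i1]
      exact row_identity_left i2 i3
    have i5 : c' ^ 2 + d' ^ 2 = C X * X := by
      rw [hc', hd', i1]
      exact row_identity_right i2 i3
    rw [nodeVal, i5, RingHom.comp_apply, RingHom.comp_apply, RingHom.comp_apply, i4]
  have e2 : ∀ n : Fin 3 →₀ ℕ, n ∈ f.support →
      (((Int.castRingHom (Polynomial (Polynomial ℂ))) (f.coeff n) *
        ∏ i, (![C (C (3 / (Real.pi : ℂ))) * (C X * X), C (C (omega : ℂ)) * (C X) ^ 4, 0] :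
          Fin 3 → Polynomial (Polynomial ℂ)) i ^ n i).coeff (m 0)).coeff (m 0 + 4 * m 1) =
      if n = m then ((f.coeff m : ℤ) : ℂ) * ((3 / Real.pi) ^ m 0 * (omega : ℂ) ^ m 1) else 0 := by
    intro n hn
    rw [Fin.prod_univ_three]
    simp only [Matrix.cons_val_zero, Matrix.cons_val_one, Matrix.cons_val]
    rcases eq_or_ne (n 2) 0 with h0 | h0
    · have e3 : (Int.castRingHom (Polynomial (Polynomial ℂ))) (f.coeff n) *
          ((C (C (3 / (Real.pi : ℂ))) * (C X * X)) ^ n 0 * (C (C (omega : ℂ)) * (C X) ^ 4) ^ n 1 *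
            0 ^ n 2) = C (C (((f.coeff n : ℤ) : ℂ) * ((3 / Real.pi) ^ n 0 * (omega : ℂ) ^ n 1)) *
              X ^ (n 0 + 4 * n 1)) * X ^ n 0 := by
        rw [h0]
        simp only [map_mul, map_pow, map_intCast, eq_intCast]
        ring
      rw [e3, Polynomial.coeff_C_mul_X_pow]
      by_cases hnm : n = m
      · subst hnm
        rw [if_pos rfl, if_pos rfl, Polynomial.coeff_C_mul_X_pow, if_pos rfl]
      · rw [if_neg hnm]
        split_ifs with h1
        · rw [Polynomial.coeff_C_mul_X_pow, if_neg]
          intro h2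
          apply hnm
          ext i
          fin_cases i
          · exact h1.symm
          · simp only [Fin.mk_one]; omega
          · exact h0.trans hm2.symm
        · simp
    · rw [zero_pow h0, mul_zero, mul_zero, Polynomial.coeff_zero, Polynomial.coeff_zero, if_neg]
      rintro rfl
      exact h0 hm2
  have e4 : ((σ (rowPoly f)).coeff (m 0)).coeff (m 0 + 4 * m 1) =
      ((f.coeff m : ℤ) : ℂ) * ((3 / Real.pi) ^ m 0 * (omega : ℂ) ^ m 1) := by
    rw [e1, gev, MvPolynomial.eval₂_eq', Polynomial.finsetSum_coeff,
      Polynomial.finsetSum_coeff, Finset.sum_congr rfl e2, Finset.sum_ite_eq' f.support m,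
        if_pos hm]
  have h3 : ‖((σ (rowPoly f)).coeff (m 0)).coeff (m 0 + 4 * m 1)‖ ≤ N' (σ (rowPoly f)) :=
    (len_coeff_le hC _ _).trans (len_coeff_le hL _ _)
  refine le_trans ?_ (h3.trans hσ)
  rw [e4, norm_mul, norm_mul, norm_pow, norm_pow, Complex.norm_intCast, norm_div]
  have h5 : (1 : ℝ) ≤ |((f.coeff m : ℤ) : ℝ)| := by
    have := Int.one_le_abs (MvPolynomial.mem_support_iff.mp hm)
    exact_mod_cast this
  have h6 : 1 ≤ ‖(omega : ℂ)‖ ^ m 1 := one_le_pow₀ (by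
    rw [Complex.norm_real]; exact omega_ge_one.trans (le_abs_self _))
  have h7 : ‖(3 : ℂ)‖ / ‖(Real.pi : ℂ)‖ = 3 / Real.pi := by
    rw [Complex.norm_real, Real.norm_of_nonneg Real.pi_pos.le]; simp
  have h8 : m 0 ≤ f.totalDegree := by
    refine le_trans ?_ (degree_le_of_mem_support hm)
    rw [Finsupp.degree_eq_sum]
    exact Finset.single_le_sum (f := fun i ↦ m i) (fun _ _ ↦ Nat.zero_le _) (mem_univ 0)
  rw [h7]
  have h9 : (0 : ℝ) ≤ 3 / Real.pi := by positivity
  have h10 : 3 / Real.pi ≤ 1 := by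
    rw [div_le_one Real.pi_pos]; exact Real.pi_gt_three.le
  calc (3 / Real.pi) ^ f.totalDegree ≤ (3 / Real.pi) ^ m 0 := pow_le_pow_of_le_one h9 h10 h8
    _ = 1 * ((3 / Real.pi) ^ m 0 * 1) := by ring
    _ ≤ _ := by gcongr

end NestPi

namespace NestPi

open Finset
open Polynomial (C X)

/-- The bound for the value of `f` at a point equivalent to `i`. -/
noncomputable def nodeBound (f : MvPolynomial (Fin 3) ℤ) (k D M : ℕ) : ℝ :=
  mlen f * (D : ℝ) ^ (31 * k + 3) * Real.exp (-(M / (D : ℝ) ^ 2))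

theorem norm_node_le {f : MvPolynomial (Fin 3) ℤ} {k D M c d : ℕ} (hf : f.totalDegree ≤ k)
    (hkD : 8 * k + 2 ≤ D) (hD : 10 ≤ D) (hM : ∀ m < M, (eS f).coeff m = 0) (hc : 1 ≤ c) (hd : 1 ≤ d)
    (hcD : c ≤ D) (hdD : d ≤ D) (hcd : Nat.Coprime c d) :
    ‖gev (nodeVal (RingHom.id ℂ) (c : ℂ) (d : ℂ)) f‖ ≤ nodeBound f k D M := by
  obtain ⟨q, hq, h0, h1, h2⟩ := exists_nome c d (Nat.isCoprime_iff_coprime.mpr hcd)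
  have hv : HasEv (eS f) q (gev (nodeVal (RingHom.id ℂ) (c : ℂ) (d : ℂ)) f) := by
    rw [← aeval_eq_gev]
    refine HasEv.eS (fun i ↦ ?_) f
    fin_cases i
    · simpa [HasEv, nodeVal] using h0
    · simpa [HasEv, nodeVal, E4_I] using h1
    · simpa [HasEv, nodeVal] using h2
  have hcR : (1 : ℝ) ≤ c := by exact_mod_cast hc
  have hdR : (1 : ℝ) ≤ d := by exact_mod_cast hd
  have hcDR : (c : ℝ) ≤ D := by exact_mod_cast hcD
  have hdDR : (d : ℝ) ≤ D := by exact_mod_cast hdD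
  have hDR : (10 : ℝ) ≤ D := by exact_mod_cast hD
  have hkR : 8 * (k : ℝ) + 2 ≤ D := by exact_mod_cast hkD
  set s : ℝ := (c : ℝ) ^ 2 + (d : ℝ) ^ 2 with hs
  have hs2 : 2 ≤ s := by nlinarith
  have hsD : s ≤ 2 * (D : ℝ) ^ 2 := by nlinarith
  set t : ℝ := Real.pi / (2 * s) with ht
  have hpi := Real.pi_gt_three
  have hpi4 := Real.pi_le_four
  have ht0 : 0 < t := by positivity
  have ht1 : t ≤ 1 := by rw [ht, div_le_one (by positivity)]; linarith
  have htinv : t⁻¹ ≤ 2 * (D : ℝ) ^ 2 := by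
    rw [ht, inv_div, div_le_iff₀ Real.pi_pos]
    nlinarith
  have hq' : ‖q‖ = Real.exp (-(4 * t)) := by
    rw [hq, ht]
    congr 1
    push_cast
    rw [← hs]
    field_simp
    norm_num
  have h := norm_value_le (mul_nonneg (mlen_nonneg f) (by positivity)) (growth_eS hf) hM ht0 hq' hv
  refine h.trans ?_
  have e1 : (505 : ℝ) ^ k ≤ (D : ℝ) ^ (3 * k) := by
    rw [pow_mul]
    refine pow_le_pow_left₀ (by norm_num) ?_ _
    calc (505 : ℝ) ≤ 10 ^ 3 := by norm_num
      _ ≤ _ := pow_le_pow_left₀ (by norm_num) hDR _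
  have e2 : ((7 * k).factorial : ℝ) ≤ (D : ℝ) ^ (7 * k) := by
    calc ((7 * k).factorial : ℝ) ≤ ((7 * k : ℕ) : ℝ) ^ (7 * k) := by
          exact_mod_cast Nat.factorial_le_pow _
      _ ≤ _ := pow_le_pow_left₀ (by positivity) (by push_cast; linarith) _
  have htD : t⁻¹ ≤ (D : ℝ) ^ 3 := htinv.trans (by nlinarith [sq_nonneg (D : ℝ)])
  have e3 : t⁻¹ ^ (7 * k) ≤ (D : ℝ) ^ (21 * k) := by
    rw [show 21 * k = 3 * (7 * k) by ring, pow_mul (D : ℝ) 3 (7 * k)]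
    exact pow_le_pow_left₀ (by positivity) htD _
  have e4 : Real.exp t * (1 + t⁻¹) ≤ (D : ℝ) ^ 3 := by
    have : Real.exp t ≤ 3 := (Real.exp_le_exp.mpr ht1).trans (by linarith [Real.exp_one_lt_d9])
    calc Real.exp t * (1 + t⁻¹) ≤ 3 * (1 + 2 * (D : ℝ) ^ 2) := by gcongr
      _ ≤ _ := by nlinarith [sq_nonneg (D : ℝ)]
  have e5 : Real.exp (-(2 * t * M)) ≤ Real.exp (-(M / (D : ℝ) ^ 2)) := by
    rw [Real.exp_le_exp, neg_le_neg_iff, div_eq_mul_inv, mul_comm]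
    refine mul_le_mul_of_nonneg_right ?_ (Nat.cast_nonneg _)
    rw [inv_le_iff_one_le_mul₀ (by positivity)]
    have := mul_le_mul_of_nonneg_right htinv ht0.le
    rw [inv_mul_cancel₀ ht0.ne'] at this
    linarith
  calc mlen f * 505 ^ k * ((7 * k).factorial * t⁻¹ ^ (7 * k)) * Real.exp t * (1 + t⁻¹) *
        Real.exp (-(2 * t * M)) = mlen f * 505 ^ k * ((7 * k).factorial * t⁻¹ ^ (7 * k)) *
        (Real.exp t * (1 + t⁻¹)) * Real.exp (-(2 * t * M)) := by ring
    _ ≤ mlen f * (D : ℝ) ^ (3 * k) * ((D : ℝ) ^ (7 * k) * (D : ℝ) ^ (21 * k)) * (D : ℝ) ^ 3 *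
        Real.exp (-(M / (D : ℝ) ^ 2)) := by
      have := mlen_nonneg f
      gcongr
    _ = nodeBound f k D M := by
      rw [nodeBound, show 31 * k + 3 = 3 * k + (7 * k + 21 * k) + 3 by ring, pow_add, pow_add,
        pow_add]
      ring

theorem len_smul_le (c : ℂ) (p : Polynomial ℂ) :
    polyLen (fun z : ℂ ↦ ‖z‖) (c • p) ≤ ‖c‖ * polyLen (fun z : ℂ ↦ ‖z‖) p := by
  have hC := isLen_norm (A := ℂ)
  rw [Polynomial.smul_eq_C_mul]
  refine ((isLen_polyLen hC).mul _ _).trans ?_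
  rw [polyLen_C hC]

theorem exists_node_primes {k D : ℕ} (hD : 8 * k + 2 ≤ Nat.primeCounting D) :
    ∃ s : Finset ℕ, s.card = 4 * k + 1 ∧ ∀ p ∈ s, p.Prime ∧ 4 * k + 1 < p ∧ p ≤ D := by
  have h1 : 4 * k + 1 ≤ (D.primesLE \ Icc 1 (4 * k + 1)).card := by
    have := le_card_sdiff (Icc 1 (4 * k + 1)) D.primesLE
    rw [Nat.primesLE_card_eq_primeCounting, Nat.card_Icc] at this
    omega
  obtain ⟨s, hs, hc⟩ := exists_subset_card_eq h1
  refine ⟨s, hc, fun p hp ↦ ?_⟩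
  have h2 := mem_sdiff.mp (hs hp)
  have h3 := Nat.mem_primesLE.mp h2.1
  have h4 := h3.2.one_lt
  refine ⟨h3.2, ?_, h3.1⟩
  by_contra h
  exact h2.2 (mem_Icc.mpr ⟨h4.le, by omega⟩)

theorem vanishing_le_of_primes {f : MvPolynomial (Fin 3) ℤ} {k D M : ℕ} {m : Fin 3 →₀ ℕ}
    (hm : m ∈ f.support) (hm2 : m 2 = 0) (hk : 1 ≤ k) (hf : f.totalDegree ≤ k)
    (hD : 8 * k + 2 ≤ Nat.primeCounting D) (hM : ∀ m < M, (eS f).coeff m = 0) :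
    (M : ℝ) ≤ (D : ℝ) ^ 2 * (Real.log (mlen f) + 53 * k * Real.log D) := by
  have hkD : 8 * k + 2 ≤ D := hD.trans (by
    rw [← Nat.primesLE_card_eq_primeCounting]
    refine (card_le_card (t := Icc 1 D) fun p hp ↦ ?_).trans (by simp)
    have h3 := Nat.mem_primesLE.mp hp
    exact mem_Icc.mpr ⟨h3.2.one_lt.le, h3.1⟩)
  have hD10 : 10 ≤ D := by omega
  obtain ⟨s, hs, hsp⟩ := exists_node_primes hD
  have hC := isLen_norm (A := ℂ)
  have hL := isLen_polyLen hC
  have h1 : ∀ d ∈ Icc 1 (4 * k + 1), polyLen (fun z : ℂ ↦ ‖z‖)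
    ((rowPoly f).eval (d : Polynomial ℂ)) ≤
      (((4 * k : ℕ) : ℝ) + 1) * (1 + D) ^ (4 * k) * nodeBound f k D M := fun d hd ↦ by
    have hd := mem_Icc.mp hd
    refine polyLen_le_of_eval_nodes hC (fun c a ↦ by rw [smul_eq_mul, norm_mul]) s
      (fun a ha ↦ (hsp a ha).2.2) _ hs (natDegree_rowPoly_eval_le hf d) fun c hc ↦ ?_
    rw [← map_natCast (C : ℂ →+* _) d, rowPoly_eval_eval]
    obtain ⟨hp, hlt, hle⟩ := hsp c hc
    exact norm_node_le hf hkD hD10 hM hp.one_lt.le hd.1 hle (by omega)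
      (Nat.coprime_of_lt_prime (by omega) (by omega) hp)
  have h2 := polyLen_le_of_eval_nodes hL len_smul_le (Icc 1 (4 * k + 1)) (D := D)
    (fun a ha ↦ by have := mem_Icc.mp ha; omega) (rowPoly f) (by simp)
    (natDegree_rowPoly_le hf) h1
  have h3 := (exists_coeff_le_len_rowPoly hm hm2).trans h2
  have hDR : (10 : ℝ) ≤ D := by exact_mod_cast hD10
  have hkR : 8 * (k : ℝ) + 2 ≤ D := by exact_mod_cast hkD
  have hk1 : (1 : ℝ) ≤ k := by exact_mod_cast hk
  have hl1 : 1 ≤ mlen f := one_le_mlen (by rintro rfl; simp at hm)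
  have e1 : (((4 * k : ℕ) : ℝ) + 1) ≤ D := by push_cast; linarith
  have e2 : (1 + (D : ℝ)) ^ (4 * k) ≤ (D : ℝ) ^ (8 * k) := by
    rw [show 8 * k = 2 * (4 * k) by ring, pow_mul (D : ℝ) 2 (4 * k)]
    exact pow_le_pow_left₀ (by positivity) (by nlinarith) _
  have e0 : 0 ≤ nodeBound f k D M := by
    have := mlen_nonneg f
    rw [nodeBound]; positivity
  have e3 : 1 ≤ (Real.pi / 3) ^ k * (3 / Real.pi) ^ f.totalDegree := by
    have h9 : (0 : ℝ) ≤ 3 / Real.pi := by positivity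
    have h10 : 3 / Real.pi ≤ 1 := by
      rw [div_le_one Real.pi_pos]; exact Real.pi_gt_three.le
    calc (1 : ℝ) = (Real.pi / 3) ^ k * (3 / Real.pi) ^ k := by
          rw [← mul_pow, div_mul_div_cancel₀ (by norm_num), div_self Real.pi_ne_zero, one_pow]
      _ ≤ _ := by gcongr _ * ?_; exact pow_le_pow_of_le_one h9 h10 hf
  have e4 : (Real.pi / 3) ^ k ≤ (D : ℝ) ^ k :=
    pow_le_pow_left₀ (by positivity) (by linarith [Real.pi_le_four]) _
  have e5 : Real.exp (M / (D : ℝ) ^ 2) ≤ mlen f * (D : ℝ) ^ (53 * k) := by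
    have : (1 : ℝ) ≤ (D : ℝ) ^ k * (D * (D : ℝ) ^ (8 * k) *
        (D * (D : ℝ) ^ (8 * k) * nodeBound f k D M)) := by
      refine e3.trans (mul_le_mul e4 (h3.trans ?_) (by positivity) (by positivity))
      gcongr
    rw [nodeBound, Real.exp_neg] at this
    have h5 := mul_le_mul_of_nonneg_right this (Real.exp_pos (M / (D : ℝ) ^ 2)).le
    rw [one_mul] at h5
    refine h5.trans ?_
    have e6 : (D : ℝ) ^ k * (D * (D : ℝ) ^ (8 * k) * (D * (D : ℝ) ^ (8 * k) *
        (mlen f * (D : ℝ) ^ (31 * k + 3) * (Real.exp (M / (D : ℝ) ^ 2))⁻¹))) *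
        Real.exp (M / (D : ℝ) ^ 2) = mlen f * (D : ℝ) ^ (48 * k + 5) := by
      rw [show 48 * k + 5 = k + (8 * k + (8 * k + (31 * k + 3))) + 2 by ring, pow_add _ _ 2,
        pow_add, pow_add, pow_add]
      field_simp
      ring
    rw [e6]
    gcongr
    · linarith
    · omega
  have e7 := Real.log_le_log (Real.exp_pos _) e5
  rw [Real.log_exp, Real.log_mul (by linarith) (by positivity), Real.log_pow,
    div_le_iff₀ (by positivity)] at e7
  push_cast at e7
  linarith

end NestPi

namespace NestPi

open Finset Filter
open MvPolynomial (X monomial)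

theorem exists_eq_X_two_pow_mul (n : ℕ) : ∀ f : MvPolynomial (Fin 3) ℤ, f ≠ 0 → f.totalDegree = n →
    ∃ (s : ℕ) (g : MvPolynomial (Fin 3) ℤ), f = X 2 ^ s * g ∧ (∃ m ∈ g.support, m 2 = 0) ∧
      g.totalDegree ≤ n ∧ mlen g ≤ mlen f := by
  induction n using Nat.strong_induction_on with
  | _ n ih =>
    intro f hf hn
    by_cases h : ∃ m ∈ f.support, m 2 = 0
    · exact ⟨0, f, by simp, h, hn.le, le_rfl⟩
    · push Not at h
      obtain ⟨g, hg⟩ : X 2 ∣ f := by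
        rw [f.as_sum]
        exact Finset.dvd_sum fun m hm ↦ MvPolynomial.X_dvd_monomial.mpr (Or.inr (h m hm))
      have hg0 : g ≠ 0 := by rintro rfl; exact hf (by simpa using hg)
      have hdeg : f.totalDegree = g.totalDegree + 1 := by
        rw [hg, MvPolynomial.totalDegree_mul_of_isDomain (MvPolynomial.X_ne_zero 2) hg0,
          MvPolynomial.totalDegree_X, add_comm]
      have hlen : mlen f = mlen g := by
        rw [mlen, mlen, hg, MvPolynomial.support_X_mul, Finset.sum_map]
        refine Finset.sum_congr rfl fun m _ ↦ ?_
        rw [addLeftEmbedding_apply, MvPolynomial.coeff_X_mul]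
      obtain ⟨s, r, h1, h2, h3, h4⟩ := ih g.totalDegree (by omega) g hg0 rfl
      exact ⟨s + 1, r, by rw [hg, pow_succ', mul_assoc, ← h1], h2, by omega, by rw [hlen]; exact h4⟩

theorem vanishing_le_of_primeCounting {f : MvPolynomial (Fin 3) ℤ} (hf0 : f ≠ 0) {k D M : ℕ}
    (hk : 1 ≤ k) (hf : f.totalDegree ≤ k) (hD : 8 * k + 2 ≤ Nat.primeCounting D)
    (hM : ∀ m < M, (eS f).coeff m = 0) :
    (M : ℝ) ≤ (D : ℝ) ^ 2 * (Real.log (mlen f) + 53 * k * Real.log D) := by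
  obtain ⟨s, g, h1, ⟨m, hm, hm2⟩, h3, h4⟩ := exists_eq_X_two_pow_mul _ f hf0 rfl
  have hM' : ∀ m < M, (eS g).coeff m = 0 := by
    rw [← PowerSeries.X_pow_dvd_iff] at hM ⊢
    rw [h1, map_mul, map_pow] at hM
    have hu : IsUnit (eS (X 2) ^ s) := by
      refine IsUnit.pow s ?_
      rw [PowerSeries.isUnit_iff_constantCoeff]
      have : eS (X 2) = eisSer (-504) 5 := by simp [eS, ser]
      rw [this, constantCoeff_eisSer]
      exact isUnit_one
    exact (hu.dvd_mul_left).mp hM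
  refine (vanishing_le_of_primes hm hm2 hk (h3.trans hf) hD hM').trans ?_
  have : 1 ≤ mlen g := one_le_mlen (by rintro rfl; simp at hm)
  gcongr

theorem eventually_mul_log_le (C : ℝ) {ε : ℝ} (hε : 0 < ε) :
    ∀ᶠ u : ℝ in atTop, C * Real.log u ≤ u ^ ε := by
  have h1 := (isLittleO_log_rpow_atTop hε).bound (c := (|C| + 1)⁻¹) (by positivity)
  filter_upwards [h1, eventually_ge_atTop 1] with u hu h1
  have hl := Real.log_nonneg h1
  rw [Real.norm_of_nonneg hl, Real.norm_of_nonneg (by positivity),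
    inv_mul_eq_div, le_div_iff₀ (by positivity)] at hu
  nlinarith [le_abs_self C]

theorem eventually_rpow_le_primeCounting {α : ℝ} (h : α < 1) :
    ∀ᶠ n : ℕ in atTop, (n : ℝ) ^ α ≤ Nat.primeCounting n := by
  have h1 : (0 : ℝ) < (1 - α) / 2 := by linarith
  have e1 := tendsto_natCast_atTop_atTop.eventually (eventually_mul_log_le 1 h1)
  have e2 := tendsto_natCast_atTop_atTop.eventually
    (eventually_mul_rpow_le 4 (show α + (1 - α) / 2 < 1 by linarith))
  have e3 := tendsto_natCast_atTop_atTop.eventually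
    (eventually_mul_log_le 16 (ε := 1) one_pos)
  filter_upwards [e1, e2, e3, eventually_ge_atTop 2] with n h1 h2 h3 hn
  have hn2 : (2 : ℝ) ≤ n := by exact_mod_cast hn
  have hn0 : (0 : ℝ) < n := by linarith
  rw [Real.rpow_one] at h2 h3
  have hpsi := (Chebyshev.psi_ge n).trans (Chebyshev.psi_le_primeCounting_mul_log n)
  have hlog : 0 < Real.log n := Real.log_pos (by linarith)
  have hl1 : Real.log (n + 1) ≤ 2 * Real.log n := by
    rw [← Real.log_rpow hn0 2]
    refine Real.log_le_log (by positivity) ?_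
    rw [Real.rpow_two]
    nlinarith
  have hl2 := Real.log_two_gt_d9
  have h4 : (n : ℝ) / 4 ≤ Nat.primeCounting n * Real.log n := by nlinarith
  rw [Real.rpow_add hn0] at h2
  rw [one_mul] at h1
  have h5 : (n : ℝ) ^ α * Real.log n ≤ n / 4 := by
    have := mul_le_mul_of_nonneg_left h1 (Real.rpow_nonneg hn0.le α)
    linarith
  exact le_of_mul_le_mul_right (h5.trans h4) hlog

theorem eventually_vanishing_le : ∀ᶠ k : ℕ in atTop, ∀ f : MvPolynomial (Fin 3) ℤ, f ≠ 0 →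
    f.totalDegree ≤ k → ∀ M : ℕ, (∀ m < M, (eS f).coeff m = 0) →
    (M : ℝ) ≤ (k : ℝ) ^ (2.004 : ℝ) * (Real.log (mlen f) + (k : ℝ) ^ (1.004 : ℝ)) := by
  have hk := tendsto_natCast_atTop_atTop (R := ℝ)
  have hceil : Tendsto (fun k : ℕ ↦ ⌈(k : ℝ) ^ (1.001 : ℝ)⌉₊) atTop atTop :=
    tendsto_nat_ceil_atTop.comp ((tendsto_rpow_atTop (by norm_num)).comp hk)
  filter_upwards [hceil.eventually (eventually_rpow_le_primeCounting (α := 0.9995) (by norm_num)),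
    hk.eventually (eventually_mul_rpow_le 10 (show (1 : ℝ) < 1.001 * 0.9995 by norm_num)),
    hk.eventually (eventually_mul_rpow_le 2 (show (1.001 : ℝ) < 1.002 by norm_num)),
    hk.eventually (eventually_mul_log_le 60 (show (0 : ℝ) < 0.004 by norm_num)),
    eventually_ge_atTop 1] with k h1 h2 h3 h4 hk1 f hf0 hf M hM
  set D := ⌈(k : ℝ) ^ (1.001 : ℝ)⌉₊ with hDdef
  have hkR : (1 : ℝ) ≤ k := by exact_mod_cast hk1
  have hk0 : (0 : ℝ) < k := by linarith
  have hD1 : (k : ℝ) ^ (1.001 : ℝ) ≤ D := Nat.le_ceil _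
  have hone : (1 : ℝ) ≤ (k : ℝ) ^ (1.001 : ℝ) := Real.one_le_rpow hkR (by norm_num)
  have hD2 : (D : ℝ) ≤ (k : ℝ) ^ (1.002 : ℝ) := by
    have : (D : ℝ) < (k : ℝ) ^ (1.001 : ℝ) + 1 := Nat.ceil_lt_add_one (by linarith)
    linarith
  have hD : 8 * k + 2 ≤ Nat.primeCounting D := by
    have h5 : ((k : ℝ) ^ (1.001 : ℝ)) ^ (0.9995 : ℝ) ≤ (D : ℝ) ^ (0.9995 : ℝ) :=
      Real.rpow_le_rpow (by linarith) hD1 (by norm_num)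
    rw [← Real.rpow_mul hk0.le] at h5
    rw [Real.rpow_one] at h2
    have : (8 : ℝ) * k + 2 ≤ Nat.primeCounting D := by linarith
    exact_mod_cast this
  refine (vanishing_le_of_primeCounting hf0 hk1 hf hD hM).trans ?_
  have hl : 0 ≤ Real.log (mlen f) := Real.log_nonneg (one_le_mlen hf0)
  have hD0 : (1 : ℝ) ≤ D := hone.trans hD1
  have hlD : 0 ≤ Real.log D := Real.log_nonneg hD0
  have hlD2 : Real.log D ≤ 1.002 * Real.log k := by
    rw [← Real.log_rpow hk0]
    exact Real.log_le_log (by linarith) hD2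
  have e1 : (D : ℝ) ^ 2 ≤ (k : ℝ) ^ (2.004 : ℝ) := by
    calc (D : ℝ) ^ 2 ≤ ((k : ℝ) ^ (1.002 : ℝ)) ^ 2 := by gcongr
      _ = _ := by rw [← Real.rpow_natCast, ← Real.rpow_mul hk0.le]; norm_num
  have e2 : 53 * k * Real.log D ≤ (k : ℝ) ^ (1.004 : ℝ) := by
    rw [show (1.004 : ℝ) = 1 + 0.004 by norm_num, Real.rpow_add hk0, Real.rpow_one]
    nlinarith [Real.log_nonneg hkR]
  have h0 : (0 : ℝ) ≤ 53 * k * Real.log D := by positivity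
  gcongr

end NestPi

namespace NestPi

open Finset
open MvPolynomial (X)


/-- The action of `12 z d/dz` on the factor of `z ^ c`. -/
noncomputable def dltShift (c : ℕ) (g : MvPolynomial (Fin 3) ℤ) : MvPolynomial (Fin 3) ℤ :=
    dlt g + 12 * (c : MvPolynomial (Fin 3) ℤ) * g

/-- Coefficientwise extension of `dlt`. -/
noncomputable def dltCoeff (p : PowerSeries (MvPolynomial (Fin 3) ℤ)) :
    PowerSeries (MvPolynomial (Fin 3) ℤ) :=
  PowerSeries.mk fun n ↦ dlt (p.coeff n)

theorem coeff_dltCoeff (p : PowerSeries (MvPolynomial (Fin 3) ℤ)) (n : ℕ) : (dltCoeff p).coeff n =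
    dlt (p.coeff n) :=
  PowerSeries.coeff_mk _ _

theorem dltCoeff_add (p r : PowerSeries (MvPolynomial (Fin 3) ℤ)) : dltCoeff (p + r) =
    dltCoeff p + dltCoeff r := by
  ext1 n
  simp only [coeff_dltCoeff, map_add]

theorem dltCoeff_mul (p r : PowerSeries (MvPolynomial (Fin 3) ℤ)) :
    dltCoeff (p * r) = p * dltCoeff r + r * dltCoeff p := by
  ext1 n
  rw [coeff_dltCoeff, map_add, mul_comm r, PowerSeries.coeff_mul, PowerSeries.coeff_mul,
    PowerSeries.coeff_mul, map_sum, ← Finset.sum_add_distrib]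
  refine Finset.sum_congr rfl fun x _ ↦ ?_
  rw [Derivation.leibniz, coeff_dltCoeff, coeff_dltCoeff, smul_eq_mul, smul_eq_mul]
  ring

theorem dltCoeff_intCast (a : ℤ) : dltCoeff (a : PowerSeries (MvPolynomial (Fin 3) ℤ)) = 0 := by
  ext1 n
  rw [coeff_dltCoeff, ← map_intCast (PowerSeries.C : MvPolynomial (Fin 3) ℤ →+* _),
    PowerSeries.coeff_C]
  split_ifs <;> simp

theorem dltCoeff_X_pow_mul_C (n : ℕ) (b : MvPolynomial (Fin 3) ℤ) :
    dltCoeff (PowerSeries.X ^ n * PowerSeries.C b) = PowerSeries.X ^ n * PowerSeries.C (dlt b) := by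
  ext1 m
  rw [coeff_dltCoeff, mul_comm, mul_comm _ (PowerSeries.C (dlt b)), PowerSeries.coeff_C_mul,
    PowerSeries.coeff_C_mul, PowerSeries.coeff_X_pow]
  split_ifs <;> simp

theorem dltCoeff_X_pow_mul (n : ℕ) (p : PowerSeries (MvPolynomial (Fin 3) ℤ)) :
    dltCoeff (PowerSeries.X ^ n * p) = PowerSeries.X ^ n * dltCoeff p := by
  have := dltCoeff_X_pow_mul_C n 1
  rw [map_one, mul_one, Derivation.map_one_eq_zero, map_zero, mul_zero] at this
  rw [dltCoeff_mul, this, mul_zero, add_zero]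

/-- The isobaric weights times the variable. -/
noncomputable def isobVal {A : Type*} [CommRing A] (ι : MvPolynomial (Fin 3) ℤ →+* A) (t : A) :
    Fin 3 → A :=
  ![t ^ 2 * ι (X 0), t ^ 4 * ι (X 1), t ^ 6 * ι (X 2)]

/-- The grading homomorphism `x_i ↦ t ^ {w_i} x_i`. -/
noncomputable def isob {A : Type*} [CommRing A] (ι : MvPolynomial (Fin 3) ℤ →+* A) (t : A) :
    MvPolynomial (Fin 3) ℤ →+* A :=
  MvPolynomial.eval₂Hom (Int.castRingHom A) (isobVal ι t)

theorem comp_isob {A A' : Type*} [CommRing A] [CommRing A'] (ι : MvPolynomial (Fin 3) ℤ →+* A)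
    (t : A) (φ : A →+* A') :
    φ.comp (isob ι t) = isob (φ.comp ι) (φ t) := by
  refine MvPolynomial.ringHom_ext' (RingHom.ext_int _ _) fun i ↦ ?_
  fin_cases i <;> simp [isob, isobVal]

theorem isob_id_one : isob (RingHom.id (MvPolynomial (Fin 3) ℤ)) 1 =
    RingHom.id (MvPolynomial (Fin 3) ℤ) := by
  refine MvPolynomial.ringHom_ext' (RingHom.ext_int _ _) fun i ↦ ?_
  fin_cases i <;> simp [isob, isobVal]

/-- The grading homomorphism into power series. -/
noncomputable def isobS : MvPolynomial (Fin 3) ℤ →+* PowerSeries (MvPolynomial (Fin 3) ℤ) :=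
    isob PowerSeries.C PowerSeries.X

theorem isobS_injective : Function.Injective isobS := by
  have h1 : (Polynomial.coeToPowerSeries.ringHom).comp (isob (Polynomial.C : MvPolynomial (Fin 3)
    ℤ →+* _) Polynomial.X) =
      isobS := by
    rw [comp_isob, isobS]
    congr 1
    · exact RingHom.ext fun z ↦ by simp
    · simp
  have h2 : (Polynomial.evalRingHom (1 : MvPolynomial (Fin 3) ℤ)).comp
    (isob (Polynomial.C : MvPolynomial (Fin 3) ℤ →+* _) Polynomial.X) =
      RingHom.id (MvPolynomial (Fin 3) ℤ) := by
    rw [comp_isob, ← isob_id_one]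
    congr 1
    · exact RingHom.ext fun z ↦ by simp
    · simp
  rw [← h1, RingHom.coe_comp]
  refine Function.Injective.comp (Polynomial.coe_injective (MvPolynomial (Fin 3) ℤ)) ?_
  exact Function.LeftInverse.injective (g := Polynomial.evalRingHom (1 : MvPolynomial (Fin 3) ℤ))
    fun x ↦ RingHom.congr_fun h2 x

theorem isobS_dlt (f : MvPolynomial (Fin 3) ℤ) : isobS (dlt f) = PowerSeries.X ^ 2 * dltCoeff
    (isobS f) := by
  induction f using MvPolynomial.induction_on with
  | C a =>
    have e1 : (MvPolynomial.C a : MvPolynomial (Fin 3) ℤ) = (a : MvPolynomial (Fin 3) ℤ) := by simp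
    rw [e1, map_intCast isobS, dltCoeff_intCast, mul_zero]
    simp
  | add p q hp hq => rw [map_add, map_add, hp, hq, map_add, dltCoeff_add, mul_add]
  | mul_X p i hp =>
    have hX : isobS (dlt (X i)) = PowerSeries.X ^ 2 * dltCoeff (isobS (X i)) := by
      have e0 : isobS (X 0) = PowerSeries.X ^ 2 * PowerSeries.C (X 0) := by
        simp [isobS, isob, isobVal]
      have e1 : isobS (X 1) = PowerSeries.X ^ 4 * PowerSeries.C (X 1) := by
        simp [isobS, isob, isobVal]
      have e2 : isobS (X 2) = PowerSeries.X ^ 6 * PowerSeries.C (X 2) := by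
        simp [isobS, isob, isobVal]
      fin_cases i
      · simp only [Fin.zero_eta, e0, dltCoeff_X_pow_mul_C]
        simp only [dlt, MvPolynomial.mkDerivation_X, Matrix.cons_val_zero, map_sub, map_pow, e0, e1]
        ring
      · simp only [Fin.mk_one, e1, dltCoeff_X_pow_mul_C]
        simp only [dlt, MvPolynomial.mkDerivation_X, Matrix.cons_val_one, Matrix.cons_val_zero,
          map_sub, map_mul, map_ofNat, e0, e1, e2]
        ring
      · simp only [Fin.reduceFinMk, e2, dltCoeff_X_pow_mul_C]
        simp only [dlt, MvPolynomial.mkDerivation_X, Matrix.cons_val,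
          map_sub, map_mul, map_pow, map_ofNat, e0, e1, e2]
        ring
    rw [Derivation.leibniz, smul_eq_mul, smul_eq_mul, map_add, map_mul, map_mul, map_mul, hp, hX,
      dltCoeff_mul]
    ring

/-- The operator on power series corresponding to `dltShift` under the grading homomorphism. -/
noncomputable def dltShiftS (c : ℕ) (p : PowerSeries (MvPolynomial (Fin 3) ℤ)) :
    PowerSeries (MvPolynomial (Fin 3) ℤ) :=
  PowerSeries.X ^ 2 * dltCoeff p + 12 * (c : PowerSeries (MvPolynomial (Fin 3) ℤ)) * p

theorem isobS_iterate (c i : ℕ) (f : MvPolynomial (Fin 3) ℤ) :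
    isobS ((dltShift c)^[i] f) = (dltShiftS c)^[i] (isobS f) := by
  refine Function.Semiconj.iterate_right (f := isobS) (fun g ↦ ?_) i f
  rw [dltShift, dltShiftS, map_add, isobS_dlt, map_mul, map_mul, map_ofNat, map_natCast]

theorem iterate_X_pow_mul (c i v : ℕ) (p : PowerSeries (MvPolynomial (Fin 3) ℤ)) :
    (dltShiftS c)^[i] (PowerSeries.X ^ v * p) = PowerSeries.X ^ v * (dltShiftS c)^[i] p := by
  refine (Function.Semiconj.iterate_right (f := fun p ↦ PowerSeries.X ^ v * p) (fun p ↦ ?_)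
    i p).symm
  rw [dltShiftS, dltShiftS, dltCoeff_X_pow_mul]
  ring

theorem constantCoeff_iterate (c i : ℕ) (p : PowerSeries (MvPolynomial (Fin 3) ℤ)) :
    PowerSeries.constantCoeff ((dltShiftS c)^[i] p) =
      (12 * (c : MvPolynomial (Fin 3) ℤ)) ^ i * PowerSeries.constantCoeff p := by
  induction i with
  | zero => simp
  | succ i ih =>
    rw [Function.iterate_succ_apply', dltShiftS, map_add, map_mul, map_mul, map_mul, map_ofNat,
      map_natCast, map_pow, PowerSeries.constantCoeff_X, ih]
    ring

/-- The Wronskian-type matrix of a family of terms `z ^ {c_j} f_j`. -/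
noncomputable def wronMat {n : ℕ} (f : Fin n → MvPolynomial (Fin 3) ℤ) (c : Fin n → ℕ) :
    Matrix (Fin n) (Fin n) (MvPolynomial (Fin 3) ℤ) :=
  Matrix.of fun i j ↦ (dltShift (c j))^[i] (f j)

theorem det_wronMat_ne_zero {n : ℕ} (f : Fin n → MvPolynomial (Fin 3) ℤ) (hf : ∀ j, f j ≠ 0)
    (c : Fin n → ℕ)
    (hc : Function.Injective c) : (wronMat f c).det ≠ 0 := by
  set h : Fin n → PowerSeries (MvPolynomial (Fin 3) ℤ) := fun j ↦ (isobS (f j)).divXPowOrder with hh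
  have h0 : ∀ j, PowerSeries.constantCoeff (h j) ≠ 0 := fun j e ↦ by
    rw [hh, PowerSeries.constantCoeff_divXPowOrder_eq_zero_iff] at e
    exact hf j (isobS_injective (e.trans (map_zero _).symm))
  set A : Matrix (Fin n) (Fin n) (PowerSeries (MvPolynomial (Fin 3) ℤ)) :=
    Matrix.of fun i j ↦ (dltShiftS (c j))^[i] (h j) with hA
  have e1 : isobS.mapMatrix (wronMat f c) =
      Matrix.of fun i j ↦ PowerSeries.X ^ (isobS (f j)).order.toNat * A i j := by
    ext1 i j
    simp only [RingHom.mapMatrix_apply, Matrix.map_apply, wronMat, Matrix.of_apply, hA]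
    rw [isobS_iterate, ← iterate_X_pow_mul, hh, PowerSeries.X_pow_order_mul_divXPowOrder]
  have e2 : PowerSeries.constantCoeff.mapMatrix A =
      Matrix.of fun i j ↦ PowerSeries.constantCoeff (h j) *
        (Matrix.vandermonde fun j ↦ 12 * (c j : MvPolynomial (Fin 3) ℤ)).transpose i j := by
    ext1 i j
    simp only [RingHom.mapMatrix_apply, Matrix.map_apply, hA, Matrix.of_apply,
      Matrix.transpose_apply, Matrix.vandermonde_apply]
    rw [constantCoeff_iterate, mul_comm]
  have hA0 : A.det ≠ 0 := fun e ↦ by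
    have := congrArg PowerSeries.constantCoeff e
    rw [RingHom.map_det, e2, Matrix.det_mul_row, Matrix.det_transpose, map_zero] at this
    rcases mul_eq_zero.mp this with h1 | h1
    · obtain ⟨j, -, hj⟩ := Finset.prod_eq_zero_iff.mp h1
      exact h0 j hj
    · refine Matrix.det_vandermonde_ne_zero_iff.mpr (fun a b hab ↦ hc ?_) h1
      have h12 : (12 : MvPolynomial (Fin 3) ℤ) ≠ 0 := by norm_num
      exact_mod_cast mul_left_cancel₀ h12 hab
  intro e
  have := congrArg isobS e
  rw [RingHom.map_det, e1, Matrix.det_mul_row, map_zero] at this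
  rcases mul_eq_zero.mp this with h1 | h1
  · obtain ⟨j, -, hj⟩ := Finset.prod_eq_zero_iff.mp h1
    exact pow_ne_zero _ PowerSeries.X_ne_zero hj
  · exact hA0 h1

/-- The power series `∑ z ^ {c_j} f_j`. -/
noncomputable def expSum {n : ℕ} (f : Fin n → MvPolynomial (Fin 3) ℤ) (c : Fin n → ℕ) :
    PowerSeries ℤ :=
  ∑ j, PowerSeries.X ^ c j * eS (f j)

theorem theta_X_pow_mul (c : ℕ) (p : PowerSeries ℤ) :
    theta ℤ (PowerSeries.X ^ c * p) = PowerSeries.X ^ c * (theta ℤ p + (c : PowerSeries ℤ) * p) :=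
      by
  have h : theta ℤ (PowerSeries.X ^ c) = (c : PowerSeries ℤ) * PowerSeries.X ^ c := by
    ext1 n
    rw [coeff_theta, ← map_natCast (PowerSeries.C : ℤ →+* _), PowerSeries.coeff_C_mul,
      PowerSeries.coeff_X_pow]
    split_ifs with h
    · rw [h]
    · simp
  rw [Derivation.leibniz, h, smul_eq_mul, smul_eq_mul]
  ring

theorem wronMat_mulVec {n : ℕ} (f : Fin n → MvPolynomial (Fin 3) ℤ) (c : Fin n → ℕ) (i : Fin n) :
    ((wronMat f c).map eS).mulVec (fun j ↦ PowerSeries.X ^ c j) i =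
      (fun p ↦ 12 * theta ℤ p)^[i] (expSum f c) := by
  have key : ∀ i : ℕ, (fun p ↦ 12 * theta ℤ p)^[i] (expSum f c) =
      ∑ j, PowerSeries.X ^ c j * eS ((dltShift (c j))^[i] (f j)) := fun i ↦ by
    induction i with
    | zero => rfl
    | succ i ih =>
      rw [Function.iterate_succ_apply', ih, map_sum, Finset.mul_sum]
      refine Finset.sum_congr rfl fun j _ ↦ ?_
      rw [theta_X_pow_mul, Function.iterate_succ_apply', dltShift, map_add, eS_dlt, map_mul,
        map_mul, map_ofNat, map_natCast]
      ring
  rw [key, Matrix.mulVec, dotProduct]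
  exact Finset.sum_congr rfl fun j _ ↦ mul_comm _ _

theorem X_pow_dvd_det {n M : ℕ} (f : Fin n → MvPolynomial (Fin 3) ℤ) (c : Fin n → ℕ)
    (hM : ∀ m < M, (expSum f c).coeff m = 0) (j : Fin n) (m : ℕ) (hm : m < M - c j) :
    (eS (wronMat f c).det).coeff m = 0 := by
  have h1 : ∀ i : ℕ, PowerSeries.X ^ M ∣ (fun p ↦ 12 * theta ℤ p)^[i] (expSum f c) := fun i ↦ by
    induction i with
    | zero => exact PowerSeries.X_pow_dvd_iff.mpr hM
    | succ i ih =>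
      rw [Function.iterate_succ_apply']
      refine Dvd.dvd.mul_left ?_ _
      rw [PowerSeries.X_pow_dvd_iff] at ih ⊢
      intro m hm
      rw [coeff_theta, ih m hm, mul_zero]
  set A := (wronMat f c).map eS with hA
  have hdet : eS (wronMat f c).det = A.det := by
    rw [hA]; exact AlgHom.map_det eS _
  have h2 : (A.adjugate.mulVec (A.mulVec fun j ↦ PowerSeries.X ^ c j)) j =
      A.det * PowerSeries.X ^ c j := by
    rw [Matrix.mulVec_mulVec, Matrix.adjugate_mul, Matrix.smul_mulVec, Matrix.one_mulVec]
    rfl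
  have h3 : PowerSeries.X ^ M ∣ A.det * PowerSeries.X ^ c j := by
    rw [← h2]
    simp only [Matrix.mulVec, dotProduct]
    refine Finset.dvd_sum fun i _ ↦ ?_
    have := wronMat_mulVec f c i
    simp only [Matrix.mulVec, dotProduct] at this
    rw [this]
    exact Dvd.dvd.mul_left (h1 i) _
  rw [hdet]
  have := PowerSeries.X_pow_dvd_iff.mp h3 (m + c j) (by omega)
  rwa [PowerSeries.coeff_mul_X_pow] at this

end NestPi

namespace NestPi

open Finset Filter

theorem dltShift_bounds {g : MvPolynomial (Fin 3) ℤ} {k N c : ℕ} (hg : g.totalDegree ≤ k)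
    (hk : k ≤ 4 * N) (hc : c ≤ N) :
    (dltShift c g).totalDegree ≤ k + 1 ∧ mlen (dltShift c g) ≤ 60 * N * mlen g := by
  have e : dltShift c g = dlt g + ((12 * c : ℕ) : ℤ) • g := by
    rw [dltShift, zsmul_eq_mul]; push_cast; ring
  constructor
  · rw [e]
    refine (MvPolynomial.totalDegree_add _ _).trans (max_le ?_ ?_)
    · exact (dlt_totalDegree_le g).trans (by omega)
    · exact (MvPolynomial.totalDegree_smul_le _ _).trans (by omega)
  · have hL := isLen_mlen
    rw [e, zsmul_eq_mul]
    have h0 := mlen_nonneg g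
    have h1 : (k : ℝ) ≤ 4 * N := by exact_mod_cast hk
    have h2 : (c : ℝ) ≤ N := by exact_mod_cast hc
    have h3 : mlen (((((12 * c : ℕ) : ℤ)) : MvPolynomial (Fin 3) ℤ)) ≤ 12 * c := by
      refine (hL.intCast _).trans ?_
      rw [abs_of_nonneg (by positivity)]
      push_cast
      exact le_rfl
    calc _ ≤ mlen (dlt g) + mlen _ * mlen g := (hL.add _ _).trans (by gcongr; exact hL.mul _ _)
      _ ≤ 12 * k * mlen g + 12 * c * mlen g := by
        gcongr
        exact mlen_dlt_le hg
      _ ≤ _ := by nlinarith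

theorem iterate_dltShift_bounds {g : MvPolynomial (Fin 3) ℤ} {N c : ℕ} (hg : g.totalDegree ≤ 3 * N)
    (hc : c ≤ N) (i : ℕ) (hi : i ≤ N) : ((dltShift c)^[i] g).totalDegree ≤ 3 * N + i ∧
      mlen ((dltShift c)^[i] g) ≤ (60 * N) ^ i * mlen g := by
  induction i with
  | zero => simpa using hg
  | succ i ih =>
    obtain ⟨h1, h2⟩ := ih (by omega)
    obtain ⟨h3, h4⟩ := dltShift_bounds h1 (N := N) (by omega) hc
    rw [Function.iterate_succ_apply']
    refine ⟨h3, h4.trans ?_⟩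
    rw [pow_succ']
    calc _ ≤ 60 * (N : ℝ) * ((60 * N) ^ i * mlen g) := by gcongr
      _ = _ := by ring

theorem totalDegree_det_le {n k : ℕ} (A : Matrix (Fin n) (Fin n) (MvPolynomial (Fin 3) ℤ))
    (hA : ∀ i j, (A i j).totalDegree ≤ k) : A.det.totalDegree ≤ n * k := by
  rw [Matrix.det_apply]
  refine MvPolynomial.totalDegree_finsetSum_le fun σ _ ↦ ?_
  have h : (∏ i, A (σ i) i).totalDegree ≤ n * k := by
    refine (MvPolynomial.totalDegree_finsetProd _ _).trans ?_
    refine (Finset.sum_le_sum fun i _ ↦ hA (σ i) i).trans ?_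
    simp
  rcases Int.units_eq_one_or (Equiv.Perm.sign σ) with h1 | h1
  · rwa [h1, one_smul]
  · rw [h1, Units.neg_smul, one_smul, MvPolynomial.totalDegree_neg]; exact h

theorem wronMat_bounds {n N : ℕ} {H : ℝ} {f : Fin n → MvPolynomial (Fin 3) ℤ} {c : Fin n → ℕ}
    (hN : 1 ≤ N) (hn : n ≤ N + 1)
    (hf : ∀ j, (f j).totalDegree ≤ 3 * N) (hc : ∀ j, c j ≤ N) (hH : ∀ j, mlen (f j) ≤ H)
    (hH1 : 1 ≤ H) :
    (wronMat f c).det.totalDegree ≤ 8 * N ^ 2 ∧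
      mlen (wronMat f c).det ≤ (2 * N * ((60 * N) ^ N * H)) ^ (2 * N) := by
  have hN1 : (1 : ℝ) ≤ N := by exact_mod_cast hN
  have hb : ∀ i j, _ := fun i j : Fin n ↦
    iterate_dltShift_bounds (hf j) (hc j) i (show (i : ℕ) ≤ N by omega)
  constructor
  · refine (totalDegree_det_le (k := 4 * N) _ fun i j ↦ ?_).trans ?_
    · exact (hb i j).1.trans (by omega)
    · calc n * (4 * N) ≤ (2 * N) * (4 * N) := by gcongr; omega
        _ = _ := by ring
  · refine (isLen_mlen.det _).trans ?_
    have hn2 : (n : ℝ) ≤ 2 * N := by exact_mod_cast (show n ≤ 2 * N by omega)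
    have h1 : ∀ i, ∑ j, mlen (wronMat f c i j) ≤ 2 * N * ((60 * N) ^ N * H) := fun i ↦ by
      calc ∑ j, mlen (wronMat f c i j) ≤ ∑ j : Fin n, (60 * (N : ℝ)) ^ N * H := by
            refine Finset.sum_le_sum fun j _ ↦ (hb i j).2.trans ?_
            have := mlen_nonneg (f j)
            gcongr
            · linarith
            · omega
            · exact hH j
        _ = n * ((60 * (N : ℝ)) ^ N * H) := by simp
        _ ≤ _ := by gcongr
    have h2 : (1 : ℝ) ≤ 2 * N * ((60 * N) ^ N * H) := by
      have : (1 : ℝ) ≤ (60 * N) ^ N := one_le_pow₀ (by linarith)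
      nlinarith [mul_le_mul this hH1 zero_le_one (by positivity)]
    calc ∏ i, ∑ j, mlen (wronMat f c i j) ≤ ∏ i : Fin n, 2 * N * ((60 * N) ^ N * H) :=
          Finset.prod_le_prod (fun i _ ↦ Finset.sum_nonneg fun j _ ↦ mlen_nonneg _) fun i _ ↦ h1 i
      _ = (2 * N * ((60 * N) ^ N * H)) ^ n := by simp
      _ ≤ _ := by gcongr; omega

theorem eventually_expSum_vanishing_le : ∀ᶠ N : ℕ in atTop, ∀ (n : ℕ)
    (f : Fin n → MvPolynomial (Fin 3) ℤ) (c : Fin n → ℕ), 0 < n → Function.Injective c →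
    (∀ j, f j ≠ 0) → (∀ j, c j ≤ N) → (∀ j, (f j).totalDegree ≤ 3 * N) →
    (∀ j, mlen (f j) ≤ Real.exp ((N : ℝ) ^ (1.1 : ℝ))) →
    ∀ M : ℕ, (∀ m < M, (expSum f c).coeff m = 0) → (M : ℝ) ≤ (N : ℝ) ^ (7 : ℝ) := by
  have hk := tendsto_natCast_atTop_atTop (R := ℝ)
  have hsq : Tendsto (fun N : ℕ ↦ 8 * N ^ 2) atTop atTop :=
    tendsto_atTop_mono (fun N ↦ by
      show N ≤ 8 * N ^ 2; nlinarith [Nat.le_self_pow two_ne_zero N]) tendsto_id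
  filter_upwards [hsq.eventually eventually_vanishing_le,
    hk.eventually (eventually_mul_log_le 1 (show (0 : ℝ) < 0.1 by norm_num)),
    hk.eventually (eventually_mul_rpow_le 8 (show (2 : ℝ) < 2.01 by norm_num)),
    hk.eventually (eventually_mul_rpow_le 20 (show (2.1 : ℝ) < 2.2 by norm_num)),
    hk.eventually (eventually_mul_rpow_le 3 (show (6.3 : ℝ) < 7 by norm_num)),
    eventually_ge_atTop 60] with N hZ hlog h8 h20 h3 hN n f c hn hc hf0 hcN hf hH M hM
  have hNR : (60 : ℝ) ≤ N := by exact_mod_cast hN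
  have hN0 : (0 : ℝ) < N := by linarith
  have hN1 : (1 : ℝ) ≤ N := by linarith
  have hnN : n ≤ N + 1 := by
    have := Fintype.card_le_of_injective (fun j ↦ (⟨c j, Nat.lt_succ_of_le (hcN j)⟩ : Fin (N + 1)))
      (fun a b hab ↦ hc (by simpa using hab))
    simpa using this
  have hH1 : 1 ≤ Real.exp ((N : ℝ) ^ (1.1 : ℝ)) := Real.one_le_exp (by positivity)
  obtain ⟨h1, h2⟩ := wronMat_bounds (by omega) hnN hf hcN hH hH1
  have hdet := det_wronMat_ne_zero f hf0 c hc
  have hv := hZ _ hdet h1 (M - c ⟨0, hn⟩) (X_pow_dvd_det f c hM ⟨0, hn⟩)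
  have hl : Real.log (mlen (wronMat f c).det) ≤ (N : ℝ) ^ (2.2 : ℝ) := by
    have hmlen := one_le_mlen hdet
    refine (Real.log_le_log (by linarith) h2).trans ?_
    have hp1 : (0 : ℝ) < (60 * N) ^ N := by positivity
    have hp2 := Real.log_mul hp1.ne' (Real.exp_pos ((N : ℝ) ^ (1.1 : ℝ))).ne'
    rw [Real.log_pow, Real.log_mul (by positivity) (by positivity), hp2, Real.log_pow,
      Real.log_exp]
    have hl2 : Real.log (2 * N) ≤ 2 * Real.log N := by
      rw [Real.log_mul (by norm_num) hN0.ne']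
      linarith [Real.log_le_log (by norm_num) (show (2 : ℝ) ≤ N by linarith)]
    have hl60 : Real.log (60 * N) ≤ 2 * Real.log N := by
      rw [Real.log_mul (by norm_num) hN0.ne']
      linarith [Real.log_le_log (by norm_num) hNR]
    have e11 : (N : ℝ) ^ (1.1 : ℝ) = N * (N : ℝ) ^ (0.1 : ℝ) := by
      rw [show (1.1 : ℝ) = 1 + 0.1 by norm_num, Real.rpow_add hN0, Real.rpow_one]
    have e21 : (N : ℝ) ^ (2.1 : ℝ) = N * N * (N : ℝ) ^ (0.1 : ℝ) := by
      rw [show (2.1 : ℝ) = 1 + 1 + 0.1 by norm_num, Real.rpow_add hN0, Real.rpow_add hN0,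
        Real.rpow_one]
    have hlN : 0 ≤ Real.log N := Real.log_nonneg hN1
    rw [one_mul] at hlog
    refine le_trans ?_ h20
    rw [e21, e11]
    push_cast
    have hy : 0 ≤ (N : ℝ) ^ (0.1 : ℝ) := by positivity
    have b1 : Real.log (2 * N) ≤ N * (2 * (N : ℝ) ^ (0.1 : ℝ)) := by nlinarith
    have b2 : N * Real.log (60 * N) ≤ N * (2 * (N : ℝ) ^ (0.1 : ℝ)) := by gcongr; linarith
    calc 2 * (N : ℝ) * (Real.log (2 * N) + (N * Real.log (60 * N) + N * (N : ℝ) ^ (0.1 : ℝ))) ≤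
          2 * N * (N * (2 * (N : ℝ) ^ (0.1 : ℝ)) + (N * (2 * (N : ℝ) ^ (0.1 : ℝ)) +
            N * (N : ℝ) ^ (0.1 : ℝ))) := by gcongr
      _ = 10 * (N * N * (N : ℝ) ^ (0.1 : ℝ)) := by ring
      _ ≤ _ := by gcongr; norm_num
  have hkN : (((8 * N ^ 2 : ℕ)) : ℝ) ≤ (N : ℝ) ^ (2.01 : ℝ) := by
    push_cast
    rwa [Real.rpow_two] at h8
  have e1 : (((8 * N ^ 2 : ℕ)) : ℝ) ^ (2.004 : ℝ) ≤ (N : ℝ) ^ (4.1 : ℝ) := by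
    refine (Real.rpow_le_rpow (by positivity) hkN (by norm_num)).trans ?_
    rw [← Real.rpow_mul hN0.le]
    exact Real.rpow_le_rpow_of_exponent_le hN1 (by norm_num)
  have e2 : (((8 * N ^ 2 : ℕ)) : ℝ) ^ (1.004 : ℝ) ≤ (N : ℝ) ^ (2.2 : ℝ) := by
    refine (Real.rpow_le_rpow (by positivity) hkN (by norm_num)).trans ?_
    rw [← Real.rpow_mul hN0.le]
    exact Real.rpow_le_rpow_of_exponent_le hN1 (by norm_num)
  have h5 : ((M - c ⟨0, hn⟩ : ℕ) : ℝ) ≤ (N : ℝ) ^ (4.1 : ℝ) * ((N : ℝ) ^ (2.2 : ℝ) + (N : ℝ)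
    ^ (2.2 : ℝ)) := by
    refine hv.trans ?_
    have : 0 ≤ Real.log (mlen (wronMat f c).det) := Real.log_nonneg (one_le_mlen hdet)
    gcongr
  have e3 : (N : ℝ) ^ (4.1 : ℝ) * (N : ℝ) ^ (2.2 : ℝ) = (N : ℝ) ^ (6.3 : ℝ) := by
    rw [← Real.rpow_add hN0]; norm_num
  have h6 : (M : ℝ) ≤ ((M - c ⟨0, hn⟩ : ℕ) : ℝ) + N := by
    have := hcN ⟨0, hn⟩
    exact_mod_cast (show M ≤ (M - c ⟨0, hn⟩) + N by omega)
  have h7 : (N : ℝ) ≤ (N : ℝ) ^ (6.3 : ℝ) := by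
    have := Real.rpow_le_rpow_of_exponent_le hN1 (show (1 : ℝ) ≤ 6.3 by norm_num)
    rwa [Real.rpow_one] at this
  linarith

end NestPi

namespace NestPi

open Finset

/-- The operator multiplying the coefficient of `z ^ m` by `12 * (a - m)`, on the factor of
`z ^ j`. -/
noncomputable def lowerOp (a j : ℕ) (g : MvPolynomial (Fin 3) ℤ) : MvPolynomial (Fin 3) ℤ :=
  ((12 * ((a : ℤ) - j) : ℤ) : MvPolynomial (Fin 3) ℤ) * g - dlt g

theorem expSum_lowerOp {D : ℕ} (a : ℕ) (f : Fin D → MvPolynomial (Fin 3) ℤ) :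
    expSum (fun j ↦ lowerOp a j (f j)) Fin.val =
      12 * ((a : PowerSeries ℤ) * expSum f Fin.val - theta ℤ (expSum f Fin.val)) := by
  rw [expSum, expSum, map_sum, Finset.mul_sum, ← Finset.sum_sub_distrib, Finset.mul_sum]
  refine Finset.sum_congr rfl fun j _ ↦ ?_
  rw [theta_X_pow_mul, lowerOp, map_sub, map_mul, map_intCast, eS_dlt]
  push_cast
  ring

theorem coeff_expSum_lowerOp {D : ℕ} (a : ℕ) (f : Fin D → MvPolynomial (Fin 3) ℤ) (m : ℕ) :
    (expSum (fun j ↦ lowerOp a j (f j)) Fin.val).coeff m =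
      12 * ((a : ℤ) - m) * (expSum f Fin.val).coeff m := by
  have e : ∀ p : PowerSeries ℤ, 12 * ((a : PowerSeries ℤ) * p - theta ℤ p) =
      PowerSeries.C (12 * (a : ℤ)) * p - PowerSeries.C (12 : ℤ) * theta ℤ p := fun p ↦ by
    rw [map_mul, map_natCast, map_ofNat]; ring
  rw [expSum_lowerOp, e, map_sub, PowerSeries.coeff_C_mul, PowerSeries.coeff_C_mul, coeff_theta]
  ring

/-- Iterating `lowerOp` with parameters `M + 1, …, M + L`. -/
noncomputable def lowerIter {D : ℕ} (M : ℕ) (f : Fin D → MvPolynomial (Fin 3) ℤ) :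
    ℕ → Fin D → MvPolynomial (Fin 3) ℤ
  | 0 => f
  | L + 1 => fun j ↦ lowerOp (M + L + 1) j (lowerIter M f L j)

theorem coeff_expSum_lowerIter {D : ℕ} (M : ℕ) (f : Fin D → MvPolynomial (Fin 3) ℤ) (L m : ℕ) :
    (expSum (lowerIter M f L) Fin.val).coeff m =
      (∏ i ∈ range L, 12 * ((M : ℤ) + i + 1 - m)) * (expSum f Fin.val).coeff m := by
  induction L with
  | zero => simp [lowerIter]
  | succ L ih =>
    rw [lowerIter, coeff_expSum_lowerOp, ih, Finset.prod_range_succ]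
    push_cast
    ring

theorem lowerOp_bounds {g : MvPolynomial (Fin 3) ℤ} {a j k : ℕ} {Q : ℝ} (hg : g.totalDegree ≤ k)
    (hQ : (k : ℝ) + a + j ≤ Q) :
    (lowerOp a j g).totalDegree ≤ k + 1 ∧ mlen (lowerOp a j g) ≤ 12 * Q * mlen g := by
  have e : lowerOp a j g = (12 * ((a : ℤ) - j) : ℤ) • g - dlt g := by
    rw [lowerOp, zsmul_eq_mul]
  have hL := isLen_mlen
  constructor
  · rw [e]
    refine (MvPolynomial.totalDegree_sub _ _).trans (max_le ?_ ?_)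
    · exact (MvPolynomial.totalDegree_smul_le _ _).trans (by omega)
    · exact (dlt_totalDegree_le g).trans (by omega)
  · have h0 := mlen_nonneg g
    have h3 : mlen (((12 * ((a : ℤ) - j) : ℤ)) : MvPolynomial (Fin 3) ℤ) ≤ 12 * (a + j) := by
      refine (hL.intCast _).trans ?_
      push_cast
      have ha : (0 : ℝ) ≤ a := by positivity
      have hj : (0 : ℝ) ≤ j := by positivity
      rw [abs_le]
      constructor <;> linarith
    rw [lowerOp]
    calc _ ≤ mlen _ * mlen g + mlen (dlt g) :=
          (hL.sub _ _).trans (by gcongr; exact hL.mul _ _)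
      _ ≤ 12 * (a + j) * mlen g + 12 * k * mlen g := by
        gcongr
        exact mlen_dlt_le hg
      _ ≤ _ := by nlinarith

theorem lowerIter_bounds {D M k : ℕ} {H Q : ℝ} {f : Fin D → MvPolynomial (Fin 3) ℤ}
    (hf : ∀ j, (f j).totalDegree ≤ k) (hH : ∀ j, mlen (f j) ≤ H) (L : ℕ)
    (hQ : (k : ℝ) + M + 2 * L + D ≤ Q) (j : Fin D) :
    (lowerIter M f L j).totalDegree ≤ k + L ∧ mlen (lowerIter M f L j) ≤ (12 * Q) ^ L * H := by
  induction L with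
  | zero => exact ⟨hf j, by simpa [lowerIter] using hH j⟩
  | succ L ih =>
    have hQ0 : 0 ≤ Q := le_trans (by positivity) hQ
    push_cast at hQ
    obtain ⟨h1, h2⟩ := ih (by linarith)
    have hj : ((j : ℕ) : ℝ) ≤ D := by exact_mod_cast j.2.le
    obtain ⟨h3, h4⟩ := lowerOp_bounds (a := M + L + 1) (j := j) (Q := Q) h1 (by push_cast; linarith)
    refine ⟨h3, h4.trans ?_⟩
    rw [pow_succ']
    calc _ ≤ 12 * Q * ((12 * Q) ^ L * H) := by gcongr
      _ = _ := by ring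

theorem prod_shift_self (M L : ℕ) :
    ∏ i ∈ range L, 12 * ((M : ℤ) + i + 1 - M) = 12 ^ L * L.factorial := by
  rw [Finset.prod_mul_distrib, Finset.prod_const, card_range,
    ← Finset.prod_range_add_one_eq_factorial]
  push_cast
  congr 1
  exact Finset.prod_congr rfl fun i _ ↦ by ring

theorem prod_shift_eq_zero {M L m : ℕ} (h1 : M < m) (h2 : m ≤ M + L) :
    ∏ i ∈ range L, 12 * ((M : ℤ) + i + 1 - m) = 0 := by
  refine Finset.prod_eq_zero (mem_range.mpr (show m - M - 1 < L by omega)) ?_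
  rw [show ((m - M - 1 : ℕ) : ℤ) = m - M - 1 by omega]
  ring

theorem abs_prod_shift_le (M L i : ℕ) :
    |((∏ l ∈ range L, 12 * ((M : ℤ) + l + 1 - ((i + (M + 1 + L) : ℕ) : ℤ)) : ℤ) : ℝ)| ≤
      12 ^ L * L.factorial * 2 ^ (i + L) := by
  have e : ∏ l ∈ range L, 12 * ((M : ℤ) + l + 1 - ((i + (M + 1 + L) : ℕ) : ℤ)) =
      (-12) ^ L * ((i + L).descFactorial L : ℕ) := by
    have h12 : (-12 : ℤ) ^ L = ∏ _l ∈ range L, (-12 : ℤ) := by simp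
    rw [Nat.descFactorial_eq_prod_range, Nat.cast_prod, h12, ← Finset.prod_mul_distrib]
    refine Finset.prod_congr rfl fun l hl ↦ ?_
    have := mem_range.mp hl
    rw [Nat.cast_sub (by omega)]
    push_cast
    ring
  rw [e, Nat.descFactorial_eq_factorial_mul_choose]
  push_cast
  rw [abs_mul, abs_pow, abs_neg, abs_of_pos (show (0 : ℝ) < 12 by norm_num),
    abs_of_nonneg (by positivity), mul_assoc]
  gcongr
  exact_mod_cast Nat.choose_le_two_pow _ _

end NestPi

namespace NestPi

open Finset

theorem norm_value_two_sided {p r : PowerSeries ℤ} {M L s : ℕ} {a q : ℝ} {V : ℂ} (ha : 0 ≤ a)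
    (hr : ∀ m, r.coeff m = (∏ i ∈ range L, 12 * ((M : ℤ) + i + 1 - m)) * p.coeff m)
    (hp0 : ∀ m < M, p.coeff m = 0) (hpM : p.coeff M ≠ 0) (hg : Growth a s p) (hq : 0 < q)
    (hq' : q ≤ Real.exp (-6)) (hV : HasEv r q V)
    (hX : 2 * (a * ((M : ℝ) + 1) ^ s * (s.factorial * Real.exp 1)) ≤ Real.exp (4 * L)) :
    q ^ M / 2 ≤ ‖V‖ ∧ ‖V‖ ≤ 12 ^ L * L.factorial * q ^ M * Real.exp (4 * L) := by
  set W : ℝ := 12 ^ L * L.factorial * q ^ M with hW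
  set Y : ℝ := a * ((M : ℝ) + 1) ^ s * (s.factorial * Real.exp 1) with hY
  have hW0 : 0 < W := by positivity
  set g : ℕ → ℂ := fun n ↦ ((r.coeff n : ℤ) : ℂ) * (q : ℂ) ^ n with hgdef
  have hgn : ∀ n, ‖g n‖ = |((r.coeff n : ℤ) : ℝ)| * q ^ n := fun n ↦ by
    rw [hgdef, norm_mul, norm_pow, Complex.norm_intCast, Complex.norm_real, Real.norm_of_nonneg
      hq.le]
  have hsum : ∑ i ∈ range (M + 1 + L), g i = g M := by
    refine Finset.sum_eq_single M (fun m hm hne ↦ ?_) (fun h ↦ absurd (mem_range.mpr (by omega)) h)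
    have hm' := mem_range.mp hm
    have : r.coeff m = 0 := by
      rw [hr]
      rcases lt_or_gt_of_ne hne with h | h
      · rw [hp0 m h, mul_zero]
      · rw [prod_shift_eq_zero h (by omega), zero_mul]
    rw [hgdef]
    simp [this]
  have htail : HasSum (fun i ↦ g (i + (M + 1 + L))) (V - g M) := by
    rw [← hsum]
    exact (hasSum_nat_add_iff' _).mpr hV
  have hbound : ∀ i, ‖g (i + (M + 1 + L))‖ ≤ W / 2 / 2 / 2 ^ i := fun i ↦ by
    rw [hgn, hr]
    push_cast
    rw [abs_mul]
    have h1 := abs_prod_shift_le M L i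
    push_cast at h1
    have h2 := hg (i + (M + 1 + L))
    push_cast at h2
    have h3 : ((i : ℝ) + (M + 1 + L) + 1) ^ s ≤
        ((M : ℝ) + 1) ^ s * (s.factorial * Real.exp 1 * Real.exp ((i + 1 + L : ℕ) : ℝ)) := by
      have h4 := pow_le_factorial_mul_exp one_pos s (i + 1 + L)
      rw [inv_one, one_pow, mul_one, one_mul, add_comm (((i + 1 + L : ℕ) : ℝ)) 1, Real.exp_add,
        ← mul_assoc] at h4
      calc ((i : ℝ) + (M + 1 + L) + 1) ^ s ≤ (((M : ℝ) + 1) * (1 + ((i + 1 + L : ℕ) : ℝ))) ^ s := by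
            gcongr
            push_cast
            nlinarith [show (0 : ℝ) ≤ M * (i + 1 + L) by positivity]
        _ = ((M : ℝ) + 1) ^ s * (1 + ((i + 1 + L : ℕ) : ℝ)) ^ s := mul_pow _ _ _
        _ ≤ _ := by gcongr
    have h5 : (2 : ℝ) ^ (i + L) * Real.exp ((i + 1 + L : ℕ) : ℝ) * q ^ (i + 1 + L) ≤
        Real.exp (-(4 * L)) * (1 / 2 / 2 ^ i) := by
      have e2 : (2 : ℝ) ≤ Real.exp 1 := by linarith [Real.add_one_le_exp 1]
      have e3 : Real.exp (-1) ≤ 1 / 2 := by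
        rw [Real.exp_neg, inv_eq_one_div]; gcongr
      calc (2 : ℝ) ^ (i + L) * Real.exp ((i + 1 + L : ℕ) : ℝ) * q ^ (i + 1 + L)
          ≤ Real.exp 1 ^ (i + 1 + L) * Real.exp 1 ^ (i + 1 + L) * Real.exp (-6) ^ (i + 1 + L) := by
            have : Real.exp ((i + 1 + L : ℕ) : ℝ) = Real.exp 1 ^ (i + 1 + L) := by
              rw [← Real.exp_nat_mul, mul_one]
            rw [this]
            gcongr
            calc (2 : ℝ) ^ (i + L) ≤ 2 ^ (i + 1 + L) := by
                  gcongr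
                  · norm_num
                  · omega
              _ ≤ _ := by gcongr
        _ = Real.exp (-(4 * L)) * Real.exp (-4) ^ (i + 1) := by
            simp only [← Real.exp_nat_mul, ← Real.exp_add]
            congr 1
            push_cast
            ring
        _ ≤ Real.exp (-(4 * L)) * (1 / 2) ^ (i + 1) := by
            gcongr
            exact (Real.exp_le_exp.mpr (by norm_num)).trans e3
        _ = _ := by
            rw [pow_succ, one_div, inv_pow]; ring
    calc _ ≤ 12 ^ L * L.factorial * 2 ^ (i + L) * (a * (((M : ℝ) + 1) ^ s *
          (s.factorial * Real.exp 1 * Real.exp ((i + 1 + L : ℕ) : ℝ)))) * q ^ (i + (M + 1 + L)) :=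
            by
          gcongr
          exact h2.trans (by gcongr)
      _ = W * Y * ((2 : ℝ) ^ (i + L) * Real.exp ((i + 1 + L : ℕ) : ℝ) * q ^ (i + 1 + L)) := by
          rw [hW, hY, show i + (M + 1 + L) = M + (i + 1 + L) by ring, pow_add q]; ring
      _ ≤ W * Y * (Real.exp (-(4 * L)) * (1 / 2 / 2 ^ i)) := by
          gcongr
      _ ≤ W * (Real.exp (4 * L) / 2) * (Real.exp (-(4 * L)) * (1 / 2 / 2 ^ i)) := by
          gcongr; linarith
      _ = _ := by
          rw [Real.exp_neg]
          field_simp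
  have hdiff : ‖V - g M‖ ≤ W / 2 := by
    rw [← htail.tsum_eq]
    exact tsum_of_norm_bounded (hasSum_geometric_two' _) hbound
  have hM : ‖g M‖ = W * |((p.coeff M : ℤ) : ℝ)| := by
    rw [hgn, hr, prod_shift_self]
    push_cast
    rw [abs_mul, abs_of_nonneg (by positivity), hW]
    ring
  have h1 : (1 : ℝ) ≤ |((p.coeff M : ℤ) : ℝ)| := by exact_mod_cast Int.one_le_abs hpM
  have h2 : |((p.coeff M : ℤ) : ℝ)| ≤ Y := by
    refine (hg M).trans ?_
    have : (1 : ℝ) ≤ s.factorial * Real.exp 1 := by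
      have := Real.one_le_exp (show (0 : ℝ) ≤ 1 by norm_num)
      have h3 : (1 : ℝ) ≤ s.factorial := by
        exact_mod_cast Nat.one_le_iff_ne_zero.mpr s.factorial_ne_zero
      nlinarith
    exact le_mul_of_one_le_right (by positivity) this
  have hn1 := norm_sub_norm_le (g M) V
  have hn2 := norm_sub_norm_le V (g M)
  rw [norm_sub_rev] at hn1
  constructor
  · have h3 : q ^ M ≤ W := by
      have e1 : (1 : ℝ) ≤ 12 ^ L := one_le_pow₀ (by norm_num)
      have e2 : (1 : ℝ) ≤ L.factorial := by
        exact_mod_cast Nat.one_le_iff_ne_zero.mpr L.factorial_ne_zero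
      rw [hW]
      exact le_mul_of_one_le_left (by positivity) (by nlinarith)
    nlinarith
  · nlinarith

theorem hasEv_ser (i : Fin 3) :
    HasEv (ser i) ((Real.exp (-(2 * Real.pi)) : ℝ) : ℂ) ((pt i : ℝ) : ℂ) := by
  have := Complex.hasSum_ofReal.mpr (hasSum_ser i)
  push_cast at this
  simpa [HasEv] using this

theorem hasEv_expSum {D : ℕ} (f : Fin D → MvPolynomial (Fin 3) ℤ) :
    HasEv (expSum f Fin.val) ((Real.exp (-(2 * Real.pi)) : ℝ) : ℂ)
      (∑ j : Fin D, ((Real.exp (-(2 * Real.pi)) : ℝ) : ℂ) ^ (j : ℕ) *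
        MvPolynomial.aeval (fun i ↦ ((pt i : ℝ) : ℂ)) (f j)) :=
  HasEv.sum _ fun j _ ↦ (HasEv.eS hasEv_ser (f j)).X_pow_mul j

theorem Growth.X_pow_mul {a : ℝ} {s : ℕ} {p : PowerSeries ℤ} (ha : 0 ≤ a) (hp : Growth a s p)
    (j : ℕ) : Growth a s (PowerSeries.X ^ j * p) := fun m ↦ by
  rw [PowerSeries.coeff_X_pow_mul']
  split_ifs with h
  · refine (hp _).trans ?_
    have : ((m - j : ℕ) : ℝ) ≤ m := by exact_mod_cast Nat.sub_le m j
    gcongr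
  · simp only [Int.cast_zero, abs_zero]
    positivity

theorem growth_expSum {D k : ℕ} {H : ℝ} {f : Fin D → MvPolynomial (Fin 3) ℤ}
    (hf : ∀ j, (f j).totalDegree ≤ k) (hH : ∀ j, mlen (f j) ≤ H) :
    Growth (D * (H * 505 ^ k)) (7 * k) (expSum f Fin.val) := fun m ↦ by
  rw [expSum, map_sum]
  push_cast
  refine (Finset.abs_sum_le_sum_abs _ _).trans ?_
  calc _ ≤ ∑ _j : Fin D, H * 505 ^ k * ((m : ℝ) + 1) ^ (7 * k) := by
        refine Finset.sum_le_sum fun j _ ↦ ?_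
        have h0 := mlen_nonneg (f j)
        refine (Growth.X_pow_mul (by positivity) (growth_eS (hf j)) j m).trans ?_
        gcongr
        exact hH j
    _ = _ := by simp; ring

end NestPi

namespace NestPi

open Finset
open MvPolynomial (monomial)

attribute [local instance] Matrix.seminormedAddCommGroup

/-- The exponent vector with entries `α i`. -/
noncomputable def boxExp {N : ℕ} (α : Fin 3 → Fin (N + 1)) : Fin 3 →₀ ℕ :=
  Finsupp.equivFunOnFinite.symm fun i ↦ (α i : ℕ)

theorem boxExp_injective (N : ℕ) : Function.Injective (boxExp (N := N)) := fun α β h ↦ by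
  have := Finsupp.equivFunOnFinite.symm.injective h
  funext i
  exact Fin.ext (congr_fun this i)

theorem totalDegree_monomial_boxExp_le {N : ℕ} (α : Fin 3 → Fin (N + 1)) (a : ℤ) :
    (monomial (boxExp α) a).totalDegree ≤ 3 * N := by
  refine (MvPolynomial.totalDegree_monomial_le _ _).trans ?_
  rw [Finsupp.sum_fintype _ _ (fun _ ↦ rfl)]
  calc _ ≤ ∑ _i : Fin 3, N := Finset.sum_le_sum fun i _ ↦ Nat.lt_succ_iff.mp (α i).2
    _ = _ := by simp

/-- A solution of a linear system with more unknowns than twice the number of equations. -/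
theorem exists_small_solution {β : Type*} [Fintype β] [DecidableEq β] {R : ℕ} (hR : 0 < R)
    (hRβ : 2 * R ≤ Fintype.card β) (A : Fin R → β → ℤ) {Y : ℝ} (hY : 1 ≤ Y)
    (hA : ∀ i j, |(A i j : ℝ)| ≤ Y) :
    ∃ t : β → ℤ, t ≠ 0 ∧ (∀ i, ∑ j, A i j * t j = 0) ∧
      ∀ j, |(t j : ℝ)| ≤ Fintype.card β * Y := by
  obtain ⟨t, ht, h0, hn⟩ := Int.Matrix.exists_ne_zero_int_vec_norm_le (Matrix.of A)
    (by rw [Fintype.card_fin]; omega) (by simpa using hR)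
  refine ⟨t, ht, fun i ↦ congr_fun h0 i, fun j ↦ ?_⟩
  have hc : 2 * (R : ℝ) ≤ Fintype.card β := by exact_mod_cast hRβ
  have hR' : (1 : ℝ) ≤ R := by exact_mod_cast hR
  have hAn : max 1 ‖Matrix.of A‖ ≤ Y := by
    refine max_le hY ((Matrix.norm_le_iff (by linarith)).mpr fun i j ↦ ?_)
    simpa [Int.norm_eq_abs] using hA i j
  have hbase : (1 : ℝ) ≤ Fintype.card β * max 1 ‖Matrix.of A‖ := by
    have : (1 : ℝ) ≤ Fintype.card β := by linarith
    nlinarith [le_max_left 1 ‖Matrix.of A‖]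
  rw [← Int.norm_eq_abs]
  refine (norm_le_pi_norm t j).trans (hn.trans ?_)
  calc _ ≤ (Fintype.card β * max 1 ‖Matrix.of A‖) ^ (1 : ℝ) := by
        refine Real.rpow_le_rpow_of_exponent_le hbase ?_
        rw [Fintype.card_fin, div_le_one (by linarith)]
        linarith
    _ = Fintype.card β * max 1 ‖Matrix.of A‖ := Real.rpow_one _
    _ ≤ _ := by gcongr

theorem exists_auxiliary {N D : ℕ} (hN : 1 ≤ N) (hD : 1 ≤ D) :
    ∃ f : Fin D → MvPolynomial (Fin 3) ℤ, f ≠ 0 ∧ (∀ j, (f j).totalDegree ≤ 3 * N) ∧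
      (∀ j, mlen (f j) ≤ ((D * (N + 1) ^ 3 : ℕ) : ℝ) ^ (21 * N + 2) * 505 ^ (3 * N)) ∧
      ∀ m < D * (N + 1) ^ 3 / 2, (expSum f Fin.val).coeff m = 0 := by
  set K := D * (N + 1) ^ 3 with hK
  have hcard : Fintype.card (Fin D × (Fin 3 → Fin (N + 1))) = K := by simp [hK]
  have hK8 : 8 ≤ K := by
    calc 8 = 1 * (1 + 1) ^ 3 := by norm_num
      _ ≤ _ := by rw [hK]; gcongr
  have hKR : (1 : ℝ) ≤ K := by exact_mod_cast (show 1 ≤ K by omega)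
  have hentry : ∀ (i : Fin (K / 2)) (x : Fin D × (Fin 3 → Fin (N + 1))),
      |(((PowerSeries.X ^ (x.1 : ℕ) * eS (monomial (boxExp x.2) 1)).coeff i : ℤ) : ℝ)| ≤
        505 ^ (3 * N) * (K : ℝ) ^ (21 * N) := fun i x ↦ by
    have h0 := mlen_nonneg (monomial (boxExp x.2) 1)
    have h1 : mlen (monomial (boxExp x.2) 1) ≤ 1 := by simpa using mlen_monomial_le (boxExp x.2) 1
    refine (Growth.X_pow_mul (by positivity)
      (growth_eS (totalDegree_monomial_boxExp_le x.2 1)) x.1 i).trans ?_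
    have hi : ((i : ℕ) : ℝ) + 1 ≤ K := by exact_mod_cast (show (i : ℕ) + 1 ≤ K by omega)
    rw [show 7 * (3 * N) = 21 * N by ring]
    gcongr
    exact mul_le_of_le_one_left (by positivity) h1
  obtain ⟨t, ht, hsol, hsize⟩ := exists_small_solution (R := K / 2)
    (β := Fin D × (Fin 3 → Fin (N + 1))) (Y := 505 ^ (3 * N) * (K : ℝ) ^ (21 * N)) (by omega)
    (by rw [hcard]; omega)
    (fun i x ↦ (PowerSeries.X ^ (x.1 : ℕ) * eS (monomial (boxExp x.2) 1)).coeff i)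
    (one_le_mul_of_one_le_of_one_le (one_le_pow₀ (by norm_num)) (one_le_pow₀ hKR)) hentry
  rw [hcard] at hsize
  refine ⟨fun j ↦ ∑ α, monomial (boxExp α) (t (j, α)), ?_, fun j ↦ ?_, fun j ↦ ?_, fun m hm ↦ ?_⟩
  · obtain ⟨⟨j, α⟩, hx⟩ := Function.ne_iff.mp ht
    intro h
    refine hx ?_
    have h1 := congr_arg (MvPolynomial.coeff (boxExp α)) (congr_fun h j)
    rw [MvPolynomial.coeff_sum] at h1
    rw [Finset.sum_eq_single α (fun β _ hβ ↦ by
        rw [MvPolynomial.coeff_monomial, if_neg fun h ↦ hβ (boxExp_injective N h)])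
      (fun h ↦ absurd (mem_univ α) h), MvPolynomial.coeff_monomial, if_pos rfl] at h1
    simpa using h1
  · exact MvPolynomial.totalDegree_finsetSum_le fun α _ ↦ totalDegree_monomial_boxExp_le α _
  · refine (mlen_sum_le _ _).trans ?_
    calc _ ≤ ∑ _α : Fin 3 → Fin (N + 1), (K : ℝ) * (505 ^ (3 * N) * (K : ℝ) ^ (21 * N)) :=
          Finset.sum_le_sum fun α _ ↦ (mlen_monomial_le _ _).trans (hsize (j, α))
      _ = (((N + 1) ^ 3 : ℕ) : ℝ) * ((K : ℝ) * (505 ^ (3 * N) * (K : ℝ) ^ (21 * N))) := by simp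
      _ ≤ (K : ℝ) * ((K : ℝ) * (505 ^ (3 * N) * (K : ℝ) ^ (21 * N))) := by
          gcongr
          exact Nat.le_mul_of_pos_left _ hD
      _ = _ := by ring
  · have h := hsol ⟨m, hm⟩
    rw [Fintype.sum_prod_type] at h
    rw [expSum, map_sum, ← h]
    refine Finset.sum_congr rfl fun j _ ↦ ?_
    rw [map_sum, Finset.mul_sum, map_sum]
    refine Finset.sum_congr rfl fun α _ ↦ ?_
    have e : (monomial (boxExp α) (t (j, α)) : MvPolynomial (Fin 3) ℤ) =
        t (j, α) • monomial (boxExp α) 1 := by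
      rw [MvPolynomial.smul_monomial, smul_eq_mul, mul_one]
    rw [e, map_zsmul, mul_smul_comm, map_zsmul, smul_eq_mul, mul_comm]

end NestPi

namespace NestPi

open Finset Filter

/-- The value at `q = e ^ (-2 π)` of the exponential sum with coefficients `f`. -/
noncomputable def expValue {D : ℕ} (f : Fin D → MvPolynomial (Fin 3) ℤ) : ℂ :=
  ∑ j : Fin D, ((Real.exp (-(2 * Real.pi)) : ℝ) : ℂ) ^ (j : ℕ) *
    MvPolynomial.aeval (fun i ↦ ((pt i : ℝ) : ℂ)) (f j)

theorem natCast_pow_eq_exp {N : ℕ} (hN : 0 < N) (k : ℕ) :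
    (N : ℝ) ^ k = Real.exp (k * Real.log N) := by
  rw [Real.exp_nat_mul, Real.exp_log (by exact_mod_cast hN)]

set_option maxHeartbeats 1000000 in
theorem eventually_expValue_two_sided : ∀ᶠ N : ℕ in atTop, ∀ D : ℕ, D ≤ N + 1 →
    ∀ f : Fin D → MvPolynomial (Fin 3) ℤ, (∀ j, (f j).totalDegree ≤ 3 * N) →
    (∀ j, mlen (f j) ≤ Real.exp ((N : ℝ) ^ (1.001 : ℝ))) → ∀ M : ℕ, (M : ℝ) ≤ (N : ℝ) ^ (7 : ℝ) →
    (∀ m < M, (expSum f Fin.val).coeff m = 0) → (expSum f Fin.val).coeff M ≠ 0 →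
    ∃ g : Fin D → MvPolynomial (Fin 3) ℤ, (∀ j, ((g j).totalDegree : ℝ) ≤ (N : ℝ) ^ (1.01 : ℝ)) ∧
      (∀ j, mlen (g j) ≤ Real.exp ((N : ℝ) ^ (1.01 : ℝ))) ∧
      Real.exp (-(7 * M + 1)) ≤ ‖expValue g‖ ∧
      ‖expValue g‖ ≤ Real.exp ((N : ℝ) ^ (1.01 : ℝ) - 6 * M) := by
  have hk := tendsto_natCast_atTop_atTop (R := ℝ)
  filter_upwards [
    hk.eventually (eventually_mul_log_le 216 (show (0 : ℝ) < 0.001 by norm_num)),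
    hk.eventually (eventually_mul_log_le 40 (show (0 : ℝ) < 0.005 by norm_num)),
    hk.eventually (eventually_mul_rpow_le 2 (show (1.001 : ℝ) < 1.002 by norm_num)),
    hk.eventually (eventually_mul_rpow_le 2 (show (1.007 : ℝ) < 1.01 by norm_num)),
    hk.eventually (eventually_mul_rpow_le 10 (show (1.002 : ℝ) < 1.01 by norm_num)),
    hk.eventually (eventually_mul_rpow_le 2 (show (1.002 : ℝ) < 2 by norm_num)),
    eventually_ge_atTop 1000] with N ha hb hc hd he hfq hN D hD f hf hH M hM h0 hMne
  have hNR : (1000 : ℝ) ≤ N := by exact_mod_cast hN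
  have hN0 : (0 : ℝ) < N := by linarith
  have hN1 : (1 : ℝ) ≤ N := by linarith
  have hNpos : 0 < N := by omega
  have hlog : 0 ≤ Real.log N := Real.log_nonneg hN1
  set L := ⌈(N : ℝ) ^ (1.002 : ℝ)⌉₊ with hL
  have hL1 : (N : ℝ) ^ (1.002 : ℝ) ≤ L := Nat.le_ceil _
  have h1002 : (1 : ℝ) ≤ (N : ℝ) ^ (1.002 : ℝ) := Real.one_le_rpow hN1 (by norm_num)
  have hL2 : (L : ℝ) ≤ 2 * (N : ℝ) ^ (1.002 : ℝ) := by
    have := Nat.ceil_lt_add_one (show (0 : ℝ) ≤ (N : ℝ) ^ (1.002 : ℝ) by positivity)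
    rw [← hL] at this
    linarith
  have hLN : (L : ℝ) ≤ (N : ℝ) ^ 2 := by
    rw [Real.rpow_two] at hfq
    linarith
  have hDN : (D : ℝ) ≤ N + 1 := by exact_mod_cast hD
  rw [show (N : ℝ) ^ (7 : ℝ) = (N : ℝ) ^ 7 by exact_mod_cast Real.rpow_natCast (N : ℝ) 7] at hM
  have e1 : (N : ℝ) ^ (1.001 : ℝ) = N * (N : ℝ) ^ (0.001 : ℝ) := by
    rw [show (1.001 : ℝ) = 1 + 0.001 by norm_num, Real.rpow_add hN0, Real.rpow_one]
  have hLlog : 20 * (L * Real.log N) ≤ (N : ℝ) ^ (1.007 : ℝ) := by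
    rw [show (1.007 : ℝ) = 1.002 + 0.005 by norm_num, Real.rpow_add hN0]
    nlinarith
  have hmono : (N : ℝ) ^ (1.001 : ℝ) ≤ (N : ℝ) ^ (1.007 : ℝ) :=
    Real.rpow_le_rpow_of_exponent_le hN1 (by norm_num)
  have hX : 2 * (D * (Real.exp ((N : ℝ) ^ (1.001 : ℝ)) * 505 ^ (3 * N)) * ((M : ℝ) + 1)
    ^ (7 * (3 * N)) *
      ((7 * (3 * N)).factorial * Real.exp 1)) ≤ Real.exp (4 * L) := by
    have x1 : (D : ℝ) ≤ (N : ℝ) ^ 2 := by nlinarith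
    have x2 : (505 : ℝ) ^ (3 * N) ≤ (N : ℝ) ^ (3 * N) := by gcongr; linarith
    have x3 : ((M : ℝ) + 1) ^ (7 * (3 * N)) ≤ ((N : ℝ) ^ 8) ^ (7 * (3 * N)) := by
      gcongr
      have : (1 : ℝ) ≤ (N : ℝ) ^ 7 := one_le_pow₀ hN1
      nlinarith [pow_succ (N : ℝ) 7]
    have x4 : ((7 * (3 * N)).factorial : ℝ) ≤ ((N : ℝ) ^ 2) ^ (7 * (3 * N)) := by
      have h1 : ((7 * (3 * N)).factorial : ℝ) ≤ ((7 * (3 * N) : ℕ) : ℝ) ^ (7 * (3 * N)) := by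
        exact_mod_cast Nat.factorial_le_pow _
      refine h1.trans ?_
      gcongr
      push_cast
      nlinarith
    have x5 : 2 * Real.exp 1 ≤ N := by linarith [Real.exp_one_lt_d9]
    calc _ = (2 * Real.exp 1) * D * 505 ^ (3 * N) * ((M : ℝ) + 1) ^ (7 * (3 * N)) *
          ((7 * (3 * N)).factorial : ℝ) * Real.exp ((N : ℝ) ^ (1.001 : ℝ)) := by ring
      _ ≤ N * (N : ℝ) ^ 2 * (N : ℝ) ^ (3 * N) * ((N : ℝ) ^ 8) ^ (7 * (3 * N)) *
          ((N : ℝ) ^ 2) ^ (7 * (3 * N)) * Real.exp ((N : ℝ) ^ (1.001 : ℝ)) := by gcongr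
      _ = (N : ℝ) ^ (213 * N + 3) * Real.exp ((N : ℝ) ^ (1.001 : ℝ)) := by
          rw [← pow_mul, ← pow_mul]; ring
      _ ≤ (N : ℝ) ^ (216 * N) * Real.exp ((N : ℝ) ^ (1.001 : ℝ)) := by
          gcongr
          omega
      _ = Real.exp (216 * N * Real.log N + (N : ℝ) ^ (1.001 : ℝ)) := by
          rw [natCast_pow_eq_exp hNpos, ← Real.exp_add]; push_cast; ring_nf
      _ ≤ _ := by
          refine Real.exp_le_exp.mpr ?_
          nlinarith
  have hq6 : Real.exp (-(2 * Real.pi)) ≤ Real.exp (-6) :=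
    Real.exp_le_exp.mpr (by linarith [Real.pi_gt_three])
  obtain ⟨hv1, hv2⟩ := norm_value_two_sided (V := expValue (lowerIter M f L)) (by positivity)
    (coeff_expSum_lowerIter M f L) h0 hMne (growth_expSum hf hH) (Real.exp_pos _) hq6
    (hasEv_expSum _) hX
  have hQ : ((3 * N : ℕ) : ℝ) + M + 2 * L + D ≤ (N : ℝ) ^ 8 := by
    push_cast
    have h27 : (N : ℝ) ^ 2 ≤ (N : ℝ) ^ 7 := pow_le_pow_right₀ hN1 (by norm_num)
    have h1 : (N : ℝ) ≤ (N : ℝ) ^ 7 := by simpa using pow_le_pow_right₀ hN1 (show 1 ≤ 7 by norm_num)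
    have h17 : (1 : ℝ) ≤ (N : ℝ) ^ 7 := one_le_pow₀ hN1
    have h8 : 1000 * (N : ℝ) ^ 7 ≤ (N : ℝ) ^ 8 := by rw [pow_succ' (N : ℝ) 7]; gcongr
    linarith only [hM, hLN, hDN, h27, h1, h17, h8]
  have hqM : Real.exp (-(2 * Real.pi)) ^ M = Real.exp (-(2 * Real.pi * M)) := by
    rw [← Real.exp_nat_mul]; ring_nf
  have hM0 : (0 : ℝ) ≤ M := by positivity
  refine ⟨lowerIter M f L, fun j ↦ ?_, fun j ↦ ?_, ?_, ?_⟩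
  · have h1 : ((lowerIter M f L j).totalDegree : ℝ) ≤ 3 * N + L := by
      exact_mod_cast (lowerIter_bounds hf hH L hQ j).1
    have h2 : (N : ℝ) ≤ (N : ℝ) ^ (1.002 : ℝ) := by
      have := Real.rpow_le_rpow_of_exponent_le hN1 (show (1 : ℝ) ≤ 1.002 by norm_num)
      rwa [Real.rpow_one] at this
    linarith
  · refine (lowerIter_bounds hf hH L hQ j).2.trans ?_
    calc (12 * (N : ℝ) ^ 8) ^ L * Real.exp ((N : ℝ) ^ (1.001 : ℝ)) ≤
          ((N : ℝ) ^ 9) ^ L * Real.exp ((N : ℝ) ^ (1.001 : ℝ)) := by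
          gcongr
          rw [pow_succ _ 8, mul_comm]
          gcongr
          linarith
      _ = Real.exp (9 * (L * Real.log N) + (N : ℝ) ^ (1.001 : ℝ)) := by
          rw [← pow_mul, natCast_pow_eq_exp hNpos, ← Real.exp_add]; push_cast; ring_nf
      _ ≤ _ := by
          refine Real.exp_le_exp.mpr ?_
          nlinarith
  · refine le_trans ?_ hv1
    rw [hqM]
    have h2 : Real.exp (-1) ≤ 1 / 2 := by
      rw [Real.exp_neg, inv_eq_one_div]
      gcongr
      linarith [Real.add_one_le_exp 1]
    calc Real.exp (-(7 * M + 1)) = Real.exp (-(7 * M)) * Real.exp (-1) := by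
          rw [← Real.exp_add]; ring_nf
      _ ≤ Real.exp (-(2 * Real.pi * M)) * (1 / 2) := by
          gcongr
          linarith [Real.pi_lt_d2]
      _ = _ := by ring
  · refine hv2.trans ?_
    rw [hqM]
    have x1 : (L.factorial : ℝ) ≤ ((N : ℝ) ^ 2) ^ L := by
      have : (L.factorial : ℝ) ≤ (L : ℝ) ^ L := by exact_mod_cast Nat.factorial_le_pow _
      refine this.trans ?_
      gcongr
    have x2 : Real.exp (4 * L) ≤ (N : ℝ) ^ L := by
      rw [mul_comm, Real.exp_nat_mul]
      gcongr
      calc Real.exp 4 = Real.exp 1 ^ 4 := by rw [← Real.exp_nat_mul]; norm_num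
        _ ≤ 3 ^ 4 := by
          gcongr
          linarith [Real.exp_one_lt_d9]
        _ ≤ _ := by linarith
    calc _ ≤ (N : ℝ) ^ L * ((N : ℝ) ^ 2) ^ L * Real.exp (-(2 * Real.pi * M)) * (N : ℝ) ^ L := by
          gcongr
          linarith
      _ = Real.exp (4 * (L * Real.log N) - 2 * Real.pi * M) := by
          rw [← pow_mul, natCast_pow_eq_exp hNpos, natCast_pow_eq_exp hNpos, ← Real.exp_add,
            ← Real.exp_add, ← Real.exp_add]
          push_cast
          ring_nf
      _ ≤ _ := by
          refine Real.exp_le_exp.mpr ?_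
          have : 6 * (M : ℝ) ≤ 2 * Real.pi * M := by
            gcongr
            linarith [Real.pi_gt_three]
          nlinarith [mul_nonneg (Nat.cast_nonneg (α := ℝ) L) hlog]

end NestPi

namespace NestPi

open Finset Filter

theorem exists_order_of_vanishing_le {p : PowerSeries ℤ} {Y : ℝ}
    (h : ∀ M : ℕ, (∀ m < M, p.coeff m = 0) → (M : ℝ) ≤ Y) :
    ∃ M : ℕ, (∀ m < M, p.coeff m = 0) ∧ p.coeff M ≠ 0 ∧ (M : ℝ) ≤ Y := by
  classical
  have hex : ∃ m, p.coeff m ≠ 0 := by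
    by_contra! hcon
    obtain ⟨n, hn⟩ := exists_nat_gt Y
    linarith [h n fun m _ ↦ hcon m]
  have h0 : ∀ m < Nat.find hex, p.coeff m = 0 := fun m hm ↦ not_not.mp (Nat.find_min hex hm)
  exact ⟨Nat.find hex, h0, Nat.find_spec hex, h _ h0⟩

theorem eventually_auxiliary_length_le : ∀ᶠ N : ℕ in atTop, ∀ D : ℕ, D ≤ N + 1 →
    ((D * (N + 1) ^ 3 : ℕ) : ℝ) ^ (21 * N + 2) * 505 ^ (3 * N) ≤
      Real.exp ((N : ℝ) ^ (1.001 : ℝ)) := by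
  filter_upwards [tendsto_natCast_atTop_atTop (R := ℝ) |>.eventually
    (eventually_mul_log_le 216 (show (0 : ℝ) < 0.001 by norm_num)),
    eventually_ge_atTop 1000] with N ha hN D hD
  have hNR : (1000 : ℝ) ≤ N := by exact_mod_cast hN
  have hN0 : (0 : ℝ) < N := by linarith
  have hN1 : (1 : ℝ) ≤ N := by linarith
  have hK : ((D * (N + 1) ^ 3 : ℕ) : ℝ) ≤ (N : ℝ) ^ 5 := by
    have : D * (N + 1) ^ 3 ≤ N ^ 5 := by
      calc D * (N + 1) ^ 3 ≤ (2 * N) * (2 * N) ^ 3 := by gcongr <;> omega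
        _ = 16 * N ^ 4 := by ring
        _ ≤ N * N ^ 4 := by gcongr; omega
        _ = N ^ 5 := by ring
    exact_mod_cast this
  have e1 : (N : ℝ) ^ (1.001 : ℝ) = N * (N : ℝ) ^ (0.001 : ℝ) := by
    rw [show (1.001 : ℝ) = 1 + 0.001 by norm_num, Real.rpow_add hN0, Real.rpow_one]
  calc _ ≤ ((N : ℝ) ^ 5) ^ (21 * N + 2) * (N : ℝ) ^ (3 * N) := by
        gcongr
        linarith
    _ = (N : ℝ) ^ (108 * N + 10) := by rw [← pow_mul, ← pow_add]; congr 1; ring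
    _ ≤ (N : ℝ) ^ (216 * N) := by gcongr; omega
    _ = Real.exp (N * (216 * Real.log N)) := by
        rw [natCast_pow_eq_exp (by omega)]; push_cast; ring_nf
    _ ≤ _ := by
        rw [e1]
        gcongr

theorem expSum_fin_one (f : Fin 1 → MvPolynomial (Fin 3) ℤ) : expSum f Fin.val = eS (f 0) := by
  simp [expSum]

theorem eventually_exists_value_two_sided : ∀ᶠ N : ℕ in atTop, ∃ g : MvPolynomial (Fin 3) ℤ,
    (g.totalDegree : ℝ) ≤ (N : ℝ) ^ (1.01 : ℝ) ∧ mlen g ≤ Real.exp ((N : ℝ) ^ (1.01 : ℝ)) ∧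
      Real.exp (-((N : ℝ) ^ (3.02 : ℝ))) ≤ ‖MvPolynomial.aeval (fun i ↦ ((pt i : ℝ) : ℂ)) g‖ ∧
      ‖MvPolynomial.aeval (fun i ↦ ((pt i : ℝ) : ℂ)) g‖ ≤ Real.exp (-((N : ℝ) ^ (3 : ℝ))) := by
  have hk := tendsto_natCast_atTop_atTop (R := ℝ)
  have h3N : Tendsto (fun N : ℕ ↦ 3 * N) atTop atTop :=
    tendsto_id.const_mul_atTop' (by norm_num)
  filter_upwards [eventually_expValue_two_sided, eventually_auxiliary_length_le,
    h3N.eventually eventually_vanishing_le,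
    hk.eventually (eventually_mul_rpow_le 3 (show (1 : ℝ) < 1.001 by norm_num)),
    hk.eventually (eventually_mul_rpow_le 15 (show (3.013 : ℝ) < 3.02 by norm_num)),
    eventually_ge_atTop 1] with N hval hlen hvan h3 h15 hN
  have hNR : (1 : ℝ) ≤ N := by exact_mod_cast hN
  have hN0 : (0 : ℝ) < N := by linarith
  obtain ⟨f, hf0, hfd, hfl, hfv⟩ := exists_auxiliary hN le_rfl
  have hfl' := fun j ↦ (hfl j).trans (hlen 1 (by omega))
  have hf00 : f 0 ≠ 0 := fun h ↦ hf0 (by funext j; rw [Subsingleton.elim j 0, h]; rfl)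
  have hbound : ∀ M : ℕ, (∀ m < M, (expSum f Fin.val).coeff m = 0) →
      (M : ℝ) ≤ 2 * (N : ℝ) ^ (3.013 : ℝ) := fun M hM ↦ by
    rw [expSum_fin_one] at hM
    refine (hvan _ hf00 (hfd 0) M hM).trans ?_
    have hl : Real.log (mlen (f 0)) ≤ (N : ℝ) ^ (1.006 : ℝ) := by
      refine (Real.log_le_log (by linarith [one_le_mlen hf00]) (hfl' 0)).trans ?_
      rw [Real.log_exp]
      exact Real.rpow_le_rpow_of_exponent_le hNR (by norm_num)
    have hb : ((3 * N : ℕ) : ℝ) ≤ (N : ℝ) ^ (1.001 : ℝ) := by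
      rw [Real.rpow_one] at h3
      exact_mod_cast h3
    have e1 : ((3 * N : ℕ) : ℝ) ^ (2.004 : ℝ) ≤ (N : ℝ) ^ (2.007 : ℝ) := by
      refine (Real.rpow_le_rpow (by positivity) hb (by norm_num)).trans ?_
      rw [← Real.rpow_mul hN0.le]
      exact Real.rpow_le_rpow_of_exponent_le hNR (by norm_num)
    have e2 : ((3 * N : ℕ) : ℝ) ^ (1.004 : ℝ) ≤ (N : ℝ) ^ (1.006 : ℝ) := by
      refine (Real.rpow_le_rpow (by positivity) hb (by norm_num)).trans ?_
      rw [← Real.rpow_mul hN0.le]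
      exact Real.rpow_le_rpow_of_exponent_le hNR (by norm_num)
    have hl0 := Real.log_nonneg (one_le_mlen hf00)
    calc _ ≤ (N : ℝ) ^ (2.007 : ℝ) * ((N : ℝ) ^ (1.006 : ℝ) + (N : ℝ) ^ (1.006 : ℝ)) := by gcongr
      _ = 2 * ((N : ℝ) ^ (2.007 : ℝ) * (N : ℝ) ^ (1.006 : ℝ)) := by ring
      _ = _ := by rw [← Real.rpow_add hN0]; norm_num
  obtain ⟨M, hM0, hMne, hMle⟩ := exists_order_of_vanishing_le hbound
  have h302 : (N : ℝ) ^ (3.02 : ℝ) ≤ (N : ℝ) ^ (7 : ℝ) :=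
    Real.rpow_le_rpow_of_exponent_le hNR (by norm_num)
  have h1 : (1 : ℝ) ≤ (N : ℝ) ^ (3.013 : ℝ) := Real.one_le_rpow hNR (by norm_num)
  obtain ⟨g, hg1, hg2, hg3, hg4⟩ := hval 1 (by omega) f hfd hfl' M (by linarith) hM0 hMne
  have e : expValue g = MvPolynomial.aeval (fun i ↦ ((pt i : ℝ) : ℂ)) (g 0) := by simp [expValue]
  rw [e] at hg3 hg4
  refine ⟨g 0, hg1 0, hg2 0, le_trans ?_ hg3, hg4.trans ?_⟩
  · exact Real.exp_le_exp.mpr (by linarith)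
  · have hMK : 1 * (N + 1) ^ 3 / 2 ≤ M := by
      by_contra! hcon
      exact hMne (hfv M hcon)
    have h2 : N ^ 3 ≤ 2 * M := by
      have : (N + 1) ^ 3 = N ^ 3 + (3 * N ^ 2 + 3 * N) + 1 := by ring
      omega
    have h2' : (N : ℝ) ^ (3 : ℝ) ≤ 2 * M := by
      rw [show (N : ℝ) ^ (3 : ℝ) = (N : ℝ) ^ 3 by exact_mod_cast Real.rpow_natCast (N : ℝ) 3]
      exact_mod_cast h2
    have h4 : (N : ℝ) ^ (1.01 : ℝ) ≤ (N : ℝ) ^ (3 : ℝ) :=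
      Real.rpow_le_rpow_of_exponent_le hNR (by norm_num)
    exact Real.exp_le_exp.mpr (by linarith)

theorem eventually_expSum_val_vanishing_le : ∀ᶠ N : ℕ in atTop,
    ∀ f : Fin (N + 1) → MvPolynomial (Fin 3) ℤ, f ≠ 0 → (∀ j, (f j).totalDegree ≤ 3 * N) →
    (∀ j, mlen (f j) ≤ Real.exp ((N : ℝ) ^ (1.1 : ℝ))) →
    ∀ M : ℕ, (∀ m < M, (expSum f Fin.val).coeff m = 0) → (M : ℝ) ≤ (N : ℝ) ^ (7 : ℝ) := by
  filter_upwards [eventually_expSum_vanishing_le] with N hN f hf hd hl M hM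
  classical
  set S := univ.filter fun j ↦ f j ≠ 0 with hS
  have hSne : S.Nonempty := by
    obtain ⟨j, hj⟩ := Function.ne_iff.mp hf
    exact ⟨j, mem_filter.mpr ⟨mem_univ j, hj⟩⟩
  set φ := S.equivFin.symm with hφ
  refine hN S.card (fun i ↦ f (φ i)) (fun i ↦ ((φ i : Fin (N + 1)) : ℕ)) hSne.card_pos ?_ ?_ ?_ ?_
    ?_
    M ?_
  · exact fun a b h ↦ φ.injective (Subtype.ext (Fin.ext h))
  · exact fun i ↦ (mem_filter.mp (φ i).2).2
  · exact fun i ↦ Nat.lt_succ_iff.mp (φ i : Fin (N + 1)).2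
  · exact fun i ↦ hd _
  · exact fun i ↦ hl _
  · have e : expSum (fun i ↦ f (φ i)) (fun i ↦ ((φ i : Fin (N + 1)) : ℕ)) = expSum f Fin.val := by
      rw [expSum, expSum, φ.sum_comp (fun s : S ↦ PowerSeries.X ^ ((s : Fin (N + 1)) : ℕ) *
        eS (f s)), Finset.sum_coe_sort S (fun j ↦ PowerSeries.X ^ (j : ℕ) * eS (f j))]
      refine Finset.sum_subset (subset_univ _) fun j _ hj ↦ ?_
      have : f j = 0 := by
        by_contra h
        exact hj (mem_filter.mpr ⟨mem_univ j, h⟩)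
      rw [this, map_zero, mul_zero]
    rwa [e]

theorem eventually_exists_expValue_small : ∀ᶠ N : ℕ in atTop,
    ∃ g : Fin (N + 1) → MvPolynomial (Fin 3) ℤ,
      (∀ j, ((g j).totalDegree : ℝ) ≤ (N : ℝ) ^ (1.01 : ℝ)) ∧
      (∀ j, mlen (g j) ≤ Real.exp ((N : ℝ) ^ (1.01 : ℝ))) ∧ 0 < ‖expValue g‖ ∧
      ‖expValue g‖ ≤ Real.exp (-((N : ℝ) ^ (4 : ℝ))) := by
  filter_upwards [eventually_expValue_two_sided, eventually_auxiliary_length_le,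
    eventually_expSum_val_vanishing_le, eventually_ge_atTop 1] with N hval hlen hvan hN
  have hNR : (1 : ℝ) ≤ N := by exact_mod_cast hN
  obtain ⟨f, hf0, hfd, hfl, hfv⟩ := exists_auxiliary hN (D := N + 1) (by omega)
  have hfl' := fun j ↦ (hfl j).trans (hlen (N + 1) le_rfl)
  obtain ⟨M, hM0, hMne, hMle⟩ := exists_order_of_vanishing_le (hvan f hf0 hfd fun j ↦ (hfl' j).trans
    (Real.exp_le_exp.mpr (Real.rpow_le_rpow_of_exponent_le hNR (by norm_num))))
  obtain ⟨g, hg1, hg2, hg3, hg4⟩ := hval (N + 1) le_rfl f hfd hfl' M hMle hM0 hMne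
  refine ⟨g, hg1, hg2, (Real.exp_pos _).trans_le hg3, hg4.trans ?_⟩
  have hMK : (N + 1) * (N + 1) ^ 3 / 2 ≤ M := by
    by_contra! hcon
    exact hMne (hfv M hcon)
  have h2 : N ^ 4 ≤ 2 * M := by
    have : (N + 1) * (N + 1) ^ 3 = N ^ 4 + (4 * N ^ 3 + 6 * N ^ 2 + 4 * N) + 1 := by ring
    omega
  have h2' : (N : ℝ) ^ (4 : ℝ) ≤ 2 * M := by
    rw [show (N : ℝ) ^ (4 : ℝ) = (N : ℝ) ^ 4 by exact_mod_cast Real.rpow_natCast (N : ℝ) 4]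
    exact_mod_cast h2
  have h4 : (N : ℝ) ^ (1.01 : ℝ) ≤ (N : ℝ) ^ (4 : ℝ) :=
    Real.rpow_le_rpow_of_exponent_le hNR (by norm_num)
  exact Real.exp_le_exp.mpr (by linarith)

end NestPi

namespace NestPi

open Polynomial Finset Filter

/-- An integer polynomial in three variables, specialised at `0` in the last one. -/
noncomputable def toBi (f : MvPolynomial (Fin 3) ℤ) : ℤ[X][X] := gev ![C X, X, 0] f

theorem map_gev {A A' : Type*} [CommRing A] [CommRing A'] (φ : A →+* A') (v : Fin 3 → A)
    (f : MvPolynomial (Fin 3) ℤ) : φ (gev v f) = gev (fun i ↦ φ (v i)) f := by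
  rw [gev, MvPolynomial.hom_eval₂, gev]
  congr 1
  exact RingHom.ext_int _ _

theorem ev_toBi (f : MvPolynomial (Fin 3) ℤ) :
    ev ((3 / Real.pi : ℝ) : ℂ) (omega : ℝ) (toBi f) =
      MvPolynomial.aeval (fun i ↦ ((pt i : ℝ) : ℂ)) f := by
  rw [aeval_eq_gev, toBi, map_gev]
  congr 1
  funext i
  fin_cases i <;> simp [ev_apply, pt]

theorem natDegree_toBi_le {f : MvPolynomial (Fin 3) ℤ} {k : ℕ} (hf : f.totalDegree ≤ k) :
    (toBi f).natDegree ≤ k := by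
  have := natDegree_aeval_le (g := ![C X, X, (0 : ℤ[X][X])]) (r := 1)
    (fun i ↦ by fin_cases i <;> simp) hf
  rwa [one_mul] at this

theorem degU_toBi_le {f : MvPolynomial (Fin 3) ℤ} {k : ℕ} (hf : f.totalDegree ≤ k) :
    degU (toBi f) ≤ k := by
  have h : Bivariate.swap (toBi f) = gev ![X, C X, (0 : ℤ[X][X])] f := by
    have := map_gev (Bivariate.swap (R := ℤ) : ℤ[X][X] →+* ℤ[X][X]) ![C X, X, 0] f
    refine this.trans ?_
    congr 1
    funext i
    fin_cases i
    · exact Bivariate.swap_X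
    · exact Bivariate.swap_Y
    · exact map_zero _
  rw [degU, h]
  have := natDegree_aeval_le (g := ![X, C X, (0 : ℤ[X][X])]) (r := 1)
    (fun i ↦ by fin_cases i <;> simp) hf
  rwa [one_mul] at this

theorem len2_toBi_le (f : MvPolynomial (Fin 3) ℤ) : len2 (toBi f) ≤ mlen f := by
  have h := len_aeval_le isLen_len2 (R := 1) le_rfl (g := ![C X, X, (0 : ℤ[X][X])])
    (fun i ↦ by
      fin_cases i
      · change len2 (C X) ≤ 1
        rw [len2, polyLen_C isLen_len1]
        exact polyLen_X_le isLen_norm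
      · exact polyLen_X_le isLen_len1
      · change len2 0 ≤ 1
        rw [isLen_len2.zero]; norm_num) (f := f) le_rfl
  rwa [one_pow, mul_one, aeval_eq_gev] at h

theorem tendsto_floor_rpow {a : ℝ} (ha : 0 < a) :
    Tendsto (fun T : ℝ ↦ ⌊T ^ a⌋₊) atTop atTop :=
  tendsto_nat_floor_atTop.comp (tendsto_rpow_atTop ha)

theorem eventually_floor_rpow {α β : ℝ} (hα : 0 < α) (hβ : β < 1 / α) :
    ∀ᶠ T : ℝ in atTop, ((⌊T ^ (1 / α)⌋₊ : ℕ) : ℝ) ^ α ≤ T ∧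
      T ^ β ≤ ((⌊T ^ (1 / α)⌋₊ : ℕ) : ℝ) := by
  have h0 : 0 < 1 / α := by positivity
  filter_upwards [eventually_mul_rpow_le 2 hβ, eventually_ge_atTop 1,
    (tendsto_rpow_atTop h0).eventually_ge_atTop 2] with T h2 hT h1
  have hfl := Nat.floor_le (show (0 : ℝ) ≤ T ^ (1 / α) by positivity)
  have hlt := Nat.lt_floor_add_one (T ^ (1 / α))
  constructor
  · calc ((⌊T ^ (1 / α)⌋₊ : ℕ) : ℝ) ^ α ≤ (T ^ (1 / α)) ^ α := by gcongr
      _ = T := by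
        rw [← Real.rpow_mul (by linarith), one_div_mul_cancel hα.ne', Real.rpow_one]
  · linarith

theorem twoSided_pi : TwoSided ((3 / Real.pi : ℝ) : ℂ) (omega : ℝ) := by
  have h := ((tendsto_floor_rpow (a := 1 / 1.01) (by norm_num)).eventually
    eventually_exists_value_two_sided).and ((eventually_floor_rpow (α := 1.01) (β := 0.985)
      (by norm_num) (by norm_num)).and (eventually_ge_atTop 1))
  obtain ⟨T₀, hT₀⟩ := eventually_atTop.mp h
  refine ⟨T₀, fun T hT ↦ ?_⟩
  obtain ⟨⟨g, hgd, hgl, hg1, hg2⟩, ⟨hN1, hN2⟩, hT1⟩ := hT₀ T hT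
  set N := ⌊T ^ ((1 : ℝ) / 1.01)⌋₊
  have hT0 : 0 ≤ T := by linarith
  have hN0 : (0 : ℝ) ≤ N := by positivity
  refine ⟨toBi g, ?_, ?_, ?_, ?_, ?_⟩
  · exact (Nat.cast_le.mpr (degU_toBi_le le_rfl)).trans (hgd.trans hN1)
  · exact (Nat.cast_le.mpr (natDegree_toBi_le le_rfl)).trans (hgd.trans hN1)
  · by_cases h0 : toBi g = 0
    · rw [h0, isLen_len2.zero, Real.log_zero]; exact hT0
    · rw [Real.log_le_iff_le_exp (by linarith [one_le_len2 h0])]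
      exact (len2_toBi_le g).trans (hgl.trans (Real.exp_le_exp.mpr hN1))
  · rw [ev_toBi]
    refine le_trans (Real.exp_le_exp.mpr (neg_le_neg ?_)) hg1
    calc (N : ℝ) ^ (3.02 : ℝ) ≤ (N : ℝ) ^ (1.01 * 3 : ℝ) := by
          rcases Nat.eq_zero_or_pos N with h | h
          · rw [h]
            rw [Nat.cast_zero, Real.zero_rpow (by norm_num), Real.zero_rpow (by norm_num)]
          · exact Real.rpow_le_rpow_of_exponent_le (by exact_mod_cast h) (by norm_num)
      _ = ((N : ℝ) ^ (1.01 : ℝ)) ^ 3 := by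
          rw [Real.rpow_mul hN0]; exact_mod_cast Real.rpow_natCast _ 3
      _ ≤ T ^ 3 := by gcongr
  · rw [ev_toBi]
    refine hg2.trans (Real.exp_le_exp.mpr (neg_le_neg ?_))
    calc T ^ (2.95 : ℝ) ≤ T ^ (0.985 * 3 : ℝ) :=
          Real.rpow_le_rpow_of_exponent_le hT1 (by norm_num)
      _ = (T ^ (0.985 : ℝ)) ^ (3 : ℝ) := Real.rpow_mul hT0 _ _
      _ ≤ (N : ℝ) ^ (3 : ℝ) := by gcongr

end NestPi

namespace NestPi

open Polynomial Finset Filter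

theorem verySmall_of_ev_eq_zero {x y : ℂ} {F : ℤ[X][X]} (hF : F ≠ 0) (h : ev x y F = 0) :
    VerySmall x y := by
  refine ⟨max (max (degU F) F.natDegree) (Real.log (len2 F)), fun T hT ↦ ?_⟩
  rw [max_le_iff, max_le_iff] at hT
  refine ⟨F, hF, hT.1.1, hT.1.2, hT.2, ?_⟩
  rw [h, norm_zero]
  positivity

theorem exists_irreducible_eval₂_eq_zero {A K : Type*} [CommRing A] [IsDomain A]
    [UniqueFactorizationMonoid A] [Field K] {e : A →+* K} (he : Function.Injective e) {q : K}
    {p : A[X]} (hp : p ≠ 0) (hq : p.eval₂ e q = 0) :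
    ∃ Φ : A[X], Irreducible Φ ∧ 0 < Φ.natDegree ∧ Φ.eval₂ e q = 0 := by
  have hker : RingHom.ker (eval₂RingHom e q) ≠ ⊥ := fun h ↦ hp (by
    have : p ∈ RingHom.ker (eval₂RingHom e q) := hq
    rwa [h, Ideal.mem_bot] at this)
  obtain ⟨Φ, hΦ, hprime⟩ := Ideal.IsPrime.exists_mem_prime_of_ne_bot
    (RingHom.ker_isPrime (eval₂RingHom e q)) hker
  have hΦ0 : Φ.eval₂ e q = 0 := hΦ
  refine ⟨Φ, hprime.irreducible, ?_, hΦ0⟩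
  by_contra h
  have hc := eq_C_of_natDegree_eq_zero (by omega : Φ.natDegree = 0)
  rw [hc, eval₂_C, map_eq_zero_iff e he] at hΦ0
  rw [hΦ0, C_0] at hc
  exact hprime.ne_zero hc

theorem polyLen_le_of_coeff_le {A : Type*} [CommRing A] {N : A → ℝ} (h : IsLen N) {p : A[X]}
    {k : ℕ} (hp : p.natDegree ≤ k) {E : ℝ} (hE : ∀ i, N (p.coeff i) ≤ E) :
    polyLen N p ≤ (k + 1) * E := by
  rw [polyLen_eq_range h p hp]
  refine (Finset.sum_le_card_nsmul _ _ E fun i _ ↦ hE i).trans_eq ?_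
  rw [card_range, nsmul_eq_mul]
  push_cast
  ring

/-- Eliminating an algebraic quantity `q` by means of a resultant. -/
theorem exists_eliminant {x y q : ℂ} (hq : ‖q‖ ≤ 1) {Φ : ℤ[X][X][X]} (hΦ : Irreducible Φ)
    (hd : 0 < Φ.natDegree) (hΦq : Φ.eval₂ (ev x y) q = 0) :
    ∃ c : ℝ, 0 ≤ c ∧ ∀ k : ℕ, 1 ≤ k → ∀ (ε : ℝ) (P : ℤ[X][X][X]), P.natDegree ≤ k →
      (∀ i, degU (P.coeff i) ≤ k) → (∀ i, (P.coeff i).natDegree ≤ k) →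
      (∀ i, len2 (P.coeff i) ≤ Real.exp k) → P.eval₂ (ev x y) q ≠ 0 →
      ‖P.eval₂ (ev x y) q‖ ≤ ε →
      ∃ F : ℤ[X][X], F ≠ 0 ∧ (degU F : ℝ) ≤ c * k ∧ (F.natDegree : ℝ) ≤ c * k ∧
        Real.log (len2 F) ≤ c * k ∧ ‖ev x y F‖ ≤ Real.exp (c * k) * ε := by
  set d := Φ.natDegree with hdd
  set a : ℕ := ∑ i ∈ range (d + 1), ((Φ.coeff i).natDegree + degU (Φ.coeff i)) with ha
  have hai : ∀ i, (Φ.coeff i).natDegree + degU (Φ.coeff i) ≤ a := fun i ↦ by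
    by_cases hi : i ∈ range (d + 1)
    · exact single_le_sum (f := fun i ↦ (Φ.coeff i).natDegree + degU (Φ.coeff i))
        (fun _ _ ↦ Nat.zero_le _) hi
    · rw [coeff_eq_zero_of_natDegree_lt (by rw [mem_range] at hi; omega)]
      simp [degU]
  set M : ℝ := polyLen len2 Φ with hM
  have hM0 : 0 ≤ M := polyLen_nonneg isLen_len2 Φ
  set M' : ℝ := polyLen (fun z : ℂ ↦ ‖z‖) (Φ.map (ev x y)) with hM'
  have hM'0 : 0 ≤ M' := polyLen_nonneg isLen_norm _
  set R : ℝ := 1 + ‖x‖ + ‖y‖ with hR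
  have hx0 := norm_nonneg x
  have hy0 := norm_nonneg y
  have hR1 : 1 ≤ R := by linarith
  have key : ∀ (k : ℕ) (t : ℝ), 0 ≤ t → t ^ k ≤ Real.exp (t * k) := fun k t ht ↦ by
    rw [mul_comm, Real.exp_nat_mul]
    gcongr
    linarith [Real.add_one_le_exp t]
  refine ⟨a + M + 3 * d + 1 + M' + 2 + 2 * R * d, by positivity,
    fun k hk ε P hPk hP1 hP2 hP3 hPq hPε ↦ ?_⟩
  have hkR : (1 : ℝ) ≤ k := by exact_mod_cast hk
  have hk1 : (k : ℝ) + 1 ≤ Real.exp k := Real.add_one_le_exp _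
  set n := P.natDegree with hn
  have hnk : (n : ℝ) ≤ k := by exact_mod_cast hPk
  have hdeg : n * a + d * k ≤ (a + d) * k := by nlinarith
  have hdegR : ((n * a + d * k : ℕ) : ℝ) ≤
      (a + M + 3 * d + 1 + M' + 2 + 2 * R * d) * k := by
    calc ((n * a + d * k : ℕ) : ℝ) ≤ (((a + d) * k : ℕ) : ℝ) := by exact_mod_cast hdeg
      _ = (a + d) * k := by push_cast; ring
      _ ≤ _ := by
        refine mul_le_mul_of_nonneg_right ?_ (by positivity)
        have : 0 ≤ R * d := by positivity
        have : (0 : ℝ) ≤ d := by positivity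
        linarith
  refine ⟨resultant Φ P d n, ?_, ?_, ?_, ?_, ?_⟩
  · refine resultant_ne_zero_of_irreducible hΦ hd fun hdvd ↦ hPq ?_
    obtain ⟨Q, rfl⟩ := hdvd
    rw [eval₂_mul, hΦq, zero_mul]
  · refine le_trans (Nat.cast_le.mpr ?_) hdegR
    exact natDegree_map_resultant_le (Bivariate.swap (R := ℤ) : ℤ[X][X] →+* ℤ[X][X]) Φ P d n
      (fun i ↦ (Nat.le_add_left _ _).trans (hai i)) (fun i ↦ hP1 i)
  · refine le_trans (Nat.cast_le.mpr ?_) hdegR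
    exact natDegree_map_resultant_le (RingHom.id ℤ[X][X]) Φ P d n
      (fun i ↦ (Nat.le_add_right _ _).trans (hai i)) (fun i ↦ hP2 i)
  · have h1 := len_resultant_le isLen_len2 Φ P (m := d) (n := n) le_rfl le_rfl
    have hPl : polyLen len2 P ≤ Real.exp (2 * k) := by
      refine (polyLen_le_of_coeff_le isLen_len2 hPk hP3).trans ?_
      rw [two_mul, Real.exp_add]
      gcongr
    have h2 : polyLen len2 Φ ^ n * polyLen len2 P ^ d ≤ Real.exp (M * k) * Real.exp (2 * k) ^ d :=
      by
      gcongr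
      · exact pow_nonneg (polyLen_nonneg isLen_len2 P) _
      · refine (key n M hM0).trans (Real.exp_le_exp.mpr ?_)
        gcongr
      · exact polyLen_nonneg isLen_len2 P
    rw [← Real.exp_nat_mul, ← Real.exp_add] at h2
    have h3 := h1.trans h2
    have hexp : M * k + d * (2 * k) ≤ (a + M + 3 * d + 1 + M' + 2 + 2 * R * d) * k := by
      have : 0 ≤ R * d * k := by positivity
      have : (0 : ℝ) ≤ d * k := by positivity
      have : (0 : ℝ) ≤ a * k := by positivity
      have : (0 : ℝ) ≤ M' * k := by positivity
      linarith
    by_cases h0 : len2 (resultant Φ P d n) = 0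
    · rw [h0, Real.log_zero]; positivity
    · rw [Real.log_le_iff_le_exp (lt_of_le_of_ne (isLen_len2.nonneg _) (Ne.symm h0))]
      exact h3.trans (Real.exp_le_exp.mpr hexp)
  · have hres : ev x y (resultant Φ P d n) =
        resultant (Φ.map (ev x y)) (P.map (ev x y)) d n :=
      (Polynomial.resultant_map_map Φ P d n (ev x y)).symm
    have hcoef : ∀ i, ‖(P.map (ev x y)).coeff i‖ ≤ Real.exp k * R ^ (k + k) := fun i ↦ by
      rw [coeff_map]
      refine (norm_ev_le x y (P.coeff i) hR1 (by linarith) (by linarith) (hP1 i) (hP2 i)).trans ?_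
      gcongr
      exact hP3 i
    have hG : polyLen (fun z : ℂ ↦ ‖z‖) (P.map (ev x y)) ≤ Real.exp ((2 + 2 * R) * k) := by
      refine (polyLen_le_of_coeff_le isLen_norm (natDegree_map_le.trans hPk) hcoef).trans ?_
      have := key (k + k) R (by linarith)
      rw [show (2 + 2 * R) * (k : ℝ) = k + (k + R * (k + k)) by ring, Real.exp_add, Real.exp_add]
      push_cast at this
      gcongr
    have hmain := norm_resultant_le (Φ.map (ev x y)) (P.map (ev x y)) (m := d) (n := n)
      (natDegree_map_le) (natDegree_map_le) (by omega) q (R := 1) le_rfl hq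
      (F := Real.exp M') (G := Real.exp ((2 + 2 * R) * k)) (Real.one_le_exp hM'0)
      (Real.one_le_exp (by positivity)) (by linarith [Real.add_one_le_exp M']) hG (ε := ε)
      (by rw [eval_map, hΦq, norm_zero]; exact (norm_nonneg _).trans hPε)
      (by rw [eval_map]; exact hPε)
    rw [hres]
    refine hmain.trans ?_
    have hε : 0 ≤ ε := (norm_nonneg _).trans hPε
    rw [one_pow, mul_one]
    gcongr
    have hdn : ((d : ℝ) + n) ≤ Real.exp ((d + 1) * k) := by
      have h1 := Real.add_one_le_exp ((d + 1 : ℝ) * k)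
      have : (d : ℝ) * 1 ≤ d * k := by gcongr
      linarith
    calc ((d : ℝ) + n) * (Real.exp M' ^ n * Real.exp ((2 + 2 * R) * k) ^ d)
        ≤ Real.exp ((d + 1) * k) * (Real.exp M' ^ k * Real.exp ((2 + 2 * R) * k) ^ d) := by
          gcongr
          exact Real.one_le_exp hM'0
      _ = Real.exp ((d + 1) * k + (k * M' + d * ((2 + 2 * R) * k))) := by
          rw [← Real.exp_nat_mul, ← Real.exp_nat_mul, Real.exp_add, Real.exp_add]
      _ ≤ _ := by
          refine Real.exp_le_exp.mpr ?_
          have : (0 : ℝ) ≤ a * k := by positivity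
          have : (0 : ℝ) ≤ M * k := by positivity
          linarith

end NestPi

namespace NestPi

open Polynomial Finset Filter

/-- The polynomial with coefficients `g j`. -/
noncomputable def liftPoly {D : ℕ} (g : Fin D → MvPolynomial (Fin 3) ℤ) : ℤ[X][X][X] :=
  ∑ j : Fin D, C (toBi (g j)) * X ^ (j : ℕ)

theorem coeff_liftPoly {D : ℕ} (g : Fin D → MvPolynomial (Fin 3) ℤ) (i : ℕ) :
    (liftPoly g).coeff i = if h : i < D then toBi (g ⟨i, h⟩) else 0 := by
  rw [liftPoly, finsetSum_coeff]
  simp only [coeff_C_mul, coeff_X_pow, mul_ite, mul_one, mul_zero]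
  split_ifs with h
  · rw [sum_eq_single ⟨i, h⟩]
    · simp
    · intro j _ hj
      rw [if_neg]
      rintro rfl
      exact hj rfl
    · simp
  · exact sum_eq_zero fun j _ ↦ if_neg (by have := j.2; omega)

theorem natDegree_liftPoly_le {D : ℕ} (g : Fin (D + 1) → MvPolynomial (Fin 3) ℤ) :
    (liftPoly g).natDegree ≤ D := by
  rw [natDegree_le_iff_coeff_eq_zero]
  intro i hi
  rw [coeff_liftPoly, dif_neg (by omega)]

theorem eval₂_liftPoly {D : ℕ} (g : Fin D → MvPolynomial (Fin 3) ℤ) :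
    (liftPoly g).eval₂ (ev ((3 / Real.pi : ℝ) : ℂ) (omega : ℝ))
      ((Real.exp (-(2 * Real.pi)) : ℝ) : ℂ) = expValue g := by
  rw [liftPoly, eval₂_finsetSum, expValue]
  refine sum_congr rfl fun j _ ↦ ?_
  rw [eval₂_mul, eval₂_C, eval₂_X_pow, ev_toBi, mul_comm]

theorem verySmall_of_eval₂_eq_zero {p : ℤ[X][X][X]} (hp : p ≠ 0)
    (h : p.eval₂ (ev ((3 / Real.pi : ℝ) : ℂ) (omega : ℝ))
      ((Real.exp (-(2 * Real.pi)) : ℝ) : ℂ) = 0) :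
    VerySmall ((3 / Real.pi : ℝ) : ℂ) (omega : ℝ) := by
  set e := ev ((3 / Real.pi : ℝ) : ℂ) (omega : ℝ)
  by_cases hinj : Function.Injective e
  swap
  · rw [injective_iff_map_eq_zero] at hinj
    push Not at hinj
    obtain ⟨F, hF, hF0⟩ := hinj
    exact verySmall_of_ev_eq_zero hF0 hF
  obtain ⟨Φ, hΦ, hd, hΦq⟩ := exists_irreducible_eval₂_eq_zero hinj hp h
  obtain ⟨c, hc, H⟩ := exists_eliminant (by
    rw [Complex.norm_real, Real.norm_eq_abs, abs_of_pos (Real.exp_pos _), Real.exp_le_one_iff]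
    linarith [Real.pi_pos]) hΦ hd hΦq
  have hfl := tendsto_floor_rpow (a := 1 / 1.02) (by norm_num)
  have hev := (hfl.eventually (eventually_exists_expValue_small.and
    ((tendsto_natCast_atTop_atTop (R := ℝ)).eventually (eventually_mul_rpow_le (2 * c)
      (show (1.01 : ℝ) < 1.02 by norm_num)) |>.and (eventually_ge_atTop 1)))).and
    ((eventually_floor_rpow (α := 1.02) (β := 0.98) (by norm_num) (by norm_num)).and
    ((eventually_mul_rpow_le 2 (show (3.9 : ℝ) < 3.92 by norm_num)).and (eventually_ge_atTop 1)))
  obtain ⟨T₀, hT₀⟩ := eventually_atTop.mp hev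
  refine ⟨T₀, fun T hT ↦ ?_⟩
  have hTT := hT₀ T hT
  generalize ⌊T ^ ((1 : ℝ) / 1.02)⌋₊ = N at hTT
  obtain ⟨⟨⟨g, hgd, hgl, hg1, hg2⟩, hcN, hN⟩, ⟨hN1, hN2⟩, hT2, hT1⟩ := hTT
  have hT0 : 0 ≤ T := by linarith
  have hNR : (1 : ℝ) ≤ N := by exact_mod_cast hN
  have hN0 : (0 : ℝ) ≤ N := by positivity
  have hNk : (N : ℝ) ≤ (N : ℝ) ^ (1.01 : ℝ) :=
    Real.self_le_rpow_of_one_le hNR (by norm_num)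
  set k := ⌈(N : ℝ) ^ (1.01 : ℝ)⌉₊ with hk
  have hk1 : (N : ℝ) ^ (1.01 : ℝ) ≤ k := Nat.le_ceil _
  have hk2 : (k : ℝ) ≤ 2 * (N : ℝ) ^ (1.01 : ℝ) := by
    have := (Nat.ceil_lt_add_one (show 0 ≤ (N : ℝ) ^ (1.01 : ℝ) by positivity)).le
    rw [← hk] at this
    linarith
  have hNk' : N ≤ k := by exact_mod_cast hNk.trans hk1
  have hck : c * k ≤ T := by
    calc c * k ≤ c * (2 * (N : ℝ) ^ (1.01 : ℝ)) := by gcongr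
      _ = 2 * c * (N : ℝ) ^ (1.01 : ℝ) := by ring
      _ ≤ T := hcN.trans hN1
  have htd : ∀ j, (g j).totalDegree ≤ k := fun j ↦ by exact_mod_cast (hgd j).trans hk1
  obtain ⟨F, hF0, hF1, hF2, hF3, hF4⟩ := H k (hN.trans hNk')
    (Real.exp (-((N : ℝ) ^ (4 : ℝ)))) (liftPoly g)
    ((natDegree_liftPoly_le g).trans hNk')
    (fun i ↦ by
      rw [coeff_liftPoly]
      split_ifs
      · exact degU_toBi_le (htd _)
      · simp [degU])
    (fun i ↦ by
      rw [coeff_liftPoly]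
      split_ifs
      · exact natDegree_toBi_le (htd _)
      · simp)
    (fun i ↦ by
      rw [coeff_liftPoly]
      split_ifs
      · exact (len2_toBi_le _).trans ((hgl _).trans (Real.exp_le_exp.mpr hk1))
      · rw [isLen_len2.zero]; positivity)
    (by rw [eval₂_liftPoly]; exact norm_pos_iff.mp hg1)
    (by rw [eval₂_liftPoly]; exact hg2)
  refine ⟨F, hF0, hF1.trans hck, hF2.trans hck, hF3.trans hck, hF4.trans ?_⟩
  rw [← Real.exp_add]
  refine Real.exp_le_exp.mpr ?_
  have h4 : T ^ (3.92 : ℝ) ≤ (N : ℝ) ^ (4 : ℝ) := by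
    calc T ^ (3.92 : ℝ) = T ^ (0.98 * 4 : ℝ) := by norm_num
      _ = (T ^ (0.98 : ℝ)) ^ (4 : ℝ) := Real.rpow_mul hT0 _ _
      _ ≤ (N : ℝ) ^ (4 : ℝ) := by gcongr
  have h5 : T ≤ T ^ (3.9 : ℝ) := Real.self_le_rpow_of_one_le hT1 (by norm_num)
  linarith

theorem eval₂_exp_ne_zero {p : ℤ[X][X][X]} (hp : p ≠ 0) :
    p.eval₂ (ev ((3 / Real.pi : ℝ) : ℂ) (omega : ℝ))
      ((Real.exp (-(2 * Real.pi)) : ℝ) : ℂ) ≠ 0 := fun h ↦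
  twoSided_pi.not_verySmall (verySmall_of_eval₂_eq_zero hp h)

end NestPi

namespace NestPi

open Polynomial

/-- A polynomial in two variables, viewed as one in three variables not involving the middle one. -/
noncomputable def toTri : MvPolynomial (Fin 2) ℤ →+* ℤ[X][X][X] :=
  MvPolynomial.eval₂Hom (Int.castRingHom ℤ[X][X][X])
    (![C (C X), X] : Fin 2 → ℤ[X][X][X])

theorem toTri_injective : Function.Injective toTri := by
  have h : (eval₂RingHom (eval₂RingHom (eval₂RingHom (Int.castRingHom (MvPolynomial (Fin 2) ℤ))
      (MvPolynomial.X 0)) 0) (MvPolynomial.X 1)).comp toTri = RingHom.id _ := by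
    refine MvPolynomial.ringHom_ext (fun r ↦ by simp [toTri]) fun i ↦ ?_
    fin_cases i <;> simp [toTri]
  exact Function.LeftInverse.injective fun p ↦ DFunLike.congr_fun h p

theorem eval₂_toTri (x y q : ℂ) (p : MvPolynomial (Fin 2) ℤ) :
    (toTri p).eval₂ (ev x y) q = MvPolynomial.eval₂ (Int.castRingHom ℂ) ![x, q] p := by
  have h : (eval₂RingHom (ev x y) q).comp toTri =
      MvPolynomial.eval₂Hom (Int.castRingHom ℂ) ![x, q] := by
    refine MvPolynomial.ringHom_ext (fun r ↦ by simp [toTri]) fun i ↦ ?_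
    fin_cases i <;> simp [toTri, ev_apply]
  exact DFunLike.congr_fun h p

theorem algebraicIndependent_int :
    AlgebraicIndependent ℤ ![3 / Real.pi, Real.exp (-(2 * Real.pi))] := by
  rw [algebraicIndependent_iff]
  intro p hp
  by_contra hp0
  refine eval₂_exp_ne_zero ((map_ne_zero_iff _ toTri_injective).mpr hp0) ?_
  have := congrArg (Complex.ofRealHom) hp
  rw [map_zero, MvPolynomial.aeval_def, MvPolynomial.hom_eval₂] at this
  rw [eval₂_toTri, ← this, RingHom.ext_int (Complex.ofRealHom.comp (algebraMap ℤ ℝ))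
    (Int.castRingHom ℂ)]
  congr 1
  funext i
  fin_cases i <;> simp

theorem algebraicIndependent_pair_of_isAlgebraic {R A : Type*} [CommRing R] [Nontrivial R]
    [CommRing A]
    [IsDomain A] [Algebra R A] [FaithfulSMul R A] {x y u v : A}
    (h : AlgebraicIndependent R ![x, y])
    (hx : IsAlgebraic (Algebra.adjoin R {u, v}) x) (hy : IsAlgebraic (Algebra.adjoin R {u, v}) y) :
    AlgebraicIndependent R ![u, v] := by
  have hxy : x ≠ y := fun e ↦ by
    have := h.injective.ne (show (0 : Fin 2) ≠ 1 by decide)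
    exact this e
  have hind : (AlgebraicIndependent.matroid R A).Indep {x, y} := by
    have := h.to_subtype_range
    rwa [Matrix.range_cons_cons_empty] at this
  have h2 : (2 : ℕ∞) ≤ (AlgebraicIndependent.matroid R A).eRk {u, v} := by
    rw [← Matroid.eRk_closure_eq, ← Set.encard_pair hxy]
    refine hind.encard_le_eRk_of_subset ?_
    rw [AlgebraicIndependent.matroid_closure_eq]
    rintro a (rfl | rfl)
    · exact hx
    · exact hy
  have h3 := (AlgebraicIndependent.matroid R A).eRk_le_encard {u, v}
  have huv : u ≠ v := by
    rintro rfl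
    have := h2.trans h3
    simp at this
  rw [Set.encard_pair huv] at h3
  have hind' : (AlgebraicIndependent.matroid R A).Indep {u, v} := by
    rw [Matroid.indep_iff_eRk_eq_encard_of_finite (Set.toFinite _), Set.encard_pair huv]
    exact le_antisymm h3 h2
  have hinj : Function.Injective ![u, v] := by
    intro i j hij
    fin_cases i <;> fin_cases j <;> simp_all
  rw [← algebraicIndependent_subtype_range hinj, Matrix.range_cons_cons_empty]
  exact hind'

end NestPi

theorem nesterenko_pi_exp_pi_algebraicIndependent :
    AlgebraicIndependent ℚ ![Real.pi, Real.exp Real.pi] := by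
  have : Algebra.IsAlgebraic ℤ ℚ := IsLocalization.isAlgebraic ℚ (nonZeroDivisors ℤ)
  refine AlgebraicIndependent.extendScalars (R := ℤ) (S := ℚ) ?_
  have hm : ∀ a ∈ ({Real.pi, Real.exp Real.pi} : Set ℝ),
      IsAlgebraic (Algebra.adjoin ℤ {Real.pi, Real.exp Real.pi}) a := fun a ha ↦
    isAlgebraic_algebraMap (⟨a, Algebra.subset_adjoin ha⟩ :
      Algebra.adjoin ℤ ({Real.pi, Real.exp Real.pi} : Set ℝ))
  refine NestPi.algebraicIndependent_pair_of_isAlgebraic NestPi.algebraicIndependent_int ?_ ?_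
  · rw [div_eq_mul_inv]
    exact (isAlgebraic_natCast 3).mul (hm _ (by simp)).inv
  · rw [Real.exp_neg, mul_comm, Real.exp_mul, Real.rpow_ofNat]
    exact ((hm _ (by simp)).pow 2).inv
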